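/- Theorem 4.4(i), first case: Let δ ∈ (0,1] and p ∈ (d+2,∞) satisfy γ := δ − (d+2)/p > 0. Suppose the symmetric, measurable, uniformly elliptic coefficients a^{ij} on ℝ^{d+1} are uniformly continuous in (t, x^1,…,x^{d−1}) with modulus ω_a, merely measurable in x^d, and satisfy [a]_{x',δ;Q_1} := max_{i,j}[a^{ij}]_{x',δ;Q_1} < ∞. Then there is a constant N depending only on d, p, δ, ν, ω_a such that: if u is a classical solution of u_t − a^{ij}D_{ij}u = f in Q_1 = (−1,0)×B_1 with ‖D²u‖_{L_p(Q_1)} < ∞ and [f]_{x',γ;Q_1} < ∞, then for all 1 ≤ i ≤ q, [D_i u]_{t,(1+γ)/2;Q_{1/2}} + max_{1≤k≤d} [D_k D_i u]_{γ/2,γ;Q_{1/2}} ≤ N ( [f]_{x',γ;Q_1} + (1 + [a]_{x',δ;Q_1}) ‖D²u‖_{L_p(Q_1)} ). -/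

import Mathlib

open MeasureTheory Metric Set Filter

noncomputable section

/-- Spatial first-order partial derivative `D_i`. -/
def sd {d : ℕ} (i : Fin d) (v : EuclideanSpace ℝ (Fin d) → ℝ)
    (x : EuclideanSpace ℝ (Fin d)) : ℝ :=
  fderiv ℝ v x (EuclideanSpace.single i 1)

/-- Spatial second-order partial derivative `D_i D_j`. -/
def sd2 {d : ℕ} (i j : Fin d) (v : EuclideanSpace ℝ (Fin d) → ℝ)
    (x : EuclideanSpace ℝ (Fin d)) : ℝ :=
  sd i (fun y => sd j v y) x

/-- Time derivative `∂_t`. -/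
def td {d : ℕ} (u : ℝ → EuclideanSpace ℝ (Fin d) → ℝ) (t : ℝ)
    (x : EuclideanSpace ℝ (Fin d)) : ℝ :=
  deriv (fun s => u s x) t

/-- Parabolic cylinder `Q_ρ = (-ρ², 0) × B_ρ`. -/
def parQ (d : ℕ) (ρ : ℝ) : Set (ℝ × EuclideanSpace ℝ (Fin d)) :=
  Ioo (-(ρ ^ 2)) 0 ×ˢ ball (0 : EuclideanSpace ℝ (Fin d)) ρ

/-- The half space `ℝ^{d+1}_0 = (-∞, 0) × ℝ^d`. -/
def parNeg (d : ℕ) : Set (ℝ × EuclideanSpace ℝ (Fin d)) :=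
  Iio (0 : ℝ) ×ˢ (univ : Set (EuclideanSpace ℝ (Fin d)))

/-- Partial Hölder bound in the first `q` spatial coordinates `x'`. -/
def PHolderXPar (d q : ℕ) (δ : ℝ) (Q : Set (ℝ × EuclideanSpace ℝ (Fin d)))
    (g : ℝ → EuclideanSpace ℝ (Fin d) → ℝ) (K : ℝ) : Prop :=
  ∀ (t : ℝ) (x y : EuclideanSpace ℝ (Fin d)), (t, x) ∈ Q → (t, y) ∈ Q →
    (∀ i : Fin d, q ≤ (i : ℕ) → x i = y i) → |g t x - g t y| ≤ K * dist x y ^ δ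

/-- Full spatial Hölder bound. -/
def HolderXPar (d : ℕ) (δ : ℝ) (Q : Set (ℝ × EuclideanSpace ℝ (Fin d)))
    (g : ℝ → EuclideanSpace ℝ (Fin d) → ℝ) (K : ℝ) : Prop :=
  ∀ (t : ℝ) (x y : EuclideanSpace ℝ (Fin d)), (t, x) ∈ Q → (t, y) ∈ Q →
    |g t x - g t y| ≤ K * dist x y ^ δ

/-- Hölder bound in the time variable `t`, with exponent `γ`. -/
def HolderTPar (d : ℕ) (γ : ℝ) (Q : Set (ℝ × EuclideanSpace ℝ (Fin d)))
    (g : ℝ → EuclideanSpace ℝ (Fin d) → ℝ) (K : ℝ) : Prop :=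
  ∀ (t s : ℝ) (x : EuclideanSpace ℝ (Fin d)), (t, x) ∈ Q → (s, x) ∈ Q →
    |g t x - g s x| ≤ K * |t - s| ^ γ

/-- Classical regularity of parabolic solutions: `u`, `∂_t u`, `Du`, `D²u` exist and are
continuous on `Q`. -/
def ParClassical {d : ℕ} (Q : Set (ℝ × EuclideanSpace ℝ (Fin d)))
    (u : ℝ → EuclideanSpace ℝ (Fin d) → ℝ) : Prop :=
  (∀ z ∈ Q, DifferentiableAt ℝ (fun s => u s z.2) z.1) ∧
  (∀ z ∈ Q, ContDiffAt ℝ 2 (u z.1) z.2) ∧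
  ContinuousOn (fun z : ℝ × EuclideanSpace ℝ (Fin d) => u z.1 z.2) Q ∧
  ContinuousOn (fun z : ℝ × EuclideanSpace ℝ (Fin d) => td u z.1 z.2) Q ∧
  (∀ i : Fin d,
    ContinuousOn (fun z : ℝ × EuclideanSpace ℝ (Fin d) => sd i (u z.1) z.2) Q) ∧
  (∀ i j : Fin d,
    ContinuousOn (fun z : ℝ × EuclideanSpace ℝ (Fin d) => sd2 i j (u z.1) z.2) Q)

/-- Uniform ellipticity with constant `ν` (parabolic, two-sided bound). -/
def UnifEllipticP (d : ℕ) (ν : ℝ)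
    (a : Fin d → Fin d → ℝ → EuclideanSpace ℝ (Fin d) → ℝ) : Prop :=
  ∀ (t : ℝ) (x : EuclideanSpace ℝ (Fin d)) (ξ : Fin d → ℝ),
    ν * ∑ i, ξ i ^ 2 ≤ ∑ i, ∑ j, a i j t x * ξ i * ξ j ∧
      ∑ i, ∑ j, a i j t x * ξ i * ξ j ≤ ν⁻¹ * ∑ i, ξ i ^ 2

set_option linter.all false

namespace PSP
open scoped ContDiff

/-- Coordinate vector. -/
abbrev ev {ι : Type} [DecidableEq ι] (i : ι) : ι → ℝ := Pi.single i 1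

/-- Coordinate partial derivative on a finite product of lines. -/
def pd {ι : Type} [Fintype ι] [DecidableEq ι] (i : ι) (f : (ι → ℝ) → ℝ) (z : ι → ℝ) : ℝ :=
  fderiv ℝ f z (ev i)

section basic
variable {ι : Type} [Fintype ι] [DecidableEq ι]

lemma pd_smooth {f : (ι → ℝ) → ℝ} (hf : ContDiff ℝ ∞ f) (i : ι) : ContDiff ℝ ∞ (pd i f) := by
  have := hf.fderiv_right (m := ∞) (by simp)
  exact this.clm_apply contDiff_const

lemma sm_diff {f : (ι → ℝ) → ℝ} (hf : ContDiff ℝ ∞ f) : Differentiable ℝ f :=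
  hf.differentiable (by simp)

lemma pd_comm {f : (ι → ℝ) → ℝ} (hf : ContDiff ℝ ∞ f) (i j : ι) :
    pd i (pd j f) = pd j (pd i f) := by
  funext z
  have h2 : Differentiable ℝ (fderiv ℝ f) :=
    (hf.fderiv_right (m := ∞) (by simp)).differentiable (by simp)
  have key : ∀ i j : ι, pd i (pd j f) z
      = fderiv ℝ (fderiv ℝ f) z (ev i) (ev j) := by
    intro i j
    unfold pd
    rw [fderiv_clm_apply (h2 z) (differentiableAt_const _)]
    simp
  rw [key, key]
  have hs : IsSymmSndFDerivAt ℝ f z :=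
    (hf.contDiffAt).isSymmSndFDerivAt (by simp; exact WithTop.coe_le_coe.2 (le_top : (2:ℕ∞) ≤ ⊤))
  exact hs.eq _ _

lemma pd_mul {f g : (ι → ℝ) → ℝ} (hf : ContDiff ℝ ∞ f) (hg : ContDiff ℝ ∞ g) (i : ι) (z : ι → ℝ) :
    pd i (fun z => f z * g z) z = pd i f z * g z + f z * pd i g z := by
  unfold pd
  rw [show (fun z => f z * g z) = f * g from rfl, fderiv_mul (sm_diff hf z) (sm_diff hg z)]
  simp; ring

lemma pd_add {f g : (ι → ℝ) → ℝ} (hf : ContDiff ℝ ∞ f) (hg : ContDiff ℝ ∞ g) (i : ι) (z : ι → ℝ) :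
    pd i (fun z => f z + g z) z = pd i f z + pd i g z := by
  unfold pd
  rw [show (fun z => f z + g z) = f + g from rfl, fderiv_add (sm_diff hf z) (sm_diff hg z)]
  simp

lemma pd_sub {f g : (ι → ℝ) → ℝ} (hf : ContDiff ℝ ∞ f) (hg : ContDiff ℝ ∞ g) (i : ι) (z : ι → ℝ) :
    pd i (fun z => f z - g z) z = pd i f z - pd i g z := by
  unfold pd
  rw [show (fun z => f z - g z) = f - g from rfl, fderiv_sub (sm_diff hf z) (sm_diff hg z)]
  simp

lemma pd_const_mul {f : (ι → ℝ) → ℝ} (hf : ContDiff ℝ ∞ f) (c : ℝ) (i : ι) (z : ι → ℝ) :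
    pd i (fun z => c * f z) z = c * pd i f z := by
  unfold pd
  rw [fderiv_const_mul (sm_diff hf z)]
  simp

lemma sm_line {f : (ι → ℝ) → ℝ} (hf : ContDiff ℝ ∞ f) (i : ι) (z : ι → ℝ) :
    HasLineDerivAt ℝ f (pd i f z) z (ev i) :=
  ((sm_diff hf z).hasFDerivAt).hasLineDerivAt _

/-- Measurable and locally bounded functions. -/
structure LB (f : (ι → ℝ) → ℝ) : Prop where
  meas : Measurable f
  bdd : ∀ R : ℝ, ∃ C : ℝ, ∀ z, ‖z‖ ≤ R → |f z| ≤ C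

lemma LB.cont {f : (ι → ℝ) → ℝ} (hf : Continuous f) : LB f := by
  refine ⟨hf.measurable, fun R => ?_⟩
  obtain ⟨C, hC⟩ := (isCompact_closedBall (0 : ι → ℝ) R).exists_bound_of_continuousOn
    hf.continuousOn
  exact ⟨C, fun z hz => hC z (by simpa using hz)⟩

lemma LB.sm {f : (ι → ℝ) → ℝ} (hf : ContDiff ℝ ∞ f) : LB f := LB.cont hf.continuous

lemma LB.mul {f g : (ι → ℝ) → ℝ} (hf : LB f) (hg : LB g) : LB (fun z => f z * g z) := by
  refine ⟨hf.meas.mul hg.meas, fun R => ?_⟩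
  obtain ⟨C, hC⟩ := hf.bdd R
  obtain ⟨D, hD⟩ := hg.bdd R
  refine ⟨C * D, fun z hz => ?_⟩
  rw [abs_mul]
  exact mul_le_mul (hC z hz) (hD z hz) (abs_nonneg _) ((abs_nonneg _).trans (hC z hz))

lemma LB.add {f g : (ι → ℝ) → ℝ} (hf : LB f) (hg : LB g) : LB (fun z => f z + g z) := by
  refine ⟨hf.meas.add hg.meas, fun R => ?_⟩
  obtain ⟨C, hC⟩ := hf.bdd R
  obtain ⟨D, hD⟩ := hg.bdd R
  exact ⟨C + D, fun z hz => (abs_add_le _ _).trans (add_le_add (hC z hz) (hD z hz))⟩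

lemma LB.sub {f g : (ι → ℝ) → ℝ} (hf : LB f) (hg : LB g) : LB (fun z => f z - g z) := by
  refine ⟨hf.meas.sub hg.meas, fun R => ?_⟩
  obtain ⟨C, hC⟩ := hf.bdd R
  obtain ⟨D, hD⟩ := hg.bdd R
  exact ⟨C + D, fun z hz => (abs_sub _ _).trans (add_le_add (hC z hz) (hD z hz))⟩

lemma LB.sq {f : (ι → ℝ) → ℝ} (hf : LB f) : LB (fun z => f z ^ 2) := by
  simpa [pow_two] using hf.mul hf

lemma LB.const (c : ℝ) : LB (fun _ : ι → ℝ => c) := LB.cont continuous_const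

lemma LB.cmul {f : (ι → ℝ) → ℝ} (c : ℝ) (hf : LB f) : LB (fun z => c * f z) :=
  (LB.const c).mul hf

lemma LB.abs {f : (ι → ℝ) → ℝ} (hf : LB f) : LB (fun z => |f z|) := by
  refine ⟨hf.meas.abs, fun R => ?_⟩
  obtain ⟨C, hC⟩ := hf.bdd R
  exact ⟨C, fun z hz => by simpa using hC z hz⟩

lemma LB.sum {α : Type*} {s : Finset α} {f : α → (ι → ℝ) → ℝ} (hf : ∀ a ∈ s, LB (f a)) :
    LB (fun z => ∑ a ∈ s, f a z) := by
  classical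
  induction s using Finset.induction_on with
  | empty => simpa using LB.const 0
  | insert a s ha ih =>
    simp only [Finset.sum_insert ha]
    exact (hf a (by simp)).add (ih (fun b hb => hf b (by simp [hb])))

lemma LB.bounded {f : (ι → ℝ) → ℝ} (hm : Measurable f) (C : ℝ) (h : ∀ z, |f z| ≤ C) : LB f :=
  ⟨hm, fun _ => ⟨C, fun z _ => h z⟩⟩

lemma LB.integrableOn {f : (ι → ℝ) → ℝ} (hf : LB f) {K : Set (ι → ℝ)} (hK : Bornology.IsBounded K)
    : IntegrableOn f K := by
  obtain ⟨R, hR⟩ := hK.subset_closedBall 0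
  obtain ⟨C, hC⟩ := hf.bdd R
  have : IntegrableOn f (closedBall 0 R) := by
    refine Measure.integrableOn_of_bounded (M := C) (isCompact_closedBall _ _).measure_lt_top.ne
      hf.meas.aestronglyMeasurable ?_
    refine (ae_restrict_iff' measurableSet_closedBall).2 (Eventually.of_forall fun z hz => ?_)
    exact hC z (by simpa using hz)
  exact this.mono_set hR

lemma LB.integrable {f : (ι → ℝ) → ℝ} (hf : LB f) (hc : HasCompactSupport f) : Integrable f :=
  (integrableOn_iff_integrable_of_support_subset (subset_tsupport f)).1
    (hf.integrableOn hc.isCompact.isBounded)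

lemma pd_cs {f : (ι → ℝ) → ℝ} (hf : HasCompactSupport f) (i : ι) : HasCompactSupport (pd i f) :=
  hf.fderiv_apply ℝ _

/-- Past half space. -/
def Hs (t : ι) : Set (ι → ℝ) := {z | z t ≤ 0}

lemma measHs (t : ι) : MeasurableSet (Hs t) := measurableSet_le (measurable_pi_apply t) measurable_const

lemma ibp0 {j : ι} {B f g : (ι → ℝ) → ℝ} (hBl : LB B)
    (hBinv : ∀ z (s:ℝ), B (z + s • ev j) = B z)
    (hf : ContDiff ℝ ∞ f) (hg : ContDiff ℝ ∞ g) (hc : HasCompactSupport f) :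
    ∫ z, B z * (f z * pd j g z) = - ∫ z, B z * (pd j f z * g z) := by
  have hl : ∀ z, HasLineDerivAt ℝ (fun z => B z * f z) (B z * pd j f z) z (ev j) := by
    intro z
    have h1 : HasDerivAt (fun s : ℝ => f (z + s • ev j)) (pd j f z) 0 := sm_line hf j z
    have h2 := h1.const_mul (B z)
    unfold HasLineDerivAt
    simpa only [hBinv] using h2
  have := integral_bilinear_hasLineDerivAt_right_eq_neg_left_of_integrable
    (B := ContinuousLinearMap.mul ℝ ℝ) (μ := (volume : Measure (ι → ℝ)))
    (f := fun z => B z * f z) (f' := fun z => B z * pd j f z) (g := g) (g' := pd j g)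
    (v := ev j) ?_ ?_ ?_ (fun z _ => hl z) (fun z _ => sm_line hg j z)
  · simpa [mul_assoc] using this
  · exact ((hBl.mul (LB.sm (pd_smooth hf j))).mul (LB.sm hg)).integrable
      ((pd_cs hc j).mul_left.mul_right)
  · exact ((hBl.mul (LB.sm hf)).mul (LB.sm (pd_smooth hg j))).integrable (hc.mul_left.mul_right)
  · exact ((hBl.mul (LB.sm hf)).mul (LB.sm hg)).integrable (hc.mul_left.mul_right)

lemma ibp {t j : ι} (hj : j ≠ t) {β f g : (ι → ℝ) → ℝ} (hβ : LB β)
    (hinv : ∀ z (s:ℝ), β (z + s • ev j) = β z)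
    (hf : ContDiff ℝ ∞ f) (hg : ContDiff ℝ ∞ g) (hc : HasCompactSupport f) :
    ∫ z in Hs t, β z * (f z * pd j g z) = - ∫ z in Hs t, β z * (pd j f z * g z) := by
  classical
  set χ : (ι → ℝ) → ℝ := (Hs t).indicator (fun _ => (1:ℝ)) with hχ
  have hχm : LB χ := by
    refine LB.bounded (measurable_const.indicator (measHs t)) 1 fun z => ?_
    rw [hχ]; by_cases h : z ∈ Hs t <;> simp [h]
  set B : (ι → ℝ) → ℝ := fun z => χ z * β z with hB
  have hBl : LB B := hχm.mul hβ
  have hBinv : ∀ z (s:ℝ), B (z + s • ev j) = B z := by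
    intro z s
    have : (z + s • ev j) ∈ Hs t ↔ z ∈ Hs t := by
      simp [Hs, Pi.single_eq_of_ne hj.symm]
    simp only [hB, hinv, hχ]
    by_cases h : z ∈ Hs t
    · rw [indicator_of_mem h, indicator_of_mem (this.2 h)]
    · rw [indicator_of_notMem h, indicator_of_notMem (fun h' => h (this.1 h'))]
  have conv : ∀ F : (ι → ℝ) → ℝ, ∫ z in Hs t, β z * F z = ∫ z, B z * F z := by
    intro F
    rw [← integral_indicator (measHs t)]
    congr 1; funext z
    by_cases h : z ∈ Hs t <;> simp [hB, hχ, h]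
  rw [conv (fun z => f z * pd j g z), conv (fun z => pd j f z * g z)]
  exact ibp0 hBl hBinv hf hg hc

end basic
end PSP

namespace PSP
open scoped ContDiff
section energy
variable {ι : Type} [Fintype ι] [DecidableEq ι]

lemma pd_nonpos_of_antitone {f : (ι → ℝ) → ℝ} (hf : ContDiff ℝ ∞ f) (t : ι) (z : ι → ℝ)
    (h : Antitone (fun s : ℝ => f (z + s • ev t))) : pd t f z ≤ 0 := by
  have h1 : HasDerivAt (fun s : ℝ => f (z + s • ev t)) (pd t f z) 0 := sm_line hf t z
  rw [← h1.deriv]; exact h.deriv_nonpos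

lemma LB.intH {f : (ι → ℝ) → ℝ} (hf : LB f) (hc : HasCompactSupport f) (t : ι) :
    IntegrableOn f (Hs t) := (hf.integrable hc).integrableOn

/-- The time lemma. -/
lemma time_nonneg {t : ι} {β v : (ι → ℝ) → ℝ} (hβ : LB β) (hβ0 : ∀ z, 0 ≤ β z)
    (hinv : ∀ z (s:ℝ), β (z + s • ev t) = β z)
    (hv : ContDiff ℝ ∞ v) (hc : HasCompactSupport v) :
    0 ≤ ∫ z in Hs t, β z * (v z * pd t v z) := by
  set χ : ℕ → (ι → ℝ) → ℝ := fun n z => Real.smoothTransition (1 - n * z t) with hχ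
  have hχs : ∀ n, ContDiff ℝ ∞ (χ n) := by
    intro n
    exact Real.smoothTransition.contDiff.comp (by fun_prop)
  have hpos : ∀ n, 0 ≤ ∫ z, β z * (χ n z * (v z * pd t v z)) := by
    intro n
    have h1 := ibp0 (j := t) hβ hinv ((hχs n).mul hv) hv (hc.mul_left)
    have hd : ∀ z, pd t (fun z => χ n z * v z) z = pd t (χ n) z * v z + χ n z * pd t v z :=
      fun z => pd_mul (hχs n) hv t z
    have hn : ∀ z, pd t (χ n) z ≤ 0 := by
      intro z
      refine pd_nonpos_of_antitone (hχs n) t z ?_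
      intro s1 s2 hs
      refine Real.smoothTransition.monotone ?_
      have : (n:ℝ) * s1 ≤ n * s2 := by gcongr
      simp [ev]; linarith
    have e1 : ∫ z, β z * (χ n z * v z * pd t v z) = ∫ z, β z * (χ n z * (v z * pd t v z)) := by
      congr 1; funext z; ring
    rw [e1] at h1
    have e2 : ∫ z, β z * (pd t (fun z => χ n z * v z) z * v z)
        = (∫ z, β z * (pd t (χ n) z * v z * v z)) + ∫ z, β z * (χ n z * (v z * pd t v z)) := by
      rw [← integral_add]
      · congr 1; funext z; rw [hd]; ring
      · exact (hβ.mul (((LB.sm (pd_smooth (hχs n) t)).mul (LB.sm hv)).mul (LB.sm hv))).integrable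
          (hc.mul_left.mul_left)
      · exact (hβ.mul ((LB.sm (hχs n)).mul ((LB.sm hv).mul (LB.sm (pd_smooth hv t))))).integrable
          (hc.mul_right.mul_left.mul_left)
    have e3 : ∫ z, β z * (pd t (χ n) z * v z * v z) ≤ 0 := by
      refine integral_nonpos fun z => ?_
      have : pd t (χ n) z * v z * v z ≤ 0 := by nlinarith [hn z, mul_self_nonneg (v z)]
      exact mul_nonpos_of_nonneg_of_nonpos (hβ0 z) this
    have h1' : ∫ z, β z * (χ n z * (v z * pd t v z)) =
      -∫ z, β z * (pd t (fun z => χ n z * v z) z * v z) := h1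
    rw [e2] at h1'
    linarith
  have hI : Integrable (fun z => β z * (v z * pd t v z)) :=
    (hβ.mul ((LB.sm hv).mul (LB.sm (pd_smooth hv t)))).integrable (hc.mul_right.mul_left)
  have hlim : Tendsto (fun n => ∫ z, β z * (χ n z * (v z * pd t v z))) atTop
      (nhds (∫ z, (Hs t).indicator (fun z => β z * (v z * pd t v z)) z)) := by
    refine tendsto_integral_of_dominated_convergence (fun z => |β z * (v z * pd t v z)|) ?_ hI.abs
      ?_ ?_
    · intro n
      exact (hβ.mul ((LB.sm (hχs n)).mul ((LB.sm hv).mul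
        (LB.sm (pd_smooth hv t))))).meas.aestronglyMeasurable
    · intro n
      refine Eventually.of_forall fun z => ?_
      have h0 := Real.smoothTransition.nonneg (1 - n * z t)
      have h1 := Real.smoothTransition.le_one (1 - n * z t)
      rw [show β z * (χ n z * (v z * pd t v z)) = χ n z * (β z * (v z * pd t v z)) by ring,
        Real.norm_eq_abs, abs_mul, abs_of_nonneg (show 0 ≤ χ n z from h0)]
      exact mul_le_of_le_one_left (abs_nonneg _) h1
    · refine Eventually.of_forall fun z => ?_
      by_cases hz : z ∈ Hs t
      · rw [indicator_of_mem hz]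
        refine tendsto_const_nhds.congr fun n => ?_
        have hz' : z t ≤ 0 := hz
        have : χ n z = 1 := Real.smoothTransition.one_of_one_le (by
          have : (n:ℝ) * z t ≤ 0 := mul_nonpos_of_nonneg_of_nonpos (by positivity) hz'
          linarith)
        rw [this, one_mul]
      · rw [indicator_of_notMem hz]
        have hz' : 0 < z t := not_le.1 hz
        obtain ⟨N, hN⟩ := exists_nat_gt (1 / z t)
        refine tendsto_const_nhds.congr' ?_
        filter_upwards [eventually_ge_atTop N] with n hn
        have : χ n z = 0 := Real.smoothTransition.zero_of_nonpos (by
          have h2 : (N:ℝ) ≤ n := by exact_mod_cast hn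
          have h3 : 1 < N * z t := by rwa [div_lt_iff₀ hz'] at hN
          nlinarith)
        rw [this]; ring
  rw [← integral_indicator (measHs t)]
  exact ge_of_tendsto' hlim hpos

/-- Frozen normalised coefficients. -/
structure Co (t d h : ι) (ν : ℝ) (b : (ι → ℝ) → ℝ) (M : ι → ι → (ι → ℝ) → ℝ) : Prop where
  pos : 0 < ν
  le1 : ν ≤ 1
  td : t ≠ d
  th : t ≠ h
  dh : d ≠ h
  bm : Measurable b
  Mm : ∀ i j, Measurable (M i j)
  bi : ∀ z z', z d = z' d → b z = b z'
  Mi : ∀ i j z z', z d = z' d → M i j z = M i j z'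
  blo : ∀ z, ν ≤ b z
  bhi : ∀ z, b z ≤ ν⁻¹
  Mhi : ∀ i j z, |M i j z| ≤ ν⁻¹
  Mdd : ∀ z, M d d z = 1
  Mdj : ∀ j z, j ≠ d → M d j z = 0
  Mhj : ∀ j z, j ≠ h → M h j z = 0
  Mjh : ∀ j z, j ≠ h → M j h z = 0
  Mtj : ∀ j z, M t j z = 0
  Mjt : ∀ j z, M j t z = 0
  ell : ∀ z (ξ : ι → ℝ), ν * ∑ i ∈ Finset.univ.erase t, ξ i ^ 2 ≤ ∑ i, ∑ j, M i j z * ξ i * ξ j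

/-- The operator. -/
def Fo (t : ι) (b : (ι → ℝ) → ℝ) (M : ι → ι → (ι → ℝ) → ℝ) (w : (ι → ℝ) → ℝ) (z : ι → ℝ) : ℝ :=
  b z * pd t w z - ∑ i, ∑ j, M i j z * pd i (pd j w) z

/-- spatial indices -/
abbrev Sx (t : ι) : Finset ι := Finset.univ.erase t
/-- tangential spatial indices -/
abbrev Tx (t d : ι) : Finset ι := (Finset.univ.erase t).erase d

variable {t d h : ι} {ν : ℝ} {b : (ι → ℝ) → ℝ} {M : ι → ι → (ι → ℝ) → ℝ}

lemma Co.lbb (H : Co t d h ν b M) : LB b :=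
  LB.bounded H.bm ν⁻¹ fun z => by
    rw [abs_of_nonneg (H.pos.le.trans (H.blo z))]; exact H.bhi z
lemma Co.lbM (H : Co t d h ν b M) (i j : ι) : LB (M i j) := LB.bounded (H.Mm i j) ν⁻¹ (H.Mhi i j)

lemma Co.sumM (H : Co t d h ν b M) (z : ι → ℝ) (X : ι → ι → ℝ) :
    ∑ i, ∑ j, M i j z * X i j = (∑ i ∈ Tx t d, ∑ j ∈ Sx t, M i j z * X i j) + X d d := by
  have hrow : ∀ i, ∑ j, M i j z * X i j = ∑ j ∈ Sx t, M i j z * X i j := by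
    intro i
    rw [← Finset.sum_erase_add _ _ (Finset.mem_univ t), H.Mjt]; simp
  have hd : d ∈ Sx t := by simp [H.td.symm]
  simp only [hrow]
  rw [← Finset.sum_erase_add _ _ (Finset.mem_univ t), ← Finset.sum_erase_add _ _ hd]
  have h1 : ∑ j ∈ Sx t, M t j z * X t j = 0 := Finset.sum_eq_zero fun j _ => by rw [H.Mtj]; ring
  have h2 : ∑ j ∈ Sx t, M d j z * X d j = X d d := by
    rw [← Finset.sum_erase_add _ _ hd, H.Mdd, Finset.sum_eq_zero]
    · ring
    · intro j hj
      rw [H.Mdj j z (Finset.ne_of_mem_erase hj)]; ring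
  rw [h1, h2, add_zero]

lemma Co.Fo_eq (H : Co t d h ν b M) (w : (ι → ℝ) → ℝ) (z : ι → ℝ) :
    Fo t b M w z = b z * pd t w z - (∑ i ∈ Tx t d, ∑ j ∈ Sx t, M i j z * pd i (pd j w) z)
      - pd d (pd d w) z := by
  unfold Fo; rw [H.sumM]; ring

lemma Co.lbF (H : Co t d h ν b M) {w : (ι → ℝ) → ℝ} (hw : ContDiff ℝ ∞ w) : LB (Fo t b M w) := by
  unfold Fo
  refine (H.lbb.mul (LB.sm (pd_smooth hw t))).sub (LB.sum fun i _ => LB.sum fun j _ => ?_)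
  exact (H.lbM i j).mul (LB.sm (pd_smooth (pd_smooth hw j) i))

lemma Co.binv (H : Co t d h ν b M) {k : ι} (hk : k ≠ d) (z : ι → ℝ) (s : ℝ) :
    b (z + s • ev k) = b z := H.bi _ _ (by simp [ev, Pi.single_eq_of_ne hk.symm])
lemma Co.Minv (H : Co t d h ν b M) {k : ι} (hk : k ≠ d) (i j : ι) (z : ι → ℝ) (s : ℝ) :
    M i j (z + s • ev k) = M i j z := H.Mi _ _ _ _ (by simp [ev, Pi.single_eq_of_ne hk.symm])
lemma Co.Minv' (H : Co t d h ν b M) (i j : ι) (z : ι → ℝ) (s : ℝ) :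
    M i j (z + s • ev i) = M i j z := by
  by_cases hi : i = d
  · subst hi
    by_cases hj : j = i
    · subst hj; rw [H.Mdd, H.Mdd]
    · rw [H.Mdj _ _ hj, H.Mdj _ _ hj]
  · exact H.Minv hi i j z s

lemma cross {β v : (ι → ℝ) → ℝ} {i j k : ι} (hi : i ≠ t) (hk : k ≠ t) (hβ : LB β)
    (h1 : ∀ z (s:ℝ), β (z + s • ev k) = β z) (h2 : ∀ z (s:ℝ), β (z + s • ev i) = β z)
    (hv : ContDiff ℝ ∞ v) (hc : HasCompactSupport v) :
    ∫ z in Hs t, β z * (pd i (pd j v) z * pd k (pd k v) z)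
      = ∫ z in Hs t, β z * (pd i (pd k v) z * pd j (pd k v) z) := by
  rw [ibp hk hβ h1 (pd_smooth (pd_smooth hv j) i) (pd_smooth hv k) (pd_cs (pd_cs hc j) i)]
  have : ∀ z, pd k (pd i (pd j v)) z * pd k v z = pd k v z * pd i (pd j (pd k v)) z := by
    intro z
    rw [pd_comm (pd_smooth hv j) k i, pd_comm hv k j]; ring
  simp only [this]
  rw [ibp hi hβ h2 (pd_smooth hv k) (pd_smooth (pd_smooth hv k) j) (pd_cs hc k)]
  simp

lemma time_cross {β v : (ι → ℝ) → ℝ} {k : ι} (hk : k ≠ t) (hβ : LB β) (hβ0 : ∀ z, 0 ≤ β z)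
    (h1 : ∀ z (s:ℝ), β (z + s • ev k) = β z) (h2 : ∀ z (s:ℝ), β (z + s • ev t) = β z)
    (hv : ContDiff ℝ ∞ v) (hc : HasCompactSupport v) :
    ∫ z in Hs t, β z * (pd t v z * pd k (pd k v) z) ≤ 0 := by
  rw [ibp hk hβ h1 (pd_smooth hv t) (pd_smooth hv k) (pd_cs hc t)]
  have : ∀ z, pd k (pd t v) z * pd k v z = pd k v z * pd t (pd k v) z := by
    intro z
    rw [pd_comm hv k t]; ring
  simp only [this]
  have := time_nonneg hβ hβ0 h2 (pd_smooth hv k) (pd_cs hc k)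
  linarith

end energy
end PSP

namespace PSP
open scoped ContDiff
section energy
variable {ι : Type} [Fintype ι] [DecidableEq ι]
variable {t d h : ι} {ν : ℝ} {b : (ι → ℝ) → ℝ} {M : ι → ι → (ι → ℝ) → ℝ}

lemma iadd {α : Type*} {_ : MeasurableSpace α} {μ : Measure α} {f g : α → ℝ} (hf : Integrable f μ)
    (hg : Integrable g μ) : Integrable (fun z => f z + g z) μ := hf.add hg
lemma isub {α : Type*} {_ : MeasurableSpace α} {μ : Measure α} {f g : α → ℝ} (hf : Integrable f μ)
    (hg : Integrable g μ) : Integrable (fun z => f z - g z) μ := hf.sub hg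
lemma icm {α : Type*} {_ : MeasurableSpace α} {μ : Measure α} {f : α → ℝ} (hf : Integrable f μ)
    (c : ℝ) : Integrable (fun z => c * f z) μ := hf.const_mul c

lemma tsupport_pd (v : (ι → ℝ) → ℝ) (i : ι) : tsupport (pd i v) ⊆ tsupport v := by
  refine closure_minimal ?_ isClosed_closure
  intro y hy
  apply tsupport_fderiv_subset ℝ (f := v)
  apply subset_tsupport
  intro h0
  apply hy
  show fderiv ℝ v y (ev i) = 0
  rw [show fderiv ℝ v y = 0 from h0]; rfl

lemma Fo_zero {v : (ι → ℝ) → ℝ} {z : ι → ℝ} (hz : z ∉ tsupport v) : Fo t b M v z = 0 := by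
  have h1 : ∀ i, pd i v z = 0 := fun i => by
    by_contra hne
    exact hz (tsupport_pd v i (subset_tsupport _ hne))
  have h2 : ∀ i j, pd i (pd j v) z = 0 := fun i j => by
    by_contra hne
    exact hz (tsupport_pd v j (tsupport_pd _ i (subset_tsupport _ hne)))
  simp [Fo, h1, h2]

lemma Fo_cs {v : (ι → ℝ) → ℝ} (hc : HasCompactSupport v) : HasCompactSupport (Fo t b M v) := by
  refine hc.mono' ?_
  intro z hz
  by_contra hz'
  exact hz (Fo_zero hz')

lemma Co.one (H : Co t d h ν b M) {k : ι} (hkt : k ≠ t) (hkd : k ≠ d) {v : (ι → ℝ) → ℝ}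
    (hv : ContDiff ℝ ∞ v) (hc : HasCompactSupport v) :
    ∫ z in Hs t, ∑ i ∈ Sx t, pd i (pd k v) z ^ 2 ≤ ν⁻¹ ^ 2 * ∫ z in Hs t, Fo t b M v z ^ 2 := by
  have hν := H.pos
  have s1 : ∀ i, ContDiff ℝ ∞ (pd i v) := fun i => pd_smooth hv i
  have s2 : ∀ i j, ContDiff ℝ ∞ (pd i (pd j v)) := fun i j => pd_smooth (s1 j) i
  have c2 : ∀ i j, HasCompactSupport (pd i (pd j v)) := fun i j => pd_cs (pd_cs hc j) i
  have hF : LB (Fo t b M v) := H.lbF hv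
  have cF := Fo_cs (t := t) (b := b) (M := M) hc
  -- terms
  have hij : ∀ i j, ∫ z in Hs t, M i j z * (pd i (pd k v) z * pd j (pd k v) z)
      = ∫ z in Hs t, M i j z * (pd i (pd j v) z * pd k (pd k v) z) := by
    intro i j
    by_cases hi : i = t
    · subst hi; simp [H.Mtj]
    · exact (cross hi hkt (H.lbM i j) (H.Minv hkd i j) (H.Minv' i j) hv hc).symm
  have iA : ∀ i j, IntegrableOn (fun z => M i j z * (pd i (pd k v) z * pd j (pd k v) z)) (Hs t) :=
    fun i j => ((H.lbM i j).mul ((LB.sm (s2 i k)).mul (LB.sm (s2 j k)))).intH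
      ((c2 i k).mul_right.mul_left) t
  have iB : ∀ i j, IntegrableOn (fun z => M i j z * (pd i (pd j v) z * pd k (pd k v) z)) (Hs t) :=
    fun i j => ((H.lbM i j).mul ((LB.sm (s2 i j)).mul (LB.sm (s2 k k)))).intH
      ((c2 i j).mul_right.mul_left) t
  have iS : IntegrableOn (fun z => ∑ i ∈ Sx t, pd i (pd k v) z ^ 2) (Hs t) := by
    refine integrable_finset_sum _ fun i _ => ?_
    have := ((LB.sm (s2 i k)).mul (LB.sm (s2 i k))).intH ((c2 i k).mul_right) t
    simpa [pow_two, IntegrableOn] using this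
  have iF2 : IntegrableOn (fun z => Fo t b M v z ^ 2) (Hs t) := by
    have := (hF.mul hF).intH (cF.mul_right) t
    simpa [pow_two] using this
  have iFv : IntegrableOn (fun z => Fo t b M v z * pd k (pd k v) z) (Hs t) :=
    (hF.mul (LB.sm (s2 k k))).intH ((c2 k k).mul_left) t
  have ibt : IntegrableOn (fun z => b z * (pd t v z * pd k (pd k v) z)) (Hs t) :=
    (H.lbb.mul ((LB.sm (s1 t)).mul (LB.sm (s2 k k)))).intH ((c2 k k).mul_left.mul_left) t
  have step1 : ν * ∫ z in Hs t, ∑ i ∈ Sx t, pd i (pd k v) z ^ 2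
      ≤ ∫ z in Hs t, ∑ i, ∑ j, M i j z * (pd i (pd k v) z * pd j (pd k v) z) := by
    rw [← integral_const_mul]
    refine integral_mono (iS.const_mul ν)
      (integrable_finset_sum _ fun i _ => integrable_finset_sum _ fun j _ => iA i j) fun z => ?_
    have := H.ell z (fun i => pd i (pd k v) z)
    simpa [mul_assoc] using this
  have step2 : ∫ z in Hs t, ∑ i, ∑ j, M i j z * (pd i (pd k v) z * pd j (pd k v) z)
      = ∫ z in Hs t, ∑ i, ∑ j, M i j z * (pd i (pd j v) z * pd k (pd k v) z) := by
    rw [integral_finset_sum _ fun i _ => integrable_finset_sum _ fun j _ => iA i j,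
      integral_finset_sum _ fun i _ => integrable_finset_sum _ fun j _ => iB i j]
    refine Finset.sum_congr rfl fun i _ => ?_
    rw [integral_finset_sum _ fun j _ => iA i j, integral_finset_sum _ fun j _ => iB i j]
    exact Finset.sum_congr rfl fun j _ => hij i j
  have step3 : ∫ z in Hs t, ∑ i, ∑ j, M i j z * (pd i (pd j v) z * pd k (pd k v) z)
      = (∫ z in Hs t, b z * (pd t v z * pd k (pd k v) z))
        - ∫ z in Hs t, Fo t b M v z * pd k (pd k v) z := by
    rw [← integral_sub ibt iFv]
    congr 1; funext z
    unfold Fo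
    rw [sub_mul, Finset.sum_mul]
    simp only [Finset.sum_mul]
    simp only [mul_assoc]; ring
  have step4 := time_cross hkt H.lbb (fun z => hν.le.trans (H.blo z)) (H.binv hkd) (H.binv H.td) hv hc
  have step5 : - ∫ z in Hs t, Fo t b M v z * pd k (pd k v) z
      ≤ ν / 2 * (∫ z in Hs t, ∑ i ∈ Sx t, pd i (pd k v) z ^ 2)
        + ν⁻¹ / 2 * ∫ z in Hs t, Fo t b M v z ^ 2 := by
    rw [← integral_const_mul, ← integral_const_mul, ← integral_neg, ← integral_add
      (iS.const_mul _) (iF2.const_mul _)]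
    refine integral_mono iFv.neg ((iS.const_mul _).add (iF2.const_mul _)) fun z => ?_
    have h1 : pd k (pd k v) z ^ 2 ≤ ∑ i ∈ Sx t, pd i (pd k v) z ^ 2 :=
      Finset.single_le_sum (f := fun i => pd i (pd k v) z ^ 2) (fun i _ => sq_nonneg _)
        (by simp [hkt])
    show -(Fo t b M v z * pd k (pd k v) z) ≤ ν / 2 * (∑ i ∈ Sx t, pd i (pd k v) z ^ 2)
      + ν⁻¹ / 2 * Fo t b M v z ^ 2
    have h2 : -(Fo t b M v z * pd k (pd k v) z) ≤ ν / 2 * pd k (pd k v) z ^ 2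
      + ν⁻¹ / 2 * Fo t b M v z ^ 2 := by
      have : 0 ≤ ν / 2 * (pd k (pd k v) z + ν⁻¹ * Fo t b M v z) ^ 2 := by positivity
      have e : ν / 2 * (pd k (pd k v) z + ν⁻¹ * Fo t b M v z) ^ 2 =
        ν / 2 * pd k (pd k v) z ^ 2 + Fo t b M v z * pd k (pd k v) z
          + ν⁻¹ / 2 * Fo t b M v z ^ 2 := by field_simp; ring
      linarith
    nlinarith [mul_le_mul_of_nonneg_left h1 hν.le]
  set X := ∫ z in Hs t, ∑ i ∈ Sx t, pd i (pd k v) z ^ 2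
  set Y := ∫ z in Hs t, Fo t b M v z ^ 2
  have h6 : ν / 2 * X ≤ ν⁻¹ / 2 * Y := by linarith
  have h7 := mul_le_mul_of_nonneg_left h6 (show 0 ≤ 2 * ν⁻¹ by positivity)
  calc X = 2 * ν⁻¹ * (ν / 2 * X) := by field_simp
    _ ≤ _ := h7
    _ = _ := by ring

lemma sq_int {f : (ι → ℝ) → ℝ} (hf : LB f) (hc : HasCompactSupport f) (t : ι) :
    IntegrableOn (fun z => f z ^ 2) (Hs t) := by
  have := (hf.mul hf).intH (hc.mul_right) t
  simpa [pow_two] using this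

/-- Global `L₂` estimate. -/
lemma glob (t d h : ι) (ν : ℝ) : ∃ C : ℝ, 0 < C ∧ ∀ b M, Co t d h ν b M →
    ∀ v : (ι → ℝ) → ℝ, ContDiff ℝ ∞ v → HasCompactSupport v →
    ∫ z in Hs t, (pd t v z ^ 2 + ∑ i ∈ Sx t, ∑ j ∈ Sx t, pd i (pd j v) z ^ 2)
      ≤ C * ∫ z in Hs t, Fo t b M v z ^ 2 := by
  set n : ℝ := (Fintype.card ι : ℝ) with hn
  set K : ℝ := ν⁻¹ ^ 2 * n ^ 2 with hK
  have hK0 : 0 ≤ K := by positivity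
  set X0 : ℝ := n * ν⁻¹ ^ 2 with hX0
  have hX00 : 0 ≤ X0 := by positivity
  set T0 : ℝ := 2 * ν⁻¹ ^ 2 * (1 + K * X0) with hT0
  have hT00 : 0 ≤ T0 := by positivity
  refine ⟨T0 + (2 * X0 + 3 * (ν⁻¹ ^ 2 * T0 + K * X0 + 1)), by positivity, ?_⟩
  intro b M H v hv hc
  have hν := H.pos
  have s1 : ∀ i, ContDiff ℝ ∞ (pd i v) := fun i => pd_smooth hv i
  have s2 : ∀ i j, ContDiff ℝ ∞ (pd i (pd j v)) := fun i j => pd_smooth (s1 j) i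
  have c2 : ∀ i j, HasCompactSupport (pd i (pd j v)) := fun i j => pd_cs (pd_cs hc j) i
  have hF : LB (Fo t b M v) := H.lbF hv
  have cF := Fo_cs (t := t) (b := b) (M := M) hc
  have iF2 := sq_int hF cF t
  have it2 := sq_int (LB.sm (s1 t)) (pd_cs hc t) t
  have i2 : ∀ i j, IntegrableOn (fun z => pd i (pd j v) z ^ 2) (Hs t) := fun i j =>
    sq_int (LB.sm (s2 i j)) (c2 i j) t
  set S1 : (ι → ℝ) → ℝ := fun z => ∑ k ∈ Tx t d, ∑ i ∈ Sx t, pd i (pd k v) z ^ 2 with hS1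
  have iS1 : IntegrableOn S1 (Hs t) :=
    integrable_finset_sum _ fun k _ => integrable_finset_sum _ fun i _ => i2 i k
  set Y := ∫ z in Hs t, Fo t b M v z ^ 2 with hY
  have hY0 : 0 ≤ Y := integral_nonneg fun z => sq_nonneg _
  have hX : ∫ z in Hs t, S1 z ≤ X0 * Y := by
    rw [hS1, integral_finset_sum _ fun k _ => integrable_finset_sum _ fun i _ => i2 i k]
    have : ∀ k ∈ Tx t d, ∫ z in Hs t, ∑ i ∈ Sx t, pd i (pd k v) z ^ 2 ≤ ν⁻¹ ^ 2 * Y := by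
      intro k hk
      have hk' := Finset.mem_erase.1 hk
      exact H.one (Finset.ne_of_mem_erase hk'.2) hk'.1 hv hc
    refine (Finset.sum_le_card_nsmul _ _ _ this).trans ?_
    rw [nsmul_eq_mul, hX0, mul_assoc]
    have : ((Tx t d).card : ℝ) ≤ n := by rw [hn]; exact_mod_cast Finset.card_le_univ _
    gcongr
  set R : (ι → ℝ) → ℝ := fun z => ∑ i ∈ Tx t d, ∑ j ∈ Sx t, M i j z * pd i (pd j v) z with hR
  have hFe : ∀ z, Fo t b M v z = b z * pd t v z - R z - pd d (pd d v) z := fun z => H.Fo_eq v z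
  have hRS : ∀ z, R z ^ 2 ≤ K * S1 z := by
    intro z
    have e : R z = ∑ p ∈ Tx t d ×ˢ Sx t, M p.1 p.2 z * pd p.1 (pd p.2 v) z := by
      rw [hR, Finset.sum_product]
    have e2 : S1 z = ∑ p ∈ Tx t d ×ˢ Sx t, pd p.1 (pd p.2 v) z ^ 2 := by
      rw [hS1, Finset.sum_product]
      refine Finset.sum_congr rfl fun k _ => Finset.sum_congr rfl fun i _ => ?_
      rw [pd_comm hv]
    rw [e, e2]
    refine (sq_sum_le_card_mul_sum_sq).trans ?_
    have hcard : ((Tx t d ×ˢ Sx t).card : ℝ) ≤ n ^ 2 := by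
      rw [Finset.card_product, pow_two]; push_cast
      have h1 : ((Tx t d).card : ℝ) ≤ n := by rw [hn]; exact_mod_cast Finset.card_le_univ _
      have h2 : ((Sx t).card : ℝ) ≤ n := by rw [hn]; exact_mod_cast Finset.card_le_univ _
      gcongr
    have hs : ∑ p ∈ Tx t d ×ˢ Sx t, (M p.1 p.2 z * pd p.1 (pd p.2 v) z) ^ 2
        ≤ ν⁻¹ ^ 2 * ∑ p ∈ Tx t d ×ˢ Sx t, pd p.1 (pd p.2 v) z ^ 2 := by
      rw [Finset.mul_sum]
      refine Finset.sum_le_sum fun p _ => ?_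
      rw [mul_pow]
      have : M p.1 p.2 z ^ 2 ≤ ν⁻¹ ^ 2 := by
        rw [← sq_abs]; exact pow_le_pow_left₀ (abs_nonneg _) (H.Mhi _ _ _) 2
      gcongr
    have h0 : 0 ≤ ∑ p ∈ Tx t d ×ˢ Sx t, pd p.1 (pd p.2 v) z ^ 2 :=
      Finset.sum_nonneg fun _ _ => sq_nonneg _
    calc _ ≤ n ^ 2 * (ν⁻¹ ^ 2 * ∑ p ∈ Tx t d ×ˢ Sx t, pd p.1 (pd p.2 v) z ^ 2) := by
          gcongr
      _ = _ := by rw [hK]; ring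
  have htd : ∫ z in Hs t, pd t v z * pd d (pd d v) z ≤ 0 := by
    have := time_cross (t := t) (k := d) (β := fun _ => (1:ℝ)) H.td.symm (LB.const 1)
      (fun _ => zero_le_one) (fun _ _ => rfl) (fun _ _ => rfl) hv hc
    simpa using this
  have itd : IntegrableOn (fun z => pd t v z * pd d (pd d v) z) (Hs t) :=
    ((LB.sm (s1 t)).mul (LB.sm (s2 d d))).intH ((c2 d d).mul_left) t
  have hT : ∫ z in Hs t, pd t v z ^ 2 ≤ T0 * Y := by
    have key : ν / 2 * ∫ z in Hs t, pd t v z ^ 2 ≤ ν⁻¹ * (Y + K * ∫ z in Hs t, S1 z)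
        + ∫ z in Hs t, pd t v z * pd d (pd d v) z := by
      rw [hY, ← integral_const_mul, ← integral_const_mul, ← integral_add iF2 (iS1.const_mul K),
        ← integral_const_mul, ← integral_add (icm (iadd iF2 (icm iS1 K)) _) itd]
      refine integral_mono (it2.const_mul _)
        (((iF2.add (iS1.const_mul K)).const_mul _).add itd) fun z => ?_
      show ν / 2 * pd t v z ^ 2 ≤ ν⁻¹ * (Fo t b M v z ^ 2 + K * S1 z) + pd t v z * pd d (pd d v) z
      have h1 := hFe z
      have h2 : b z * pd t v z ^ 2 = pd t v z * (Fo t b M v z + R z)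
        + pd t v z * pd d (pd d v) z := by rw [h1]; ring
      have h3 : ν * pd t v z ^ 2 ≤ b z * pd t v z ^ 2 :=
        mul_le_mul_of_nonneg_right (H.blo z) (sq_nonneg _)
      have h4 : pd t v z * (Fo t b M v z + R z) ≤ ν / 2 * pd t v z ^ 2
          + ν⁻¹ * (Fo t b M v z ^ 2 + R z ^ 2) := by
        have a1 : 0 ≤ ν / 2 * (pd t v z - ν⁻¹ * (Fo t b M v z + R z)) ^ 2 := by positivity
        have a2 : ν / 2 * (pd t v z - ν⁻¹ * (Fo t b M v z + R z)) ^ 2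
          = ν / 2 * pd t v z ^ 2 - pd t v z * (Fo t b M v z + R z)
            + ν⁻¹ / 2 * (Fo t b M v z + R z) ^ 2 := by field_simp; ring
        have a3 : ν⁻¹ / 2 * (Fo t b M v z + R z) ^ 2 ≤ ν⁻¹ * (Fo t b M v z ^ 2 + R z ^ 2) := by
          have : 0 ≤ ν⁻¹ / 2 * (Fo t b M v z - R z) ^ 2 := by positivity
          nlinarith
        linarith
      have h5 : ν⁻¹ * R z ^ 2 ≤ ν⁻¹ * (K * S1 z) :=
        mul_le_mul_of_nonneg_left (hRS z) (by positivity)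
      nlinarith
    have k2 : ν / 2 * ∫ z in Hs t, pd t v z ^ 2 ≤ ν⁻¹ * (Y + K * (X0 * Y)) := by
      have : ν⁻¹ * (Y + K * ∫ z in Hs t, S1 z) ≤ ν⁻¹ * (Y + K * (X0 * Y)) := by gcongr
      linarith
    have k3 := mul_le_mul_of_nonneg_left k2 (show 0 ≤ 2 * ν⁻¹ by positivity)
    calc ∫ z in Hs t, pd t v z ^ 2 = 2 * ν⁻¹ * (ν / 2 * ∫ z in Hs t, pd t v z ^ 2) := by
          field_simp
      _ ≤ _ := k3
      _ = _ := by rw [hT0]; ring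
  -- combine
  have fin : ∀ z, pd t v z ^ 2 + ∑ i ∈ Sx t, ∑ j ∈ Sx t, pd i (pd j v) z ^ 2
      ≤ pd t v z ^ 2 + (2 * S1 z + 3 * (ν⁻¹ ^ 2 * pd t v z ^ 2 + K * S1 z + Fo t b M v z ^ 2)) := by
    intro z
    have hd : d ∈ Sx t := by simp [H.td.symm]
    have e1 : ∑ i ∈ Sx t, ∑ j ∈ Sx t, pd i (pd j v) z ^ 2
        = S1 z + ((∑ j ∈ Tx t d, pd d (pd j v) z ^ 2) + pd d (pd d v) z ^ 2) := by
      rw [← Finset.sum_erase_add _ _ hd, ← Finset.sum_erase_add (Sx t) (fun j => pd d (pd j v) z ^ 2) hd]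
      congr 1
      refine Finset.sum_congr rfl fun k _ => Finset.sum_congr rfl fun i _ => ?_
      rw [pd_comm hv]
    have e2 : ∑ j ∈ Tx t d, pd d (pd j v) z ^ 2 ≤ S1 z := by
      refine Finset.sum_le_sum fun k _ => ?_
      exact Finset.single_le_sum (f := fun i => pd i (pd k v) z ^ 2) (fun i _ => sq_nonneg _) hd
    have e3 : pd d (pd d v) z ^ 2 ≤ 3 * (ν⁻¹ ^ 2 * pd t v z ^ 2 + K * S1 z + Fo t b M v z ^ 2) := by
      have h1 : pd d (pd d v) z = b z * pd t v z - R z - Fo t b M v z := by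
        have := hFe z; linarith
      have h2 : (b z * pd t v z) ^ 2 ≤ ν⁻¹ ^ 2 * pd t v z ^ 2 := by
        rw [mul_pow]
        have : b z ^ 2 ≤ ν⁻¹ ^ 2 := pow_le_pow_left₀ (hν.le.trans (H.blo z)) (H.bhi z) 2
        gcongr
      have h3 := hRS z
      rw [h1]
      nlinarith [sq_nonneg (b z * pd t v z + R z), sq_nonneg (b z * pd t v z + Fo t b M v z),
        sq_nonneg (R z - Fo t b M v z)]
    linarith
  calc _ ≤ ∫ z in Hs t, (pd t v z ^ 2 +
        (2 * S1 z + 3 * (ν⁻¹ ^ 2 * pd t v z ^ 2 + K * S1 z + Fo t b M v z ^ 2))) := by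
        refine integral_mono (it2.add (integrable_finset_sum _ fun i _ =>
          integrable_finset_sum _ fun j _ => i2 i j)) (it2.add ((iS1.const_mul 2).add
          ((((it2.const_mul _).add (iS1.const_mul K)).add iF2).const_mul 3))) fin
    _ = (∫ z in Hs t, pd t v z ^ 2) + (2 * (∫ z in Hs t, S1 z) +
        3 * (ν⁻¹ ^ 2 * (∫ z in Hs t, pd t v z ^ 2) + K * (∫ z in Hs t, S1 z) + Y)) := by
        rw [integral_add it2 (iadd (icm iS1 2)
          (icm (iadd (iadd (icm it2 _) (icm iS1 K)) iF2) 3)),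
          integral_add (icm iS1 2) (icm (iadd (iadd (icm it2 _) (icm iS1 K)) iF2) 3),
          integral_const_mul, integral_const_mul,
          integral_add (iadd (icm it2 _) (icm iS1 K)) iF2,
          integral_add (icm it2 _) (icm iS1 K), integral_const_mul, integral_const_mul]
    _ ≤ T0 * Y + (2 * (X0 * Y) + 3 * (ν⁻¹ ^ 2 * (T0 * Y) + K * (X0 * Y) + Y)) := by gcongr
    _ = _ := by ring

end energy
end PSP

namespace PSP
open scoped ContDiff
section boxes
variable {ι : Type} [Fintype ι] [DecidableEq ι]

/-- backward parabolic box -/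
def Cb (t : ι) (ρ : ℝ) : Set (ι → ℝ) := {z | z t ≤ 0 ∧ -ρ ^ 2 ≤ z t ∧ ∀ i, i ≠ t → |z i| ≤ ρ}

lemma Cb_closed (t : ι) (ρ : ℝ) : IsClosed (Cb t ρ) := by
  have : Cb t ρ = {z | z t ≤ 0} ∩ ({z | -ρ ^ 2 ≤ z t} ∩ ⋂ i, ⋂ (_ : i ≠ t), {z | |z i| ≤ ρ}) := by
    ext z; simp [Cb]
  rw [this]
  refine (isClosed_le (by fun_prop) (by fun_prop)).inter
    ((isClosed_le (by fun_prop) (by fun_prop)).inter ?_)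
  exact isClosed_iInter fun i => isClosed_iInter fun _ => isClosed_le (by fun_prop) (by fun_prop)

lemma Cb_meas (t : ι) (ρ : ℝ) : MeasurableSet (Cb t ρ) := (Cb_closed t ρ).measurableSet

lemma Cb_bdd (t : ι) (ρ : ℝ) : Bornology.IsBounded (Cb t ρ) := by
  refine (isBounded_iff_subset_closedBall 0).2 ⟨|ρ| + ρ ^ 2, fun z hz => ?_⟩
  rw [mem_closedBall_zero_iff, pi_norm_le_iff_of_nonneg (by positivity)]
  intro i
  rw [Real.norm_eq_abs]
  by_cases hi : i = t
  · subst hi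
    have h1 := hz.1; have h2 := hz.2.1
    rw [abs_le]; constructor <;> linarith [abs_nonneg ρ, sq_nonneg ρ]
  · linarith [hz.2.2 i hi, le_abs_self ρ, sq_nonneg ρ]

lemma Cb_sub_Hs (t : ι) (ρ : ℝ) : Cb t ρ ⊆ Hs t := fun z hz => hz.1

lemma Cb_mono (t : ι) {r s : ℝ} (h0 : 0 ≤ r) (h : r ≤ s) : Cb t r ⊆ Cb t s := by
  intro z hz
  refine ⟨hz.1, ?_, fun i hi => (hz.2.2 i hi).trans h⟩
  have : r ^ 2 ≤ s ^ 2 := pow_le_pow_left₀ h0 h 2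
  linarith [hz.2.1]

lemma LB.onCb {f : (ι → ℝ) → ℝ} (hf : LB f) (t : ι) (ρ : ℝ) : IntegrableOn f (Cb t ρ) :=
  hf.integrableOn (Cb_bdd t ρ)

lemma exists_cutoff (t : ι) {r' r : ℝ} (h0 : 0 < r') (hr : r' < r) :
    ∃ (ζ : (ι → ℝ) → ℝ) (K : ℝ), 1 ≤ K ∧ ContDiff ℝ ∞ ζ ∧ HasCompactSupport ζ ∧ (∀ z, 0 ≤ ζ z) ∧
      (∀ z, ζ z ≤ 1) ∧
      (∀ z ∈ Cb t r', ∀ᶠ y in nhds z, ζ y = 1) ∧ (∀ z ∈ Hs t, z ∉ Cb t r → z ∉ tsupport ζ) ∧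
      (∀ i z, |pd i ζ z| ≤ K) ∧ (∀ i j z, |pd i (pd j ζ) z| ≤ K) := by
  set m := (r' + r) / 2 with hm
  have hm1 : r' < m := by rw [hm]; linarith
  have hm2 : m < r := by rw [hm]; linarith
  have hsq : 0 < r ^ 2 - m ^ 2 := by nlinarith
  set g : ι → ℝ → ℝ := fun i x => if i = t then
      Real.smoothTransition ((r ^ 2 + x) / (r ^ 2 - m ^ 2)) * Real.smoothTransition (2 - x)
    else Real.smoothTransition ((r ^ 2 - x ^ 2) / (r ^ 2 - m ^ 2)) with hg
  have hgs : ∀ i, ContDiff ℝ ∞ (g i) := by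
    intro i
    by_cases hi : i = t
    · simp only [hg, hi, if_true]
      refine ContDiff.mul ?_ ?_
      · exact Real.smoothTransition.contDiff.comp (by fun_prop)
      · exact Real.smoothTransition.contDiff.comp (by fun_prop)
    · simp only [hg, hi, if_false]
      exact Real.smoothTransition.contDiff.comp (by fun_prop)
  set ζ : (ι → ℝ) → ℝ := fun z => ∏ i, g i (z i) with hζ
  have hζs : ContDiff ℝ ∞ ζ := contDiff_prod fun i _ => (hgs i).comp (contDiff_apply ℝ ℝ i)
  have hg0 : ∀ i x, 0 ≤ g i x := by
    intro i x
    simp only [hg]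
    split_ifs
    · exact mul_nonneg (Real.smoothTransition.nonneg _) (Real.smoothTransition.nonneg _)
    · exact Real.smoothTransition.nonneg _
  have hg1 : ∀ i x, g i x ≤ 1 := by
    intro i x
    simp only [hg]
    split_ifs
    · exact mul_le_one₀ (Real.smoothTransition.le_one _) (Real.smoothTransition.nonneg _)
        (Real.smoothTransition.le_one _)
    · exact Real.smoothTransition.le_one _
  set B : Set (ι → ℝ) := {z | z t ≤ 2 ∧ -r ^ 2 ≤ z t ∧ ∀ i, i ≠ t → |z i| ≤ r} with hB
  have hBc : IsClosed B := by
    have : B = {z | z t ≤ 2} ∩ ({z | -r ^ 2 ≤ z t} ∩ ⋂ i, ⋂ (_ : i ≠ t), {z | |z i| ≤ r}) := by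
      ext z; simp [hB]
    rw [this]
    refine (isClosed_le (by fun_prop) (by fun_prop)).inter
      ((isClosed_le (by fun_prop) (by fun_prop)).inter ?_)
    exact isClosed_iInter fun i => isClosed_iInter fun _ => isClosed_le (by fun_prop) (by fun_prop)
  have hBb : Bornology.IsBounded B := by
    refine (isBounded_iff_subset_closedBall 0).2 ⟨2 + |r| + r ^ 2, fun z hz => ?_⟩
    rw [mem_closedBall_zero_iff, pi_norm_le_iff_of_nonneg (by positivity)]
    intro i
    rw [Real.norm_eq_abs]
    by_cases hi : i = t
    · subst hi
      have h1 := hz.1; have h2 := hz.2.1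
      rw [abs_le]; constructor <;> linarith [abs_nonneg r, sq_nonneg r]
    · linarith [hz.2.2 i hi, le_abs_self r, sq_nonneg r]
  have hsupp : tsupport ζ ⊆ B := by
    refine closure_minimal ?_ hBc
    intro z hz
    have hne : ∀ i, g i (z i) ≠ 0 := fun i => (Finset.prod_ne_zero_iff.1 hz) i (Finset.mem_univ i)
    have ht := hne t
    simp only [hg, if_true] at ht
    have ht1 := left_ne_zero_of_mul ht
    have ht2 := right_ne_zero_of_mul ht
    rw [Ne, Real.smoothTransition.zero_iff_nonpos, not_le] at ht1 ht2
    refine ⟨by linarith, ?_, ?_⟩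
    · have := (div_pos_iff_of_pos_right hsq).1 ht1; linarith
    · intro i hi
      have h3 := hne i
      simp only [hg, hi, if_false] at h3
      rw [Ne, Real.smoothTransition.zero_iff_nonpos, not_le, div_pos_iff_of_pos_right hsq] at h3
      exact abs_le_of_sq_le_sq (by linarith) (by linarith)
  have hcs : HasCompactSupport ζ :=
    (isCompact_of_isClosed_isBounded (isClosed_tsupport ζ) (hBb.subset hsupp))
  have bd1 : ∀ i, ∃ K, ∀ z, ‖pd i ζ z‖ ≤ K := fun i =>
    (pd_cs hcs i).exists_bound_of_continuous (pd_smooth hζs i).continuous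
  have bd2 : ∀ i j, ∃ K, ∀ z, ‖pd i (pd j ζ) z‖ ≤ K := fun i j =>
    (pd_cs (pd_cs hcs j) i).exists_bound_of_continuous (pd_smooth (pd_smooth hζs j) i).continuous
  choose K1 hK1 using bd1
  choose K2 hK2 using bd2
  have hK1n : ∀ i, 0 ≤ K1 i := fun i => (norm_nonneg _).trans (hK1 i 0)
  have hK2n : ∀ i j, 0 ≤ K2 i j := fun i j => (norm_nonneg _).trans (hK2 i j 0)
  have hsum1 : 0 ≤ ∑ i, K1 i := Finset.sum_nonneg fun i _ => hK1n i
  have hsum2 : 0 ≤ ∑ i, ∑ j, K2 i j := Finset.sum_nonneg fun i _ => Finset.sum_nonneg fun j _ => hK2n i j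
  refine ⟨ζ, 1 + ∑ i, K1 i + ∑ i, ∑ j, K2 i j, by linarith, hζs, hcs, ?_, ?_, ?_, ?_, ?_, ?_⟩
  · exact fun z => Finset.prod_nonneg fun i _ => hg0 i _
  · exact fun z => Finset.prod_le_one (fun i _ => hg0 i _) fun i _ => hg1 i _
  · intro z hz
    have hev : ∀ i, ∀ᶠ y in nhds z, g i (y i) = 1 := by
      intro i
      by_cases hi : i = t
      · subst hi
        have o1 : ∀ᶠ y : ι → ℝ in nhds z, -m ^ 2 < y i :=
          (continuous_apply i).continuousAt.eventually (lt_mem_nhds (by nlinarith [hz.2.1]))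
        have o2 : ∀ᶠ y : ι → ℝ in nhds z, y i < 1 :=
          (continuous_apply i).continuousAt.eventually (gt_mem_nhds (by linarith [hz.1]))
        filter_upwards [o1, o2] with y h1 h2
        simp only [hg, if_true]
        rw [Real.smoothTransition.one_of_one_le, Real.smoothTransition.one_of_one_le, one_mul]
        · linarith
        · rw [one_le_div hsq]; linarith
      · have o1 : ∀ᶠ y : ι → ℝ in nhds z, |y i| < m :=
          ((continuous_apply i).abs.continuousAt).eventually
            (gt_mem_nhds ((hz.2.2 i hi).trans_lt hm1))
        filter_upwards [o1] with y h1
        simp only [hg, hi, if_false]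
        rw [Real.smoothTransition.one_of_one_le]
        rw [one_le_div hsq]
        have := sq_lt_sq' (by linarith [abs_nonneg (y i), neg_abs_le (y i)]) h1
        rw [sq_abs] at this; linarith
    filter_upwards [eventually_all.2 hev] with y hy
    simp [hζ, hy]
  · intro z hz hz' hzt
    have := hsupp hzt
    exact hz' ⟨hz, this.2.1, this.2.2⟩
  · intro i z
    have := hK1 i z
    rw [Real.norm_eq_abs] at this
    have h2 := Finset.single_le_sum (fun i _ => hK1n i) (Finset.mem_univ i)
    linarith
  · intro i j z
    have := hK2 i j z
    rw [Real.norm_eq_abs] at this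
    have h2 := Finset.single_le_sum (f := fun i => ∑ j, K2 i j)
      (fun i _ => Finset.sum_nonneg fun j _ => hK2n i j) (Finset.mem_univ i)
    have h3 := Finset.single_le_sum (fun j _ => hK2n i j) (Finset.mem_univ j)
    linarith

/-- integrals over the half space of functions supported in a box -/
lemma setInt_Hs_eq {f : (ι → ℝ) → ℝ} {t : ι} {r : ℝ} (h : ∀ z ∈ Hs t, z ∉ Cb t r → f z = 0) :
    ∫ z in Hs t, f z = ∫ z in Cb t r, f z :=
  setIntegral_eq_of_subset_of_forall_diff_eq_zero (measHs t) (Cb_sub_Hs t r)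
    fun z hz => h z hz.1 hz.2

end boxes
end PSP

namespace PSP
open scoped ContDiff
section energy
variable {ι : Type} [Fintype ι] [DecidableEq ι]
variable {t d h : ι} {ν : ℝ} {b : (ι → ℝ) → ℝ} {M : ι → ι → (ι → ℝ) → ℝ}

set_option maxHeartbeats 1000000 in
/-- Caccioppoli -/
lemma cacc (t d h : ι) (ν : ℝ) {r' r : ℝ} (h0 : 0 < r') (hr : r' < r) :
    ∃ C : ℝ, 0 < C ∧ ∀ b M, Co t d h ν b M → ∀ w : (ι → ℝ) → ℝ, ContDiff ℝ ∞ w →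
    ∫ z in Cb t r', ∑ i ∈ Sx t, pd i w z ^ 2
      ≤ C * ∫ z in Cb t r, (Fo t b M w z ^ 2 + w z ^ 2) := by
  obtain ⟨ζ, K, hK, hζ, hcs, hζ0, hζ1, hone, hsupp, hd1, hd2⟩ := exists_cutoff t h0 hr
  set n : ℝ := (Fintype.card ι : ℝ) with hn
  have hn0 : 0 ≤ n := by positivity
  set P : ℝ := 1 + ν⁻¹ * K + n ^ 2 * (2 * (n+1) * ν⁻¹ ^ 3 * K ^ 2) with hP
  refine ⟨2 * |ν|⁻¹ * (1 + |P|) + 1, by positivity, ?_⟩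
  intro b M H w hw
  have hν := H.pos
  have hP0 : 0 ≤ P := by rw [hP]; positivity
  rw [abs_of_nonneg hP0, abs_of_pos hν]
  have w1 : ∀ i, ContDiff ℝ ∞ (pd i w) := fun i => pd_smooth hw i
  have w2 : ∀ i j, ContDiff ℝ ∞ (pd i (pd j w)) := fun i j => pd_smooth (w1 j) i
  have z1 : ∀ i, ContDiff ℝ ∞ (pd i ζ) := fun i => pd_smooth hζ i
  have hz2 : ContDiff ℝ ∞ (fun z => ζ z * ζ z) := hζ.mul hζ
  have hz2w : ContDiff ℝ ∞ (fun z => ζ z * ζ z * w z) := hz2.mul hw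
  have cz2 : HasCompactSupport (fun z => ζ z * ζ z) := hcs.mul_right
  have cz2w : HasCompactSupport (fun z => ζ z * ζ z * w z) := cz2.mul_right
  have hpd : ∀ i z, pd i (fun z => ζ z * ζ z * w z) z
      = 2 * (ζ z * pd i ζ z * w z) + ζ z * ζ z * pd i w z := by
    intro i z
    rw [pd_mul hz2 hw, pd_mul hζ hζ]; ring
  have hF : LB (Fo t b M w) := H.lbF hw
  have lz := LB.sm hζ
  have lw := LB.sm hw
  have lz1 := fun i => LB.sm (z1 i)
  have lw1 := fun i => LB.sm (w1 i)
  have lw2 := fun i j => LB.sm (w2 i j)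
  -- integrability
  have iA : ∀ i j, IntegrableOn (fun z => M i j z * (ζ z * ζ z * pd i w z * pd j w z)) (Hs t) :=
    fun i j => ((H.lbM i j).mul (((lz.mul lz).mul (lw1 i)).mul (lw1 j))).intH
      (cz2.mul_right.mul_right.mul_left) t
  have iB : ∀ i j, IntegrableOn (fun z => M i j z * (ζ z * ζ z * w z * pd i (pd j w) z)) (Hs t) :=
    fun i j => ((H.lbM i j).mul (((lz.mul lz).mul lw).mul (lw2 i j))).intH
      (cz2w.mul_right.mul_left) t
  have iC : ∀ i j, IntegrableOn (fun z => 2 * (M i j z * (ζ z * pd i ζ z * w z * pd j w z))) (Hs t) :=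
    fun i j => icm (((H.lbM i j).mul (((lz.mul (lz1 i)).mul lw).mul (lw1 j))).intH
      (hcs.mul_right.mul_right.mul_right.mul_left) t) 2
  have iF : IntegrableOn (fun z => Fo t b M w z * (ζ z * ζ z * w z)) (Hs t) :=
    (hF.mul ((lz.mul lz).mul lw)).intH (cz2w.mul_left) t
  have ib : IntegrableOn (fun z => b z * (ζ z * ζ z * w z * pd t w z)) (Hs t) :=
    (H.lbb.mul (((lz.mul lz).mul lw).mul (lw1 t))).intH (cz2w.mul_right.mul_left) t
  have ibz : IntegrableOn (fun z => b z * (ζ z * pd t ζ z * w z ^ 2)) (Hs t) :=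
    (H.lbb.mul ((lz.mul (lz1 t)).mul lw.sq)).intH (hcs.mul_right.mul_right.mul_left) t
  have hij : ∀ i j, ∫ z in Hs t, M i j z * (ζ z * ζ z * w z * pd i (pd j w) z)
      = - (∫ z in Hs t, 2 * (M i j z * (ζ z * pd i ζ z * w z * pd j w z)))
        - ∫ z in Hs t, M i j z * (ζ z * ζ z * pd i w z * pd j w z) := by
    intro i j
    by_cases hi : i = t
    · subst hi; simp [H.Mtj]
    · rw [ibp hi (H.lbM i j) (H.Minv' i j) hz2w (w1 j) cz2w, ← neg_add', ← integral_add (iC i j) (iA i j)]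
      congr 1
      refine integral_congr_ae (Eventually.of_forall fun z => ?_)
      simp only [hpd]; ring
  have htime : 0 ≤ (∫ z in Hs t, b z * (ζ z * ζ z * w z * pd t w z))
      + ∫ z in Hs t, b z * (ζ z * pd t ζ z * w z ^ 2) := by
    have := time_nonneg H.lbb (fun z => hν.le.trans (H.blo z)) (H.binv H.td) (hζ.mul hw)
      (hcs.mul_right)
    rw [← integral_add ib ibz]
    refine this.trans (le_of_eq ?_)
    congr 1; funext z
    rw [pd_mul hζ hw]; ring
  set E : (ι → ℝ) → ℝ := fun z => ∑ i ∈ Sx t, (ζ z * pd i w z) ^ 2 with hE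
  have iE : IntegrableOn E (Hs t) := integrable_finset_sum _ fun i _ =>
    sq_int (lz.mul (lw1 i)) hcs.mul_right t
  have hell : ν * ∫ z in Hs t, E z
      ≤ ∑ i, ∑ j, ∫ z in Hs t, M i j z * (ζ z * ζ z * pd i w z * pd j w z) := by
    have e : ∑ i, ∑ j, ∫ z in Hs t, M i j z * (ζ z * ζ z * pd i w z * pd j w z)
      = ∫ z in Hs t, ∑ i, ∑ j, M i j z * (ζ z * ζ z * pd i w z * pd j w z) := by
      rw [integral_finset_sum _ fun i _ => integrable_finset_sum _ fun j _ => iA i j]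
      refine Finset.sum_congr rfl fun i _ => ?_
      rw [integral_finset_sum _ fun j _ => iA i j]
    rw [e, ← integral_const_mul]
    refine integral_mono (iE.const_mul ν)
      (integrable_finset_sum _ fun i _ => integrable_finset_sum _ fun j _ => iA i j) fun z => ?_
    have := H.ell z (fun i => ζ z * pd i w z)
    refine this.trans (le_of_eq ?_)
    refine Finset.sum_congr rfl fun i _ => Finset.sum_congr rfl fun j _ => ?_
    ring
  have hFsum : ∫ z in Hs t, Fo t b M w z * (ζ z * ζ z * w z)
      = (∫ z in Hs t, b z * (ζ z * ζ z * w z * pd t w z))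
        - ∑ i, ∑ j, ∫ z in Hs t, M i j z * (ζ z * ζ z * w z * pd i (pd j w) z) := by
    have e : ∑ i, ∑ j, ∫ z in Hs t, M i j z * (ζ z * ζ z * w z * pd i (pd j w) z)
      = ∫ z in Hs t, ∑ i, ∑ j, M i j z * (ζ z * ζ z * w z * pd i (pd j w) z) := by
      rw [integral_finset_sum _ fun i _ => integrable_finset_sum _ fun j _ => iB i j]
      refine Finset.sum_congr rfl fun i _ => ?_
      rw [integral_finset_sum _ fun j _ => iB i j]
    rw [e, ← integral_sub ib (integrable_finset_sum _ fun i _ => integrable_finset_sum _ fun j _ => iB i j)]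
    congr 1; funext z
    unfold Fo
    rw [sub_mul, Finset.sum_mul]
    simp only [Finset.sum_mul]
    congr 1
    · ring
    · refine Finset.sum_congr rfl fun i _ => Finset.sum_congr rfl fun j _ => ?_
      ring
  simp only [hij] at hFsum
  rw [show ∑ i, ∑ j, (- (∫ z in Hs t, 2 * (M i j z * (ζ z * pd i ζ z * w z * pd j w z)))
        - ∫ z in Hs t, M i j z * (ζ z * ζ z * pd i w z * pd j w z))
      = - (∑ i, ∑ j, ∫ z in Hs t, 2 * (M i j z * (ζ z * pd i ζ z * w z * pd j w z)))
        - ∑ i, ∑ j, ∫ z in Hs t, M i j z * (ζ z * ζ z * pd i w z * pd j w z) by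
    simp [Finset.sum_sub_distrib]] at hFsum
  set Z : (ι → ℝ) → ℝ := fun z => Fo t b M w z * (ζ z * ζ z * w z) + b z * (ζ z * pd t ζ z * w z ^ 2)
    - ∑ i, ∑ j, 2 * (M i j z * (ζ z * pd i ζ z * w z * pd j w z)) with hZ
  have iCs := integrable_finset_sum Finset.univ fun i (_ : i ∈ Finset.univ) =>
    integrable_finset_sum Finset.univ fun j (_ : j ∈ Finset.univ) => iC i j
  have iZ : IntegrableOn Z (Hs t) := isub (iadd iF ibz) iCs
  have hmain : ν * ∫ z in Hs t, E z ≤ ∫ z in Hs t, Z z := by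
    have e : ∫ z in Hs t, Z z = (∫ z in Hs t, Fo t b M w z * (ζ z * ζ z * w z))
      + (∫ z in Hs t, b z * (ζ z * pd t ζ z * w z ^ 2))
      - ∑ i, ∑ j, ∫ z in Hs t, 2 * (M i j z * (ζ z * pd i ζ z * w z * pd j w z)) := by
      rw [hZ, integral_sub (iadd iF ibz) iCs, integral_add iF ibz,
        integral_finset_sum _ fun i _ => integrable_finset_sum _ fun j _ => iC i j]
      congr 1
      refine Finset.sum_congr rfl fun i _ => ?_
      rw [integral_finset_sum _ fun j _ => iC i j]
    rw [e]; linarith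
  have hzero : ∀ z ∈ Hs t, z ∉ Cb t r → ζ z = 0 := fun z hz hz' =>
    image_eq_zero_of_notMem_tsupport (hsupp z hz hz')
  have eE : ∫ z in Hs t, E z = ∫ z in Cb t r, E z := setInt_Hs_eq fun z hz hz' => by
    simp [hE, hzero z hz hz']
  have eZ : ∫ z in Hs t, Z z = ∫ z in Cb t r, Z z := setInt_Hs_eq fun z hz hz' => by
    simp [hZ, hzero z hz hz']
  rw [eE, eZ] at hmain
  have iEr := iE.mono_set (Cb_sub_Hs t r)
  have iZr := iZ.mono_set (Cb_sub_Hs t r)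
  have iFw : IntegrableOn (fun z => Fo t b M w z ^ 2 + w z ^ 2) (Cb t r) := (hF.sq.add lw.sq).onCb t r
  have hpt : ∀ z, Z z ≤ ν / 2 * E z + P * (Fo t b M w z ^ 2 + w z ^ 2) := by
    intro z
    have a0 := hζ0 z
    have a1 := hζ1 z
    have b1 : Fo t b M w z * (ζ z * ζ z * w z) ≤ Fo t b M w z ^ 2 + w z ^ 2 := by
      have h1 : (ζ z * ζ z) ≤ 1 := mul_le_one₀ a1 a0 a1
      have h2 : 0 ≤ ζ z * ζ z := mul_nonneg a0 a0
      have h3 : Fo t b M w z * w z ≤ (Fo t b M w z ^ 2 + w z ^ 2) := by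
        nlinarith [sq_nonneg (Fo t b M w z - w z), sq_nonneg (Fo t b M w z), sq_nonneg (w z)]
      nlinarith [mul_le_mul_of_nonneg_left h3 h2, sq_nonneg (Fo t b M w z), sq_nonneg (w z),
        mul_le_mul_of_nonneg_right h1 (add_nonneg (sq_nonneg (Fo t b M w z)) (sq_nonneg (w z)))]
    have b2 : b z * (ζ z * pd t ζ z * w z ^ 2) ≤ ν⁻¹ * K * w z ^ 2 := by
      have h1 := hd1 t z
      have h2 : b z * (ζ z * pd t ζ z) ≤ ν⁻¹ * K := by
        refine (le_abs_self _).trans ?_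
        rw [abs_mul, abs_mul, abs_of_nonneg a0, abs_of_nonneg (hν.le.trans (H.blo z))]
        refine mul_le_mul (H.bhi z) ?_ (by positivity) (by positivity)
        nlinarith [abs_nonneg (pd t ζ z)]
      nlinarith [mul_le_mul_of_nonneg_right h2 (sq_nonneg (w z))]
    have b3 : ∀ i j, -(2 * (M i j z * (ζ z * pd i ζ z * w z * pd j w z)))
        ≤ ν / 2 * (n+1)⁻¹ * (if j = t then 0 else (ζ z * pd j w z) ^ 2)
          + 2 * (n+1) * ν⁻¹ ^ 3 * K ^ 2 * w z ^ 2 := by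
      intro i j
      by_cases hj : j = t
      · subst hj; rw [H.Mjt]; simp; positivity
      · simp only [hj, if_false]
        set X := ζ z * pd j w z
        set q := M i j z * pd i ζ z with hq
        have hq2 : q ^ 2 ≤ (ν⁻¹ * K) ^ 2 := by
          rw [← sq_abs, hq, abs_mul]
          exact pow_le_pow_left₀ (by positivity) (mul_le_mul (H.Mhi i j z) (hd1 i z) (abs_nonneg _)
            (by positivity)) 2
        have e : M i j z * (ζ z * pd i ζ z * w z * pd j w z) = q * w z * X := by
          simp only [hq, X]; ring
        rw [e]
        have hs : 0 ≤ ν / 2 * (n+1)⁻¹ * (X + 2 * (n+1) * ν⁻¹ * (q * w z)) ^ 2 := by positivity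
        have hs2 : ν / 2 * (n+1)⁻¹ * (X + 2 * (n+1) * ν⁻¹ * (q * w z)) ^ 2
          = ν / 2 * (n+1)⁻¹ * X ^ 2 + 2 * (q * w z * X) + 2 * (n+1) * ν⁻¹ * (q ^ 2 * w z ^ 2) := by
          have : n + 1 ≠ 0 := by positivity
          field_simp; ring
        have hs3 : 2 * (n+1) * ν⁻¹ * (q ^ 2 * w z ^ 2) ≤ 2 * (n+1) * ν⁻¹ * ((ν⁻¹ * K) ^ 2 * w z ^ 2) := by
          gcongr
        have hs4 : 2 * (n+1) * ν⁻¹ * ((ν⁻¹ * K) ^ 2 * w z ^ 2) = 2 * (n+1) * ν⁻¹ ^ 3 * K ^ 2 * w z ^ 2 := by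
          ring
        linarith
    have b4 : -∑ i, ∑ j, 2 * (M i j z * (ζ z * pd i ζ z * w z * pd j w z))
        ≤ ν / 2 * E z + n ^ 2 * (2 * (n+1) * ν⁻¹ ^ 3 * K ^ 2) * w z ^ 2 := by
      rw [← Finset.sum_neg_distrib]
      simp only [← Finset.sum_neg_distrib]
      refine (Finset.sum_le_sum fun i _ => Finset.sum_le_sum fun j _ => b3 i j).trans ?_
      simp only [Finset.sum_add_distrib, ← Finset.mul_sum, Finset.sum_const, Finset.card_univ,
        nsmul_eq_mul, ← hn]
      have e : ∑ j, (if j = t then (0:ℝ) else (ζ z * pd j w z) ^ 2) = E z := by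
        rw [← Finset.sum_erase_add _ _ (Finset.mem_univ t)]
        simp only [hE, if_true, add_zero]
        refine Finset.sum_congr rfl fun j hj => ?_
        rw [if_neg (Finset.ne_of_mem_erase hj)]
      rw [e]
      have hE0 : 0 ≤ E z := Finset.sum_nonneg fun _ _ => sq_nonneg _
      have : n * (ν / 2 * (n+1)⁻¹ * E z) ≤ ν / 2 * E z := by
        have h1 : n * (n+1)⁻¹ ≤ 1 := by
          rw [← div_eq_mul_inv, div_le_one (by positivity)]; linarith
        calc n * (ν / 2 * (n+1)⁻¹ * E z) = (n * (n+1)⁻¹) * (ν / 2 * E z) := by ring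
          _ ≤ 1 * (ν / 2 * E z) := by gcongr
          _ = _ := one_mul _
      nlinarith
    have hq : 0 ≤ (ν⁻¹ * K + n ^ 2 * (2 * (n+1) * ν⁻¹ ^ 3 * K ^ 2)) * Fo t b M w z ^ 2 := by positivity
    simp only [hZ]
    have hPe : P * (Fo t b M w z ^ 2 + w z ^ 2) = Fo t b M w z ^ 2 + w z ^ 2
      + (ν⁻¹ * K + n ^ 2 * (2 * (n+1) * ν⁻¹ ^ 3 * K ^ 2)) * Fo t b M w z ^ 2
      + ν⁻¹ * K * w z ^ 2 + n ^ 2 * (2 * (n+1) * ν⁻¹ ^ 3 * K ^ 2) * w z ^ 2 := by rw [hP]; ring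
    linarith
  have hZi : ∫ z in Cb t r, Z z ≤ ν / 2 * (∫ z in Cb t r, E z)
      + P * ∫ z in Cb t r, (Fo t b M w z ^ 2 + w z ^ 2) := by
    rw [← integral_const_mul, ← integral_const_mul, ← integral_add (icm iEr _) (icm iFw _)]
    exact integral_mono iZr (iadd (icm iEr _) (icm iFw _)) hpt
  have hEsmall : ∫ z in Cb t r', ∑ i ∈ Sx t, pd i w z ^ 2 ≤ ∫ z in Cb t r, E z := by
    have e : ∫ z in Cb t r', ∑ i ∈ Sx t, pd i w z ^ 2 = ∫ z in Cb t r', E z := by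
      refine setIntegral_congr_fun (Cb_meas t r') fun z hz => ?_
      simp [hE, (hone z hz).self_of_nhds]
    rw [e]
    refine setIntegral_mono_set iEr (Eventually.of_forall fun z =>
      Finset.sum_nonneg fun _ _ => sq_nonneg _) (Cb_mono t h0.le hr.le).eventuallyLE
  set X := ∫ z in Cb t r, E z
  set Y := ∫ z in Cb t r, (Fo t b M w z ^ 2 + w z ^ 2)
  have hY0 : 0 ≤ Y := integral_nonneg fun z => by positivity
  have h6 : ν / 2 * X ≤ P * Y := by linarith
  have h7 := mul_le_mul_of_nonneg_left h6 (show 0 ≤ 2 * ν⁻¹ by positivity)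
  have h8 : 2 * ν⁻¹ * (ν / 2 * X) = X := by field_simp
  have h9 : 0 ≤ 2 * ν⁻¹ * Y := by positivity
  have h10 : (2 * ν⁻¹ * (1 + P) + 1) * Y = 2 * ν⁻¹ * (P * Y) + 2 * ν⁻¹ * Y + Y := by ring
  linarith

end energy
end PSP

namespace PSP
open scoped ContDiff
section energy
variable {ι : Type} [Fintype ι] [DecidableEq ι]
variable {t d h : ι} {ν : ℝ} {b : (ι → ℝ) → ℝ} {M : ι → ι → (ι → ℝ) → ℝ}

/-- squared `L₂` norm on a cylinder -/
def N2 (t : ι) (ρ : ℝ) (f : (ι → ℝ) → ℝ) : ℝ := ∫ z in Cb t ρ, f z ^ 2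

lemma N2_nonneg (t : ι) (ρ : ℝ) (f : (ι → ℝ) → ℝ) : 0 ≤ N2 t ρ f :=
  integral_nonneg fun z => sq_nonneg _

lemma N2_mono {f : (ι → ℝ) → ℝ} (hf : LB f) (t : ι) {r s : ℝ} (h0 : 0 ≤ r) (h : r ≤ s) :
    N2 t r f ≤ N2 t s f :=
  setIntegral_mono_set (hf.sq.onCb t s) (ae_of_all _ fun z => sq_nonneg _)
    (Cb_mono t h0 h).eventuallyLE

lemma N2_le {f g : (ι → ℝ) → ℝ} (hf : LB f) (hg : LB g) (t : ι) {r : ℝ}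
    (h : ∀ z ∈ Cb t r, f z ^ 2 ≤ g z ^ 2) : N2 t r f ≤ N2 t r g :=
  setIntegral_mono_on (hf.sq.onCb t r) (hg.sq.onCb t r) (Cb_meas t r) h

lemma N2_add {f g : (ι → ℝ) → ℝ} (hf : LB f) (hg : LB g) (t : ι) (r : ℝ) :
    N2 t r (fun z => f z + g z) ≤ 2 * N2 t r f + 2 * N2 t r g := by
  unfold N2
  rw [← integral_const_mul, ← integral_const_mul,
    ← integral_add (icm (hf.sq.onCb t r) 2) (icm (hg.sq.onCb t r) 2)]
  refine integral_mono ((hf.add hg).sq.onCb t r)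
    (iadd (icm (hf.sq.onCb t r) 2) (icm (hg.sq.onCb t r) 2)) fun z => ?_
  simp only
  nlinarith [sq_nonneg (f z - g z)]

lemma N2_sub {f g : (ι → ℝ) → ℝ} (hf : LB f) (hg : LB g) (t : ι) (r : ℝ) :
    N2 t r (fun z => f z - g z) ≤ 2 * N2 t r f + 2 * N2 t r g := by
  have := N2_add hf (LB.cmul (-1) hg) t r
  have e : N2 t r (fun z => -1 * g z) = N2 t r g := by
    unfold N2; congr 1; funext z; ring
  have e2 : (fun z => f z + -1 * g z) = fun z => f z - g z := by funext z; ring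
  rw [e, e2] at this; exact this

lemma N2_cmul (c : ℝ) (f : (ι → ℝ) → ℝ) (t : ι) (r : ℝ) :
    N2 t r (fun z => c * f z) = c ^ 2 * N2 t r f := by
  unfold N2
  rw [← integral_const_mul]; congr 1; funext z; ring

lemma N2_sum {α : Type*} (s : Finset α) {f : α → (ι → ℝ) → ℝ} (hf : ∀ a ∈ s, LB (f a)) (t : ι) (r : ℝ) :
    N2 t r (fun z => ∑ a ∈ s, f a z) ≤ s.card * ∑ a ∈ s, N2 t r (f a) := by
  unfold N2
  rw [← integral_finsetSum _ (fun a ha => ((hf a ha).sq.onCb t r)), ← integral_const_mul]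
  refine integral_mono ((LB.sum hf).sq.onCb t r) ?_ fun z => ?_
  · exact icm ((LB.sum fun a ha => (hf a ha).sq).onCb t r) _
  · exact sq_sum_le_card_mul_sum_sq

set_option maxHeartbeats 1000000 in
/-- Interior estimate. -/
lemma star0 (t d h : ι) (ν : ℝ) {r' r : ℝ} (h0 : 0 < r') (hr : r' < r) :
    ∃ C : ℝ, 0 < C ∧ ∀ b M, Co t d h ν b M → ∀ w : (ι → ℝ) → ℝ, ContDiff ℝ ∞ w →
    ∫ z in Cb t r', (pd t w z ^ 2 + ∑ i ∈ Sx t, ∑ j ∈ Sx t, pd i (pd j w) z ^ 2)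
      ≤ C * (N2 t r (Fo t b M w) + N2 t r w) := by
  set r1 := (r' + r) / 2 with hr1
  have hr1' : r' < r1 := by rw [hr1]; linarith
  have hr1'' : r1 < r := by rw [hr1]; linarith
  have hr10 : 0 < r1 := by linarith
  obtain ⟨ζ, K, hK, hζ, hcs, hζ0, hζ1, hone, hsupp, hd1, hd2⟩ := exists_cutoff t h0 hr1'
  obtain ⟨C1, hC1, hglob⟩ := glob t d h ν
  obtain ⟨C2, hC2, hcacc⟩ := cacc t d h ν hr10 hr1''
  set n : ℝ := (Fintype.card ι : ℝ) with hn
  have hn0 : 0 ≤ n := by positivity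
  set P : ℝ := ν⁻¹ * K * (1 + n ^ 2) with hP
  set R : ℝ := 2 * ν⁻¹ * K * n with hR
  refine ⟨C1 * (3 * (1 + P ^ 2 + R ^ 2 * n * C2)), by positivity, ?_⟩
  intro b M H w hw
  have hν := H.pos
  have hP0 : 0 ≤ P := by rw [hP]; positivity
  have hR0 : 0 ≤ R := by rw [hR]; positivity
  have w1 : ∀ i, ContDiff ℝ ∞ (pd i w) := fun i => pd_smooth hw i
  have w2 : ∀ i j, ContDiff ℝ ∞ (pd i (pd j w)) := fun i j => pd_smooth (w1 j) i
  have z1 : ∀ i, ContDiff ℝ ∞ (pd i ζ) := fun i => pd_smooth hζ i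
  have z2 : ∀ i j, ContDiff ℝ ∞ (pd i (pd j ζ)) := fun i j => pd_smooth (z1 j) i
  set v : (ι → ℝ) → ℝ := fun z => ζ z * w z with hv
  have hvs : ContDiff ℝ ∞ v := hζ.mul hw
  have hvc : HasCompactSupport v := hcs.mul_right
  have v1 : ∀ i, ContDiff ℝ ∞ (pd i v) := fun i => pd_smooth hvs i
  have v2 : ∀ i j, ContDiff ℝ ∞ (pd i (pd j v)) := fun i j => pd_smooth (v1 j) i
  have pv : ∀ i, pd i v = fun z => pd i ζ z * w z + ζ z * pd i w z := by
    intro i; funext z; rw [hv, pd_mul hζ hw]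
  have pv2 : ∀ i j z, pd i (pd j v) z = (pd i (pd j ζ) z * w z + pd j ζ z * pd i w z)
      + (pd i ζ z * pd j w z + ζ z * pd i (pd j w) z) := by
    intro i j z
    rw [pv j, pd_add ((z1 j).mul hw) (hζ.mul (w1 j)), pd_mul (z1 j) hw, pd_mul hζ (w1 j)]
  have hglobv := hglob b M H v hvs hvc
  -- equality on the inner cylinder
  have hev : ∀ z ∈ Cb t r', v =ᶠ[nhds z] w := by
    intro z hz
    filter_upwards [hone z hz] with y hy
    simp [hv, hy]
  have hpe : ∀ (f g : (ι → ℝ) → ℝ) z i, f =ᶠ[nhds z] g → pd i f =ᶠ[nhds z] pd i g := by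
    intro f g z i hfg
    filter_upwards [hfg.eventuallyEq_nhds] with y hy
    unfold pd; rw [hy.fderiv_eq]
  have hLHS : ∫ z in Cb t r', (pd t w z ^ 2 + ∑ i ∈ Sx t, ∑ j ∈ Sx t, pd i (pd j w) z ^ 2)
      ≤ ∫ z in Hs t, (pd t v z ^ 2 + ∑ i ∈ Sx t, ∑ j ∈ Sx t, pd i (pd j v) z ^ 2) := by
    have e1 : ∫ z in Cb t r', (pd t w z ^ 2 + ∑ i ∈ Sx t, ∑ j ∈ Sx t, pd i (pd j w) z ^ 2)
        = ∫ z in Cb t r', (pd t v z ^ 2 + ∑ i ∈ Sx t, ∑ j ∈ Sx t, pd i (pd j v) z ^ 2) := by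
      refine setIntegral_congr_fun (Cb_meas t r') fun z hz => ?_
      have e := hev z hz
      show pd t w z ^ 2 + _ = pd t v z ^ 2 + _
      rw [(hpe v w z t e).self_of_nhds]
      congr 1
      refine Finset.sum_congr rfl fun i _ => Finset.sum_congr rfl fun j _ => ?_
      rw [(hpe _ _ z i (hpe v w z j e)).self_of_nhds]
    rw [e1]
    refine setIntegral_mono_set ?_ (ae_of_all _ fun z => ?_) (Cb_sub_Hs t r').eventuallyLE
    · refine iadd (sq_int (LB.sm (v1 t)) (pd_cs hvc t) t) ?_
      refine integrable_finset_sum _ fun i _ => integrable_finset_sum _ fun j _ => ?_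
      exact sq_int (LB.sm (v2 i j)) (pd_cs (pd_cs hvc j) i) t
    · simp only [Pi.zero_apply]; positivity
  -- the right-hand side
  have hFv : ∀ z, Fo t b M v z = ζ z * Fo t b M w z + (b z * pd t ζ z * w z
      - ∑ i, ∑ j, M i j z * (pd i (pd j ζ) z * w z + pd j ζ z * pd i w z + pd i ζ z * pd j w z)) := by
    intro z
    unfold Fo
    rw [pv t]
    have : ∑ i, ∑ j, M i j z * pd i (pd j v) z
      = ζ z * (∑ i, ∑ j, M i j z * pd i (pd j w) z) +
       ∑ i, ∑ j, M i j z * (pd i (pd j ζ) z * w z + pd j ζ z * pd i w z + pd i ζ z * pd j w z) := by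
      rw [Finset.mul_sum, ← Finset.sum_add_distrib]
      refine Finset.sum_congr rfl fun i _ => ?_
      rw [Finset.mul_sum, ← Finset.sum_add_distrib]
      refine Finset.sum_congr rfl fun j _ => ?_
      rw [pv2]; ring
    rw [this]; ring
  have hbnd : ∀ z, |Fo t b M v z| ≤ |Fo t b M w z| + (P * |w z| + R * ∑ i ∈ Sx t, |pd i w z|) := by
    intro z
    have hb : |b z| ≤ ν⁻¹ := by
      rw [abs_of_pos (lt_of_lt_of_le hν (H.blo z))]; exact H.bhi z
    have hT : ∀ i j, |M i j z * (pd i (pd j ζ) z * w z + pd j ζ z * pd i w z + pd i ζ z * pd j w z)|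
        ≤ ν⁻¹ * K * |w z| + ν⁻¹ * K * ((if i = t then 0 else |pd i w z|) + (if j = t then 0 else |pd j w z|)) := by
      intro i j
      by_cases hi : i = t
      · subst hi; rw [H.Mtj]; simp; positivity
      by_cases hj : j = t
      · subst hj; rw [H.Mjt]; simp [hi]; positivity
      rw [if_neg hi, if_neg hj, abs_mul]
      have h1 : |pd i (pd j ζ) z * w z + pd j ζ z * pd i w z + pd i ζ z * pd j w z|
          ≤ K * |w z| + K * |pd i w z| + K * |pd j w z| := by
        refine (abs_add_three _ _ _).trans ?_
        rw [abs_mul, abs_mul, abs_mul]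
        gcongr <;> first | exact hd2 _ _ _ | exact hd1 _ _
      calc _ ≤ ν⁻¹ * (K * |w z| + K * |pd i w z| + K * |pd j w z|) :=
            mul_le_mul (H.Mhi i j z) h1 (abs_nonneg _) (by positivity)
        _ = _ := by ring
    have hsum : ∀ g : ι → ℝ, ∑ i, (if i = t then 0 else g i) = ∑ i ∈ Sx t, g i := by
      intro g
      rw [← Finset.add_sum_erase _ _ (Finset.mem_univ t), if_pos rfl, zero_add]
      exact Finset.sum_congr rfl fun i hi => if_neg (Finset.ne_of_mem_erase hi)
    have hS : |∑ i, ∑ j, M i j z * (pd i (pd j ζ) z * w z + pd j ζ z * pd i w z + pd i ζ z * pd j w z)|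
        ≤ ν⁻¹ * K * n ^ 2 * |w z| + R * ∑ i ∈ Sx t, |pd i w z| := by
      refine (Finset.abs_sum_le_sum_abs _ _).trans ?_
      refine (Finset.sum_le_sum fun i _ => (Finset.abs_sum_le_sum_abs _ _).trans
        (Finset.sum_le_sum fun j _ => hT i j)).trans ?_
      simp only [Finset.sum_add_distrib, ← Finset.mul_sum, hsum, Finset.sum_const, Finset.card_univ,
        nsmul_eq_mul]
      rw [hR]; apply le_of_eq; rw [← hn]; ring
    rw [hFv]
    have h3 : |ζ z * Fo t b M w z| ≤ |Fo t b M w z| := by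
      rw [abs_mul, abs_of_nonneg (hζ0 z)]
      exact mul_le_of_le_one_left (abs_nonneg _) (hζ1 z)
    have h4 : |b z * pd t ζ z * w z| ≤ ν⁻¹ * K * |w z| := by
      rw [abs_mul, abs_mul]
      gcongr
      exact hd1 _ _
    refine (abs_add_le _ _).trans ?_
    refine (add_le_add h3 (abs_sub _ _)).trans ?_
    rw [hP]
    linarith
  have hsq : ∀ z, Fo t b M v z ^ 2 ≤ 3 * Fo t b M w z ^ 2 + 3 * P ^ 2 * w z ^ 2
      + 3 * R ^ 2 * n * ∑ i ∈ Sx t, pd i w z ^ 2 := by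
    intro z
    have h1 := hbnd z
    set S := ∑ i ∈ Sx t, |pd i w z| with hS
    have hS0 : 0 ≤ S := Finset.sum_nonneg fun i _ => abs_nonneg _
    have h2 : S ^ 2 ≤ n * ∑ i ∈ Sx t, pd i w z ^ 2 := by
      have := sq_sum_le_card_mul_sum_sq (s := Sx t) (f := fun i => |pd i w z|)
      simp only [sq_abs] at this
      refine this.trans ?_
      gcongr
      rw [hn]; exact_mod_cast Finset.card_le_univ _
    have h3 : Fo t b M v z ^ 2 ≤ (|Fo t b M w z| + (P * |w z| + R * S)) ^ 2 := by
      rw [← sq_abs]; gcongr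
    have h4 : (|Fo t b M w z| + (P * |w z| + R * S)) ^ 2 ≤ 3 * |Fo t b M w z| ^ 2 + 3 * (P * |w z|) ^ 2
        + 3 * (R * S) ^ 2 := by
      nlinarith [sq_nonneg (|Fo t b M w z| - P * |w z|), sq_nonneg (|Fo t b M w z| - R * S),
        sq_nonneg (P * |w z| - R * S)]
    have h5 : (R * S) ^ 2 ≤ R ^ 2 * (n * ∑ i ∈ Sx t, pd i w z ^ 2) := by
      rw [mul_pow]; gcongr
    rw [mul_pow, sq_abs, sq_abs] at h4
    nlinarith
  have hF : LB (Fo t b M w) := H.lbF hw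
  have hFvl : LB (Fo t b M v) := H.lbF hvs
  have lS : LB (fun z => ∑ i ∈ Sx t, pd i w z ^ 2) := LB.sum fun i _ => (LB.sm (w1 i)).sq
  have hRHS : ∫ z in Hs t, Fo t b M v z ^ 2 ≤ 3 * (1 + P ^ 2 + R ^ 2 * n * C2) *
      (N2 t r (Fo t b M w) + N2 t r w) := by
    rw [setInt_Hs_eq (r := r1) (fun z hz hz' => by
      rw [Fo_zero]; · norm_num
      intro hzz
      exact hsupp z hz hz' (tsupport_mul_subset_left hzz))]
    have e1 : ∫ z in Cb t r1, Fo t b M v z ^ 2 ≤ ∫ z in Cb t r1, (3 * Fo t b M w z ^ 2 + 3 * P ^ 2 * w z ^ 2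
      + 3 * R ^ 2 * n * ∑ i ∈ Sx t, pd i w z ^ 2) := by
      refine integral_mono (hFvl.sq.onCb t r1) ?_ hsq
      exact (((hF.sq.cmul 3).add ((LB.sm hw).sq.cmul (3 * P^2))).add (lS.cmul (3 * R^2 * n))).onCb t r1
    rw [integral_add (iadd (icm (hF.sq.onCb t r1) _) (icm ((LB.sm hw).sq.onCb t r1) _))
      (icm (lS.onCb t r1) _), integral_add (icm (hF.sq.onCb t r1) _) (icm ((LB.sm hw).sq.onCb t r1) _),
      integral_const_mul, integral_const_mul, integral_const_mul] at e1
    have e2 := hcacc b M H w hw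
    rw [integral_add (hF.sq.onCb t r) ((LB.sm hw).sq.onCb t r)] at e2
    have e3 := N2_mono hF t hr10.le hr1''.le
    have e4 := N2_mono (LB.sm hw) t hr10.le hr1''.le
    unfold N2 at *
    have e5 : 3 * R ^ 2 * n * (∫ z in Cb t r1, ∑ i ∈ Sx t, pd i w z ^ 2) ≤
      3 * R ^ 2 * n * (C2 * ((∫ z in Cb t r, Fo t b M w z ^ 2) + ∫ z in Cb t r, w z ^ 2)) := by gcongr
    have p1 : 0 ≤ ∫ z in Cb t r, Fo t b M w z ^ 2 := N2_nonneg t r _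
    have p2 : 0 ≤ ∫ z in Cb t r, w z ^ 2 := N2_nonneg t r _
    have e6 : 3 * P ^ 2 * ∫ z in Cb t r1, w z ^ 2 ≤ 3 * P ^ 2 * ∫ z in Cb t r, w z ^ 2 := by gcongr
    have e7 : 0 ≤ 3 * P ^ 2 * ∫ z in Cb t r, Fo t b M w z ^ 2 := by positivity
    have e8 : 3 * (1 + P ^ 2 + R ^ 2 * n * C2) *
      ((∫ z in Cb t r, Fo t b M w z ^ 2) + ∫ z in Cb t r, w z ^ 2) =
      3 * (∫ z in Cb t r, Fo t b M w z ^ 2) + 3 * (∫ z in Cb t r, w z ^ 2)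
      + 3 * P ^ 2 * (∫ z in Cb t r, Fo t b M w z ^ 2) + 3 * P ^ 2 * (∫ z in Cb t r, w z ^ 2)
      + 3 * R ^ 2 * n * (C2 * ((∫ z in Cb t r, Fo t b M w z ^ 2) + ∫ z in Cb t r, w z ^ 2)) := by ring
    rw [e8]
    linarith
  calc _ ≤ _ := hLHS
    _ ≤ _ := hglobv
    _ ≤ C1 * (3 * (1 + P ^ 2 + R ^ 2 * n * C2) * (N2 t r (Fo t b M w) + N2 t r w)) := by gcongr
    _ = _ := by ring

/-- Interior estimate, componentwise. -/
lemma star (t d h : ι) (ν : ℝ) {r' r : ℝ} (h0 : 0 < r') (hr : r' < r) :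
    ∃ C : ℝ, 0 < C ∧ ∀ b M, Co t d h ν b M → ∀ w : (ι → ℝ) → ℝ, ContDiff ℝ ∞ w →
    (∀ i, N2 t r' (pd i w) ≤ C * (N2 t r (Fo t b M w) + N2 t r w)) ∧
    (∀ i j, i ≠ t → j ≠ t → N2 t r' (pd i (pd j w)) ≤ C * (N2 t r (Fo t b M w) + N2 t r w)) := by
  obtain ⟨C1, hC1, h1⟩ := star0 t d h ν h0 hr
  obtain ⟨C2, hC2, h2⟩ := cacc t d h ν h0 hr
  refine ⟨C1 + C2, by positivity, fun b M H w hw => ?_⟩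
  have h1 := h1 b M H w hw
  have h2 := h2 b M H w hw
  have w1 : ∀ i, ContDiff ℝ ∞ (pd i w) := fun i => pd_smooth hw i
  have w2 : ∀ i j, ContDiff ℝ ∞ (pd i (pd j w)) := fun i j => pd_smooth (w1 j) i
  rw [integral_add ((H.lbF hw).sq.onCb t r) ((LB.sm hw).sq.onCb t r)] at h2
  have h2' : ∫ z in Cb t r', ∑ i ∈ Sx t, pd i w z ^ 2 ≤ C2 * (N2 t r (Fo t b M w) + N2 t r w) := h2
  have p1 := N2_nonneg t r (Fo t b M w)
  have p2 := N2_nonneg t r w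
  have q1 : C1 * (N2 t r (Fo t b M w) + N2 t r w) ≤ (C1 + C2) * (N2 t r (Fo t b M w) + N2 t r w) := by
    nlinarith [mul_nonneg hC2.le (add_nonneg p1 p2)]
  have q2 : C2 * (N2 t r (Fo t b M w) + N2 t r w) ≤ (C1 + C2) * (N2 t r (Fo t b M w) + N2 t r w) := by
    nlinarith [mul_nonneg hC1.le (add_nonneg p1 p2)]
  have l1 : LB (fun z => pd t w z ^ 2 + ∑ i ∈ Sx t, ∑ j ∈ Sx t, pd i (pd j w) z ^ 2) :=
    (LB.sm (w1 t)).sq.add (LB.sum fun i _ => LB.sum fun j _ => (LB.sm (w2 i j)).sq)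
  have l2 : LB (fun z => ∑ i ∈ Sx t, pd i w z ^ 2) := LB.sum fun i _ => (LB.sm (w1 i)).sq
  constructor
  · intro i
    by_cases hi : i = t
    · subst hi
      refine le_trans ?_ (h1.trans q1)
      refine integral_mono ((LB.sm (w1 i)).sq.onCb i r') (l1.onCb i r') fun z => ?_
      simp only [le_add_iff_nonneg_right]; positivity
    · refine le_trans ?_ (h2'.trans q2)
      refine integral_mono ((LB.sm (w1 i)).sq.onCb t r') (l2.onCb t r') fun z => ?_
      exact Finset.single_le_sum (f := fun i => pd i w z ^ 2) (fun i _ => sq_nonneg _)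
        (Finset.mem_erase.2 ⟨hi, Finset.mem_univ i⟩)
  · intro i j hi hj
    refine le_trans ?_ (h1.trans q1)
    refine integral_mono ((LB.sm (w2 i j)).sq.onCb t r') (l1.onCb t r') fun z => ?_
    have a1 := Finset.single_le_sum (f := fun j => pd i (pd j w) z ^ 2) (fun i _ => sq_nonneg _)
        (Finset.mem_erase.2 ⟨hj, Finset.mem_univ j⟩)
    have a2 := Finset.single_le_sum (f := fun i => ∑ j ∈ Sx t, pd i (pd j w) z ^ 2)
        (fun i _ => Finset.sum_nonneg fun j _ => sq_nonneg _)
        (Finset.mem_erase.2 ⟨hi, Finset.mem_univ i⟩)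
    simp only at a1 a2 ⊢
    nlinarith [sq_nonneg (pd t w z)]

end energy
end PSP

namespace PSP
open scoped ContDiff
section moll
variable {ι : Type} [Fintype ι] [DecidableEq ι]
variable {t d h : ι} {ν : ℝ} {b : (ι → ℝ) → ℝ} {M : ι → ι → (ι → ℝ) → ℝ}

/-- kill the `d`-coordinate -/
def pj (d : ι) (y : ι → ℝ) : ι → ℝ := Function.update y d 0

lemma pj_cont (d : ι) : Continuous (pj d) := by unfold pj; fun_prop
lemma pj_d (d : ι) (y : ι → ℝ) : pj d y d = 0 := by simp [pj]
lemma pj_ne (d : ι) (y : ι → ℝ) {j : ι} (hj : j ≠ d) : pj d y j = y j := by simp [pj, hj]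
lemma pj_norm (d : ι) (y : ι → ℝ) : ‖pj d y‖ ≤ ‖y‖ := by
  rw [pi_norm_le_iff_of_nonneg (norm_nonneg y)]
  intro i
  by_cases hi : i = d
  · subst hi; rw [pj_d]; simp
  · rw [pj_ne _ _ hi]; exact norm_le_pi_norm y i

/-- tangential mollification, vector valued -/
def TmV {F : Type} [NormedAddCommGroup F] [NormedSpace ℝ F] (d : ι) (κ : (ι → ℝ) → ℝ)
    (f : (ι → ℝ) → F) (z : ι → ℝ) : F := ∫ y, κ y • f (z - pj d y)

lemma TmV_hasFDerivAt {F : Type} [NormedAddCommGroup F] [NormedSpace ℝ F] (d : ι)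
    {κ : (ι → ℝ) → ℝ} (hκ : Continuous κ) (hc : HasCompactSupport κ) {f : (ι → ℝ) → F}
    (hf : ContDiff ℝ 1 f) (z : ι → ℝ) :
    HasFDerivAt (TmV d κ f) (TmV d κ (fderiv ℝ f) z) z := by
  have hpc := pj_cont d
  have hfd : Continuous (fderiv ℝ f) := hf.continuous_fderiv (by norm_num)
  have hfc := hf.continuous
  obtain ⟨R, hR⟩ := hc.isCompact.isBounded.subset_closedBall (0 : ι → ℝ)
  obtain ⟨C, hC⟩ := (isCompact_closedBall (0 : ι → ℝ) (‖z‖ + 1 + R)).exists_bound_of_continuousOn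
    hfd.continuousOn
  have hcs : ∀ {G : Type} [NormedAddCommGroup G] [NormedSpace ℝ G] (g : (ι → ℝ) → G), Continuous g →
      Integrable (fun y => κ y • g y) := by
    intro G _ _ g hg
    exact (hκ.smul hg).integrable_of_hasCompactSupport (hc.smul_right)
  refine hasFDerivAt_integral_of_dominated_of_fderiv_le (𝕜 := ℝ) (s := ball z 1)
    (bound := fun y => ‖κ y‖ * C) (F := fun z y => κ y • f (z - pj d y))
    (F' := fun z y => κ y • fderiv ℝ f (z - pj d y)) (ball_mem_nhds z one_pos) ?_ ?_ ?_ ?_ ?_ ?_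
  · filter_upwards with x
    exact (hκ.smul (hfc.comp (continuous_const.sub hpc))).aestronglyMeasurable
  · exact hcs (fun y => f (z - pj d y)) (hfc.comp (continuous_const.sub hpc))
  · exact (hκ.smul (hfd.comp (continuous_const.sub hpc))).aestronglyMeasurable
  · refine ae_of_all _ fun y x hx => ?_
    rw [norm_smul]
    by_cases hy : y ∈ tsupport κ
    · refine mul_le_mul_of_nonneg_left (hC _ ?_) (norm_nonneg _)
      have h1 : ‖y‖ ≤ R := by simpa using hR hy
      have h2 : ‖x‖ ≤ ‖z‖ + 1 := by
        have := norm_sub_norm_le x z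
        have h3 : ‖x - z‖ < 1 := by simpa [dist_eq_norm] using hx
        linarith
      have := norm_sub_le x (pj d y)
      have := pj_norm d y
      simp only [mem_closedBall_zero_iff]; linarith
    · have : κ y = 0 := image_eq_zero_of_notMem_tsupport hy
      simp [this]
  · exact ((hκ.norm).integrable_of_hasCompactSupport hc.norm).mul_const C
  · refine ae_of_all _ fun y x _ => ?_
    have h1 : HasFDerivAt f (fderiv ℝ f (x - pj d y)) (x - pj d y) :=
      ((hf.differentiable (by norm_num)) _).hasFDerivAt
    have h2 : HasFDerivAt (fun x => f (x - pj d y)) (fderiv ℝ f (x - pj d y)) x := by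
      have h3 := h1.comp x ((hasFDerivAt_id x).sub_const (pj d y))
      rw [ContinuousLinearMap.comp_id] at h3
      exact h3
    exact h2.const_smul (κ y)

lemma TmV_contDiff (d : ι) {κ : (ι → ℝ) → ℝ} (hκ : Continuous κ) (hc : HasCompactSupport κ) (n : ℕ) :
    ∀ {F : Type} [NormedAddCommGroup F] [NormedSpace ℝ F] {f : (ι → ℝ) → F},
    ContDiff ℝ ∞ f → ContDiff ℝ n (TmV d κ f) := by
  induction n with
  | zero =>
    intro F _ _ f hf
    refine contDiff_zero.2 ?_
    have : Differentiable ℝ (TmV d κ f) := fun z =>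
      (TmV_hasFDerivAt d hκ hc (hf.of_le (by exact_mod_cast le_top)) z).differentiableAt
    exact this.continuous
  | succ n ih =>
    intro F _ _ f hf
    have h1 := fun z => TmV_hasFDerivAt d hκ hc (f := f) (hf.of_le (by exact_mod_cast le_top)) z
    have : ((n + 1 : ℕ) : WithTop ℕ∞) = (n : WithTop ℕ∞) + 1 := by norm_cast
    rw [this, contDiff_succ_iff_fderiv]
    refine ⟨fun z => (h1 z).differentiableAt, by simp, ?_⟩
    have e : fderiv ℝ (TmV d κ f) = TmV d κ (fderiv ℝ f) := by
      funext z; exact (h1 z).fderiv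
    rw [e]
    exact ih (hf.fderiv_right (m := ∞) (by simp))

/-- tangential mollification -/
def Tm (d : ι) (κ : (ι → ℝ) → ℝ) (f : (ι → ℝ) → ℝ) (z : ι → ℝ) : ℝ := ∫ y, κ y * f (z - pj d y)

lemma Tm_smooth (d : ι) {κ : (ι → ℝ) → ℝ} (hκ : Continuous κ) (hc : HasCompactSupport κ)
    {f : (ι → ℝ) → ℝ} (hf : ContDiff ℝ ∞ f) : ContDiff ℝ ∞ (Tm d κ f) :=
  contDiff_infty.2 fun n => TmV_contDiff d hκ hc n hf

lemma LB.shift {f : (ι → ℝ) → ℝ} (hf : LB f) (z : ι → ℝ) (d : ι) :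
    LB (fun y => f (z - pj d y)) := by
  refine ⟨hf.meas.comp (continuous_const.sub (pj_cont d)).measurable, fun R => ?_⟩
  obtain ⟨C, hC⟩ := hf.bdd (‖z‖ + R)
  refine ⟨C, fun y hy => hC _ ?_⟩
  have := norm_sub_le z (pj d y)
  have := pj_norm d y
  linarith

lemma LB.shift' {f : (ι → ℝ) → ℝ} (hf : LB f) (y : ι → ℝ) :
    LB (fun z => f (z + y)) := by
  refine ⟨hf.meas.comp (continuous_id.add continuous_const).measurable, fun R => ?_⟩
  obtain ⟨C, hC⟩ := hf.bdd (R + ‖y‖)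
  refine ⟨C, fun z hz => hC _ ?_⟩
  have := norm_add_le z y
  linarith

lemma Tm_int (d : ι) {κ : (ι → ℝ) → ℝ} (hκ : Continuous κ) (hc : HasCompactSupport κ)
    {f : (ι → ℝ) → ℝ} (hf : LB f) (z : ι → ℝ) : Integrable (fun y => κ y * f (z - pj d y)) :=
  ((LB.cont hκ).mul (hf.shift z d)).integrable hc.mul_right

lemma pd_Tm (d : ι) {κ : (ι → ℝ) → ℝ} (hκ : Continuous κ) (hc : HasCompactSupport κ)
    {f : (ι → ℝ) → ℝ} (hf : ContDiff ℝ ∞ f) (i : ι) : pd i (Tm d κ f) = Tm d κ (pd i f) := by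
  funext z
  have h1 : HasFDerivAt (Tm d κ f) (TmV d κ (fderiv ℝ f) z) z :=
    TmV_hasFDerivAt d hκ hc (hf.of_le (by exact_mod_cast le_top)) z
  unfold pd
  rw [h1.fderiv]
  unfold TmV Tm
  rw [ContinuousLinearMap.integral_apply]
  · simp
  · have hfd : Continuous (fderiv ℝ f) := hf.continuous_fderiv (by simp)
    exact (hκ.smul (hfd.comp (continuous_const.sub (pj_cont d)))).integrable_of_hasCompactSupport
      (hc.smul_right)

/-- moving a tangential derivative to the kernel -/
lemma Tm_pd {d j : ι} (hj : j ≠ d) {κ : (ι → ℝ) → ℝ} (hκ : ContDiff ℝ ∞ κ) (hc : HasCompactSupport κ)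
    {f : (ι → ℝ) → ℝ} (hf : ContDiff ℝ ∞ f) : Tm d κ (pd j f) = Tm d (pd j κ) f := by
  funext z
  have hpl : ∀ y (s : ℝ), pj d (y + s • ev j) = pj d y + s • ev j := by
    intro y s; funext i
    by_cases hi : i = d
    · subst hi; simp [pj, ev, hj.symm]
    · simp [pj, hi]
  have hps : ContDiff ℝ ∞ (pj d) := by
    rw [contDiff_pi]
    intro i
    by_cases hi : i = d
    · subst hi; simp only [pj_d]; exact contDiff_const
    · simp only [pj_ne _ _ hi]; fun_prop
  have hφ : ContDiff ℝ ∞ (fun y => f (z - pj d y)) := hf.comp (contDiff_const.sub hps)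
  have hpd : ∀ y, pd j (fun y => f (z - pj d y)) y = - pd j f (z - pj d y) := by
    intro y
    have h1 : HasDerivAt (fun s : ℝ => f (z - pj d (y + s • ev j)))
        (pd j (fun y => f (z - pj d y)) y) 0 := sm_line hφ j y
    have h2 : HasDerivAt (fun s : ℝ => f ((z - pj d y) + s • ev j)) (pd j f (z - pj d y)) 0 :=
      sm_line hf j _
    have h3 : HasDerivAt (fun s : ℝ => f ((z - pj d y) + (-s) • ev j)) (- pd j f (z - pj d y)) 0 := by
      have h2' : HasDerivAt (fun s : ℝ => f ((z - pj d y) + s • ev j)) (pd j f (z - pj d y)) (-(0:ℝ)) := by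
        simpa using h2
      have := h2'.comp (0:ℝ) (hasDerivAt_neg (0:ℝ))
      simpa [Function.comp_def] using this
    have e : (fun s : ℝ => f (z - pj d (y + s • ev j))) = fun s : ℝ => f ((z - pj d y) + (-s) • ev j) := by
      funext s; rw [hpl, neg_smul]; congr 1; abel
    rw [e] at h1
    exact h1.unique h3
  have := ibp0 (j := j) (LB.const 1) (fun _ _ => rfl) hκ hφ hc
  simp only [one_mul, hpd, mul_neg, integral_neg] at this
  unfold Tm
  linarith

lemma Fo_Tm {d : ι} (H : Co t d h ν b M) {κ : (ι → ℝ) → ℝ} (hκ : Continuous κ) (hc : HasCompactSupport κ)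
    {f : (ι → ℝ) → ℝ} (hf : ContDiff ℝ ∞ f) : Fo t b M (Tm d κ f) = Tm d κ (Fo t b M f) := by
  funext z
  have f1 : ∀ i, ContDiff ℝ ∞ (pd i f) := fun i => pd_smooth hf i
  have f2 : ∀ i j, ContDiff ℝ ∞ (pd i (pd j f)) := fun i j => pd_smooth (f1 j) i
  unfold Fo
  have e2 : ∀ i j, pd i (pd j (Tm d κ f)) = Tm d κ (pd i (pd j f)) := by
    intro i j; rw [pd_Tm d hκ hc hf, pd_Tm d hκ hc (f1 j)]
  simp only [e2]
  rw [pd_Tm d hκ hc hf]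
  unfold Tm
  simp only [← integral_const_mul]
  have i1 := fun i j => icm (Tm_int d hκ hc (LB.sm (f2 i j)) z) (M i j z)
  have e3 : ∀ i, ∑ j, ∫ y, M i j z * (κ y * pd i (pd j f) (z - pj d y)) =
      ∫ y, ∑ j, M i j z * (κ y * pd i (pd j f) (z - pj d y)) := by
    intro i; rw [integral_finsetSum _ (fun j _ => i1 i j)]
  simp only [e3]
  rw [← integral_finsetSum _ (fun i _ => integrable_finset_sum _ (fun j _ => i1 i j)),
    ← integral_sub (icm (Tm_int d hκ hc (LB.sm (f1 t)) z) (b z))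
      (integrable_finset_sum _ (fun i _ => integrable_finset_sum _ (fun j _ => i1 i j)))]
  congr 1; funext y
  have hb : b (z - pj d y) = b z := H.bi _ _ (by simp [pj_d])
  have hM : ∀ i j, M i j (z - pj d y) = M i j z := fun i j => H.Mi i j _ _ (by simp [pj_d])
  simp only [hb, hM]
  rw [mul_sub, Finset.mul_sum]
  congr 1
  · ring
  · refine Finset.sum_congr rfl fun i _ => ?_
    rw [Finset.mul_sum]
    exact Finset.sum_congr rfl fun j _ => by ring

end moll
end PSP

namespace PSP
open scoped ContDiff
section moll
variable {ι : Type} [Fintype ι] [DecidableEq ι]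
variable {t d h : ι} {ν : ℝ} {b : (ι → ℝ) → ℝ} {M : ι → ι → (ι → ℝ) → ℝ}

lemma cs_sq {α : Type*} {_ : MeasurableSpace α} {μ : Measure α} {k g : α → ℝ}
    (h0 : Integrable (fun y => |k y|) μ) (h1 : Integrable (fun y => k y * g y) μ)
    (h2 : Integrable (fun y => |k y| * g y ^ 2) μ) :
    (∫ y, k y * g y ∂μ) ^ 2 ≤ (∫ y, |k y| ∂μ) * ∫ y, |k y| * g y ^ 2 ∂μ := by
  have h3 : Integrable (fun y => |k y| * |g y|) μ := by
    have := h1.abs; simpa [abs_mul] using this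
  have hq : ∀ x : ℝ, 0 ≤ (∫ y, |k y| ∂μ) * (x * x) + (-2 * ∫ y, |k y| * |g y| ∂μ) * x
      + ∫ y, |k y| * g y ^ 2 ∂μ := by
    intro x
    have e : (∫ y, |k y| ∂μ) * (x * x) + (-2 * ∫ y, |k y| * |g y| ∂μ) * x
      + ∫ y, |k y| * g y ^ 2 ∂μ = ∫ y, (x * x * |k y| + (-2 * x) * (|k y| * |g y|) + |k y| * g y ^ 2) ∂μ := by
      rw [integral_add (iadd (icm h0 _) (icm h3 _)) h2, integral_add (icm h0 _) (icm h3 _),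
        integral_const_mul, integral_const_mul]
      ring
    rw [e]
    refine integral_nonneg fun y => ?_
    have : x * x * |k y| + (-2 * x) * (|k y| * |g y|) + |k y| * g y ^ 2 = |k y| * (|g y| - x) ^ 2 := by
      rw [← sq_abs (g y)]; ring
    simp only [Pi.zero_apply, this]
    positivity
  have hd := discrim_le_zero hq
  unfold discrim at hd
  have h4 : (∫ y, k y * g y ∂μ) ^ 2 ≤ (∫ y, |k y| * |g y| ∂μ) ^ 2 := by
    rw [← sq_abs]
    have : |∫ y, k y * g y ∂μ| ≤ ∫ y, |k y| * |g y| ∂μ := by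
      have := abs_integral_le_integral_abs (f := fun y => k y * g y) (μ := μ)
      simpa [abs_mul] using this
    gcongr
  nlinarith

lemma jensen (t : ι) (ρ : ℝ) {κ : (ι → ℝ) → ℝ} (hκ : Continuous κ) (hc : HasCompactSupport κ)
    {g : (ι → ℝ) → (ι → ℝ) → ℝ} (hg : Measurable (Function.uncurry g))
    (hgb : ∀ R : ℝ, ∃ K : ℝ, ∀ z y, ‖z‖ ≤ R → ‖y‖ ≤ R → |g z y| ≤ K)
    (hT : LB (fun z => ∫ y, κ y * g z y)) {B : ℝ}
    (hB : ∀ y, κ y ≠ 0 → N2 t ρ (fun z => g z y) ≤ B) :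
    N2 t ρ (fun z => ∫ y, κ y * g z y) ≤ (∫ y, |κ y|) ^ 2 * B := by
  have lz : ∀ y, LB (fun z => g z y) := by
    intro y
    refine ⟨hg.comp (measurable_id.prodMk measurable_const), fun R => ?_⟩
    obtain ⟨K, hK⟩ := hgb (max R ‖y‖)
    exact ⟨K, fun z hz => hK z y (hz.trans (le_max_left _ _)) (le_max_right _ _)⟩
  have ly : ∀ z, LB (fun y => g z y) := by
    intro z
    refine ⟨hg.comp (measurable_const.prodMk measurable_id), fun R => ?_⟩
    obtain ⟨K, hK⟩ := hgb (max R ‖z‖)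
    exact ⟨K, fun y hy => hK z y (le_max_right _ _) (hy.trans (le_max_left _ _))⟩
  have ca : HasCompactSupport (fun y => |κ y|) := by simpa using hc.norm
  have i0 : Integrable (fun y => |κ y|) := (LB.cont hκ).abs.integrable ca
  have hpt : ∀ z, (∫ y, κ y * g z y) ^ 2 ≤ (∫ y, |κ y|) * ∫ y, |κ y| * g z y ^ 2 := by
    intro z
    exact cs_sq i0 (((LB.cont hκ).mul (ly z)).integrable hc.mul_right)
      (((LB.cont hκ).abs.mul (ly z).sq).integrable ca.mul_right)
  obtain ⟨R, hR⟩ := hc.isCompact.isBounded.subset_closedBall (0 : ι → ℝ)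
  obtain ⟨R', hR'⟩ := (Cb_bdd t ρ).subset_closedBall (0 : ι → ℝ)
  obtain ⟨K, hK⟩ := hgb (max R R')
  haveI : IsFiniteMeasure (volume.restrict (Cb t ρ)) :=
    ⟨by rw [Measure.restrict_apply_univ]; exact (Cb_bdd t ρ).measure_lt_top⟩
  have hm : Measurable (fun p : (ι → ℝ) × (ι → ℝ) => |κ p.2| * g p.1 p.2 ^ 2) :=
    (hκ.measurable.comp measurable_snd).abs.mul (hg.pow_const 2)
  have iP : Integrable (fun p : (ι → ℝ) × (ι → ℝ) => |κ p.2| * g p.1 p.2 ^ 2)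
      ((volume.restrict (Cb t ρ)).prod volume) := by
    have ib : Integrable (fun p : (ι → ℝ) × (ι → ℝ) => (1:ℝ) * (|κ p.2| * K ^ 2))
      ((volume.restrict (Cb t ρ)).prod volume) :=
      (integrable_const (1:ℝ)).mul_prod (i0.mul_const (K ^ 2))
    refine ib.mono' hm.aestronglyMeasurable ?_
    have hz : ∀ᵐ p ∂((volume.restrict (Cb t ρ)).prod (volume : Measure (ι → ℝ))), p.1 ∈ Cb t ρ :=
      Measure.quasiMeasurePreserving_fst.ae (ae_restrict_mem (Cb_meas t ρ))
    filter_upwards [hz] with p hp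
    rw [Real.norm_eq_abs, abs_of_nonneg (by positivity), one_mul]
    by_cases hy : p.2 ∈ tsupport κ
    · have h1 : ‖p.2‖ ≤ R := by simpa using hR hy
      have h2 : ‖p.1‖ ≤ R' := by simpa using hR' hp
      have h3 := hK p.1 p.2 (h2.trans (le_max_right _ _)) (h1.trans (le_max_left _ _))
      have : g p.1 p.2 ^ 2 ≤ K ^ 2 := by rw [← sq_abs]; gcongr
      gcongr
    · rw [image_eq_zero_of_notMem_tsupport hy]; simp
  unfold N2
  calc ∫ z in Cb t ρ, (∫ y, κ y * g z y) ^ 2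
      ≤ ∫ z in Cb t ρ, (∫ y, |κ y|) * ∫ y, |κ y| * g z y ^ 2 :=
        integral_mono (hT.sq.onCb t ρ) (icm iP.integral_prod_left _) hpt
    _ = (∫ y, |κ y|) * ∫ y, |κ y| * ∫ z in Cb t ρ, g z y ^ 2 := by
        rw [integral_const_mul, integral_integral_swap iP]
        simp only [integral_const_mul]
    _ ≤ (∫ y, |κ y|) * ∫ y, |κ y| * B := by
        refine mul_le_mul_of_nonneg_left ?_ (integral_nonneg fun y => abs_nonneg _)
        refine integral_mono ?_ (i0.mul_const B) fun y => ?_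
        · have := iP.integral_prod_right
          simpa only [integral_const_mul] using this
        · by_cases hy : κ y = 0
          · simp [hy]
          · exact mul_le_mul_of_nonneg_left (hB y hy) (abs_nonneg _)
    _ = _ := by rw [integral_mul_const]; ring

lemma transl {f : (ι → ℝ) → ℝ} (hf : LB f) (h0 : ∀ z, 0 ≤ f z) {C C' : Set (ι → ℝ)}
    (hC : MeasurableSet C) (hC' : MeasurableSet C') (hb : Bornology.IsBounded C') (v : ι → ℝ)
    (hs : ∀ z ∈ C, z + v ∈ C') : ∫ z in C, f (z + v) ≤ ∫ z in C', f z := by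
  have e : ∫ z in C', f z = ∫ z in (fun z => z + v) ⁻¹' C', f (z + v) :=
    ((measurePreserving_add_right volume v).setIntegral_preimage_emb
      (MeasurableEquiv.addRight v).measurableEmbedding f C').symm
  rw [e]
  refine setIntegral_mono_set ?_ (ae_of_all _ fun z => h0 _) (LE.le.eventuallyLE (show C ≤ (fun z => z + v) ⁻¹' C' from hs))
  exact ((measurePreserving_add_right volume v).integrableOn_comp_preimage
      (MeasurableEquiv.addRight v).measurableEmbedding).2 (hf.integrableOn hb)

/-- directional derivative -/
def dv (v : ι → ℝ) (g : (ι → ℝ) → ℝ) (z : ι → ℝ) : ℝ := fderiv ℝ g z v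

lemma dv_smooth {g : (ι → ℝ) → ℝ} (hg : ContDiff ℝ ∞ g) (v : ι → ℝ) : ContDiff ℝ ∞ (dv v g) := by
  unfold dv
  exact (hg.fderiv_right (m := ∞) (by simp)).clm_apply contDiff_const

lemma diff1 {g : (ι → ℝ) → ℝ} (hg : ContDiff ℝ ∞ g) {C C' : Set (ι → ℝ)}
    (hC : MeasurableSet C) (hC' : MeasurableSet C') (hCb : Bornology.IsBounded C)
    (hb : Bornology.IsBounded C') (v : ι → ℝ)
    (hs : ∀ z ∈ C, ∀ τ : ℝ, 0 ≤ τ → τ ≤ 1 → z + τ • v ∈ C') :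
    ∫ z in C, (g (z + v) - g z) ^ 2 ≤ ∫ z in C', dv v g z ^ 2 := by
  have hdv := dv_smooth hg v
  haveI : IsFiniteMeasure (volume.restrict C) :=
    ⟨by rw [Measure.restrict_apply_univ]; exact hCb.measure_lt_top⟩
  haveI : IsProbabilityMeasure ((volume : Measure ℝ).restrict (Ioc 0 1)) :=
    ⟨by simp⟩
  have hcont : Continuous (fun p : (ι → ℝ) × ℝ => dv v g (p.1 + p.2 • v) ^ 2) := by
    have := hdv.continuous; fun_prop
  have iP : Integrable (fun p : (ι → ℝ) × ℝ => dv v g (p.1 + p.2 • v) ^ 2)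
      ((volume.restrict C).prod (volume.restrict (Ioc (0:ℝ) 1))) := by
    rw [Measure.prod_restrict]
    have : IntegrableOn (fun p : (ι → ℝ) × ℝ => dv v g (p.1 + p.2 • v) ^ 2)
      (closure C ×ˢ Icc (0:ℝ) 1) (volume.prod volume) :=
      hcont.continuousOn.integrableOn_compact (hCb.isCompact_closure.prod isCompact_Icc)
    exact this.mono_set (prod_mono subset_closure Ioc_subset_Icc_self)
  have hpt : ∀ z, (g (z + v) - g z) ^ 2 ≤ ∫ τ in Ioc (0:ℝ) 1, dv v g (z + τ • v) ^ 2 := by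
    intro z
    have hc1 : Continuous (fun τ : ℝ => dv v g (z + τ • v)) := by
      have := hdv.continuous; fun_prop
    have hder : ∀ τ ∈ uIcc (0:ℝ) 1, HasDerivAt (fun τ : ℝ => g (z + τ • v)) (dv v g (z + τ • v)) τ := by
      intro τ _
      have h1 := (sm_diff hg (z + τ • v)).hasFDerivAt
      have h2 : HasDerivAt (fun τ : ℝ => z + τ • v) v τ := by
        simpa using ((hasDerivAt_id τ).smul_const v).const_add z
      exact h1.comp_hasDerivAt τ h2
    have e := intervalIntegral.integral_eq_sub_of_hasDerivAt hder (hc1.intervalIntegrable 0 1)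
    simp only [one_smul, zero_smul, add_zero] at e
    rw [← e, intervalIntegral.integral_of_le zero_le_one]
    have hi : ∀ {f : ℝ → ℝ}, Continuous f → Integrable f (volume.restrict (Ioc (0:ℝ) 1)) := fun hf =>
      (hf.integrableOn_Icc).mono_set Ioc_subset_Icc_self
    have := cs_sq (k := fun _ => (1:ℝ)) (g := fun τ => dv v g (z + τ • v))
      (μ := volume.restrict (Ioc (0:ℝ) 1)) (by simpa using integrable_const (1:ℝ)) (by simpa using hi hc1)
      (by simpa using hi (f := fun τ => dv v g (z + τ • v) ^ 2) (hc1.pow 2))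
    simpa using this
  calc ∫ z in C, (g (z + v) - g z) ^ 2
      ≤ ∫ z in C, ∫ τ in Ioc (0:ℝ) 1, dv v g (z + τ • v) ^ 2 := by
        refine integral_mono ?_ iP.integral_prod_left hpt
        have : LB (fun z => (g (z + v) - g z) ^ 2) := LB.cont (by have := hg.continuous; fun_prop)
        exact this.integrableOn hCb
    _ = ∫ τ in Ioc (0:ℝ) 1, ∫ z in C, dv v g (z + τ • v) ^ 2 := integral_integral_swap iP
    _ ≤ ∫ τ in Ioc (0:ℝ) 1, ∫ z in C', dv v g z ^ 2 := by
        refine setIntegral_mono_on iP.integral_prod_right (integrable_const _) measurableSet_Ioc ?_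
        intro τ hτ
        exact transl (LB.sm hdv).sq (fun z => sq_nonneg _) hC hC' hb (τ • v)
          (fun z hz => hs z hz τ hτ.1.le hτ.2)
    _ = _ := by simp

lemma dv_eq {g : (ι → ℝ) → ℝ} (v : ι → ℝ) (z : ι → ℝ) : dv v g z = ∑ i, v i * pd i g z := by
  unfold dv pd
  conv_lhs => rw [pi_eq_sum_univ' v]
  rw [map_sum]
  refine Finset.sum_congr rfl fun i _ => ?_
  rw [map_smul, smul_eq_mul]

end moll
end PSP

namespace PSP
open scoped ContDiff
section moll
variable {ι : Type} [Fintype ι] [DecidableEq ι]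
variable {t d h : ι} {ν : ℝ} {b : (ι → ℝ) → ℝ} {M : ι → ι → (ι → ℝ) → ℝ}

/-- mollification kernels -/
structure Ker (t : ι) (s : ℝ) (η : (ι → ℝ) → ℝ) : Prop where
  sm : ContDiff ℝ ∞ η
  cs : HasCompactSupport η
  nn : ∀ y, 0 ≤ η y
  int1 : ∫ y, η y = 1
  sp : ∀ y, η y ≠ 0 → 0 ≤ y t ∧ y t ≤ s ^ 2 ∧ ∀ i, i ≠ t → |y i| ≤ s
  inv : ∀ σ : ι → ℝ, σ t = 1 → (∀ i, σ i = 1 ∨ σ i = -1) → ∀ y, η (fun i => σ i * y i) = η y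

lemma exists_ker (t : ι) {s : ℝ} (hs : 0 < s) : ∃ η, Ker t s η := by
  let φ : ContDiffBump (0:ℝ) := ⟨s / 2, s, by positivity, by linarith⟩
  let ψ : ContDiffBump (s ^ 2 / 2) := ⟨s ^ 2 / 4, s ^ 2 / 2, by positivity, by nlinarith [sq_pos_of_pos hs]⟩
  let g : ι → ℝ → ℝ := fun i => if i = t then ψ.normed volume else φ.normed volume
  have gsm : ∀ i, ContDiff ℝ ∞ (g i) := by
    intro i; by_cases hi : i = t
    · simp only [g, hi, if_true]; exact ψ.contDiff_normed
    · simp only [g, hi, if_false]; exact φ.contDiff_normed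
  have gnn : ∀ i x, 0 ≤ g i x := by
    intro i x; by_cases hi : i = t
    · simp only [g, hi, if_true]; exact ψ.nonneg_normed x
    · simp only [g, hi, if_false]; exact φ.nonneg_normed x
  have gint : ∀ i, ∫ x, g i x = 1 := by
    intro i; by_cases hi : i = t
    · simp only [g, hi, if_true]; exact ψ.integral_normed
    · simp only [g, hi, if_false]; exact φ.integral_normed
  have gt : ∀ x, g t x ≠ 0 → 0 ≤ x ∧ x ≤ s ^ 2 := by
    intro x hx
    simp only [g, if_true] at hx
    have : x ∈ Function.support (ψ.normed volume) := hx
    rw [ψ.support_normed_eq, mem_ball, Real.dist_eq, abs_lt] at this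
    have e : ψ.rOut = s ^ 2 / 2 := rfl
    rw [e] at this
    constructor <;> linarith [this.1, this.2]
  have gi : ∀ i, i ≠ t → ∀ x, g i x ≠ 0 → |x| ≤ s := by
    intro i hi x hx
    simp only [g, if_neg hi] at hx
    have : x ∈ Function.support (φ.normed volume) := hx
    rw [φ.support_normed_eq, mem_ball, Real.dist_eq, sub_zero] at this
    exact this.le
  have hsp : ∀ y : ι → ℝ, (∏ i, g i (y i)) ≠ 0 → 0 ≤ y t ∧ y t ≤ s ^ 2 ∧ ∀ i, i ≠ t → |y i| ≤ s := by
    intro y hy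
    rw [Finset.prod_ne_zero_iff] at hy
    exact ⟨(gt _ (hy t (Finset.mem_univ t))).1, (gt _ (hy t (Finset.mem_univ t))).2,
      fun i hi => gi i hi _ (hy i (Finset.mem_univ i))⟩
  refine ⟨fun y => ∏ i, g i (y i), ?_, ?_, ?_, ?_, hsp, ?_⟩
  · exact contDiff_prod fun i _ => (gsm i).comp (contDiff_apply ℝ ℝ i)
  · refine HasCompactSupport.of_support_subset_isCompact (isCompact_closedBall (0 : ι → ℝ) (s + s ^ 2)) ?_
    intro y hy
    obtain ⟨h1, h2, h3⟩ := hsp y hy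
    rw [mem_closedBall_zero_iff, pi_norm_le_iff_of_nonneg (by positivity)]
    intro i
    rw [Real.norm_eq_abs]
    by_cases hi : i = t
    · subst hi; rw [abs_of_nonneg h1]; linarith
    · have := h3 i hi; nlinarith [sq_nonneg s]
  · exact fun y => Finset.prod_nonneg fun i _ => gnn i _
  · rw [integral_fintype_prod_volume_eq_prod]
    simp [gint]
  · intro σ hσt hσ y
    refine Finset.prod_congr rfl fun i _ => ?_
    show g i (σ i * y i) = g i (y i)
    by_cases hi : i = t
    · subst hi; rw [hσt, one_mul]
    · rcases hσ i with h1 | h1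
      · rw [h1, one_mul]
      · rw [h1, neg_one_mul]
        simp only [g, if_neg hi]
        exact φ.normed_neg _

lemma flip_mp (σ : ι → ℝ) (hσ : ∀ i, σ i = 1 ∨ σ i = -1) :
    MeasurePreserving (fun (y : ι → ℝ) i => σ i * y i) := by
  refine volume_preserving_pi (f := fun i x => σ i * x) fun i => ?_
  rcases hσ i with h1 | h1
  · simp only [h1, one_mul]; exact MeasurePreserving.id _
  · simp only [h1, neg_one_mul]; exact Measure.measurePreserving_neg _

lemma flip_int (σ : ι → ℝ) (hσ : ∀ i, σ i = 1 ∨ σ i = -1) (f : (ι → ℝ) → ℝ) :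
    ∫ y : ι → ℝ, f (fun i => σ i * y i) = ∫ y, f y := by
  have hne : ∀ i, σ i ≠ 0 := fun i => by rcases hσ i with h | h <;> rw [h] <;> norm_num
  let e : (ι → ℝ) ≃ᵐ (ι → ℝ) := MeasurableEquiv.piCongrRight fun i => MeasurableEquiv.mulLeft₀ (σ i) (hne i)
  exact (flip_mp σ hσ).integral_comp e.measurableEmbedding f

lemma Ker.abs_int {s : ℝ} {η : (ι → ℝ) → ℝ} (K : Ker t s η) : ∫ y, |η y| = 1 := by
  rw [← K.int1]; congr 1; funext y; exact abs_of_nonneg (K.nn y)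

lemma Cb_shift {t : ι} {r r' : ℝ} {v z : ι → ℝ} (hz : z ∈ Cb t r) (h1 : v t ≤ 0) (h2 : r ^ 2 - v t ≤ r' ^ 2)
    (h3 : ∀ i, i ≠ t → |v i| ≤ r' - r) : z + v ∈ Cb t r' := by
  refine ⟨?_, ?_, fun i hi => ?_⟩
  · have := hz.1; simp only [Pi.add_apply]; linarith
  · have := hz.2.1; simp only [Pi.add_apply]; linarith
  · have := hz.2.2 i hi; have := h3 i hi; have := abs_add_le (z i) (v i)
    simp only [Pi.add_apply]; linarith

lemma dv_dv_eq {g : (ι → ℝ) → ℝ} (hg : ContDiff ℝ ∞ g) (v : ι → ℝ) (z : ι → ℝ) :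
    dv v (dv v g) z = ∑ i, ∑ j, v i * v j * pd i (pd j g) z := by
  rw [dv_eq]
  refine Finset.sum_congr rfl fun i _ => ?_
  have e : dv v g = fun z => ∑ j, v j * pd j g z := by funext z; exact dv_eq v z
  have h1 : pd i (dv v g) z = ∑ j, v j * pd i (pd j g) z := by
    rw [e]
    show fderiv ℝ (fun z => ∑ j, v j * pd j g z) z (ev i) = _
    rw [fderiv_fun_sum (fun j _ => ((sm_diff (pd_smooth hg j)).const_mul (v j)) z)]
    rw [ContinuousLinearMap.sum_apply]
    refine Finset.sum_congr rfl fun j _ => ?_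
    exact pd_const_mul (pd_smooth hg j) (v j) i z
  rw [h1, Finset.mul_sum]
  exact Finset.sum_congr rfl fun j _ => by ring

/-- the second order energy -/
def Ph (t : ι) (ρ : ℝ) (W : (ι → ℝ) → ℝ) : ℝ :=
  N2 t ρ (pd t W) + ∑ i ∈ Sx t, ∑ j ∈ Sx t, N2 t ρ (pd i (pd j W))

lemma Ph_nonneg (t : ι) (ρ : ℝ) (W : (ι → ℝ) → ℝ) : 0 ≤ Ph t ρ W :=
  add_nonneg (N2_nonneg _ _ _) (Finset.sum_nonneg fun i _ => Finset.sum_nonneg fun j _ => N2_nonneg _ _ _)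

lemma Ph_t (t : ι) (ρ : ℝ) (W : (ι → ℝ) → ℝ) : N2 t ρ (pd t W) ≤ Ph t ρ W :=
  le_add_of_nonneg_right (Finset.sum_nonneg fun i _ => Finset.sum_nonneg fun j _ => N2_nonneg _ _ _)

lemma Ph_x (t : ι) (ρ : ℝ) (W : (ι → ℝ) → ℝ) {i j : ι} (hi : i ≠ t) (hj : j ≠ t) :
    N2 t ρ (pd i (pd j W)) ≤ Ph t ρ W := by
  have a1 := Finset.single_le_sum (f := fun j => N2 t ρ (pd i (pd j W))) (fun i _ => N2_nonneg _ _ _)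
        (Finset.mem_erase.2 ⟨hj, Finset.mem_univ j⟩)
  have a2 := Finset.single_le_sum (f := fun i => ∑ j ∈ Sx t, N2 t ρ (pd i (pd j W)))
        (fun i _ => Finset.sum_nonneg fun j _ => N2_nonneg _ _ _)
        (Finset.mem_erase.2 ⟨hi, Finset.mem_univ i⟩)
  have := N2_nonneg t ρ (pd t W)
  unfold Ph
  linarith

lemma second_diff {W : (ι → ℝ) → ℝ} (hW : ContDiff ℝ ∞ W) (t : ι) {s : ℝ} (hs0 : 0 ≤ s) (hs : s ≤ 1/16)
    (v : ι → ℝ) (hvt : v t = 0) (hv : ∀ i, |v i| ≤ s) :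
    N2 t (13/16) (fun z => W (z + v) + W (z - v) - 2 * W z)
      ≤ s ^ 4 * (Fintype.card ι : ℝ) ^ 2 * Ph t 1 W := by
  set D : (ι → ℝ) → ℝ := fun z => W z - W (z - v) with hD
  have hDs : ContDiff ℝ ∞ D := hW.sub (hW.comp (contDiff_id.sub contDiff_const))
  set E := dv v W with hE
  have hEs : ContDiff ℝ ∞ E := dv_smooth hW v
  have e1 : N2 t (13/16) (fun z => W (z + v) + W (z - v) - 2 * W z)
      = ∫ z in Cb t (13/16), (D (z + v) - D z) ^ 2 := by
    unfold N2; congr 1; funext z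
    simp only [hD, add_sub_cancel_right]; ring
  have sub1 : ∀ z ∈ Cb t (13/16 : ℝ), ∀ τ : ℝ, 0 ≤ τ → τ ≤ 1 → z + τ • v ∈ Cb t (7/8 : ℝ) := by
    intro z hz τ h0 h1
    refine Cb_shift hz (by simp [hvt]) (by simp [hvt]; norm_num) fun i hi => ?_
    simp only [Pi.smul_apply, smul_eq_mul, abs_mul, abs_of_nonneg h0]
    have := hv i; nlinarith [abs_nonneg (v i)]
  have sub2 : ∀ z ∈ Cb t (7/8 : ℝ), ∀ τ : ℝ, 0 ≤ τ → τ ≤ 1 → z + τ • (-v) ∈ Cb t (1 : ℝ) := by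
    intro z hz τ h0 h1
    refine Cb_shift hz (by simp [hvt]) (by simp [hvt]; norm_num) fun i hi => ?_
    simp only [Pi.smul_apply, smul_eq_mul, abs_mul, abs_of_nonneg h0, Pi.neg_apply, abs_neg]
    have := hv i; nlinarith [abs_nonneg (v i)]
  have h1 := diff1 hDs (Cb_meas t _) (Cb_meas t _) (Cb_bdd t _) (Cb_bdd t _) v sub1
  have h2 := diff1 hEs (Cb_meas t _) (Cb_meas t _) (Cb_bdd t _) (Cb_bdd t _) (-v) sub2
  have e2 : ∀ z, dv v D z ^ 2 = (E (z + -v) - E z) ^ 2 := by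
    intro z
    have : dv v D z = E z - E (z - v) := by
      have hd := sm_diff hW
      have h3 : HasFDerivAt (fun z => W (z - v)) (fderiv ℝ W (z - v)) z := by
        have := (hd (z - v)).hasFDerivAt.comp z ((hasFDerivAt_id z).sub_const v)
        rw [ContinuousLinearMap.comp_id] at this; exact this
      have h4 : HasFDerivAt D (fderiv ℝ W z - fderiv ℝ W (z - v)) z := (hd z).hasFDerivAt.sub h3
      unfold dv
      rw [h4.fderiv]; rfl
    rw [this, ← sub_eq_add_neg]; ring
  simp only [e2] at h1
  have e3 : ∀ z, dv (-v) E z ^ 2 ≤ s ^ 4 * (Fintype.card ι : ℝ) ^ 2 * ∑ i ∈ Sx t, ∑ j ∈ Sx t, pd i (pd j W) z ^ 2 := by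
    intro z
    have : dv (-v) E z = - dv v (dv v W) z := by
      show fderiv ℝ E z (-v) = - fderiv ℝ E z v
      rw [map_neg]
    rw [this, neg_sq, dv_dv_eq hW]
    have e4 : ∑ i, ∑ j, v i * v j * pd i (pd j W) z = ∑ i ∈ Sx t, ∑ j ∈ Sx t, v i * v j * pd i (pd j W) z := by
      symm
      refine (Finset.sum_subset (Finset.subset_univ _) ?_).trans (Finset.sum_congr rfl fun i _ =>
        Finset.sum_subset (Finset.subset_univ _) ?_)
      · intro i _ hi
        have : i = t := by by_contra hne; exact hi (Finset.mem_erase.2 ⟨hne, Finset.mem_univ i⟩)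
        subst this; simp [hvt]
      · intro j _ hj
        have : j = t := by by_contra hne; exact hj (Finset.mem_erase.2 ⟨hne, Finset.mem_univ j⟩)
        subst this; simp [hvt]
    rw [e4, ← Finset.sum_product', ← Finset.sum_product']
    have hcs := sq_sum_le_card_mul_sum_sq (s := Sx t ×ˢ Sx t) (f := fun x => v x.1 * v x.2 * pd x.1 (pd x.2 W) z)
    have hcard : ((Sx t ×ˢ Sx t).card : ℝ) ≤ (Fintype.card ι : ℝ) ^ 2 := by
      rw [Finset.card_product, pow_two]; push_cast
      have : ((Sx t).card : ℝ) ≤ Fintype.card ι := by exact_mod_cast Finset.card_le_univ _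
      gcongr
    have hsum : ∑ x ∈ Sx t ×ˢ Sx t, (v x.1 * v x.2 * pd x.1 (pd x.2 W) z) ^ 2 ≤
        s ^ 4 * ∑ x ∈ Sx t ×ˢ Sx t, pd x.1 (pd x.2 W) z ^ 2 := by
      rw [Finset.mul_sum]
      refine Finset.sum_le_sum fun x _ => ?_
      rw [mul_pow, mul_pow]
      have a1 : v x.1 ^ 2 ≤ s ^ 2 := by rw [← sq_abs]; have := hv x.1; gcongr
      have a2 : v x.2 ^ 2 ≤ s ^ 2 := by rw [← sq_abs]; have := hv x.2; gcongr
      have a3 : v x.1 ^ 2 * v x.2 ^ 2 ≤ s ^ 2 * s ^ 2 := by gcongr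
      have : s ^ 4 = s ^ 2 * s ^ 2 := by ring
      rw [this]; gcongr
    have hS0 : 0 ≤ ∑ x ∈ Sx t ×ˢ Sx t, (v x.1 * v x.2 * pd x.1 (pd x.2 W) z) ^ 2 :=
      Finset.sum_nonneg fun x _ => sq_nonneg _
    calc _ ≤ _ := hcs
      _ ≤ (Fintype.card ι : ℝ) ^ 2 * (s ^ 4 * ∑ x ∈ Sx t ×ˢ Sx t, pd x.1 (pd x.2 W) z ^ 2) := by gcongr
      _ = _ := by ring
  have w2 : ∀ i j, ContDiff ℝ ∞ (pd i (pd j W)) := fun i j => pd_smooth (pd_smooth hW j) i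
  have ls : LB (fun z => ∑ i ∈ Sx t, ∑ j ∈ Sx t, pd i (pd j W) z ^ 2) :=
    LB.sum fun i _ => LB.sum fun j _ => (LB.sm (w2 i j)).sq
  have h3 : ∫ z in Cb t 1, dv (-v) E z ^ 2 ≤ s ^ 4 * (Fintype.card ι : ℝ) ^ 2 * Ph t 1 W := by
    refine (integral_mono ((LB.sm (dv_smooth hEs (-v))).sq.onCb t 1) (icm (ls.onCb t 1) _) e3).trans ?_
    rw [integral_const_mul]
    gcongr
    rw [integral_finsetSum _ (fun i _ => (LB.sum fun j _ => (LB.sm (w2 i j)).sq).onCb t 1)]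
    have : ∀ i, ∫ z in Cb t 1, ∑ j ∈ Sx t, pd i (pd j W) z ^ 2 = ∑ j ∈ Sx t, N2 t 1 (pd i (pd j W)) := by
      intro i; rw [integral_finsetSum _ (fun j _ => (LB.sm (w2 i j)).sq.onCb t 1)]; rfl
    simp only [this]
    unfold Ph
    linarith [N2_nonneg t 1 (pd t W)]
  rw [e1]
  exact h1.trans (h2.trans h3)

lemma moll_err (t d : ι) {s : ℝ} (hs0 : 0 < s) (hs : s ≤ 1/16) {η : (ι → ℝ) → ℝ} (K : Ker t s η)
    (htd : t ≠ d) {W : (ι → ℝ) → ℝ} (hW : ContDiff ℝ ∞ W) :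
    N2 t (3/4) (fun z => W z - Tm d η W z) ≤ ((Fintype.card ι : ℝ) ^ 2 + 2) * s ^ 4 * Ph t 1 W := by
  set σ : ι → ℝ := fun i => if i = t then 1 else -1 with hσ
  have hσ1 : ∀ i, σ i = 1 ∨ σ i = -1 := fun i => by by_cases hi : i = t <;> simp [hσ, hi]
  have hσt : σ t = 1 := by simp [hσ]
  set g : (ι → ℝ) → (ι → ℝ) → ℝ := fun z y => 1/2 * (2 * W z - W (z - pj d y) - W (z - pj d (fun i => σ i * y i)))
    with hg
  have hWc := hW.continuous
  have hpc := pj_cont d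
  have hgc : Continuous (Function.uncurry g) := by
    have : Continuous (fun p : (ι → ℝ) × (ι → ℝ) => pj d (fun i => σ i * p.2 i)) :=
      hpc.comp (by fun_prop)
    have h2 : Continuous (fun p : (ι → ℝ) × (ι → ℝ) => pj d p.2) := hpc.comp continuous_snd
    simp only [hg, Function.uncurry_def]
    fun_prop
  have hic : ∀ {f : (ι → ℝ) → ℝ}, Continuous f → Integrable (fun y => η y * f y) := fun hf =>
    ((LB.cont K.sm.continuous).mul (LB.cont hf)).integrable K.cs.mul_right
  have hσc : Continuous (fun (y : ι → ℝ) i => σ i * y i) := by fun_prop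
  have hrep : ∀ z, W z - Tm d η W z = ∫ y, η y * g z y := by
    intro z
    have c1 : Continuous fun y => W (z - pj d y) := hWc.comp (continuous_const.sub hpc)
    have c2 : Continuous fun y : ι → ℝ => W (z - pj d (fun i => σ i * y i)) :=
      hWc.comp (continuous_const.sub (hpc.comp hσc))
    have e0 : ∀ y, η y * g z y = W z * η y + (-1/2) * (η y * W (z - pj d y))
        + (-1/2) * (η y * W (z - pj d (fun i => σ i * y i))) := by intro y; simp only [hg]; ring
    simp only [e0]
    have iη : Integrable η := (LB.cont K.sm.continuous).integrable K.cs
    rw [integral_add (iadd (icm iη _) (icm (hic c1) _)) (icm (hic c2) _),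
      integral_add (icm iη _) (icm (hic c1) _), integral_const_mul, integral_const_mul, integral_const_mul,
      K.int1]
    have e1 : ∫ y, η y * W (z - pj d (fun i => σ i * y i)) = ∫ y, η y * W (z - pj d y) := by
      rw [← flip_int σ hσ1 (fun y => η y * W (z - pj d y))]
      congr 1; funext y
      rw [K.inv σ hσt hσ1]
    rw [e1]; unfold Tm; ring
  have hgb : ∀ R : ℝ, ∃ B : ℝ, ∀ z y, ‖z‖ ≤ R → ‖y‖ ≤ R → |g z y| ≤ B := by
    intro R
    obtain ⟨B, hB⟩ := ((isCompact_closedBall (0 : ι → ℝ) R).prod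
      (isCompact_closedBall (0 : ι → ℝ) R)).exists_bound_of_continuousOn hgc.continuousOn
    exact ⟨B, fun z y hz hy => hB (z, y) ⟨by simpa using hz, by simpa using hy⟩⟩
  have hTs := Tm_smooth d K.sm.continuous K.cs hW
  have hTl : LB (fun z => ∫ y, η y * g z y) := by
    simp only [← hrep]; exact LB.sm (hW.sub hTs)
  have hmain := jensen t (3/4) K.sm.continuous K.cs hgc.measurable hgb hTl
    (B := ((Fintype.card ι : ℝ) ^ 2 + 2) * s ^ 4 * Ph t 1 W) ?_
  · simp only [hrep]
    rwa [K.abs_int, one_pow, one_mul] at hmain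
  intro y hy
  obtain ⟨y0, y1, y2⟩ := K.sp y hy
  have hP := Ph_nonneg t 1 W
  set τ : ι → ℝ := (-(y t)) • ev t with hτ
  set v : ι → ℝ := fun i => if i = t then 0 else pj d y i with hv
  have hvt : v t = 0 := by simp [hv]
  have hvs : ∀ i, |v i| ≤ s := by
    intro i
    by_cases hi : i = t
    · subst hi; simp [hv]; exact hs0.le
    · simp only [hv, if_neg hi]
      by_cases hd : i = d
      · subst hd; rw [pj_d]; simp; exact hs0.le
      · rw [pj_ne _ _ hd]; exact y2 i hi
  have e1 : ∀ z : ι → ℝ, z - pj d y = (z + τ) - v := by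
    intro z; funext i
    by_cases hi : i = t
    · subst hi; simp [hτ, hv, pj_ne _ _ htd]; ring
    · simp [hτ, hv, hi]
  have e2 : ∀ z : ι → ℝ, z - pj d (fun i => σ i * y i) = (z + τ) + v := by
    intro z; funext i
    by_cases hi : i = t
    · subst hi; simp [hτ, hv, pj_ne _ _ htd, hσt]; ring
    · by_cases hd : i = d
      · subst hd; simp [hτ, hv, hi, pj_d]
      · simp [hτ, hv, hi, pj_ne _ _ hd, hσ]
  set SD : (ι → ℝ) → ℝ := fun z => W (z + v) + W (z - v) - 2 * W z with hSD
  have hSDc : LB SD := LB.cont (by fun_prop)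
  have e3 : (fun z => g z y) = fun z => (-1/2) * SD (z + τ) + (-1) * (W (z + τ) - W z) := by
    funext z; simp only [hg, e1, e2, hSD]; ring
  have lA : LB (fun z => SD (z + τ)) := hSDc.shift' τ
  have lB : LB (fun z => W (z + τ) - W z) := LB.cont (by fun_prop)
  rw [e3]
  refine (N2_add (lA.cmul _) (lB.cmul _) t (3/4)).trans ?_
  rw [N2_cmul, N2_cmul]
  have hy1 : y t ≤ 1 / 256 := by nlinarith
  have hτt : τ t = - y t := by simp [hτ, ev]
  have hτi : ∀ i, i ≠ t → τ i = 0 := fun i hi => by simp [hτ, ev, hi]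
  have hA : N2 t (3/4) (fun z => SD (z + τ)) ≤ N2 t (13/16) SD := by
    refine transl hSDc.sq (fun z => sq_nonneg _) (Cb_meas t _) (Cb_meas t _) (Cb_bdd t _) τ fun z hz => ?_
    refine Cb_shift hz (by rw [hτt]; linarith) (by rw [hτt]; norm_num; linarith) fun i hi => ?_
    rw [hτi i hi]; norm_num
  have hA2 := second_diff hW t hs0.le hs v hvt hvs
  have hB : N2 t (3/4) (fun z => W (z + τ) - W z) ≤ s ^ 4 * Ph t 1 W := by
    refine (diff1 hW (Cb_meas t _) (Cb_meas t 1) (Cb_bdd t _) (Cb_bdd t 1) τ fun z hz r h0 h1 => ?_).trans ?_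
    · refine Cb_shift hz ?_ ?_ fun i hi => ?_
      · simp [hτt]; positivity
      · simp only [Pi.smul_apply, smul_eq_mul, hτt]; nlinarith
      · simp [hτi i hi]; norm_num
    · have e4 : ∀ z, dv τ W z = (- y t) * pd t W z := by
        intro z; unfold dv pd; rw [hτ, map_smul, smul_eq_mul]
      have : ∫ z in Cb t 1, dv τ W z ^ 2 = (- y t) ^ 2 * N2 t 1 (pd t W) := by
        rw [← N2_cmul]; simp only [e4]; rfl
      rw [this]
      have h5 := Ph_t t 1 W
      have h6 : (-y t) ^ 2 ≤ s ^ 4 := by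
        rw [neg_sq]
        calc y t ^ 2 ≤ (s ^ 2) ^ 2 := by gcongr
          _ = s ^ 4 := by ring
      exact mul_le_mul h6 h5 (N2_nonneg _ _ _) (by positivity)
  have hs4 : 0 ≤ s ^ 4 * Ph t 1 W := by positivity
  have hn : 0 ≤ s ^ 4 * (Fintype.card ι : ℝ) ^ 2 * Ph t 1 W := by positivity
  nlinarith

end moll
end PSP

namespace PSP
open scoped ContDiff
section moll
variable {ι : Type} [Fintype ι] [DecidableEq ι]
variable {t d h : ι} {ν : ℝ} {b : (ι → ℝ) → ℝ} {M : ι → ι → (ι → ℝ) → ℝ}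

/-- iterated partial derivatives -/
def pds : List ι → ((ι → ℝ) → ℝ) → ((ι → ℝ) → ℝ)
  | [], f => f
  | i :: l, f => pds l (pd i f)

lemma pds_smooth (l : List ι) : ∀ {f : (ι → ℝ) → ℝ}, ContDiff ℝ ∞ f → ContDiff ℝ ∞ (pds l f) := by
  induction l with
  | nil => intro f hf; exact hf
  | cons i l ih => intro f hf; exact ih (pd_smooth hf i)

lemma pds_pd (l : List ι) : ∀ {f : (ι → ℝ) → ℝ}, ContDiff ℝ ∞ f → ∀ i, pds l (pd i f) = pd i (pds l f) := by
  induction l with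
  | nil => intro f hf i; rfl
  | cons j l ih =>
    intro f hf i
    show pds l (pd j (pd i f)) = pd i (pds l (pd j f))
    rw [pd_comm hf, ih (pd_smooth hf j)]

lemma pds_append (l l' : List ι) : ∀ f : (ι → ℝ) → ℝ, pds (l ++ l') f = pds l' (pds l f) := by
  induction l with
  | nil => intro f; rfl
  | cons i l ih => intro f; exact ih _

lemma pds_perm {l l' : List ι} (hp : l.Perm l') : ∀ {f : (ι → ℝ) → ℝ}, ContDiff ℝ ∞ f → pds l f = pds l' f := by
  induction hp with
  | nil => intro f _; rfl
  | cons i _ ih => intro f hf; exact ih (pd_smooth hf i)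
  | swap i j l => intro f hf; show pds l (pd i (pd j f)) = pds l (pd j (pd i f)); rw [pd_comm hf]
  | trans _ _ ih1 ih2 => intro f hf; rw [ih1 hf, ih2 hf]

lemma pds_cs (l : List ι) : ∀ {f : (ι → ℝ) → ℝ}, HasCompactSupport f → HasCompactSupport (pds l f) := by
  induction l with
  | nil => intro f hf; exact hf
  | cons i l ih => intro f hf; exact ih (pd_cs hf i)

lemma tsupport_pds (l : List ι) : ∀ f : (ι → ℝ) → ℝ, tsupport (pds l f) ⊆ tsupport f := by
  induction l with
  | nil => intro f; exact le_rfl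
  | cons i l ih => intro f; exact (ih _).trans (tsupport_pd f i)

lemma pds_Tm (d : ι) {κ : (ι → ℝ) → ℝ} (hκ : Continuous κ) (hc : HasCompactSupport κ) (l : List ι) :
    ∀ {f : (ι → ℝ) → ℝ}, ContDiff ℝ ∞ f → pds l (Tm d κ f) = Tm d κ (pds l f) := by
  induction l with
  | nil => intro f _; rfl
  | cons i l ih => intro f hf; show pds l (pd i _) = _; rw [pd_Tm d hκ hc hf, ih (pd_smooth hf i)]; rfl

lemma Tm_pds (d : ι) (l : List ι) (hl : ∀ i ∈ l, i ≠ d) :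
    ∀ {κ : (ι → ℝ) → ℝ} (hκ : ContDiff ℝ ∞ κ) (hc : HasCompactSupport κ) {f : (ι → ℝ) → ℝ}, ContDiff ℝ ∞ f →
    Tm d κ (pds l f) = Tm d (pds l κ) f := by
  induction l with
  | nil => intro κ _ _ f _; rfl
  | cons i l ih =>
    intro κ hκ hc f hf
    have hl' : ∀ i ∈ l, i ≠ d := fun j hj => hl j (List.mem_cons_of_mem _ hj)
    show Tm d κ (pds l (pd i f)) = Tm d (pds l (pd i κ)) f
    rw [pds_pd l hf, Tm_pd (hl i List.mem_cons_self) hκ hc (pds_smooth l hf), ih hl' (pd_smooth hκ i) (pd_cs hc i) hf]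

lemma Ker.sp' {s : ℝ} {η : (ι → ℝ) → ℝ} (K : Ker t s η) {y : ι → ℝ} (hy : y ∈ tsupport η) :
    0 ≤ y t ∧ y t ≤ s ^ 2 ∧ ∀ i, i ≠ t → |y i| ≤ s := by
  have hcl : IsClosed {y : ι → ℝ | 0 ≤ y t ∧ y t ≤ s ^ 2 ∧ ∀ i, i ≠ t → |y i| ≤ s} := by
    have e : {y : ι → ℝ | 0 ≤ y t ∧ y t ≤ s ^ 2 ∧ ∀ i, i ≠ t → |y i| ≤ s}
      = {y | 0 ≤ y t} ∩ ({y | y t ≤ s ^ 2} ∩ ⋂ i, ⋂ (_ : i ≠ t), {y : ι → ℝ | |y i| ≤ s}) := by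
      ext y; simp
    rw [e]
    refine (isClosed_le continuous_const (continuous_apply t)).inter
      ((isClosed_le (continuous_apply t) continuous_const).inter ?_)
    exact isClosed_iInter fun i => isClosed_iInter fun _ => isClosed_le (continuous_apply i).abs continuous_const
  exact closure_minimal (fun y hy => K.sp y hy) hcl hy

lemma Tm_N2 (t d : ι) (htd : t ≠ d) {s : ℝ} (hs0 : 0 < s) (hs : s ≤ 1/16) {η : (ι → ℝ) → ℝ} (K : Ker t s η)
    (l : List ι) {f : (ι → ℝ) → ℝ} (hf : LB f) (hT : LB (Tm d (pds l η) f)) :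
    N2 t (3/4) (Tm d (pds l η) f) ≤ (∫ y, |pds l η y|) ^ 2 * N2 t 1 f := by
  refine jensen t (3/4) (pds_smooth l K.sm).continuous (pds_cs l K.cs) (g := fun z y => f (z - pj d y)) ?_ ?_ hT ?_
  · exact hf.meas.comp (measurable_fst.sub ((pj_cont d).measurable.comp measurable_snd))
  · intro R
    obtain ⟨C, hC⟩ := hf.bdd (R + R)
    refine ⟨C, fun z y hz hy => hC _ ?_⟩
    have := norm_sub_le z (pj d y)
    have := pj_norm d y
    linarith
  · intro y hy
    have hy' := K.sp' (tsupport_pds l η (subset_tsupport _ hy))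
    have := transl hf.sq (fun z => sq_nonneg _) (Cb_meas t (3/4)) (Cb_meas t 1) (Cb_bdd t 1) (-(pj d y)) ?_
    · simp only [← sub_eq_add_neg] at this; exact this
    · intro z hz
      refine Cb_shift hz ?_ ?_ fun i hi => ?_
      · simp only [Pi.neg_apply, pj_ne d y htd]; linarith [hy'.1]
      · simp only [Pi.neg_apply, pj_ne d y htd]; nlinarith [hy'.2.1]
      · simp only [Pi.neg_apply, abs_neg]
        by_cases hid : i = d
        · subst hid; rw [pj_d]; norm_num
        · rw [pj_ne d y hid]; have := hy'.2.2 i hi; linarith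

/-- reflection in the `h` coordinate -/
def fl (h : ι) (z : ι → ℝ) : ι → ℝ := Function.update z h (- z h)

def OddH (h : ι) (W : (ι → ℝ) → ℝ) : Prop := ∀ z, W (fl h z) = - W z

lemma Tm_odd (htd : t ≠ h) {s : ℝ} {η : (ι → ℝ) → ℝ} (K : Ker t s η) {W : (ι → ℝ) → ℝ}
    (ho : OddH h W) : OddH h (Tm d η W) := by
  intro z
  set σ : ι → ℝ := fun i => if i = h then -1 else 1 with hσ
  have hσ1 : ∀ i, σ i = 1 ∨ σ i = -1 := by intro i; by_cases hi : i = h <;> simp [hσ, hi]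
  have hfl : ∀ y, fl h y = fun i => σ i * y i := by
    intro y; funext i; by_cases hi : i = h
    · subst hi; simp [hσ, fl]
    · simp [hσ, fl, hi]
  unfold Tm
  rw [← flip_int σ hσ1, ← integral_neg]
  congr 1; funext y
  rw [K.inv σ (by simp [hσ, htd]) hσ1]
  have : fl h z - pj d (fun i => σ i * y i) = fl h (z - pj d y) := by
    rw [hfl, hfl]; funext i
    by_cases hi : i = d
    · subst hi; simp [pj_d]
    · simp [pj_ne _ _ hi]; ring
  rw [this, ho]; ring

lemma pd_odd {W : (ι → ℝ) → ℝ} (hW : ContDiff ℝ ∞ W) (ho : OddH h W) {i : ι} (hi : i ≠ h) : OddH h (pd i W) := by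
  intro z
  have h1 : HasDerivAt (fun s : ℝ => W (fl h z + s • ev i)) (pd i W (fl h z)) 0 := sm_line hW i _
  have h2 : HasDerivAt (fun s : ℝ => W (z + s • ev i)) (pd i W z) 0 := sm_line hW i _
  have e : (fun s : ℝ => W (fl h z + s • ev i)) = fun s => - W (z + s • ev i) := by
    funext s; rw [← ho]; congr 1; funext j
    by_cases hj : j = h
    · subst hj; simp [fl, ev, hi.symm]
    · simp [fl, hj]
  rw [e] at h1
  exact h1.unique h2.neg

lemma pd_pd_odd {W : (ι → ℝ) → ℝ} (hW : ContDiff ℝ ∞ W) (ho : OddH h W) : OddH h (pd h (pd h W)) := by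
  have key : ∀ {W : (ι → ℝ) → ℝ}, ContDiff ℝ ∞ W → ∀ c : ℝ, (∀ z, W (fl h z) = c * W z) →
      ∀ z, pd h W (fl h z) = - c * pd h W z := by
    intro W hW c hc z
    have h1 : HasDerivAt (fun s : ℝ => W (fl h z + s • ev h)) (pd h W (fl h z)) 0 := sm_line hW h _
    have h2 : HasDerivAt (fun s : ℝ => W (z + s • ev h)) (pd h W z) (-0) := by
      rw [neg_zero]; exact sm_line hW h _
    have h3 : HasDerivAt (fun s : ℝ => W (z + (-s) • ev h)) (- pd h W z) 0 := by
      have := h2.comp (0:ℝ) (hasDerivAt_neg (0:ℝ))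
      simpa [Function.comp_def] using this
    have e : (fun s : ℝ => W (fl h z + s • ev h)) = fun s => c * W (z + (-s) • ev h) := by
      funext s; rw [← hc]; congr 1; funext j
      by_cases hj : j = h
      · subst hj; simp [fl, ev]; ring
      · simp [fl, hj, ev]
    rw [e] at h1
    rw [h1.unique (h3.const_mul c)]; ring
  intro z
  have h1 := key hW (-1) (fun z => by rw [ho]; ring)
  have h2 := key (pd_smooth hW h) 1 (fun z => by rw [h1]; ring) z
  rw [h2]; ring

lemma odd_zero {g : (ι → ℝ) → ℝ} (ho : OddH h g) {z : ι → ℝ} (hz : z h = 0) : g z = 0 := by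
  have := ho z
  have e : fl h z = z := by unfold fl; rw [hz, neg_zero, ← hz, Function.update_eq_self]
  rw [e] at this; linarith

end moll
end PSP

namespace PSP
open scoped ContDiff
section chain
variable {ι : Type} [Fintype ι] [DecidableEq ι]
variable {t d h : ι} {ν : ℝ} {b : (ι → ℝ) → ℝ} {M : ι → ι → (ι → ℝ) → ℝ}

lemma chain (t d h : ι) (ν : ℝ) (n : ℕ) : ∀ {r' r : ℝ} (h0 : 0 < r') (hr : r' < r),
    ∃ C : ℝ, 1 ≤ C ∧ ∀ b M, Co t d h ν b M → ∀ w : (ι → ℝ) → ℝ, ContDiff ℝ ∞ w → ∀ B : ℝ,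
    (∀ l : List ι, (∀ i ∈ l, i ≠ d) → l.length ≤ n → N2 t r (Fo t b M (pds l w)) ≤ B) →
    N2 t r w ≤ B →
    ∀ l : List ι, (∀ i ∈ l, i ≠ d) → l.length ≤ n → N2 t r' (pds l w) ≤ C * B ∧
      N2 t r' (pd d (pds l w)) ≤ C * B ∧ N2 t r' (pd d (pd d (pds l w))) ≤ C * B := by
  induction n with
  | zero =>
    intro r' r h0 hr
    obtain ⟨C, hC, hs⟩ := star t d h ν h0 hr
    refine ⟨2 * C + 1, by linarith, fun b M H w hw B hF hw0 l hl hn => ?_⟩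
    have hl0 : l = [] := List.length_eq_zero_iff.1 (Nat.le_zero.1 hn)
    subst hl0
    have hF0 := hF [] hl hn
    obtain ⟨s1, s2⟩ := hs b M H w hw
    have hd := H.td
    have hB : 0 ≤ B := (N2_nonneg _ _ _).trans hw0
    simp only [pds] at hF0 ⊢
    have m := N2_mono (LB.sm hw) t h0.le hr.le
    refine ⟨by nlinarith, (s1 d).trans ?_, (s2 d d hd.symm hd.symm).trans ?_⟩ <;> nlinarith
  | succ n ih =>
    intro r' r h0 hr
    set m1 := (r' + r) / 2 with hm1
    set m2 := (r' + m1) / 2 with hm2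
    have a1 : m1 < r := by rw [hm1]; linarith
    have a2 : m2 < m1 := by rw [hm2, hm1]; linarith
    have a3 : r' < m2 := by rw [hm2, hm1]; linarith
    obtain ⟨C0, hC0, k0⟩ := ih h0 hr
    obtain ⟨C1, hC1, k1⟩ := ih (h0.trans (a3.trans a2)) a1
    obtain ⟨C2, hC2, k2⟩ := star t d h ν (h0.trans a3) a2
    obtain ⟨C3, hC3, k3⟩ := star t d h ν h0 a3
    refine ⟨C0 + C2 * (1 + C1) + C3 * (1 + C2 * (1 + C1)), ?_, ?_⟩
    · have : 0 < C2 * (1 + C1) := by positivity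
      have : 0 < C3 * (1 + C2 * (1 + C1)) := by positivity
      linarith
    intro b M H w hw B hF hw0 l hl hn
    have hd := H.td
    have hB : 0 ≤ B := (N2_nonneg _ _ _).trans hw0
    have p1 : 0 < C2 * (1 + C1) := by positivity
    have p2 : 0 < C3 * (1 + C2 * (1 + C1)) := by positivity
    have hF' : ∀ l : List ι, (∀ i ∈ l, i ≠ d) → l.length ≤ n → N2 t r (Fo t b M (pds l w)) ≤ B :=
      fun l hl hn => hF l hl (hn.trans (Nat.le_succ n))
    rcases Nat.lt_or_ge n l.length with hlt | hge
    · match l, hl, hn, hlt with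
      | [], _, _, hlt => simp at hlt
      | i :: l', hl, hn, hlt =>
      have hl' : ∀ i ∈ l', i ≠ d := fun j hj => hl j (List.mem_cons_of_mem _ hj)
      have hn' : l'.length ≤ n := by simpa using hn
      have e : pds (i :: l') w = pd i (pds l' w) := pds_pd l' hw i
      have s0 : ContDiff ℝ ∞ (pds l' w) := pds_smooth l' hw
      have s1 : ContDiff ℝ ∞ (pds (i :: l') w) := pds_smooth _ hw
      have b1 := (k1 b M H w hw B hF' hw0 l' hl' hn').1
      have b2 := (N2_mono (H.lbF s0) t (h0.trans (a3.trans a2)).le a1.le).trans (hF' l' hl' hn')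
      have b3 := (k2 b M H _ s0).1 i
      rw [← e] at b3
      have b3' : N2 t m2 (pds (i :: l') w) ≤ C2 * (1 + C1) * B := by
        refine b3.trans ?_
        rw [mul_assoc]
        exact mul_le_mul_of_nonneg_left (by linarith) hC2.le
      have b4 := (N2_mono (H.lbF s1) t (h0.trans a3).le (a2.trans a1).le).trans (hF _ hl hn)
      obtain ⟨c1, c2⟩ := k3 b M H _ s1
      have b5 : C3 * (N2 t m2 (Fo t b M (pds (i :: l') w)) + N2 t m2 (pds (i :: l') w)) ≤
          C3 * (1 + C2 * (1 + C1)) * B := by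
        rw [mul_assoc]
        exact mul_le_mul_of_nonneg_left (by linarith) hC3.le
      have b6 := N2_mono (LB.sm s1) t h0.le a3.le
      have q1 := mul_nonneg p1.le hB
      have q2 := mul_nonneg p2.le hB
      have q3 := mul_nonneg (zero_le_one.trans hC0) hB
      refine ⟨by linarith, (c1 d).trans ?_, (c2 d d hd.symm hd.symm).trans ?_⟩ <;> linarith
    · obtain ⟨c1, c2, c3⟩ := k0 b M H w hw B hF' hw0 l hl hge
      have q1 := mul_nonneg p1.le hB
      have q2 := mul_nonneg p2.le hB
      refine ⟨by linarith, by linarith, by linarith⟩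

/-- constant bounding all kernels of order at most `n` -/
lemma ker_const (n : ℕ) (η : (ι → ℝ) → ℝ) : ∃ C : ℝ, 1 ≤ C ∧ ∀ l : List ι, l.length ≤ n →
    (∫ y, |pds l η y|) ^ 2 ≤ C := by
  have hfin : {l : List ι | l.length ≤ n}.Finite := List.finite_length_le ι n
  obtain ⟨C, hC⟩ := (hfin.image fun l => (∫ y, |pds l η y|) ^ 2).bddAbove
  exact ⟨max C 1, le_max_right _ _, fun l hl => (hC ⟨l, hl, rfl⟩).trans (le_max_left _ _)⟩

/-- tangential base lists -/
def Base (t d : ι) (l : List ι) : Prop := l = [t] ∨ ∃ i j, i ≠ t ∧ i ≠ d ∧ j ≠ t ∧ j ≠ d ∧ l = [i, j]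

lemma Base.tan {l : List ι} (hl : Base t d l) (htd : t ≠ d) : ∀ i ∈ l, i ≠ d := by
  rcases hl with rfl | ⟨i, j, h1, h2, h3, h4, rfl⟩
  · simpa using htd
  · intro k hk; simp at hk; rcases hk with rfl | rfl <;> assumption

lemma Base.N2_le {l : List ι} (hl : Base t d l) {W : (ι → ℝ) → ℝ} (hW : ContDiff ℝ ∞ W) :
    N2 t 1 (pds l W) ≤ Ph t 1 W := by
  rcases hl with rfl | ⟨i, j, h1, h2, h3, h4, rfl⟩
  · exact Ph_t t 1 W
  · exact Ph_x t 1 W h3 h1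

lemma Base.len {l : List ι} (hl : Base t d l) : l.length ≤ 2 := by
  rcases hl with rfl | ⟨i, j, h1, h2, h3, h4, rfl⟩ <;> simp

/-- `L₂` bounds for all derivatives of the mollified function. -/
lemma moll_N2 (t d h : ι) (ν : ℝ) (n : ℕ) : ∃ C : ℝ, 1 ≤ C ∧
    ∀ s : ℝ, 0 < s → s ≤ 1/16 → ∀ η, Ker t s η → ∃ Cs : ℝ, 1 ≤ Cs ∧
    ∀ b M, Co t d h ν b M → ∀ W : (ι → ℝ) → ℝ, ContDiff ℝ ∞ W →
    ∀ l0, Base t d l0 → ∀ l : List ι, (∀ i ∈ l, i ≠ d) → l.length ≤ n →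
      N2 t (1/2) (pds (l0 ++ l) (Tm d η W)) ≤ C * (Ph t 1 W + Cs * N2 t 1 (Fo t b M W)) ∧
      N2 t (1/2) (pd d (pds (l0 ++ l) (Tm d η W))) ≤ C * (Ph t 1 W + Cs * N2 t 1 (Fo t b M W)) ∧
      N2 t (1/2) (pd d (pd d (pds (l0 ++ l) (Tm d η W)))) ≤ C * (Ph t 1 W + Cs * N2 t 1 (Fo t b M W)) := by
  obtain ⟨C, hC, hc⟩ := chain t d h ν n (r' := 1/2) (r := 3/4) (by norm_num) (by norm_num)
  refine ⟨C, hC, fun s hs0 hs η K => ?_⟩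
  obtain ⟨Cs, hCs, hk⟩ := ker_const (n + 2) η
  refine ⟨Cs, hCs, fun b M H W hW l0 hl0 l hl hn => ?_⟩
  have hκ := K.sm.continuous
  have hV := Tm_smooth d hκ K.cs hW
  have htd := H.td
  rw [pds_append]
  refine hc b M H (pds l0 (Tm d η W)) (pds_smooth l0 hV) _ ?_ ?_ l hl hn
  · intro l hl hn
    have htan : ∀ i ∈ l0 ++ l, i ≠ d := by
      intro i hi; rcases List.mem_append.1 hi with hi | hi
      · exact hl0.tan htd i hi
      · exact hl i hi
    have e : Fo t b M (pds l (pds l0 (Tm d η W))) = Tm d (pds (l0 ++ l) η) (Fo t b M W) := by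
      rw [← pds_append, pds_Tm d hκ K.cs _ hW, Tm_pds d _ htan K.sm K.cs hW,
        Fo_Tm H (pds_smooth _ K.sm).continuous (pds_cs _ K.cs) hW]
    have hT : LB (Tm d (pds (l0 ++ l) η) (Fo t b M W)) := by
      rw [← e]; exact H.lbF (pds_smooth l (pds_smooth l0 hV))
    rw [e]
    refine (Tm_N2 t d htd hs0 hs K _ (H.lbF hW) hT).trans ?_
    have := hk (l0 ++ l) (by rw [List.length_append]; have := hl0.len; omega)
    have h2 := mul_le_mul_of_nonneg_right this (N2_nonneg t 1 (Fo t b M W))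
    have := Ph_nonneg t 1 W
    linarith
  · rw [pds_Tm d hκ K.cs _ hW]
    have hT : LB (Tm d (pds [] η) (pds l0 W)) := LB.sm (Tm_smooth d hκ K.cs (pds_smooth l0 hW))
    have h1 := Tm_N2 t d htd hs0 hs K [] (LB.sm (pds_smooth l0 hW)) hT
    simp only [pds, K.abs_int, one_pow, one_mul] at h1
    have h2 := hl0.N2_le hW
    have h3 := mul_nonneg (zero_le_one.trans hCs) (N2_nonneg t 1 (Fo t b M W))
    linarith

end chain
end PSP

namespace PSP
open scoped ContDiff ENNReal
section sob
variable {ι : Type} [Fintype ι] [DecidableEq ι]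
variable {t d h : ι} {ν : ℝ} {b : (ι → ℝ) → ℝ} {M : ι → ι → (ι → ℝ) → ℝ}

def lo (t : ι) (ρ : ℝ) (i : ι) : ℝ := if i = t then -ρ ^ 2 else -ρ
def hi (t : ι) (ρ : ℝ) (i : ι) : ℝ := if i = t then 0 else ρ

lemma Cb_eq (t : ι) (ρ : ℝ) : Cb t ρ = Icc (lo t ρ) (hi t ρ) := by
  ext z
  constructor
  · intro hz
    refine ⟨fun i => ?_, fun i => ?_⟩
    · by_cases hi : i = t
      · subst hi; simpa [lo] using hz.2.1
      · simpa [lo, hi] using (abs_le.1 (hz.2.2 i hi)).1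
    · by_cases hi : i = t
      · subst hi; simpa [PSP.hi] using hz.1
      · simpa [PSP.hi, hi] using (abs_le.1 (hz.2.2 i hi)).2
  · intro hz
    refine ⟨by simpa [hi] using hz.2 t, by simpa [lo] using hz.1 t, fun i hi => abs_le.2 ?_⟩
    exact ⟨by simpa [lo, hi] using hz.1 i, by simpa [PSP.hi, hi] using hz.2 i⟩

lemma mem_Cb {t : ι} {ρ : ℝ} {z : ι → ℝ} : z ∈ Cb t ρ ↔ ∀ i, z i ∈ Icc (lo t ρ i) (hi t ρ i) := by
  rw [Cb_eq]; exact ⟨fun h i => ⟨h.1 i, h.2 i⟩, fun h => ⟨fun i => (h i).1, fun i => (h i).2⟩⟩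

lemma lo_lt_hi (t : ι) {ρ : ℝ} (hρ : 0 < ρ) (i : ι) : lo t ρ i < hi t ρ i := by
  unfold lo hi; split_ifs
  · nlinarith [sq_pos_of_pos hρ]
  · linarith

lemma upd_mem_Cb {t : ι} {ρ : ℝ} {z : ι → ℝ} (hz : z ∈ Cb t ρ) (i : ι) (s : ℝ) :
    Function.update z i s ∈ Cb t ρ ↔ s ∈ Icc (lo t ρ i) (hi t ρ i) := by
  rw [mem_Cb] at *
  constructor
  · intro h; simpa using h i
  · intro h j
    by_cases hj : j = i
    · subst hj; simpa using h
    · rw [Function.update_of_ne hj]; exact hz j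

lemma vol_Cb (t : ι) {ρ : ℝ} (hρ : 0 ≤ ρ) :
    (volume (Cb t ρ)).toReal = 2 ^ (Fintype.card ι - 1) * ρ ^ (Fintype.card ι + 1) := by
  have hle : lo t ρ ≤ hi t ρ := by
    intro i; unfold lo hi; split_ifs
    · nlinarith [sq_nonneg ρ]
    · linarith
  rw [Cb_eq, Real.volume_Icc_pi_toReal hle, ← Finset.mul_prod_erase _ _ (Finset.mem_univ t)]
  have : ∀ i ∈ Finset.univ.erase t, hi t ρ i - lo t ρ i = 2 * ρ := by
    intro i hi; have := Finset.ne_of_mem_erase hi; simp [PSP.hi, lo, this]; ring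
  rw [Finset.prod_congr rfl this, Finset.prod_const, Finset.card_erase_of_mem (Finset.mem_univ t), Finset.card_univ]
  obtain ⟨n, hn⟩ : ∃ n, Fintype.card ι = n + 1 := ⟨_, (Nat.succ_pred (Fintype.card_pos_iff.2 ⟨t⟩).ne').symm⟩
  simp [hi, lo, hn]; ring

lemma one_dim {a b x : ℝ} (hab : a < b) {g g' : ℝ → ℝ} (hg : ∀ s, HasDerivAt g (g' s) s) (hc : Continuous g')
    (hx : x ∈ Icc a b) :
    ‖g x‖ₑ ≤ (ENNReal.ofReal (1 / (b - a)) + 1) * ∫⁻ s in Icc a b, (‖g s‖ₑ + ‖g' s‖ₑ) := by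
  have hgc : Continuous g := continuous_iff_continuousAt.2 fun s => (hg s).continuousAt
  set J := ∫⁻ s in Icc a b, ‖g' s‖ₑ with hJ
  have h1 : ∀ s ∈ Icc a b, ‖g x‖ₑ ≤ ‖g s‖ₑ + J := by
    intro s hs
    have e : g x - g s = ∫ τ in s..x, g' τ :=
      (intervalIntegral.integral_eq_sub_of_hasDerivAt (fun τ _ => hg τ) (hc.intervalIntegrable _ _)).symm
    have h2 : ‖g x - g s‖ₑ ≤ J := by
      rw [e]
      have : ‖∫ τ in s..x, g' τ‖ₑ = ‖∫ τ in Set.uIoc s x, g' τ‖ₑ := by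
        rw [← ofReal_norm_eq_enorm, ← ofReal_norm_eq_enorm, intervalIntegral.norm_intervalIntegral_eq]
      rw [this]
      refine (enorm_integral_le_lintegral_enorm _).trans (lintegral_mono_set ?_)
      intro τ hτ
      rw [Set.mem_uIoc] at hτ
      rcases hτ with hτ | hτ
      · exact ⟨hs.1.trans hτ.1.le, hτ.2.trans hx.2⟩
      · exact ⟨hx.1.trans hτ.1.le, hτ.2.trans hs.2⟩
    calc ‖g x‖ₑ = ‖g s + (g x - g s)‖ₑ := by ring_nf
      _ ≤ _ := (enorm_add_le _ _).trans (by gcongr)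
  have hba : 0 < b - a := by linarith
  have h2 : ENNReal.ofReal (b - a) * ‖g x‖ₑ ≤ (∫⁻ s in Icc a b, ‖g s‖ₑ) + ENNReal.ofReal (b - a) * J := by
    have := setLIntegral_mono (μ := volume) (s := Icc a b) (f := fun _ => ‖g x‖ₑ)
      (g := fun s => ‖g s‖ₑ + J) (by fun_prop) h1
    rw [lintegral_add_right _ measurable_const] at this
    simpa [mul_comm] using this
  have h3 : ‖g x‖ₑ = ENNReal.ofReal (1 / (b - a)) * (ENNReal.ofReal (b - a) * ‖g x‖ₑ) := by
    rw [← mul_assoc, ← ENNReal.ofReal_mul (by positivity), one_div_mul_cancel hba.ne']; simp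
  have h4 : ENNReal.ofReal (1 / (b - a)) * (ENNReal.ofReal (b - a) * J) = J := by
    rw [← mul_assoc, ← ENNReal.ofReal_mul (by positivity), one_div_mul_cancel hba.ne']; simp
  rw [h3]
  calc ENNReal.ofReal (1 / (b - a)) * (ENNReal.ofReal (b - a) * ‖g x‖ₑ)
      ≤ ENNReal.ofReal (1 / (b - a)) * ((∫⁻ s in Icc a b, ‖g s‖ₑ) + ENNReal.ofReal (b - a) * J) := by gcongr
    _ = ENNReal.ofReal (1 / (b - a)) * (∫⁻ s in Icc a b, ‖g s‖ₑ) + J := by rw [mul_add, h4]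
    _ ≤ _ := by
      rw [lintegral_add_left (by fun_prop), ← hJ, mul_add, add_mul, add_mul]
      calc _ ≤ ENNReal.ofReal (1 / (b - a)) * (∫⁻ s in Icc a b, ‖g s‖ₑ) + 1 * J := by rw [one_mul]
        _ ≤ _ := add_le_add le_self_add le_add_self

lemma upd_line (z : ι → ℝ) (i : ι) (s : ℝ) : Function.update z i s = z + (s - z i) • ev i := by
  funext j; by_cases hj : j = i
  · subst hj; simp
  · simp [hj, ev]

lemma upd_deriv {f : (ι → ℝ) → ℝ} (hf : ContDiff ℝ ∞ f) (z : ι → ℝ) (i : ι) (s : ℝ) :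
    HasDerivAt (fun s => f (Function.update z i s)) (pd i f (Function.update z i s)) s := by
  have h1 : HasDerivAt (fun τ : ℝ => f (Function.update z i s + τ • ev i)) (pd i f (Function.update z i s)) (s - s) := by
    rw [sub_self]; exact sm_line hf i _
  have h2 := HasDerivAt.comp (h := fun x : ℝ => x - s) s h1 ((hasDerivAt_id' s).sub_const s)
  rw [mul_one] at h2
  refine h2.congr_of_eventuallyEq (Eventually.of_forall fun τ => ?_)
  simp only [Function.comp]
  congr 1
  rw [upd_line, upd_line z i s, add_assoc, ← add_smul]; congr 2; ring

/-- sum of mixed derivatives -/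
def Asum : List ι → ((ι → ℝ) → ℝ) → (ι → ℝ) → ℝ≥0∞
  | [], f => fun z => ‖f z‖ₑ
  | i :: l, f => fun z => Asum l f z + Asum l (pd i f) z

lemma Asum_meas (l : List ι) : ∀ {f : (ι → ℝ) → ℝ}, ContDiff ℝ ∞ f → Measurable (Asum l f) := by
  induction l with
  | nil => intro f hf; have := hf.continuous.measurable; unfold Asum; fun_prop
  | cons i l ih => intro f hf; exact (ih hf).add (ih (pd_smooth hf i))

lemma Asum_int (l : List ι) {C : Set (ι → ℝ)} {X : ℝ≥0∞} : ∀ {f : (ι → ℝ) → ℝ}, ContDiff ℝ ∞ f →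
    (∀ l', List.Sublist l' l → ∫⁻ z in C, ‖pds l' f z‖ₑ ≤ X) → ∫⁻ z in C, Asum l f z ≤ 2 ^ l.length * X := by
  induction l with
  | nil => intro f hf hX; simpa [Asum, pds] using hX [] (List.Sublist.refl _)
  | cons i l ih =>
    intro f hf hX
    simp only [Asum]
    rw [lintegral_add_left (Asum_meas l hf)]
    have h1 := ih hf fun l' hl' => hX l' (hl'.cons i)
    have h2 := ih (pd_smooth hf i) fun l' hl' => hX (i :: l') (hl'.cons_cons i)
    refine (add_le_add h1 h2).trans (le_of_eq ?_)
    rw [List.length_cons, pow_succ]; ring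

lemma sob_step (t : ι) {ρ : ℝ} (hρ : 0 < ρ) : ∃ K : ℝ≥0∞, K ≠ ⊤ ∧ ∀ l : List ι, l.Nodup →
    ∀ {f : (ι → ℝ) → ℝ}, ContDiff ℝ ∞ f → ∀ z ∈ Cb t ρ,
    ‖f z‖ₑ ≤ K ^ l.length * (∫⋯∫⁻_l.toFinset, (Cb t ρ).indicator (Asum l f) ∂(fun _ => volume)) z := by
  refine ⟨∑ i, (ENNReal.ofReal (1 / (hi t ρ i - lo t ρ i)) + 1), ?_, ?_⟩
  · rw [ENNReal.sum_ne_top]; intro i _; simp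
  set K := ∑ i, (ENNReal.ofReal (1 / (hi t ρ i - lo t ρ i)) + 1) with hK
  have hKi : ∀ i, ENNReal.ofReal (1 / (hi t ρ i - lo t ρ i)) + 1 ≤ K := fun i =>
    Finset.single_le_sum (f := fun i => ENNReal.ofReal (1 / (hi t ρ i - lo t ρ i)) + 1)
      (fun _ _ => zero_le) (Finset.mem_univ i)
  intro l
  induction l with
  | nil => intro _ f hf z hz; simp [Asum, hz]
  | cons i l ih =>
    intro hnd f hf z hz
    have hnd' := List.nodup_cons.1 hnd
    have hil : i ∉ l.toFinset := by simpa using hnd'.1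
    have h1 := one_dim (lo_lt_hi t hρ i) (upd_deriv hf z i)
      ((pd_smooth hf i).continuous.comp (continuous_const.update i continuous_id)) (mem_Cb.1 hz i)
    simp only [Function.update_eq_self] at h1
    have m : ∀ {g : (ι → ℝ) → ℝ}, ContDiff ℝ ∞ g → Measurable ((Cb t ρ).indicator (Asum l g)) := fun hg =>
      (Asum_meas l hg).indicator (Cb_meas t ρ)
    have h2 : ∫⁻ s in Icc (lo t ρ i) (hi t ρ i), (‖f (Function.update z i s)‖ₑ + ‖pd i f (Function.update z i s)‖ₑ)
        ≤ K ^ l.length * ∫⁻ s, (∫⋯∫⁻_l.toFinset, (Cb t ρ).indicator (Asum (i :: l) f) ∂(fun _ => volume)) (Function.update z i s) := by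
      have hm : Measurable fun s : ℝ => (∫⋯∫⁻_l.toFinset, (Cb t ρ).indicator (Asum (i :: l) f) ∂(fun _ => volume)) (Function.update z i s) := by
        have : Measurable ((Cb t ρ).indicator (Asum (i :: l) f)) := (Asum_meas _ hf).indicator (Cb_meas t ρ)
        exact (this.lmarginal (fun _ => volume)).comp (measurable_update z)
      rw [← lintegral_const_mul _ hm]
      refine (setLIntegral_mono (hm.const_mul _) ?_).trans (setLIntegral_le_lintegral _ _)
      intro s hs
      have hz' := (upd_mem_Cb hz i s).2 hs
      refine (add_le_add (ih hnd'.2 hf _ hz') (ih hnd'.2 (pd_smooth hf i) _ hz')).trans ?_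
      rw [← mul_add]
      gcongr
      have e : (Cb t ρ).indicator (Asum (i :: l) f) =
          fun z => (Cb t ρ).indicator (Asum l f) z + (Cb t ρ).indicator (Asum l (pd i f)) z := by
        funext z; by_cases hz : z ∈ Cb t ρ <;> simp [hz, Asum]
      rw [e]
      unfold lmarginal
      rw [lintegral_add_left]
      exact (m hf).comp measurable_updateFinset
    rw [List.toFinset_cons, lmarginal_insert _ ((Asum_meas _ hf).indicator (Cb_meas t ρ)) hil, List.length_cons, pow_succ']
    calc _ ≤ _ := h1
      _ ≤ K * (K ^ l.length * _) := mul_le_mul' (hKi i) h2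
      _ = _ := by rw [mul_assoc]

/-- Sobolev embedding with mixed derivatives. -/
lemma sob (t : ι) {ρ : ℝ} (hρ : 0 < ρ) : ∃ C : ℝ, 0 < C ∧ ∀ f : (ι → ℝ) → ℝ, ContDiff ℝ ∞ f → ∀ X : ℝ,
    (∀ l : List ι, l.Nodup → N2 t ρ (pds l f) ≤ X) → ∀ z ∈ Cb t ρ, f z ^ 2 ≤ C * X := by
  obtain ⟨K, hK, h⟩ := sob_step t hρ
  set n := (Finset.univ : Finset ι).toList.length with hn
  set v := (volume (Cb t ρ)).toReal with hv
  have hv0 : 0 ≤ v := ENNReal.toReal_nonneg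
  refine ⟨(K ^ n).toReal ^ 2 * (2 ^ n) ^ 2 * v + 1, by positivity, fun f hf X hX z hz => ?_⟩
  have hX0 : 0 ≤ X := (N2_nonneg _ _ _).trans (hX [] List.nodup_nil)
  have h1 := h (Finset.univ : Finset ι).toList (Finset.nodup_toList _) hf z hz
  rw [Finset.toList_toFinset, lmarginal_univ, lintegral_indicator (Cb_meas t ρ)] at h1
  have hL1 : ∀ g : (ι → ℝ) → ℝ, ContDiff ℝ ∞ g → N2 t ρ g ≤ X → ∫⁻ z in Cb t ρ, ‖g z‖ₑ ≤ ENNReal.ofReal (Real.sqrt (v * X)) := by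
    intro g hg hgX
    have hi : IntegrableOn g (Cb t ρ) := (LB.sm hg).onCb t ρ
    have : ∫⁻ z in Cb t ρ, ‖g z‖ₑ = ENNReal.ofReal (∫ z in Cb t ρ, |g z|) := by
      rw [ofReal_integral_eq_lintegral_ofReal hi.abs (ae_of_all _ fun z => abs_nonneg _)]
      congr 1; funext z; rw [← ofReal_norm_eq_enorm]; rfl
    rw [this]
    refine ENNReal.ofReal_le_ofReal (Real.le_sqrt_of_sq_le ?_)
    haveI : IsFiniteMeasure (volume.restrict (Cb t ρ)) :=
      ⟨by rw [Measure.restrict_apply_univ]; exact (Cb_bdd t ρ).measure_lt_top⟩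
    have c := cs_sq (μ := volume.restrict (Cb t ρ)) (k := fun _ => (1:ℝ)) (g := fun z => |g z|)
      (by simp) (by simpa using hi.abs) (by simp only [abs_one, one_mul, sq_abs]; exact (LB.sm hg).sq.onCb t ρ)
    simp only [one_mul, abs_one, sq_abs, integral_const, smul_eq_mul, mul_one] at c
    have e : (volume.restrict (Cb t ρ)).real univ = v := by
      rw [measureReal_def, Measure.restrict_apply_univ]
    rw [e] at c
    exact c.trans (mul_le_mul_of_nonneg_left hgX hv0)
  have h2 := Asum_int (Finset.univ : Finset ι).toList (C := Cb t ρ) (X := ENNReal.ofReal (Real.sqrt (v * X))) hf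
    fun l' hl' => hL1 _ (pds_smooth l' hf) (hX l' (hl'.nodup (Finset.nodup_toList _)))
  have h3 : ‖f z‖ₑ ≤ K ^ n * (2 ^ n * ENNReal.ofReal (Real.sqrt (v * X))) := h1.trans (mul_le_mul' le_rfl h2)
  have h4 : |f z| ≤ (K ^ n).toReal * (2 ^ n * Real.sqrt (v * X)) := by
    have := ENNReal.toReal_mono (by finiteness) h3
    rw [toReal_enorm, ENNReal.toReal_mul, ENNReal.toReal_mul, ENNReal.toReal_ofReal (Real.sqrt_nonneg _)] at this
    simpa using this
  have h5 := pow_le_pow_left₀ (abs_nonneg _) h4 2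
  rw [sq_abs, mul_pow, mul_pow, Real.sq_sqrt (by positivity)] at h5
  nlinarith

end sob
end PSP

namespace PSP
open scoped ContDiff ENNReal
section slice
variable {ι : Type} [Fintype ι] [DecidableEq ι]
variable {t d h : ι} {ν : ℝ} {b : (ι → ℝ) → ℝ} {M : ι → ι → (ι → ℝ) → ℝ}

lemma slice (t : ι) (ρ : ℝ) (j : ι) {G : (ι → ℝ) → ℝ≥0∞} (hG : Measurable G) :
    ∫⁻ z in Cb t ρ, ∫⁻ s in Icc (lo t ρ j) (hi t ρ j), G (Function.update z j s)
      = ENNReal.ofReal (hi t ρ j - lo t ρ j) * ∫⁻ z in Cb t ρ, G z := by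
  set g := (Cb t ρ).indicator G with hg
  have gm : Measurable g := hG.indicator (Cb_meas t ρ)
  set F := (∫⋯∫⁻_{j}, g ∂(fun _ => volume)) with hF
  have Fm : Measurable F := gm.lmarginal _
  have Fe : ∀ z, F z = ∫⁻ s, g (Function.update z j s) := by intro z; rw [hF, lmarginal_singleton]
  have e1 : ∀ z ∈ Cb t ρ, ∫⁻ s in Icc (lo t ρ j) (hi t ρ j), G (Function.update z j s) = F z := by
    intro z hz
    rw [Fe, ← lintegral_indicator measurableSet_Icc]
    congr 1; funext s
    by_cases hs : s ∈ Icc (lo t ρ j) (hi t ρ j)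
    · rw [indicator_of_mem hs, hg, indicator_of_mem ((upd_mem_Cb hz j s).2 hs)]
    · rw [indicator_of_notMem hs, hg, indicator_of_notMem (fun h => hs ((upd_mem_Cb hz j s).1 h))]
  rw [setLIntegral_congr_fun (Cb_meas t ρ) e1, ← lintegral_indicator (Cb_meas t ρ),
    ← lintegral_indicator (Cb_meas t ρ), ← lintegral_const_mul _ gm]
  refine lintegral_eq_of_lmarginal_eq (μ := fun _ => volume) {j} (Fm.indicator (Cb_meas t ρ)) (gm.const_mul _) ?_
  rw [lmarginal_singleton, lmarginal_singleton]
  funext z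
  have gmu : Measurable fun s : ℝ => g (Function.update z j s) := gm.comp (measurable_update z)
  rw [lintegral_const_mul _ gmu, ← Fe]
  have Fu : ∀ s, F (Function.update z j s) = F z := fun s =>
    lmarginal_update_of_mem (μ := fun _ => volume) (Finset.mem_singleton_self j) g z s
  by_cases hz : ∃ s0, Function.update z j s0 ∈ Cb t ρ
  · obtain ⟨s0, hs0⟩ := hz
    have : ∀ s, (Cb t ρ).indicator F (Function.update z j s) = (Icc (lo t ρ j) (hi t ρ j)).indicator (fun _ => F z) s := by
      intro s
      have hm := upd_mem_Cb hs0 j s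
      rw [Function.update_idem] at hm
      by_cases hs : s ∈ Icc (lo t ρ j) (hi t ρ j)
      · rw [indicator_of_mem hs, indicator_of_mem (hm.2 hs), Fu]
      · rw [indicator_of_notMem hs, indicator_of_notMem (fun h => hs (hm.1 h))]
    simp only [this]
    rw [lintegral_indicator measurableSet_Icc]
    simp [mul_comm]
  · push Not at hz
    have : F z = 0 := by
      rw [Fe]
      have : ∀ s, g (Function.update z j s) = 0 := fun s => indicator_of_notMem (hz s) _
      simp [this]
    rw [this]
    have : ∀ s, (Cb t ρ).indicator F (Function.update z j s) = 0 := fun s => indicator_of_notMem (hz s) _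
    simp [this]

lemma sq_line {a b x y : ℝ} (hx : x ∈ Icc a b) (hy : y ∈ Icc a b) {g g' : ℝ → ℝ}
    (hg : ∀ s ∈ Icc a b, HasDerivAt g (g' s) s) (hc : ContinuousOn g' (Icc a b)) :
    (g x - g y) ^ 2 ≤ (b - a) * ∫ s in Icc a b, g' s ^ 2 := by
  have hsub : uIcc y x ⊆ Icc a b := uIcc_subset_Icc hy hx
  have e : g x - g y = ∫ τ in y..x, g' τ :=
    (intervalIntegral.integral_eq_sub_of_hasDerivAt (fun τ hτ => hg τ (hsub hτ))
      ((hc.mono hsub).intervalIntegrable)).symm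
  have hsub' : Set.uIoc y x ⊆ Icc a b := uIoc_subset_uIcc.trans hsub
  have hi1 : IntegrableOn g' (Icc a b) := hc.integrableOn_Icc
  have hi2 : IntegrableOn (fun s => g' s ^ 2) (Icc a b) := (hc.pow 2).integrableOn_Icc
  have h1 : (g x - g y) ^ 2 = (∫ τ in Set.uIoc y x, 1 * g' τ) ^ 2 := by
    rw [e, ← sq_abs, ← Real.norm_eq_abs, intervalIntegral.norm_intervalIntegral_eq, Real.norm_eq_abs, sq_abs]
    simp only [one_mul]
  haveI : IsFiniteMeasure (volume.restrict (Set.uIoc y x)) := ⟨by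
    rw [Measure.restrict_apply_univ, uIoc, Real.volume_Ioc]; exact ENNReal.ofReal_lt_top⟩
  have h2 := cs_sq (μ := volume.restrict (Set.uIoc y x)) (k := fun _ => (1:ℝ)) (g := g')
    (by simp) (by simp only [one_mul]; exact hi1.mono_set hsub') (by simp only [abs_one, one_mul]; exact hi2.mono_set hsub')
  rw [h1]
  refine h2.trans ?_
  simp only [abs_one, one_mul, integral_const, smul_eq_mul, mul_one]
  have h3 : ∫ s in Set.uIoc y x, g' s ^ 2 ≤ ∫ s in Icc a b, g' s ^ 2 :=
    setIntegral_mono_set hi2 (ae_of_all _ fun _ => sq_nonneg _) hsub'.eventuallyLE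
  have h4 : (volume.restrict (Set.uIoc y x)).real univ ≤ b - a := by
    rw [measureReal_def, Measure.restrict_apply_univ, uIoc, Real.volume_Ioc]
    rw [ENNReal.toReal_ofReal (by simp)]
    have := max_le hy.2 hx.2
    have := le_min hy.1 hx.1
    linarith
  exact mul_le_mul h4 h3 (integral_nonneg fun _ => sq_nonneg _) (by linarith [hx.1, hx.2])

lemma N2_lint (t : ι) (ρ : ℝ) {f : (ι → ℝ) → ℝ} (hf : LB f) :
    ENNReal.ofReal (N2 t ρ f) = ∫⁻ z in Cb t ρ, ENNReal.ofReal (f z ^ 2) :=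
  ofReal_integral_eq_lintegral_ofReal (hf.sq.onCb t ρ) (ae_of_all _ fun z => sq_nonneg _)

lemma poinc (t : ι) {ρ : ℝ} (hρ : 0 < ρ) {d : ι} (hd : d ≠ t) {g : (ι → ℝ) → ℝ} (hg : ContDiff ℝ ∞ g) :
    N2 t ρ (fun z => g z - g (Function.update z d 0)) ≤ 4 * ρ ^ 2 * N2 t ρ (pd d g) := by
  have hup : Continuous (fun z : ι → ℝ => Function.update z d (0:ℝ)) := continuous_id.update d continuous_const
  have hl : LB (fun z => g z - g (Function.update z d 0)) :=
    LB.cont (hg.continuous.sub (hg.continuous.comp hup))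
  have hp : LB (pd d g) := LB.sm (pd_smooth hg d)
  have hpc := (pd_smooth hg d).continuous
  rw [← ENNReal.ofReal_le_ofReal_iff (by have := N2_nonneg t ρ (pd d g); positivity), N2_lint t ρ hl]
  have elo : lo t ρ d = -ρ := by simp [lo, hd]
  have ehi : hi t ρ d = ρ := by simp [hi, hd]
  have h1 : ∀ z ∈ Cb t ρ, ENNReal.ofReal ((g z - g (Function.update z d 0)) ^ 2) ≤
      ENNReal.ofReal (2 * ρ) * ∫⁻ s in Icc (lo t ρ d) (hi t ρ d), ENNReal.ofReal (pd d g (Function.update z d s) ^ 2) := by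
    intro z hz
    have hzd := mem_Cb.1 hz d
    have hcl : Continuous fun s => pd d g (Function.update z d s) := hpc.comp (continuous_const.update d continuous_id)
    have h0 : (0:ℝ) ∈ Icc (lo t ρ d) (hi t ρ d) := by rw [elo, ehi]; constructor <;> linarith
    have := sq_line hzd h0 (fun s _ => upd_deriv hg z d s) hcl.continuousOn
    simp only [Function.update_eq_self] at this
    have hcl2 : Continuous fun s => pd d g (Function.update z d s) ^ 2 := hcl.pow 2
    rw [← ofReal_integral_eq_lintegral_ofReal (hcl2.integrableOn_Icc) (ae_of_all _ fun s => sq_nonneg _),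
      ← ENNReal.ofReal_mul (by positivity)]
    refine ENNReal.ofReal_le_ofReal (this.trans (le_of_eq ?_))
    rw [elo, ehi]; ring
  have hGm : Measurable (fun z => ENNReal.ofReal (pd d g z ^ 2)) := (hp.sq.meas).ennreal_ofReal
  refine (setLIntegral_mono' (Cb_meas t ρ) h1).trans (le_of_eq ?_)
  rw [lintegral_const_mul', slice t ρ d hGm, ← N2_lint t ρ hp, elo, ehi, ← ENNReal.ofReal_mul (by linarith),
    ← ENNReal.ofReal_mul (by positivity)]
  · congr 1; ring
  · exact ENNReal.ofReal_ne_top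

end slice
end PSP

namespace PSP
open scoped ContDiff ENNReal
section sup
variable {ι : Type} [Fintype ι] [DecidableEq ι]
variable {t d h : ι} {ν : ℝ} {b : (ι → ℝ) → ℝ} {M : ι → ι → (ι → ℝ) → ℝ}

/-- pointwise bounds for derivatives of the mollified function. -/
lemma moll_sup (t d h : ι) (ν : ℝ) : ∃ C : ℝ, 1 ≤ C ∧
    ∀ s : ℝ, 0 < s → s ≤ 1/16 → ∀ η, Ker t s η → ∃ Cs : ℝ, 1 ≤ Cs ∧
    ∀ b M, Co t d h ν b M → ∀ W : (ι → ℝ) → ℝ, ContDiff ℝ ∞ W →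
    ∀ l0, Base t d l0 → ∀ l : List ι, (∀ i ∈ l, i ≠ d) → l.length ≤ 1 → ∀ z ∈ Cb t (1/2),
      (pds (l0 ++ l) (Tm d η W) z) ^ 2 ≤ C * (Ph t 1 W + Cs * N2 t 1 (Fo t b M W)) ∧
      (pd d (pds (l0 ++ l) (Tm d η W)) z) ^ 2 ≤ C * (Ph t 1 W + Cs * N2 t 1 (Fo t b M W)) := by
  obtain ⟨C1, hC1, hc1⟩ := sob t (ρ := 1/2) (by norm_num)
  obtain ⟨C2, hC2, hc2⟩ := moll_N2 t d h ν (Fintype.card ι + 1)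
  refine ⟨max 1 (C1 * C2), le_max_left _ _, fun s hs0 hs η K => ?_⟩
  obtain ⟨Cs, hCs, hc3⟩ := hc2 s hs0 hs η K
  refine ⟨Cs, hCs, fun b M H W hW l0 hl0 l hl hln z hz => ?_⟩
  have hV := Tm_smooth d K.sm.continuous K.cs hW
  set V := Tm d η W with hVdef
  set S := Ph t 1 W + Cs * N2 t 1 (Fo t b M W) with hSdef
  have hS : 0 ≤ S := add_nonneg (Ph_nonneg _ _ _) (mul_nonneg (by linarith) (N2_nonneg _ _ _))
  have key : ∀ l' : List ι, l'.Nodup → N2 t (1/2) (pds l' (pds (l0 ++ l) V)) ≤ C2 * S ∧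
      N2 t (1/2) (pds l' (pd d (pds (l0 ++ l) V))) ≤ C2 * S := by
    intro l' hn
    have hlen : l'.length ≤ Fintype.card ι := hn.length_le_card
    have hg := pds_smooth (l0 ++ l) hV
    by_cases hd : d ∈ l'
    · have hp : l'.Perm (d :: l'.erase d) := List.perm_cons_erase hd
      have hlen' : (l'.erase d).length ≤ l'.length := List.length_erase_le
      have htan : ∀ i ∈ l ++ l'.erase d, i ≠ d := by
        intro i hi
        rcases List.mem_append.1 hi with hi | hi
        · exact hl i hi
        · rintro rfl; exact (hn.not_mem_erase) hi
      have := hc3 b M H W hW l0 hl0 (l ++ l'.erase d) htan (by rw [List.length_append]; omega)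
      rw [pds_perm hp hg, pds_perm hp (pd_smooth hg d)]
      simp only [pds]
      rw [pds_pd _ hg, pds_pd _ (pd_smooth hg d), pds_pd _ hg, ← pds_append, List.append_assoc]
      exact ⟨this.2.1, this.2.2⟩
    · have htan : ∀ i ∈ l ++ l', i ≠ d := by
        intro i hi
        rcases List.mem_append.1 hi with hi | hi
        · exact hl i hi
        · rintro rfl; exact hd hi
      have := hc3 b M H W hW l0 hl0 (l ++ l') htan (by rw [List.length_append]; omega)
      rw [pds_pd _ hg, ← pds_append, List.append_assoc]
      exact ⟨this.1, this.2.1⟩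
  have hle : C1 * (C2 * S) ≤ max 1 (C1 * C2) * S := by
    rw [← mul_assoc]; exact mul_le_mul_of_nonneg_right (le_max_right _ _) hS
  exact ⟨(hc1 _ (pds_smooth _ hV) _ (fun l' hn => (key l' hn).1) z hz).trans hle,
    (hc1 _ (pd_smooth (pds_smooth _ hV) d) _ (fun l' hn => (key l' hn).2) z hz).trans hle⟩

end sup
end PSP

namespace PSP
open scoped ContDiff ENNReal
section mv
variable {ι : Type} [Fintype ι] [DecidableEq ι]
variable {t d h : ι} {ν : ℝ} {b : (ι → ℝ) → ℝ} {M : ι → ι → (ι → ℝ) → ℝ}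

lemma zero_mem_lohi (t : ι) {ρ : ℝ} (hρ : 0 ≤ ρ) (i : ι) : (0:ℝ) ∈ Icc (lo t ρ i) (hi t ρ i) := by
  unfold lo hi; split_ifs <;> constructor <;> nlinarith

lemma upd_mem_Cb' {t : ι} {ρ : ℝ} {z : ι → ℝ} (hz : z ∈ Cb t ρ) (i : ι) {s : ℝ}
    (hs : s ∈ Icc (lo t ρ i) (hi t ρ i)) : Function.update z i s ∈ Cb t ρ := by
  rw [mem_Cb] at *
  intro j; by_cases hj : j = i
  · subst hj; simpa using hs
  · simpa [hj] using hz j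

lemma move1 {g : (ι → ℝ) → ℝ} (hg : ContDiff ℝ ∞ g) (t : ι) {ρ T : ℝ} (hρ : 0 < ρ) (hρ1 : ρ ≤ 1) (i : ι)
    (hT : ∀ z ∈ Cb t ρ, |pd i g z| ≤ T) {z : ι → ℝ} (hz : z ∈ Cb t ρ) {s : ℝ}
    (hs : s ∈ Icc (lo t ρ i) (hi t ρ i)) : |g z - g (Function.update z i s)| ≤ 2 * ρ * T := by
  have h1 := Convex.norm_image_sub_le_of_norm_hasDerivWithin_le (𝕜 := ℝ)
    (f := fun s => g (Function.update z i s)) (f' := fun s => pd i g (Function.update z i s))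
    (s := Icc (lo t ρ i) (hi t ρ i)) (C := T) (x := s) (y := z i)
    (fun x _ => (upd_deriv hg z i x).hasDerivWithinAt)
    (fun x hx => hT _ (upd_mem_Cb' hz i hx)) (convex_Icc _ _) hs (mem_Cb.1 hz i)
  simp only [Function.update_eq_self, Real.norm_eq_abs] at h1
  have hT0 : 0 ≤ T := (abs_nonneg _).trans (hT z hz)
  have h2 : |z i - s| ≤ 2 * ρ := by
    have := mem_Cb.1 hz i
    unfold lo hi at *
    rw [abs_le]
    split_ifs at * <;> simp only [mem_Icc] at * <;> constructor <;> nlinarith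
  calc _ ≤ T * |z i - s| := h1
    _ ≤ T * (2 * ρ) := mul_le_mul_of_nonneg_left h2 hT0
    _ = _ := by ring

lemma pw_mem {t : ι} {ρ : ℝ} (hρ : 0 ≤ ρ) {z : ι → ℝ} (hz : z ∈ Cb t ρ) (s : Finset ι) :
    s.piecewise 0 z ∈ Cb t ρ := by
  rw [mem_Cb] at *
  intro j; by_cases hj : j ∈ s
  · simpa [hj] using zero_mem_lohi t hρ j
  · simpa [hj] using hz j

lemma moveS {g : (ι → ℝ) → ℝ} (hg : ContDiff ℝ ∞ g) (t : ι) {ρ T : ℝ} (hρ : 0 < ρ) (hρ1 : ρ ≤ 1) (s : Finset ι)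
    (hT : ∀ i ∈ s, ∀ z ∈ Cb t ρ, |pd i g z| ≤ T) {z : ι → ℝ} (hz : z ∈ Cb t ρ) :
    |g z - g (s.piecewise 0 z)| ≤ s.card * (2 * ρ * T) := by
  induction s using Finset.induction_on with
  | empty => simp
  | insert i s hi ih =>
    have h1 := ih (fun j hj => hT j (Finset.mem_insert_of_mem hj))
    have h2 := move1 hg t hρ hρ1 i (hT i (Finset.mem_insert_self _ _)) (pw_mem hρ.le hz s)
      (zero_mem_lohi t hρ.le i)
    rw [Finset.card_insert_of_notMem hi, Finset.piecewise_insert]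
    push_cast
    have h3 := abs_sub_le (g z) (g (s.piecewise 0 z)) (g (Function.update (s.piecewise 0 z) i 0))
    simp only [Pi.zero_apply]
    linarith

lemma moveQ {g : (ι → ℝ) → ℝ} (hg : ContDiff ℝ ∞ g) (t : ι) {ρ S : ℝ} (hS0 : 0 ≤ S) (hρ : 0 < ρ) (hρ1 : ρ ≤ 1) (s : Finset ι)
    (hS : ∀ i ∈ s, ∀ z ∈ Cb t ρ, pd i g z ^ 2 ≤ S) {z : ι → ℝ} (hz : z ∈ Cb t ρ) :
    (g z - g (s.piecewise 0 z)) ^ 2 ≤ 4 * (Fintype.card ι : ℝ) ^ 2 * ρ ^ 2 * S := by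
  have h1 := moveS hg t hρ hρ1 s (T := Real.sqrt S) (fun i hi z hz => Real.abs_le_sqrt (hS i hi z hz)) hz
  have hc : (s.card : ℝ) ≤ Fintype.card ι := by exact_mod_cast Finset.card_le_univ s
  have h2 : |g z - g (s.piecewise 0 z)| ≤ Fintype.card ι * (2 * ρ * Real.sqrt S) :=
    h1.trans (mul_le_mul_of_nonneg_right hc (by positivity))
  rw [← sq_abs]
  calc _ ≤ (Fintype.card ι * (2 * ρ * Real.sqrt S)) ^ 2 := by gcongr
    _ = 4 * (Fintype.card ι : ℝ) ^ 2 * ρ ^ 2 * (Real.sqrt S) ^ 2 := by ring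
    _ = _ := by rw [Real.sq_sqrt hS0]

lemma moveOdd {g : (ι → ℝ) → ℝ} (hg : ContDiff ℝ ∞ g) (t : ι) {ρ S : ℝ} (hS0 : 0 ≤ S) (hρ : 0 < ρ) (hρ1 : ρ ≤ 1)
    (ho : OddH h g) (hS : ∀ z ∈ Cb t ρ, pd h g z ^ 2 ≤ S) {z : ι → ℝ} (hz : z ∈ Cb t ρ) :
    g z ^ 2 ≤ 4 * (Fintype.card ι : ℝ) ^ 2 * ρ ^ 2 * S := by
  have := moveQ hg t hS0 hρ hρ1 {h} (by simpa using hS) hz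
  rwa [odd_zero ho (z := Finset.piecewise {h} 0 z) (by simp), sub_zero] at this

lemma N2_bdd {f : (ι → ℝ) → ℝ} (hf : LB f) (t : ι) {ρ X : ℝ} (hρ : 0 ≤ ρ)
    (hX : ∀ z ∈ Cb t ρ, f z ^ 2 ≤ X) : N2 t ρ f ≤ X * (2 ^ (Fintype.card ι - 1) * ρ ^ (Fintype.card ι + 1)) := by
  unfold N2
  calc _ ≤ ∫ z in Cb t ρ, X := setIntegral_mono_on (hf.sq.onCb t ρ) ((LB.const X).onCb t ρ) (Cb_meas t ρ) hX
    _ = _ := by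
      rw [setIntegral_const, Measure.real, vol_Cb t hρ, smul_eq_mul, mul_comm]

lemma N2_cf {β f : (ι → ℝ) → ℝ} (hβ : LB β) (hf : LB f) (t : ι) {r c X : ℝ} (hc : ∀ z, |β z| ≤ c)
    (hX : N2 t r f ≤ X) : N2 t r (fun z => β z * f z) ≤ c ^ 2 * X := by
  refine (N2_le (hβ.mul hf) (hf.cmul c) t (r := r) ?_).trans ?_
  · intro z _
    rw [mul_pow, mul_pow]
    exact mul_le_mul_of_nonneg_right (sq_le_sq' (abs_le.1 (hc z)).1 (abs_le.1 (hc z)).2) (sq_nonneg _)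
  · rw [N2_cmul]; exact mul_le_mul_of_nonneg_left hX (sq_nonneg _)

lemma eq_dd (H : Co t d h ν b M) {w : (ι → ℝ) → ℝ} (hw : ContDiff ℝ ∞ w) {r X : ℝ}
    (h1 : N2 t r (pd t w) ≤ X) (h2 : N2 t r (Fo t b M w) ≤ X)
    (h3 : ∀ i j, i ≠ t → i ≠ d → j ≠ t → (i = h ↔ j = h) → N2 t r (pd i (pd j w)) ≤ X) :
    N2 t r (pd d (pd d w)) ≤ (4 * ν⁻¹ ^ 2 + 4 + 2 * (Fintype.card ι : ℝ) ^ 4 * ν⁻¹ ^ 2) * X := by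
  have hX : 0 ≤ X := (N2_nonneg _ _ _).trans h1
  have hb : ∀ z, |b z| ≤ ν⁻¹ := fun z => by
    rw [abs_of_nonneg (H.pos.le.trans (H.blo z))]; exact H.bhi z
  have sm2 : ∀ i j, LB (pd i (pd j w)) := fun i j => LB.sm (pd_smooth (pd_smooth hw j) i)
  have A1 := N2_cf H.lbb (LB.sm (pd_smooth hw t)) t hb h1
  have A2 : ∀ i ∈ Tx t d, ∀ j ∈ Sx t, N2 t r (fun z => M i j z * pd i (pd j w) z) ≤ ν⁻¹ ^ 2 * X := by
    intro i hi j hj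
    simp only [Tx, Sx, Finset.mem_erase, Finset.mem_univ, and_true] at hi hj
    by_cases hm : (i = h ↔ j = h)
    · exact N2_cf (H.lbM i j) (sm2 i j) t (H.Mhi i j) (h3 i j hi.2 hi.1 hj hm)
    · have e : ∀ z, M i j z = 0 := by
        intro z
        by_cases hih : i = h
        · subst hih; exact H.Mhj j z (by tauto)
        · have : j = h := by tauto
          subst this; exact H.Mjh i z hih
      simp only [e, zero_mul]
      simp only [N2, zero_pow two_ne_zero, integral_zero]; positivity
  have L2 : ∀ i j, LB (fun z => M i j z * pd i (pd j w) z) := fun i j => (H.lbM i j).mul (sm2 i j)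
  have cS : ((Sx t).card : ℝ) ≤ Fintype.card ι := by exact_mod_cast Finset.card_le_univ _
  have cT : ((Tx t d).card : ℝ) ≤ Fintype.card ι := by exact_mod_cast Finset.card_le_univ _
  set n : ℝ := (Fintype.card ι : ℝ)
  have hn0 : (0:ℝ) ≤ n := by positivity
  have hY : 0 ≤ ν⁻¹ ^ 2 * X := by positivity
  have A3 : ∀ i ∈ Tx t d, N2 t r (fun z => ∑ j ∈ Sx t, M i j z * pd i (pd j w) z) ≤ n ^ 2 * (ν⁻¹ ^ 2 * X) := by
    intro i hi
    refine (N2_sum (Sx t) (fun j _ => L2 i j) t r).trans ?_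
    have := Finset.sum_le_card_nsmul _ _ _ (A2 i hi)
    rw [nsmul_eq_mul] at this
    calc _ ≤ ((Sx t).card : ℝ) * ((Sx t).card * (ν⁻¹ ^ 2 * X)) := by gcongr
      _ ≤ n * (n * (ν⁻¹ ^ 2 * X)) := by gcongr
      _ = _ := by ring
  have L3 : ∀ i, LB (fun z => ∑ j ∈ Sx t, M i j z * pd i (pd j w) z) := fun i => LB.sum fun j _ => L2 i j
  have A4 : N2 t r (fun z => ∑ i ∈ Tx t d, ∑ j ∈ Sx t, M i j z * pd i (pd j w) z) ≤ n ^ 4 * (ν⁻¹ ^ 2 * X) := by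
    refine (N2_sum (Tx t d) (fun i _ => L3 i) t r).trans ?_
    have := Finset.sum_le_card_nsmul _ _ _ A3
    rw [nsmul_eq_mul] at this
    calc _ ≤ ((Tx t d).card : ℝ) * ((Tx t d).card * (n ^ 2 * (ν⁻¹ ^ 2 * X))) := by gcongr
      _ ≤ n * (n * (n ^ 2 * (ν⁻¹ ^ 2 * X))) := by gcongr
      _ = _ := by ring
  have L1 := H.lbb.mul (LB.sm (pd_smooth hw t))
  have A5 := N2_sub L1 (H.lbF hw) t r
  have A6 := N2_sub (L1.sub (H.lbF hw)) (LB.sum (s := Tx t d) (fun i _ => L3 i)) t r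
  have e : (fun z => b z * pd t w z - Fo t b M w z - ∑ i ∈ Tx t d, ∑ j ∈ Sx t, M i j z * pd i (pd j w) z)
      = pd d (pd d w) := by
    funext z; rw [H.Fo_eq w z]; ring
  rw [e] at A6
  nlinarith

end mv
end PSP

namespace PSP
open scoped ContDiff ENNReal
section dec
variable {ι : Type} [Fintype ι] [DecidableEq ι]
variable {t d h : ι} {ν : ℝ} {b : (ι → ℝ) → ℝ} {M : ι → ι → (ι → ℝ) → ℝ}

/-- the constants of the approximating polynomial -/
def cf (t h : ι) (V : (ι → ℝ) → ℝ) (i j : ι) : ℝ :=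
  if i = t ∨ j = t ∨ (i = h ↔ j = h) then 0 else pd i (pd j V) 0

set_option maxHeartbeats 1000000 in
lemma decayV (t d h : ι) (ν : ℝ) : ∃ K : ℝ, 1 ≤ K ∧
    ∀ s : ℝ, 0 < s → s ≤ 1/16 → ∀ η, Ker t s η → ∃ Cs : ℝ, 1 ≤ Cs ∧ ∀ θ : ℝ, 0 < θ → θ ≤ 1/8 →
    ∀ b M, Co t d h ν b M → ∀ W : (ι → ℝ) → ℝ, ContDiff ℝ ∞ W → OddH h W →
      N2 t θ (pd t (Tm d η W)) ≤ K * (θ ^ (Fintype.card ι + 3) * Ph t 1 W + Cs * N2 t 1 (Fo t b M W)) ∧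
      ∀ i j, i ≠ t → j ≠ t → N2 t θ (fun z => pd i (pd j (Tm d η W)) z - cf t h (Tm d η W) i j)
        ≤ K * (θ ^ (Fintype.card ι + 3) * Ph t 1 W + Cs * N2 t 1 (Fo t b M W)) := by
  obtain ⟨C2, hC2, hsup⟩ := moll_sup t d h ν
  set n := Fintype.card ι with hn
  set B : ℝ := max 1 (4 * (n:ℝ) ^ 2 * C2 * 2 ^ (n - 1)) with hB
  set B' : ℝ := max 1 (C2 * 2 ^ (n - 1)) with hB'
  set C3 : ℝ := 4 * ν⁻¹ ^ 2 + 4 + 2 * (n : ℝ) ^ 4 * ν⁻¹ ^ 2 with hC3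
  have hB1 : 1 ≤ B := le_max_left _ _
  have hB'1 : 1 ≤ B' := le_max_left _ _
  have hC31 : 1 ≤ C3 := by
    have : 0 ≤ 4 * ν⁻¹ ^ 2 + 2 * (n : ℝ) ^ 4 * ν⁻¹ ^ 2 := by positivity
    rw [hC3]; linarith
  refine ⟨C3 * B + 2 * B + 8 * C3 * B', by nlinarith, fun s hs0 hs η K => ?_⟩
  obtain ⟨Cs, hCs, hsup⟩ := hsup s hs0 hs η K
  obtain ⟨Ch, hCh, hker⟩ := ker_const 1 η
  refine ⟨Cs + Ch, by linarith, fun θ hθ0 hθ b M H W hW ho => ?_⟩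
  have hsup := hsup b M H W hW
  have hκ := K.sm.continuous
  have hV := Tm_smooth d hκ K.cs hW
  have hoV : OddH h (Tm d η W) := Tm_odd H.th K ho
  have hθ1 : θ ≤ 1 := by linarith
  have htd := H.td
  have hth := H.th
  have hdh := H.dh
  have hFV : N2 t θ (Fo t b M (Tm d η W)) ≤ N2 t 1 (Fo t b M W) := by
    have e := Fo_Tm H hκ K.cs hW
    have h1 := Tm_N2 t d htd hs0 hs K [] (H.lbF hW) (by
      simp only [pds]; rw [← e]; exact H.lbF hV)
    simp only [pds, K.abs_int, one_pow, one_mul, ← e] at h1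
    exact (N2_mono (H.lbF hV) t hθ0.le (by linarith)).trans h1
  have hFV' : N2 t θ (Fo t b M (pd h (Tm d η W))) ≤ Ch * N2 t 1 (Fo t b M W) := by
    have e : Fo t b M (pd h (Tm d η W)) = Tm d (pds [h] η) (Fo t b M W) := by
      have e1 : pd h (Tm d η W) = Tm d (pds [h] η) W := by
        have := Tm_pds d [h] (by simpa using hdh.symm) K.sm K.cs hW
        rw [← this, ← pds_Tm d hκ K.cs [h] hW]; rfl
      rw [e1, Fo_Tm H (pds_smooth [h] K.sm).continuous (pds_cs _ K.cs) hW]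
    have h1 := Tm_N2 t d htd hs0 hs K [h] (H.lbF hW) (by
      rw [← e]; exact H.lbF (pd_smooth hV h))
    rw [← e] at h1
    refine (N2_mono (H.lbF (pd_smooth hV h)) t hθ0.le (by linarith)).trans (h1.trans ?_)
    exact mul_le_mul_of_nonneg_right (hker [h] (by simp)) (N2_nonneg _ _ _)
  set V := Tm d η W with hVdef
  set F2 := N2 t 1 (Fo t b M W) with hF2
  set Φ := Ph t 1 W with hΦ
  have hF20 : 0 ≤ F2 := N2_nonneg _ _ _
  have hΦ0 : 0 ≤ Φ := Ph_nonneg _ _ _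
  set S := Φ + Cs * F2 with hS
  have hS0 : 0 ≤ S := by positivity
  set X := θ ^ (n + 3) * Φ + (Cs + Ch) * F2 with hX
  have hθn : θ ^ (n + 3) ≤ 1 := pow_le_one₀ hθ0.le hθ1
  have hθn1 : θ ^ (n + 1) ≤ 1 := pow_le_one₀ hθ0.le hθ1
  have hSX : θ ^ (n + 3) * S ≤ X := by
    have : θ ^ (n + 3) * (Cs * F2) ≤ 1 * (Cs * F2) := mul_le_mul_of_nonneg_right hθn (by positivity)
    have : 0 ≤ Ch * F2 := by positivity
    rw [hS, hX]; nlinarith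
  have hFX : F2 ≤ X := by
    have : 0 ≤ θ ^ (n + 3) * Φ := by positivity
    have : 0 ≤ Ch * F2 := by positivity
    have : 0 ≤ (Cs - 1) * F2 := mul_nonneg (by linarith) hF20
    rw [hX]; nlinarith
  have hX0 : 0 ≤ X := hF20.trans hFX
  have hsub : Cb t θ ⊆ Cb t (1/2) := Cb_mono t hθ0.le (by linarith)
  have hCS : 0 ≤ C2 * S := by positivity
  -- pointwise to integral
  have toN : ∀ g : (ι → ℝ) → ℝ, LB g → (∀ z ∈ Cb t θ, g z ^ 2 ≤ 4 * (n:ℝ) ^ 2 * θ ^ 2 * (C2 * S)) →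
      N2 t θ g ≤ B * X := by
    intro g hg hb
    refine (N2_bdd hg t hθ0.le hb).trans ?_
    calc _ = (4 * (n:ℝ) ^ 2 * C2 * 2 ^ (n - 1)) * (θ ^ (n + 3) * S) := by
          rw [← hn]; ring
      _ ≤ B * (θ ^ (n + 3) * S) := mul_le_mul_of_nonneg_right (le_max_right _ _) (by positivity)
      _ ≤ _ := mul_le_mul_of_nonneg_left hSX (by linarith)
  have toN' : ∀ g : (ι → ℝ) → ℝ, LB g → (∀ z ∈ Cb t θ, g z ^ 2 ≤ C2 * S) →
      N2 t θ g ≤ B' * (θ ^ (n + 1) * S) := by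
    intro g hg hb
    refine (N2_bdd hg t hθ0.le hb).trans ?_
    calc _ = (C2 * 2 ^ (n - 1)) * (θ ^ (n + 1) * S) := by
          rw [← hn]; ring
      _ ≤ B' * (θ ^ (n + 1) * S) := mul_le_mul_of_nonneg_right (le_max_right _ _) (by positivity)
  have bT : Base t d [t] := Or.inl rfl
  have bS : ∀ i j, i ≠ t → i ≠ d → j ≠ t → j ≠ d → Base t d [i, j] := fun i j h1 h2 h3 h4 =>
    Or.inr ⟨i, j, h1, h2, h3, h4, rfl⟩
  have sm1 : ∀ i, ContDiff ℝ ∞ (pd i V) := fun i => pd_smooth hV i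
  have sm2 : ∀ i j, ContDiff ℝ ∞ (pd i (pd j V)) := fun i j => pd_smooth (sm1 j) i
  -- time
  have hT : N2 t θ (pd t V) ≤ B * X := by
    refine toN _ (LB.sm (sm1 t)) fun z hz => ?_
    refine moveOdd (sm1 t) t hCS hθ0 hθ1 (pd_odd hV hoV hth) (fun z hz => ?_) hz
    exact (hsup [t] bT [h] (by simpa using hdh.symm) (by simp) z (hsub hz)).1
  -- good pairs
  have hG : ∀ i j, i ≠ t → i ≠ d → j ≠ t → (i = h ↔ j = h) → N2 t θ (pd i (pd j V)) ≤ B * X := by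
    intro i j hit hid hjt hij
    have hodd : OddH h (pd i (pd j V)) := by
      by_cases hi : i = h
      · have hj := hij.1 hi
        subst hi; subst hj; exact pd_pd_odd hV hoV
      · have hj : j ≠ h := fun hj => hi (hij.2 hj)
        exact pd_odd (sm1 j) (pd_odd hV hoV hj) hi
    refine toN _ (LB.sm (sm2 i j)) fun z hz => ?_
    refine moveOdd (sm2 i j) t hCS hθ0 hθ1 hodd (fun z hz => ?_) hz
    by_cases hj : j = d
    · subst hj
      have := (hsup [i, h] (bS i h hit hid hth.symm hdh.symm) [] (by simp) (by simp) z (hsub hz)).2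
      have e : pd h (pd i (pd j V)) = pd j (pds ([i, h] ++ []) V) := by
        simp only [pds, List.append_nil]
        rw [pd_comm hV i j, pd_comm (sm1 i) h j]
      rw [e]; exact this
    · exact (hsup [j, i] (bS j i hjt hj hit hid) [h] (by simpa using hdh.symm) (by simp) z (hsub hz)).1
  -- dd
  have hDD : N2 t θ (pd d (pd d V)) ≤ C3 * (B * X) :=
    eq_dd H hV hT (hFV.trans (by nlinarith)) hG
  have hBX : B * X ≤ (C3 * B + 2 * B + 8 * C3 * B') * X := by
    refine mul_le_mul_of_nonneg_right ?_ hX0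
    have : 0 ≤ C3 * B := by positivity
    have : 0 ≤ C3 * B' := by positivity
    linarith
  have hDDX : C3 * (B * X) ≤ (C3 * B + 2 * B + 8 * C3 * B') * X := by
    rw [← mul_assoc]
    refine mul_le_mul_of_nonneg_right ?_ hX0
    have : 0 ≤ C3 * B' := by positivity
    linarith
  -- mixed, tangential
  have hM : ∀ j, j ≠ t → j ≠ d → N2 t θ (fun z => pd h (pd j V) z - pd h (pd j V) 0) ≤ B * X := by
    intro j hjt hjd
    refine toN _ ((LB.sm (sm2 h j)).sub (LB.const _)) fun z hz => ?_
    have := moveQ (sm2 h j) t hCS hθ0 hθ1 Finset.univ (fun k _ z hz => ?_) hz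
    · rwa [Finset.piecewise_univ] at this
    · have b := bS j h hjt hjd hth.symm hdh.symm
      by_cases hk : k = d
      · subst hk
        exact (hsup [j, h] b [] (by simp) (by simp) z (hsub hz)).2
      · exact (hsup [j, h] b [k] (by simpa using hk) (by simp) z (hsub hz)).1
  -- mixed with the bad direction
  have hMd : N2 t θ (fun z => pd h (pd d V) z - pd h (pd d V) 0) ≤ (8 * C3 * B' + 2 * B) * X := by
    set g := pd h (pd d V) with hg
    have hgs : ContDiff ℝ ∞ g := sm2 h d
    set Y := B' * (θ ^ (n + 1) * S + Ch * F2) with hY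
    have hY1 : B' * (θ ^ (n + 1) * S) ≤ Y := by
      rw [hY]; refine mul_le_mul_of_nonneg_left ?_ (by linarith)
      have : 0 ≤ Ch * F2 := by positivity
      linarith
    have hgd : N2 t θ (pd d g) ≤ C3 * Y := by
      have e : pd d g = pd d (pd d (pd h V)) := by rw [hg, pd_comm hV h d]
      rw [e]
      refine eq_dd H (sm1 h) ?_ ?_ ?_
      · refine (toN' _ (LB.sm (sm2 t h)) fun z hz => ?_).trans hY1
        rw [pd_comm hV t h]
        exact (hsup [t] bT [h] (by simpa using hdh.symm) (by simp) z (hsub hz)).1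
      · refine hFV'.trans ?_
        have : 0 ≤ θ ^ (n + 1) * S := by positivity
        have h5 : 0 ≤ Ch * F2 := by positivity
        rw [hY]; nlinarith
      · intro i j hit hid hjt hij
        refine (toN' _ (LB.sm (pd_smooth (sm2 j h) i)) fun z hz => ?_).trans hY1
        by_cases hj : j = d
        · subst hj
          have := (hsup [h, i] (bS h i hth.symm hdh.symm hit hid) [] (by simp) (by simp) z (hsub hz)).2
          have e : pd i (pd j (pd h V)) = pd j (pds ([h, i] ++ []) V) := by
            simp only [pds, List.append_nil]
            rw [pd_comm (sm1 h) i j]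
          rw [e]; exact this
        · exact (hsup [h, j] (bS h j hth.symm hdh.symm hjt hj) [i] (by simpa using hid) (by simp) z (hsub hz)).1
    have hp := poinc t hθ0 htd.symm hgs
    have hL1 : LB (fun z => g (Function.update z d 0) - g 0) := by
      refine LB.cont (Continuous.sub (hgs.continuous.comp ?_) continuous_const)
      fun_prop
    have hL2 : LB (fun z => g z - g (Function.update z d 0)) := by
      refine LB.cont (hgs.continuous.sub (hgs.continuous.comp ?_))
      fun_prop
    have h2 : N2 t θ (fun z => g (Function.update z d 0) - g 0) ≤ B * X := by
      refine toN _ hL1 fun z hz => ?_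
      have hz' : Function.update z d 0 ∈ Cb t θ := upd_mem_Cb' hz d (zero_mem_lohi t hθ0.le d)
      have := moveQ hgs t hCS hθ0 hθ1 (Finset.univ.erase d) (fun k hk z hz => ?_) hz'
      · have e : (Finset.univ.erase d).piecewise 0 (Function.update z d 0) = (0 : ι → ℝ) := by
          funext k
          by_cases hk : k = d
          · subst hk; simp
          · simp [hk]
        rwa [e] at this
      · have hkd : k ≠ d := (Finset.mem_erase.1 hk).1
        by_cases hkt : k = t
        · subst hkt
          have := (hsup [k] bT [h] (by simpa using hdh.symm) (by simp) z (hsub hz)).2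
          have e : pd k g = pd d (pds ([k] ++ [h]) V) := by
            simp only [pds, List.cons_append, List.nil_append]
            rw [hg, pd_comm (sm1 d) k h, pd_comm hV k d, pd_comm (sm1 k) h d]
          rw [e]; exact this
        · have := (hsup [h, k] (bS h k hth.symm hdh.symm hkt hkd) [] (by simp) (by simp) z (hsub hz)).2
          have e : pd k g = pd d (pds ([h, k] ++ []) V) := by
            simp only [pds, List.append_nil]
            rw [hg, pd_comm hV h d, pd_comm (sm1 h) k d]
          rw [e]; exact this
    have h3 := N2_add hL2 hL1 t θ
    have e3 : (fun z => g z - g (Function.update z d 0) + (g (Function.update z d 0) - g 0)) = fun z => g z - g 0 := by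
      funext z; ring
    rw [e3] at h3
    have h4 : θ ^ 2 * Y ≤ B' * X := by
      have h5 : θ ^ 2 * (θ ^ (n + 1) * S + Ch * F2) ≤ X := by
        have a1 : θ ^ 2 * (θ ^ (n + 1) * S) = θ ^ (n + 3) * Φ + θ ^ (n + 3) * (Cs * F2) := by rw [hS]; ring
        have a2 : θ ^ (n + 3) * (Cs * F2) ≤ 1 * (Cs * F2) := mul_le_mul_of_nonneg_right hθn (by positivity)
        have a3 : θ ^ 2 * (Ch * F2) ≤ 1 * (Ch * F2) :=
          mul_le_mul_of_nonneg_right (pow_le_one₀ hθ0.le hθ1) (by positivity)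
        rw [mul_add, a1, hX]; linarith
      calc θ ^ 2 * Y = B' * (θ ^ 2 * (θ ^ (n + 1) * S + Ch * F2)) := by rw [hY]; ring
        _ ≤ _ := mul_le_mul_of_nonneg_left h5 (by linarith)
    have h6 : 4 * θ ^ 2 * N2 t θ (pd d g) ≤ 4 * C3 * (B' * X) := by
      calc _ ≤ 4 * θ ^ 2 * (C3 * Y) := mul_le_mul_of_nonneg_left hgd (by positivity)
        _ = 4 * C3 * (θ ^ 2 * Y) := by ring
        _ ≤ _ := mul_le_mul_of_nonneg_left h4 (by positivity)
    calc _ ≤ _ := h3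
      _ ≤ 2 * (4 * C3 * (B' * X)) + 2 * (B * X) := by
          have := hp.trans h6
          linarith
      _ = _ := by ring
  have hMX : (8 * C3 * B' + 2 * B) * X ≤ (C3 * B + 2 * B + 8 * C3 * B') * X := by
    refine mul_le_mul_of_nonneg_right ?_ hX0
    have : 0 ≤ C3 * B := by positivity
    linarith
  refine ⟨hT.trans hBX, fun i j hit hjt => ?_⟩
  by_cases hij : (i = h ↔ j = h)
  · have e : (fun z => pd i (pd j V) z - cf t h V i j) = pd i (pd j V) := by
      funext z; simp [cf, hij]
    rw [e]
    by_cases hi : i = d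
    · by_cases hj : j = d
      · subst hi; subst hj; exact hDD.trans hDDX
      · rw [pd_comm hV]; exact (hG j i hjt hj hit hij.symm).trans hBX
    · exact (hG i j hit hi hjt hij).trans hBX
  · have key : ∀ j, j ≠ t → N2 t θ (fun z => pd h (pd j V) z - pd h (pd j V) 0) ≤ (C3 * B + 2 * B + 8 * C3 * B') * X := by
      intro j hjt
      by_cases hj : j = d
      · subst hj; exact hMd.trans hMX
      · exact (hM j hjt hj).trans hBX
    have e : (fun z => pd i (pd j V) z - cf t h V i j) = fun z => pd i (pd j V) z - pd i (pd j V) 0 := by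
      funext z; simp [cf, hij, hit, hjt]
    rw [e]
    by_cases hi : i = h
    · subst hi; exact key j hjt
    · have hj : j = h := by tauto
      subst hj; rw [pd_comm hV i j]; exact key i hit

end dec
end PSP

namespace PSP
open scoped ContDiff ENNReal
section dec2
variable {ι : Type} [Fintype ι] [DecidableEq ι]
variable {t d h : ι} {ν : ℝ} {b : (ι → ℝ) → ℝ} {M : ι → ι → (ι → ℝ) → ℝ}

lemma pd_fsub {f g : (ι → ℝ) → ℝ} (hf : ContDiff ℝ ∞ f) (hg : ContDiff ℝ ∞ g) (i : ι) :
    pd i (fun z => f z - g z) = fun z => pd i f z - pd i g z := by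
  funext z; exact pd_sub hf hg i z

lemma pd2_fsub {f g : (ι → ℝ) → ℝ} (hf : ContDiff ℝ ∞ f) (hg : ContDiff ℝ ∞ g) (i j : ι) :
    pd i (pd j (fun z => f z - g z)) = fun z => pd i (pd j f) z - pd i (pd j g) z := by
  rw [pd_fsub hf hg, pd_fsub (pd_smooth hf j) (pd_smooth hg j)]

lemma Fo_sub {f g : (ι → ℝ) → ℝ} (hf : ContDiff ℝ ∞ f) (hg : ContDiff ℝ ∞ g) (z : ι → ℝ) :
    Fo t b M (fun z => f z - g z) z = Fo t b M f z - Fo t b M g z := by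
  unfold Fo
  simp only [pd2_fsub hf hg, mul_sub, Finset.sum_sub_distrib]
  rw [pd_fsub hf hg]
  ring

/-- The distance to the model polynomial. -/
def Dv (t : ι) (ρ : ℝ) (W : (ι → ℝ) → ℝ) (c : ι → ι → ℝ) : ℝ :=
  N2 t ρ (pd t W) + ∑ i ∈ Sx t, ∑ j ∈ Sx t, N2 t ρ (fun z => pd i (pd j W) z - c i j)

/-- admissible constants -/
structure Adm (t h : ι) (c : ι → ι → ℝ) : Prop where
  symm : ∀ i j, c i j = c j i
  zero : ∀ i j, (i = h ↔ j = h) → c i j = 0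
  tz : ∀ i, c t i = 0

set_option maxHeartbeats 1000000 in
lemma decay (t d h : ι) (ν : ℝ) : ∃ C0 : ℝ, 1 ≤ C0 ∧ ∀ θ : ℝ, 0 < θ → θ ≤ 1/8 → ∃ C1 : ℝ, 1 ≤ C1 ∧
    ∀ b M, Co t d h ν b M → ∀ W : (ι → ℝ) → ℝ, ContDiff ℝ ∞ W → OddH h W →
    ∃ c : ι → ι → ℝ, Adm t h c ∧
      Dv t θ W c ≤ C0 * (θ ^ (Fintype.card ι + 3) * Ph t 1 W) + C1 * N2 t 1 (Fo t b M W) := by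
  obtain ⟨K, hK, hdv⟩ := decayV t d h ν
  obtain ⟨C4, hC4, hst⟩ := star t d h ν (r' := 1/2) (r := 3/4) (by norm_num) (by norm_num)
  set n := Fintype.card ι with hn
  set Z : ℝ := 2 * (C4 * ((n:ℝ) ^ 2 + 6)) + 2 * K with hZ
  have hZ1 : 1 ≤ Z := by
    have : 0 ≤ C4 * ((n:ℝ) ^ 2 + 6) := by positivity
    rw [hZ]; linarith
  refine ⟨((n:ℝ) ^ 2 + 1) * Z, by nlinarith [sq_nonneg (n:ℝ)], fun θ hθ0 hθ => ?_⟩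
  set s := θ ^ (n + 3) with hs
  have hs0 : 0 < s := by positivity
  have hs16 : s ≤ 1/16 := by
    calc s ≤ θ ^ 2 := pow_le_pow_of_le_one hθ0.le (by linarith) (by omega)
      _ ≤ (1/8) ^ 2 := by gcongr
      _ ≤ _ := by norm_num
  obtain ⟨η, Kη⟩ := exists_ker t hs0
  obtain ⟨Cs, hCs, hdv⟩ := hdv s hs0 hs16 η Kη
  refine ⟨((n:ℝ) ^ 2 + 1) * (Z * Cs), by nlinarith [mul_le_mul hZ1 hCs (by norm_num) (by linarith), sq_nonneg (n:ℝ)], fun b M H W hW ho => ?_⟩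
  obtain ⟨hvt, hvx⟩ := hdv θ hθ0 hθ b M H W hW ho
  have hκ := Kη.sm.continuous
  have hV := Tm_smooth d hκ Kη.cs hW
  have hmo := moll_err t d hs0 hs16 Kη H.td hW
  have hFV : N2 t (3/4) (Fo t b M (Tm d η W)) ≤ N2 t 1 (Fo t b M W) := by
    have e := Fo_Tm H hκ Kη.cs hW
    have h1 := Tm_N2 t d H.td hs0 hs16 Kη [] (H.lbF hW) (by
      simp only [pds]; rw [← e]; exact H.lbF hV)
    simp only [pds, Kη.abs_int, one_pow, one_mul, ← e] at h1
    exact h1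
  set V := Tm d η W with hVd
  set F2 := N2 t 1 (Fo t b M W) with hF2
  set Φ := Ph t 1 W with hΦ
  have hF20 : 0 ≤ F2 := N2_nonneg _ _ _
  have hΦ0 : 0 ≤ Φ := Ph_nonneg _ _ _
  have hD : ContDiff ℝ ∞ (fun z => W z - V z) := hW.sub hV
  have hFD : N2 t (3/4) (Fo t b M (fun z => W z - V z)) ≤ 4 * F2 := by
    have e : Fo t b M (fun z => W z - V z) = fun z => Fo t b M W z - Fo t b M V z := by
      funext z; exact Fo_sub hW hV z
    rw [e]
    have h1 := N2_sub (H.lbF hW) (H.lbF hV) t (3/4)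
    have h2 := N2_mono (H.lbF hW) t (r := 3/4) (s := 1) (by norm_num) (by norm_num)
    linarith
  have hs4 : s ^ 4 ≤ s := by
    calc s ^ 4 ≤ s ^ 1 := pow_le_pow_of_le_one hs0.le (by linarith) (by omega)
      _ = s := pow_one s
  set X := s * Φ + Cs * F2 with hX
  have hX0 : 0 ≤ X := by positivity
  have hDX : C4 * (N2 t (3/4) (Fo t b M (fun z => W z - V z)) + N2 t (3/4) (fun z => W z - V z))
      ≤ C4 * ((n:ℝ) ^ 2 + 6) * X := by
    rw [mul_assoc]
    refine mul_le_mul_of_nonneg_left ?_ hC4.le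
    have h1 : ((n:ℝ) ^ 2 + 2) * s ^ 4 * Φ ≤ ((n:ℝ) ^ 2 + 2) * (s * Φ) := by
      rw [mul_assoc]
      exact mul_le_mul_of_nonneg_left (mul_le_mul_of_nonneg_right hs4 hΦ0) (by positivity)
    have h2 : F2 ≤ Cs * F2 := by nlinarith
    have h3 : 0 ≤ s * Φ := by positivity
    have h4 : 0 ≤ (n:ℝ) ^ 2 * (Cs * F2) := by positivity
    rw [hX]; nlinarith
  obtain ⟨hd1, hd2⟩ := hst b M H _ hD
  have sm1 : ∀ i, ContDiff ℝ ∞ (pd i V) := fun i => pd_smooth hV i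
  have sm2 : ∀ i j, ContDiff ℝ ∞ (pd i (pd j V)) := fun i j => pd_smooth (sm1 j) i
  have hZX : 2 * (C4 * ((n:ℝ) ^ 2 + 6) * X) + 2 * (K * X) = Z * X := by rw [hZ]; ring
  have ht : N2 t θ (pd t W) ≤ Z * X := by
    have e : pd t W = fun z => pd t (fun z => W z - V z) z + pd t V z := by
      funext z; rw [pd_fsub hW hV]; ring
    rw [e]
    refine (N2_add (LB.sm (pd_smooth hD t)) (LB.sm (sm1 t)) t θ).trans ?_
    have h1 := (N2_mono (LB.sm (pd_smooth hD t)) t hθ0.le (by linarith : θ ≤ 1/2)).trans ((hd1 t).trans hDX)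
    rw [← hZX]; linarith
  have hx : ∀ i ∈ Sx t, ∀ j ∈ Sx t, N2 t θ (fun z => pd i (pd j W) z - cf t h V i j) ≤ Z * X := by
    intro i hi j hj
    have hi := (Finset.mem_erase.1 hi).1
    have hj := (Finset.mem_erase.1 hj).1
    have e : (fun z => pd i (pd j W) z - cf t h V i j)
        = fun z => pd i (pd j (fun z => W z - V z)) z + (pd i (pd j V) z - cf t h V i j) := by
      funext z; rw [pd2_fsub hW hV]; ring
    rw [e]
    have hs2 : ContDiff ℝ ∞ (pd i (pd j (fun z => W z - V z))) := pd_smooth (pd_smooth hD j) i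
    refine (N2_add (LB.sm hs2) ((LB.sm (sm2 i j)).sub (LB.const _)) t θ).trans ?_
    have h1 := (N2_mono (LB.sm hs2) t hθ0.le (by linarith : θ ≤ 1/2)).trans ((hd2 i j hi hj).trans hDX)
    have h2 := hvx i j hi hj
    rw [← hZX]; linarith
  refine ⟨cf t h V, ⟨fun i j => ?_, fun i j hij => by simp [cf, hij], fun i => by simp [cf]⟩, ?_⟩
  · unfold cf; rw [pd_comm hV i j]
    by_cases h1 : i = t <;> by_cases h2 : j = t <;> by_cases h3 : i = h <;> by_cases h4 : j = h <;> simp [h1, h2, h3, h4]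
  · have hZX0 : 0 ≤ Z * X := by positivity
    have hcS : ((Sx t).card : ℝ) ≤ n := by exact_mod_cast Finset.card_le_univ _
    have h1 : ∑ i ∈ Sx t, ∑ j ∈ Sx t, N2 t θ (fun z => pd i (pd j W) z - cf t h V i j) ≤ (n:ℝ) ^ 2 * (Z * X) := by
      have := Finset.sum_le_card_nsmul _ _ _ (fun i hi => Finset.sum_le_card_nsmul _ _ _ (hx i hi))
      simp only [nsmul_eq_mul] at this
      refine this.trans ?_
      calc _ ≤ (n:ℝ) * (n * (Z * X)) := by gcongr
        _ = _ := by ring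
    unfold Dv
    calc _ ≤ Z * X + (n:ℝ) ^ 2 * (Z * X) := add_le_add ht h1
      _ = _ := by rw [hX, hs]; ring

end dec2
end PSP

namespace PSP
open scoped ContDiff ENNReal
section poly
variable {ι : Type} [Fintype ι] [DecidableEq ι]
variable {t d h : ι} {ν : ℝ} {b : (ι → ℝ) → ℝ} {M : ι → ι → (ι → ℝ) → ℝ}

/-- quadratic polynomial with Hessian `c` -/
def Pc (c : ι → ι → ℝ) (z : ι → ℝ) : ℝ := (1/2) * ∑ i, ∑ j, c i j * (z i * z j)

lemma Pc_smooth (c : ι → ι → ℝ) : ContDiff ℝ ∞ (Pc c) := by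
  unfold Pc; fun_prop

lemma pd_lin (α : ι → ℝ) (k : ι) (z : ι → ℝ) : pd k (fun z => ∑ j, α j * z j) z = α k := by
  have h1 : HasFDerivAt (fun z : ι → ℝ => ∑ j, α j * z j)
      (∑ j, α j • (ContinuousLinearMap.proj (R := ℝ) (φ := fun _ : ι => ℝ) j)) z := by
    refine HasFDerivAt.fun_sum fun j _ => ?_
    exact (hasFDerivAt_apply j z).const_mul (α j)
  unfold pd
  rw [h1.fderiv]
  simp [ContinuousLinearMap.sum_apply, Pi.single_apply]

lemma pd_Pc {c : ι → ι → ℝ} (hc : ∀ i j, c i j = c j i) (k : ι) : pd k (Pc c) = fun z => ∑ j, c k j * z j := by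
  funext z
  have h1 : HasFDerivAt (fun z : ι → ℝ => Pc c z)
      ((1/2 : ℝ) • ∑ i, ∑ j, c i j • (z i • (ContinuousLinearMap.proj (R := ℝ) (φ := fun _ : ι => ℝ) j)
        + z j • (ContinuousLinearMap.proj (R := ℝ) (φ := fun _ : ι => ℝ) i))) z := by
    unfold Pc
    refine HasFDerivAt.const_mul ?_ _
    refine HasFDerivAt.fun_sum fun i _ => HasFDerivAt.fun_sum fun j _ => ?_
    exact ((hasFDerivAt_apply i z).mul (hasFDerivAt_apply j z)).const_mul _
  unfold pd
  rw [h1.fderiv]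
  simp only [ContinuousLinearMap.smul_apply, ContinuousLinearMap.sum_apply, ContinuousLinearMap.add_apply,
    ContinuousLinearMap.proj_apply, Pi.single_apply, smul_eq_mul, mul_add, Finset.sum_add_distrib,
    mul_ite, mul_one, mul_zero, Finset.sum_ite_eq', Finset.mem_univ, if_true]
  have e : ∑ x, ∑ x_1, (if x = k then c x x_1 * z x_1 else 0) = ∑ x, c k x * z x := by
    rw [Finset.sum_comm]; simp
  rw [e]
  have e2 : ∑ x, c x k * z x = ∑ x, c k x * z x := Finset.sum_congr rfl fun x _ => by rw [hc]
  rw [e2]; ring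

lemma pd_pd_Pc {c : ι → ι → ℝ} (hc : ∀ i j, c i j = c j i) (i k : ι) : pd i (pd k (Pc c)) = fun z => c k i := by
  rw [pd_Pc hc]; funext z; exact pd_lin (c k) i z

lemma Pc_odd {c : ι → ι → ℝ} (hc : Adm t h c) : OddH h (Pc c) := by
  intro z
  unfold Pc
  rw [← mul_neg, ← Finset.sum_neg_distrib]
  congr 1
  refine Finset.sum_congr rfl fun i _ => ?_
  rw [← Finset.sum_neg_distrib]
  refine Finset.sum_congr rfl fun j _ => ?_
  by_cases hij : (i = h ↔ j = h)
  · rw [hc.zero i j hij]; ring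
  · by_cases hi : i = h
    · have hj : j ≠ h := by tauto
      subst hi; simp [fl, hj]
    · have hj : j = h := by tauto
      subst hj; simp [fl, hi]

lemma Co.sum_adm (H : Co t d h ν b M) {c : ι → ι → ℝ} (hc : Adm t h c) (z : ι → ℝ) (i j : ι) : M i j z * c i j = 0 := by
  by_cases hij : (i = h ↔ j = h)
  · rw [hc.zero i j hij]; ring
  · by_cases hi : i = h
    · have hj : j ≠ h := by tauto
      subst hi; rw [H.Mhj j z hj]; ring
    · have hj : j = h := by tauto
      subst hj; rw [H.Mjh i z hi]; ring

lemma Fo_Pc (H : Co t d h ν b M) {c : ι → ι → ℝ} (hc : Adm t h c) (z : ι → ℝ) : Fo t b M (Pc c) z = 0 := by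
  unfold Fo
  simp only [pd_pd_Pc hc.symm]
  rw [pd_Pc hc.symm]
  have : ∀ i j, M i j z * c j i = 0 := fun i j => by rw [hc.symm]; exact H.sum_adm hc z i j
  simp [this, hc.tz]

lemma Adm.add {c c' : ι → ι → ℝ} (h1 : Adm t h c) (h2 : Adm t h c') : Adm t h (fun i j => c i j + c' i j) :=
  ⟨fun i j => by rw [h1.symm, h2.symm], fun i j hij => by rw [h1.zero i j hij, h2.zero i j hij]; ring,
    fun i => by rw [h1.tz, h2.tz]; ring⟩

lemma Adm.zero' : Adm t h (fun _ _ => 0) := ⟨fun _ _ => rfl, fun _ _ _ => rfl, fun _ => rfl⟩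

lemma decay2 (t d h : ι) (ν : ℝ) : ∃ C0 : ℝ, 1 ≤ C0 ∧ ∀ θ : ℝ, 0 < θ → θ ≤ 1/8 → ∃ C1 : ℝ, 1 ≤ C1 ∧
    ∀ b M, Co t d h ν b M → ∀ W : (ι → ℝ) → ℝ, ContDiff ℝ ∞ W → OddH h W → ∀ c, Adm t h c →
    ∃ c' : ι → ι → ℝ, Adm t h c' ∧
      Dv t θ W c' ≤ C0 * (θ ^ (Fintype.card ι + 3) * Dv t 1 W c) + C1 * N2 t 1 (Fo t b M W) := by
  obtain ⟨C0, hC0, hd⟩ := decay t d h ν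
  refine ⟨C0, hC0, fun θ h0 h1 => ?_⟩
  obtain ⟨C1, hC1, hd⟩ := hd θ h0 h1
  refine ⟨C1, hC1, fun b M H W hW ho c hc => ?_⟩
  have hP := Pc_smooth c
  have hodd : OddH h (fun z => W z - Pc c z) := fun z => by
    simp only; rw [ho z, Pc_odd hc z]; ring
  obtain ⟨c', hc', hle⟩ := hd b M H _ (hW.sub hP) hodd
  have e1 : pd t (fun z => W z - Pc c z) = pd t W := by
    rw [pd_fsub hW hP, pd_Pc hc.symm]; funext z; simp [hc.tz]
  have e2 : ∀ i j, pd i (pd j (fun z => W z - Pc c z)) = fun z => pd i (pd j W) z - c i j := by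
    intro i j; rw [pd2_fsub hW hP, pd_pd_Pc hc.symm, hc.symm]
  have e3 : Fo t b M (fun z => W z - Pc c z) = Fo t b M W := by
    funext z; rw [Fo_sub hW hP, Fo_Pc H hc, sub_zero]
  refine ⟨fun i j => c i j + c' i j, hc.add hc', ?_⟩
  rw [e3] at hle
  unfold Dv Ph at *
  simp only [e1, e2] at hle
  simp only [← sub_sub]
  exact hle

end poly
end PSP

namespace PSP
open scoped ContDiff ENNReal
section ap
variable {ι : Type} [Fintype ι] [DecidableEq ι]
variable {t d h : ι} {ν : ℝ} {b : (ι → ℝ) → ℝ} {M : ι → ι → (ι → ℝ) → ℝ}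

def Ev (t : ι) (ρ : ℝ) (wT : (ι → ℝ) → ℝ) (w : ι → ι → (ι → ℝ) → ℝ) (c : ι → ι → ℝ) : ℝ :=
  N2 t ρ wT + ∑ i ∈ Sx t, ∑ j ∈ Sx t, N2 t ρ (fun z => w i j z - c i j)

def FoW (b : (ι → ℝ) → ℝ) (M : ι → ι → (ι → ℝ) → ℝ) (wT : (ι → ℝ) → ℝ) (w : ι → ι → (ι → ℝ) → ℝ)
    (z : ι → ℝ) : ℝ := b z * wT z - ∑ i, ∑ j, M i j z * w i j z

/-- approximable families -/
def Ap (t h : ι) (wT : (ι → ℝ) → ℝ) (w : ι → ι → (ι → ℝ) → ℝ) : Prop :=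
  ∀ ε : ℝ, 0 < ε → ∃ W : (ι → ℝ) → ℝ, ContDiff ℝ ∞ W ∧ OddH h W ∧ ∀ z ∈ Cb t 1,
    |pd t W z - wT z| ≤ ε ∧ ∀ i j, i ≠ t → j ≠ t → |pd i (pd j W) z - w i j z| ≤ ε

lemma N2_near {f g : (ι → ℝ) → ℝ} (hf : LB f) (hg : LB g) (t : ι) {ρ ε : ℝ} (hρ : 0 ≤ ρ) (hρ1 : ρ ≤ 1)
    (he : ∀ z ∈ Cb t ρ, |f z - g z| ≤ ε) : N2 t ρ f ≤ 2 * N2 t ρ g + 2 * ε ^ 2 * 2 ^ (Fintype.card ι - 1) := by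
  have h1 := N2_add hg (hf.sub hg) t ρ
  have e : (fun z => g z + (f z - g z)) = f := by funext z; ring
  rw [e] at h1
  have h2 := N2_bdd (hf.sub hg) t hρ (X := ε ^ 2) (fun z hz => by
    have := abs_le.1 (he z hz); exact sq_le_sq' this.1 this.2)
  have h3 : ε ^ 2 * (2 ^ (Fintype.card ι - 1) * ρ ^ (Fintype.card ι + 1)) ≤ ε ^ 2 * (2 ^ (Fintype.card ι - 1) * 1) := by
    gcongr; exact pow_le_one₀ hρ hρ1
  linarith

lemma Co.lbFW (H : Co t d h ν b M) {wT : (ι → ℝ) → ℝ} {w : ι → ι → (ι → ℝ) → ℝ} (h1 : LB wT)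
    (h2 : ∀ i j, LB (w i j)) : LB (FoW b M wT w) :=
  (H.lbb.mul h1).sub (LB.sum fun i _ => LB.sum fun j _ => (H.lbM i j).mul (h2 i j))

lemma dsum_le (t : ι) {α β : ι → ι → ℝ} {K L : ℝ} (hL : 0 ≤ L) (hle : ∀ i ∈ Sx t, ∀ j ∈ Sx t, α i j ≤ K * β i j + L) :
    ∑ i ∈ Sx t, ∑ j ∈ Sx t, α i j ≤ K * ∑ i ∈ Sx t, ∑ j ∈ Sx t, β i j + (Fintype.card ι : ℝ) ^ 2 * L := by
  have hcS : ((Sx t).card : ℝ) ≤ Fintype.card ι := by exact_mod_cast Finset.card_le_univ _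
  calc _ ≤ ∑ i ∈ Sx t, ∑ j ∈ Sx t, (K * β i j + L) := Finset.sum_le_sum fun i hi => Finset.sum_le_sum fun j hj => hle i hi j hj
    _ = K * ∑ i ∈ Sx t, ∑ j ∈ Sx t, β i j + ((Sx t).card : ℝ) * ((Sx t).card * L) := by
        simp only [Finset.sum_add_distrib, Finset.mul_sum, Finset.sum_const, nsmul_eq_mul]
    _ ≤ K * ∑ i ∈ Sx t, ∑ j ∈ Sx t, β i j + (Fintype.card ι : ℝ) * (Fintype.card ι * L) := by gcongr
    _ = _ := by ring

set_option maxHeartbeats 1000000 in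
lemma step (t d h : ι) (ν : ℝ) : ∃ C0 : ℝ, 1 ≤ C0 ∧ ∀ θ : ℝ, 0 < θ → θ ≤ 1/8 → ∃ C1 : ℝ, 1 ≤ C1 ∧
    ∀ b M, Co t d h ν b M → ∀ wT w, LB wT → (∀ i j, LB (w i j)) → Ap t h wT w → ∀ c, Adm t h c →
    ∃ c' : ι → ι → ℝ, Adm t h c' ∧
      Ev t θ wT w c' ≤ C0 * (θ ^ (Fintype.card ι + 3) * Ev t 1 wT w c) + C1 * N2 t 1 (FoW b M wT w) := by
  obtain ⟨C0, hC0, hd⟩ := decay2 t d h ν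
  refine ⟨5 * C0, by linarith, fun θ hθ0 hθ => ?_⟩
  obtain ⟨C1, hC1, hd⟩ := hd θ hθ0 hθ
  refine ⟨4 * C1, by linarith, fun b M H wT w hT hw hA c hc => ?_⟩
  have hEnn : ∀ ρ c, 0 ≤ Ev t ρ wT w c := fun ρ c =>
    add_nonneg (N2_nonneg _ _ _) (Finset.sum_nonneg fun i _ => Finset.sum_nonneg fun j _ => N2_nonneg _ _ _)
  rcases (hEnn 1 c).eq_or_lt with h0 | hpos
  · refine ⟨c, hc, ?_⟩
    have h1 : Ev t θ wT w c ≤ Ev t 1 wT w c :=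
      add_le_add (N2_mono hT t hθ0.le (by linarith)) (Finset.sum_le_sum fun i _ => Finset.sum_le_sum fun j _ =>
        N2_mono ((hw i j).sub (LB.const _)) t hθ0.le (by linarith))
    rw [← h0] at h1 ⊢
    have := mul_nonneg (by linarith : 0 ≤ 4 * C1) (N2_nonneg t 1 (FoW b M wT w))
    linarith
  set n := Fintype.card ι with hn
  set κ : ℝ := 2 ^ (n - 1) with hκ
  have hκ0 : 0 < κ := by positivity
  have hν := H.pos
  set R0 : ℝ := 2 * κ + (n:ℝ) ^ 2 * (2 * κ) with hR0
  set R1 : ℝ := 2 * (ν⁻¹ * (1 + (n:ℝ) ^ 2)) ^ 2 * κ with hR1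
  set R : ℝ := R0 + 2 * C0 * R0 + 2 * C1 * R1 with hR
  have hR0p : 0 < R0 := by positivity
  have hR1p : 0 ≤ R1 := by positivity
  have hRp : 0 < R := by positivity
  set Y := C0 * (θ ^ (n + 3) * Ev t 1 wT w c) with hY
  have hY0 : 0 < Y := by positivity
  obtain ⟨W, hW, ho, hWe⟩ := hA (Real.sqrt (Y / R)) (Real.sqrt_pos.2 (by positivity))
  set ε := Real.sqrt (Y / R) with hε
  have hε2 : ε ^ 2 * R = Y := by
    rw [hε, Real.sq_sqrt (by positivity)]; field_simp
  have hε0 : 0 ≤ ε := Real.sqrt_nonneg _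
  obtain ⟨c', hc', hle⟩ := hd b M H W hW ho c hc
  refine ⟨c', hc', ?_⟩
  have sm2 : ∀ i j, LB (pd i (pd j W)) := fun i j => LB.sm (pd_smooth (pd_smooth hW j) i)
  have hsub : Cb t θ ⊆ Cb t 1 := Cb_mono t hθ0.le (by linarith)
  have A1 : Ev t θ wT w c' ≤ 2 * Dv t θ W c' + R0 * ε ^ 2 := by
    unfold Ev Dv
    have a1 := N2_near hT (LB.sm (pd_smooth hW t)) t hθ0.le (by linarith : θ ≤ 1) (ε := ε) (fun z hz => by
      rw [abs_sub_comm]; exact (hWe z (hsub hz)).1)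
    have a2 := dsum_le t (α := fun i j => N2 t θ (fun z => w i j z - c' i j))
      (β := fun i j => N2 t θ (fun z => pd i (pd j W) z - c' i j)) (K := 2) (L := 2 * ε ^ 2 * κ) (by positivity)
      (fun i hi j hj => N2_near ((hw i j).sub (LB.const _)) ((sm2 i j).sub (LB.const _)) t hθ0.le
        (by linarith : θ ≤ 1) (ε := ε) (fun z hz => by
        have := (hWe z (hsub hz)).2 i j (Finset.mem_erase.1 hi).1 (Finset.mem_erase.1 hj).1
        rw [abs_sub_comm] at this
        convert this using 2; ring))
    rw [← hn] at a1 a2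
    rw [hR0]; nlinarith
  have A2 : Dv t 1 W c ≤ 2 * Ev t 1 wT w c + R0 * ε ^ 2 := by
    unfold Ev Dv
    have a1 := N2_near (LB.sm (pd_smooth hW t)) hT t zero_le_one le_rfl (ε := ε) (fun z hz => (hWe z hz).1)
    have a2 := dsum_le t (β := fun i j => N2 t 1 (fun z => w i j z - c i j))
      (α := fun i j => N2 t 1 (fun z => pd i (pd j W) z - c i j)) (K := 2) (L := 2 * ε ^ 2 * κ) (by positivity)
      (fun i hi j hj => N2_near ((sm2 i j).sub (LB.const _)) ((hw i j).sub (LB.const _)) t zero_le_one le_rfl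
        (ε := ε) (fun z hz => by
        have := (hWe z hz).2 i j (Finset.mem_erase.1 hi).1 (Finset.mem_erase.1 hj).1
        convert this using 2; ring))
    rw [← hn] at a1 a2
    rw [hR0]; nlinarith
  have A3 : N2 t 1 (Fo t b M W) ≤ 2 * N2 t 1 (FoW b M wT w) + R1 * ε ^ 2 := by
    have := N2_near (H.lbF hW) (H.lbFW hT hw) t zero_le_one le_rfl (ε := ν⁻¹ * (1 + (n:ℝ) ^ 2) * ε) (fun z hz => by
      have e : Fo t b M W z - FoW b M wT w z = b z * (pd t W z - wT z)
          - ∑ i, ∑ j, M i j z * (pd i (pd j W) z - w i j z) := by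
        unfold Fo FoW; simp only [mul_sub, Finset.sum_sub_distrib]; ring
      rw [e]
      refine (abs_sub _ _).trans ?_
      have b1 : |b z * (pd t W z - wT z)| ≤ ν⁻¹ * ε := by
        rw [abs_mul, abs_of_nonneg (hν.le.trans (H.blo z))]
        exact mul_le_mul (H.bhi z) (hWe z hz).1 (abs_nonneg _) (by positivity)
      have b2 : ∀ i j, |M i j z * (pd i (pd j W) z - w i j z)| ≤ ν⁻¹ * ε := by
        intro i j
        by_cases hi : i = t
        · subst hi; rw [H.Mtj]; simp; positivity
        by_cases hj : j = t
        · subst hj; rw [H.Mjt]; simp; positivity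
        rw [abs_mul]
        exact mul_le_mul (H.Mhi i j z) ((hWe z hz).2 i j hi hj) (abs_nonneg _) (by positivity)
      have b3 : |∑ i, ∑ j, M i j z * (pd i (pd j W) z - w i j z)| ≤ (n:ℝ) ^ 2 * (ν⁻¹ * ε) := by
        calc _ ≤ ∑ i : ι, ∑ j : ι, ν⁻¹ * ε :=
              (Finset.abs_sum_le_sum_abs _ _).trans (Finset.sum_le_sum fun i _ =>
                (Finset.abs_sum_le_sum_abs _ _).trans (Finset.sum_le_sum fun j _ => b2 i j))
          _ = _ := by simp only [Finset.sum_const, Finset.card_univ, nsmul_eq_mul, ← hn]; ring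
      calc _ ≤ ν⁻¹ * ε + (n:ℝ) ^ 2 * (ν⁻¹ * ε) := add_le_add b1 b3
        _ = _ := by ring)
    refine this.trans (le_of_eq ?_)
    rw [hR1, ← hn]; ring
  have hθn0 : 0 ≤ θ ^ (n + 3) := by positivity
  have hθn1 : θ ^ (n + 3) ≤ 1 := pow_le_one₀ hθ0.le (by linarith)
  have B1 : C0 * (θ ^ (n + 3) * Dv t 1 W c) ≤ 2 * Y + C0 * R0 * ε ^ 2 := by
    have h1 : θ ^ (n + 3) * Dv t 1 W c ≤ θ ^ (n + 3) * (2 * Ev t 1 wT w c + R0 * ε ^ 2) :=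
      mul_le_mul_of_nonneg_left A2 hθn0
    have h2 : θ ^ (n + 3) * (R0 * ε ^ 2) ≤ 1 * (R0 * ε ^ 2) := mul_le_mul_of_nonneg_right hθn1 (by positivity)
    calc _ ≤ C0 * (2 * (θ ^ (n + 3) * Ev t 1 wT w c) + R0 * ε ^ 2) :=
          mul_le_mul_of_nonneg_left (by linarith) (by linarith)
      _ = _ := by rw [hY]; ring
  have B2 : C1 * N2 t 1 (Fo t b M W) ≤ C1 * (2 * N2 t 1 (FoW b M wT w) + R1 * ε ^ 2) :=
    mul_le_mul_of_nonneg_left A3 (by linarith)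
  have hYR : R0 * ε ^ 2 + 2 * C0 * R0 * ε ^ 2 + 2 * C1 * R1 * ε ^ 2 = Y := by rw [← hε2, hR]; ring
  calc _ ≤ 2 * Dv t θ W c' + R0 * ε ^ 2 := A1
    _ ≤ 2 * (2 * Y + C0 * R0 * ε ^ 2 + C1 * (2 * N2 t 1 (FoW b M wT w) + R1 * ε ^ 2)) + R0 * ε ^ 2 := by linarith
    _ = 4 * Y + (R0 * ε ^ 2 + 2 * C0 * R0 * ε ^ 2 + 2 * C1 * R1 * ε ^ 2) + 4 * C1 * N2 t 1 (FoW b M wT w) := by ring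
    _ = 5 * C0 * (θ ^ (n + 3) * Ev t 1 wT w c) + 4 * C1 * N2 t 1 (FoW b M wT w) := by rw [hYR, hY]; ring

end ap
end PSP

namespace PSP
open scoped ContDiff ENNReal
section sc
variable {ι : Type} [Fintype ι] [DecidableEq ι]
variable {t d h : ι} {ν : ℝ} {b : (ι → ℝ) → ℝ} {M : ι → ι → (ι → ℝ) → ℝ}

/-- parabolic dilation -/
def dl (t : ι) (r : ℝ) (z : ι → ℝ) : ι → ℝ := fun i => (if i = t then r ^ 2 else r) * z i

lemma dl_mem {t : ι} {r : ℝ} (hr : 0 < r) (z : ι → ℝ) : dl t r z ∈ Cb t r ↔ z ∈ Cb t 1 := by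
  unfold Cb dl
  simp only [mem_setOf_eq, if_true]
  have h2 : 0 < r ^ 2 := by positivity
  refine and_congr ?_ (and_congr ?_ (forall_congr' fun i => imp_congr_right fun hi => ?_))
  · constructor <;> intro h <;> nlinarith
  · constructor <;> intro h <;> nlinarith
  · rw [if_neg hi, abs_mul, abs_of_pos hr]
    constructor <;> intro h <;> nlinarith

lemma N2_dl {f g : (ι → ℝ) → ℝ} (hf : LB f) (t : ι) {r : ℝ} (hr : 0 < r) (hg : ∀ z ∈ Cb t 1, g z = f (dl t r z)) :
    N2 t r f = r ^ (Fintype.card ι + 1) * N2 t 1 g := by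
  set D : ι → ℝ := fun i => if i = t then r ^ 2 else r with hD
  have hprod : ∏ i, D i = r ^ (Fintype.card ι + 1) := by
    have : 0 < Fintype.card ι := Fintype.card_pos_iff.2 ⟨t⟩
    rw [← Finset.mul_prod_erase _ _ (Finset.mem_univ t)]
    have h2 : ∏ x ∈ Finset.univ.erase t, D x = r ^ (Fintype.card ι - 1) := by
      rw [Finset.prod_congr rfl (g := fun _ => r)]
      · rw [Finset.prod_const, Finset.card_erase_of_mem (Finset.mem_univ t), Finset.card_univ]
      · intro x hx; simp [hD, (Finset.mem_erase.1 hx).1]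
    rw [h2]; simp only [hD, if_true]; rw [← pow_add]; congr 1; omega
  have hne : (Matrix.diagonal D).det ≠ 0 := by
    rw [Matrix.det_diagonal, hprod]; positivity
  have hm := Real.smul_map_diagonal_volume_pi (D := D) hne
  have e1 : ∀ z, Matrix.toLin' (Matrix.diagonal D) z = dl t r z := by
    intro z; funext i; simp [Matrix.toLin'_apply, Matrix.mulVec_diagonal, dl, hD]
  have hmeas : Measurable (Matrix.toLin' (Matrix.diagonal D)) :=
    (LinearMap.continuous_of_finiteDimensional _).measurable
  unfold N2
  rw [← integral_indicator (Cb_meas t r), ← integral_indicator (Cb_meas t 1)]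
  conv_lhs => rw [← hm]
  rw [integral_smul_measure, integral_map hmeas.aemeasurable]
  · rw [Matrix.det_diagonal, hprod, ENNReal.toReal_ofReal (abs_nonneg _), abs_of_nonneg (by positivity), smul_eq_mul]
    congr 1
    refine integral_congr_ae (ae_of_all _ fun z => ?_)
    simp only [e1]
    by_cases hz : z ∈ Cb t 1
    · rw [indicator_of_mem hz, indicator_of_mem ((dl_mem hr z).2 hz), hg z hz]
    · rw [indicator_of_notMem hz, indicator_of_notMem (fun h => hz ((dl_mem hr z).1 h))]
  · exact (hf.sq.meas.indicator (Cb_meas t r)).aestronglyMeasurable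

end sc
end PSP

namespace PSP
open scoped ContDiff ENNReal
section it
variable {ι : Type} [Fintype ι] [DecidableEq ι]
variable {t d h : ι} {ν : ℝ} {b : (ι → ℝ) → ℝ} {M : ι → ι → (ι → ℝ) → ℝ}

lemma Ev_nonneg (t : ι) (ρ : ℝ) (wT : (ι → ℝ) → ℝ) (w : ι → ι → (ι → ℝ) → ℝ) (c : ι → ι → ℝ) : 0 ≤ Ev t ρ wT w c :=
  add_nonneg (N2_nonneg _ _ _) (Finset.sum_nonneg fun i _ => Finset.sum_nonneg fun j _ => N2_nonneg _ _ _)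

lemma Ev_T (t : ι) (ρ : ℝ) (wT : (ι → ℝ) → ℝ) (w : ι → ι → (ι → ℝ) → ℝ) (c : ι → ι → ℝ) : N2 t ρ wT ≤ Ev t ρ wT w c :=
  le_add_of_nonneg_right (Finset.sum_nonneg fun i _ => Finset.sum_nonneg fun j _ => N2_nonneg _ _ _)

lemma Ev_ij (t : ι) (ρ : ℝ) (wT : (ι → ℝ) → ℝ) (w : ι → ι → (ι → ℝ) → ℝ) (c : ι → ι → ℝ) {i j : ι} (hi : i ≠ t) (hj : j ≠ t) :
    N2 t ρ (fun z => w i j z - c i j) ≤ Ev t ρ wT w c := by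
  have h1 : N2 t ρ (fun z => w i j z - c i j) ≤ ∑ j ∈ Sx t, N2 t ρ (fun z => w i j z - c i j) :=
    Finset.single_le_sum (f := fun j => N2 t ρ (fun z => w i j z - c i j)) (fun j _ => N2_nonneg _ _ _) (Finset.mem_erase.2 ⟨hj, Finset.mem_univ _⟩)
  have h2 : ∑ j ∈ Sx t, N2 t ρ (fun z => w i j z - c i j) ≤ ∑ i ∈ Sx t, ∑ j ∈ Sx t, N2 t ρ (fun z => w i j z - c i j) :=
    Finset.single_le_sum (f := fun i => ∑ j ∈ Sx t, N2 t ρ (fun z => w i j z - c i j)) (fun i _ => Finset.sum_nonneg fun j _ => N2_nonneg _ _ _) (Finset.mem_erase.2 ⟨hi, Finset.mem_univ _⟩)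
  have := N2_nonneg t ρ wT
  unfold Ev; linarith

lemma Ev_dl {wT wT' : (ι → ℝ) → ℝ} {w w' : ι → ι → (ι → ℝ) → ℝ} (hT : LB wT) (hw : ∀ i j, LB (w i j)) (t : ι) {r : ℝ} (hr : 0 < r)
    (h1 : ∀ z ∈ Cb t 1, wT' z = wT (dl t r z)) (h2 : ∀ i j, ∀ z ∈ Cb t 1, w' i j z = w i j (dl t r z)) (c : ι → ι → ℝ) :
    Ev t r wT w c = r ^ (Fintype.card ι + 1) * Ev t 1 wT' w' c := by
  unfold Ev
  rw [N2_dl hT t hr h1, mul_add, Finset.mul_sum]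
  congr 1
  refine Finset.sum_congr rfl fun i _ => ?_
  rw [Finset.mul_sum]
  refine Finset.sum_congr rfl fun j _ => ?_
  exact N2_dl ((hw i j).sub (LB.const _)) t hr (fun z hz => by rw [h2 i j z hz])

lemma N2_constCb (t : ι) (c : ℝ) : N2 t 1 (fun _ => c) = c ^ 2 * 2 ^ (Fintype.card ι - 1) := by
  unfold N2
  rw [setIntegral_const, measureReal_def, vol_Cb t zero_le_one, smul_eq_mul]; ring

lemma exists_theta {C0 γ : ℝ} (hC0 : 1 ≤ C0) (hγ0 : 0 < γ) (hγ : γ < 1) : ∃ θ : ℝ, 0 < θ ∧ θ ≤ 1/8 ∧ C0 * θ ^ 2 ≤ (θ ^ γ) ^ 2 / 4 := by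
  set e : ℝ := (1 / (4 * C0)) ^ (1 / (2 - 2 * γ)) with he
  have he0 : 0 < e := by positivity
  refine ⟨min (1/8) e, by positivity, min_le_left _ _, ?_⟩
  set θ := min (1/8) e
  have h0 : 0 < θ := by positivity
  have h1 : θ ^ (2 - 2 * γ) ≤ 1 / (4 * C0) := by
    calc θ ^ (2 - 2 * γ) ≤ e ^ (2 - 2 * γ) := Real.rpow_le_rpow h0.le (min_le_right _ _) (by linarith)
      _ = _ := by
        rw [he, ← Real.rpow_mul (by positivity), one_div_mul_cancel (by linarith), Real.rpow_one]
  have h2 : θ ^ 2 = θ ^ (2 - 2 * γ) * (θ ^ γ) ^ 2 := by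
    rw [← Real.rpow_natCast (θ ^ γ), ← Real.rpow_mul h0.le, ← Real.rpow_add h0, ← Real.rpow_natCast]
    congr 1; push_cast; ring
  rw [h2]
  have h3 : 0 ≤ (θ ^ γ) ^ 2 := by positivity
  calc C0 * (θ ^ (2 - 2 * γ) * (θ ^ γ) ^ 2) ≤ C0 * (1 / (4 * C0) * (θ ^ γ) ^ 2) := by gcongr
    _ = _ := by field_simp

set_option maxHeartbeats 1000000 in
lemma iter (t d h : ι) (ν γ : ℝ) (hγ0 : 0 < γ) (hγ : γ < 1) : ∃ θ : ℝ, 0 < θ ∧ θ ≤ 1/8 ∧ ∃ ε0 : ℝ, 0 < ε0 ∧ ∃ K : ℝ, 1 ≤ K ∧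
    ∀ (b : ℕ → (ι → ℝ) → ℝ) (M : ℕ → ι → ι → (ι → ℝ) → ℝ) (wT : ℕ → (ι → ℝ) → ℝ) (w : ℕ → ι → ι → (ι → ℝ) → ℝ) (cinf : ι → ι → ℝ) (Y : ℝ),
    0 ≤ Y → (∀ k, Co t d h ν (b k) (M k)) → (∀ k, LB (wT k)) → (∀ k i j, LB (w k i j)) → (∀ k, Ap t h (wT k) (w k)) →
    (∀ k, ∀ z ∈ Cb t 1, wT (k+1) z = wT k (dl t θ z)) → (∀ k i j, ∀ z ∈ Cb t 1, w (k+1) i j z = w k i j (dl t θ z)) →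
    (∀ k c, Adm t h c → N2 t 1 (FoW (b k) (M k) (wT k) (w k)) ≤ ε0 * Ev t 1 (wT k) (w k) c + Y ^ 2 * ((θ ^ γ) ^ k) ^ 2) →
    Ev t 1 (wT 0) (w 0) (fun _ _ => 0) ≤ Y ^ 2 →
    (∀ i j, i ≠ t → j ≠ t → ∀ ε : ℝ, 0 < ε → ∃ k0, ∀ k ≥ k0, ∀ z ∈ Cb t 1, |w k i j z - cinf i j| ≤ ε) →
    ∀ k, N2 t 1 (wT k) ≤ K * (Y * (θ ^ γ) ^ k) ^ 2 ∧ ∀ i j, i ≠ t → j ≠ t → N2 t 1 (fun z => w k i j z - cinf i j) ≤ K * (Y * (θ ^ γ) ^ k) ^ 2 := by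
  obtain ⟨C0, hC0, hs⟩ := step t d h ν
  obtain ⟨θ, hθ0, hθ8, hθ⟩ := exists_theta hC0 hγ0 hγ
  obtain ⟨C1, hC1, hs⟩ := hs θ hθ0 hθ8
  set s := θ ^ γ with hsdef
  have hs0 : 0 < s := by positivity
  have hs1 : s < 1 := Real.rpow_lt_one hθ0.le (by linarith) hγ0
  set n := Fintype.card ι with hn
  set T := θ ^ (n + 1) with hT
  have hT0 : 0 < T := by positivity
  have hT1 : T ≤ 1 := pow_le_one₀ hθ0.le (by linarith)
  set A := max 1 (2 * C1 / (T * s ^ 2)) with hA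
  have hA1 : 1 ≤ A := le_max_left _ _
  have hA2 : C1 ≤ T * (A * s ^ 2 / 2) := by
    have : 2 * C1 / (T * s ^ 2) ≤ A := le_max_right _ _
    rw [div_le_iff₀ (by positivity)] at this; linarith
  set V : ℝ := 2 ^ (n - 1) with hV
  have hV1 : 1 ≤ V := one_le_pow₀ (by norm_num)
  set B := Real.sqrt (4 * A / T) with hB
  have hB2 : B ^ 2 = 4 * A / T := Real.sq_sqrt (by positivity)
  have hB0 : 0 ≤ B := Real.sqrt_nonneg _
  refine ⟨θ, hθ0, hθ8, T * s ^ 2 / (4 * C1), by positivity, 2 * A + 2 * V * (B / (1 - s)) ^ 2, ?_, ?_⟩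
  · have : 0 ≤ 2 * V * (B / (1 - s)) ^ 2 := by positivity
    linarith
  intro b M wT w cinf Y hY hCo hLT hLw hAp hdT hdw hF h0 hlim
  have key : ∀ k c, Adm t h c → Ev t 1 (wT k) (w k) c ≤ A * (Y * s ^ k) ^ 2 →
      ∃ c', Adm t h c' ∧ Ev t 1 (wT (k+1)) (w (k+1)) c' ≤ A * (Y * s ^ (k+1)) ^ 2 := by
    intro k c hc hE
    obtain ⟨c', hc', h1⟩ := hs _ _ (hCo k) _ _ (hLT k) (hLw k) (hAp k) c hc
    refine ⟨c', hc', ?_⟩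
    rw [Ev_dl (hLT k) (hLw k) t hθ0 (hdT k) (hdw k) c'] at h1
    have h2 := hF k c hc
    set E' := Ev t 1 (wT (k+1)) (w (k+1)) c'
    set E := Ev t 1 (wT k) (w k) c
    set Z := (Y * s ^ k) ^ 2 with hZ
    have hZ0 : 0 ≤ Z := by positivity
    have hE0 : 0 ≤ E := Ev_nonneg _ _ _ _ _
    have h3 : C0 * (θ ^ (n + 3) * E) ≤ T * (s ^ 2 / 4 * E) := by
      have : θ ^ (n + 3) = T * θ ^ 2 := by rw [hT]; ring
      rw [this]
      calc C0 * (T * θ ^ 2 * E) = T * (C0 * θ ^ 2 * E) := by ring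
        _ ≤ _ := by gcongr
    have h4 : C1 * N2 t 1 (FoW (b k) (M k) (wT k) (w k)) ≤ T * (s ^ 2 / 4 * E) + C1 * Z := by
      calc _ ≤ C1 * (T * s ^ 2 / (4 * C1) * E + Y ^ 2 * (s ^ k) ^ 2) := by gcongr
        _ = _ := by rw [hZ]; field_simp
    have h5 : T * E' ≤ T * (A * s ^ 2 * Z) := by
      have h6 : s ^ 2 / 2 * E ≤ s ^ 2 / 2 * (A * Z) := by gcongr
      have h7 : C1 * Z ≤ T * (A * s ^ 2 / 2) * Z := by gcongr
      have h8 : T * (s ^ 2 / 2 * E) ≤ T * (s ^ 2 / 2 * (A * Z)) := by gcongr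
      nlinarith
    have h6 := le_of_mul_le_mul_left h5 hT0
    rw [hZ] at h6
    calc E' ≤ _ := h6
      _ = _ := by ring
  have hex : ∃ c : ℕ → ι → ι → ℝ, ∀ k, Adm t h (c k) ∧ Ev t 1 (wT k) (w k) (c k) ≤ A * (Y * s ^ k) ^ 2 := by
    have : ∀ k, ∃ c, Adm t h c ∧ Ev t 1 (wT k) (w k) c ≤ A * (Y * s ^ k) ^ 2 := by
      intro k
      induction k with
      | zero => exact ⟨_, Adm.zero', h0.trans (by simp; nlinarith [sq_nonneg Y])⟩
      | succ k ih => obtain ⟨c, hc, hE⟩ := ih; exact key k c hc hE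
    choose c hc using this
    exact ⟨c, hc⟩
  obtain ⟨c, hc⟩ := hex
  intro k
  constructor
  · refine ((Ev_T t 1 (wT k) (w k) (c k)).trans (hc k).2).trans ?_
    have : 0 ≤ 2 * V * (B / (1 - s)) ^ 2 := by positivity
    gcongr; linarith
  intro i j hi hj
  have hN : ∀ k, N2 t 1 (fun z => w k i j z - c k i j) ≤ A * (Y * s ^ k) ^ 2 := fun k => (Ev_ij t 1 (wT k) (w k) (c k) hi hj).trans (hc k).2
  have hstep : ∀ k, dist (c k i j) (c (k+1) i j) ≤ (B * Y) * s ^ k := by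
    intro k
    have h1 := N2_sub ((hLw (k+1) i j).sub (LB.const (c k i j))) ((hLw (k+1) i j).sub (LB.const (c (k+1) i j))) t 1
    have e : (fun z => (w (k+1) i j z - c k i j) - (w (k+1) i j z - c (k+1) i j)) = fun _ => c (k+1) i j - c k i j := by
      funext z; ring
    rw [e, N2_constCb] at h1
    have h2 : T * N2 t 1 (fun z => w (k+1) i j z - c k i j) ≤ A * (Y * s ^ k) ^ 2 := by
      rw [← N2_dl ((hLw k i j).sub (LB.const (c k i j))) t hθ0 (fun z hz => by rw [hdw k i j z hz])]
      exact (N2_mono ((hLw k i j).sub (LB.const (c k i j))) t hθ0.le (by linarith)).trans (hN k)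
    have h3 := hN (k+1)
    have h4 : A * (Y * s ^ (k+1)) ^ 2 ≤ A * (Y * s ^ k) ^ 2 := by
      gcongr ?_ * (?_ * ?_) ^ 2
      exact pow_le_pow_of_le_one hs0.le hs1.le (by omega)
    have h5 : N2 t 1 (fun z => w (k+1) i j z - c k i j) ≤ A * (Y * s ^ k) ^ 2 / T := by
      rw [le_div_iff₀ hT0]; linarith
    have h6 : A * (Y * s ^ k) ^ 2 ≤ A * (Y * s ^ k) ^ 2 / T := by
      rw [le_div_iff₀ hT0]
      have : 0 ≤ A * (Y * s ^ k) ^ 2 := by positivity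
      nlinarith
    rw [dist_comm, Real.dist_eq]
    refine abs_le_of_sq_le_sq ?_ (by positivity)
    have h7 : (c (k+1) i j - c k i j) ^ 2 ≤ (c (k+1) i j - c k i j) ^ 2 * V := le_mul_of_one_le_right (sq_nonneg _) hV1
    calc (c (k+1) i j - c k i j) ^ 2 ≤ 4 * (A * (Y * s ^ k) ^ 2 / T) := by linarith
      _ = (4 * A / T) * (Y * s ^ k) ^ 2 := by ring
      _ = _ := by rw [← hB2]; ring
  have htend : Tendsto (fun k => c k i j) atTop (nhds (cinf i j)) := by
    have hb : ∀ k, ∀ ε : ℝ, (∀ z ∈ Cb t 1, |w k i j z - cinf i j| ≤ ε) → (c k i j - cinf i j) ^ 2 ≤ 2 * (A * (Y * s ^ k) ^ 2) + 2 * (ε ^ 2 * V) := by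
      intro k ε hz
      have h1 := N2_sub ((hLw k i j).sub (LB.const (cinf i j))) ((hLw k i j).sub (LB.const (c k i j))) t 1
      have e : (fun z => (w k i j z - cinf i j) - (w k i j z - c k i j)) = fun _ => c k i j - cinf i j := by
        funext z; ring
      rw [e, N2_constCb] at h1
      have h2 := N2_bdd ((hLw k i j).sub (LB.const (cinf i j))) t zero_le_one (X := ε ^ 2) (fun z hz' => by
        have := abs_le.1 (hz z hz'); exact sq_le_sq' this.1 this.2)
      rw [one_pow, mul_one] at h2
      have h7 : (c k i j - cinf i j) ^ 2 ≤ (c k i j - cinf i j) ^ 2 * V := le_mul_of_one_le_right (sq_nonneg _) hV1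
      have := hN k
      linarith
    have hz : Tendsto (fun k => 2 * (A * (Y * s ^ k) ^ 2)) atTop (nhds 0) := by
      have := ((tendsto_pow_atTop_nhds_zero_of_lt_one hs0.le hs1).const_mul Y).pow 2
      have := (this.const_mul A).const_mul 2
      simpa using this
    rw [Metric.tendsto_atTop]
    intro η hη
    obtain ⟨k0, hk0⟩ := hlim i j hi hj (η / Real.sqrt (4 * V)) (by positivity)
    obtain ⟨k1, hk1⟩ := (eventually_atTop.1 (hz.eventually (gt_mem_nhds (show 0 < η ^ 2 / 2 by positivity))))
    refine ⟨max k0 k1, fun k hk => ?_⟩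
    have h1 := hb k _ (hk0 k (le_of_max_le_left hk))
    have h2 := hk1 k (le_of_max_le_right hk)
    have h3 : (η / Real.sqrt (4 * V)) ^ 2 * V = η ^ 2 / 4 := by
      rw [div_pow, Real.sq_sqrt (by positivity)]; field_simp
    rw [Real.dist_eq]
    refine abs_lt_of_sq_lt_sq ?_ hη.le
    rw [h3] at h1; linarith
  have hd := dist_le_of_le_geometric_of_tendsto s (B * Y) hs1 hstep htend k
  rw [Real.dist_eq] at hd
  have hd2 : (c k i j - cinf i j) ^ 2 ≤ (B / (1 - s)) ^ 2 * (Y * s ^ k) ^ 2 := by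
    have := abs_le.1 hd
    have := sq_le_sq' this.1 this.2
    calc _ ≤ _ := this
      _ = _ := by ring
  have h1 := N2_add ((hLw k i j).sub (LB.const (c k i j))) (LB.const (c k i j - cinf i j)) t 1
  have e : (fun z => (w k i j z - c k i j) + (c k i j - cinf i j)) = fun z => w k i j z - cinf i j := by
    funext z; ring
  rw [e, N2_constCb] at h1
  have := hN k
  have h8 : (c k i j - cinf i j) ^ 2 * V ≤ (B / (1 - s)) ^ 2 * (Y * s ^ k) ^ 2 * V := by gcongr
  calc _ ≤ _ := h1
    _ ≤ 2 * (A * (Y * s ^ k) ^ 2) + 2 * ((B / (1 - s)) ^ 2 * (Y * s ^ k) ^ 2 * V) := by linarith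
    _ = _ := by ring

end it
end PSP

namespace PSP
open scoped ContDiff ENNReal
section moll
variable {E : Type} [NormedAddCommGroup E] [NormedSpace ℝ E] [FiniteDimensional ℝ E] [MeasurableSpace E] [BorelSpace E]
  (μ : Measure E) [μ.IsAddHaarMeasure]
open scoped Convolution
open ContinuousLinearMap

lemma ind_meas {K : Set E} (hK : IsCompact K) {g : E → ℝ} (hg : ContinuousOn g K) : Measurable (K.indicator g) := by
  classical
  rw [← piecewise_eq_indicator]
  exact hg.measurable_piecewise (g := 0) continuousOn_const hK.measurableSet

lemma ind_bdd {K : Set E} (hK : IsCompact K) {g : E → ℝ} (hg : ContinuousOn g K) : ∃ C : ℝ, 0 ≤ C ∧ ∀ z, |K.indicator g z| ≤ C := by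
  obtain ⟨C, hC⟩ := hK.exists_bound_of_continuousOn hg
  refine ⟨|C|, abs_nonneg _, fun z => ?_⟩
  by_cases hz : z ∈ K
  · rw [indicator_of_mem hz]; exact (hC z hz).trans (le_abs_self _)
  · rw [indicator_of_notMem hz, abs_zero]; positivity

lemma ind_locint {K : Set E} (hK : IsCompact K) {g : E → ℝ} (hg : ContinuousOn g K) : LocallyIntegrable (K.indicator g) μ := by
  have : Integrable (K.indicator g) μ := (integrable_indicator_iff hK.measurableSet).2 (hg.integrableOn_compact hK)
  exact this.locallyIntegrable

/-- the mollification -/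
def mo (φ : ContDiffBump (0:E)) (g : E → ℝ) : E → ℝ := (φ.normed μ) ⋆[lsmul ℝ ℝ, μ] g

lemma mo_smooth (φ : ContDiffBump (0:E)) {K : Set E} (hK : IsCompact K) {g : E → ℝ} (hg : ContinuousOn g K) :
    ContDiff ℝ ∞ (mo μ φ (K.indicator g)) :=
  φ.hasCompactSupport_normed.contDiff_convolution_left (n := ⊤) (lsmul ℝ ℝ) φ.contDiff_normed (ind_locint μ hK hg)

lemma mo_fderiv (φ : ContDiffBump (0:E)) {K : Set E} (hK : IsCompact K) {g g' : E → ℝ} (hg : ContinuousOn g K) (hg' : ContinuousOn g' K)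
    (v : E) (hd : ∀ x ∈ K, HasDerivAt (fun s : ℝ => g (x + s • v)) (g' x) 0) {z : E} {η : ℝ} (hη : 0 < η)
    (hz : ball z (φ.rOut + η) ⊆ K) :
    fderiv ℝ (mo μ φ (K.indicator g)) z v = mo μ φ (K.indicator g') z := by
  have h1 : HasDerivAt (fun s : ℝ => mo μ φ (K.indicator g) (z + s • v)) (fderiv ℝ (mo μ φ (K.indicator g)) z v) 0 := by
    have hh : HasFDerivAt (mo μ φ (K.indicator g)) (fderiv ℝ (mo μ φ (K.indicator g)) z) (z + (0:ℝ) • v) := by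
      rw [zero_smul, add_zero]
      exact ((mo_smooth μ φ hK hg).differentiable (by simp)).differentiableAt.hasFDerivAt
    have h2 : HasDerivAt (fun s : ℝ => z + s • v) v 0 := by
      simpa using ((hasDerivAt_id (0:ℝ)).smul_const v).const_add z
    exact hh.comp_hasDerivAt (0:ℝ) h2
  obtain ⟨C, hC0, hC⟩ := ind_bdd hK hg'
  obtain ⟨C1, hC10, hC1⟩ := ind_bdd hK hg
  have hφm : Measurable (φ.normed μ) := φ.continuous_normed.measurable
  set s : Set ℝ := {x | ‖x • v‖ < η} with hsdef
  have hso : IsOpen s := isOpen_lt (by fun_prop) continuous_const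
  have hs : s ∈ nhds (0:ℝ) := hso.mem_nhds (by simp [hsdef, hη])
  have h3 := hasDerivAt_integral_of_dominated_loc_of_deriv_le (μ := μ) (x₀ := (0:ℝ)) (s := s)
    (F := fun x a => φ.normed μ a * K.indicator g (z + x • v - a)) (F' := fun x a => φ.normed μ a * K.indicator g' (z + x • v - a))
    (bound := fun a => φ.normed μ a * C) hs ?_ ?_ ?_ ?_ (φ.integrable_normed.mul_const C) ?_
  · have h4 : HasDerivAt (fun s : ℝ => mo μ φ (K.indicator g) (z + s • v)) (∫ a, φ.normed μ a * K.indicator g' (z + (0:ℝ) • v - a) ∂μ) 0 := h3.2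
    rw [h1.unique h4]
    simp [mo, convolution]
  · refine Eventually.of_forall fun x => (Measurable.aestronglyMeasurable ?_)
    exact hφm.mul ((ind_meas hK hg).comp (by fun_prop))
  · refine (φ.integrable_normed.mul_const C1).mono' ?_ (ae_of_all _ fun a => ?_)
    · exact (hφm.mul ((ind_meas hK hg).comp (by fun_prop))).aestronglyMeasurable
    · rw [norm_mul, Real.norm_of_nonneg (φ.nonneg_normed a)]
      exact mul_le_mul_of_nonneg_left (hC1 _) (φ.nonneg_normed a)
  · exact (hφm.mul ((ind_meas hK hg').comp (by fun_prop))).aestronglyMeasurable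
  · refine ae_of_all _ fun a x _ => ?_
    rw [norm_mul, Real.norm_of_nonneg (φ.nonneg_normed a)]
    exact mul_le_mul_of_nonneg_left (hC _) (φ.nonneg_normed a)
  · refine ae_of_all _ fun a x hx => ?_
    by_cases ha : a ∈ ball (0:E) φ.rOut
    · refine HasDerivAt.const_mul _ ?_
      have hin : ∀ y ∈ s, z + y • v - a ∈ K := by
        intro y hy
        refine hz ?_
        rw [mem_ball, dist_eq_norm]
        have : z + y • v - a - z = y • v - a := by abel
        rw [this]
        have h5 := norm_sub_le (y • v) a
        rw [mem_ball_zero_iff] at ha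
        have h6 : ‖y • v‖ < η := hy
        linarith
      have h6 := hd _ (hin x hx)
      have h7 : HasDerivAt (fun y : ℝ => g (z + y • v - a)) (g' (z + x • v - a)) x := by
        have h8 : HasDerivAt (fun y : ℝ => y - x) 1 x := (hasDerivAt_id x).sub_const x
        have h6' : HasDerivAt (fun s : ℝ => g (z + x • v - a + s • v)) (g' (z + x • v - a)) (x - x) := by rwa [sub_self]
        have h9 := HasDerivAt.scomp (h := fun y : ℝ => y - x) x h6' h8
        rw [one_smul] at h9
        refine h9.congr_of_eventuallyEq (Eventually.of_forall fun y => ?_)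
        simp only [Function.comp]
        congr 1
        rw [sub_smul]; abel
      rw [indicator_of_mem (hin x hx)]
      refine h7.congr_of_eventuallyEq ?_
      filter_upwards [hso.mem_nhds hx] with y hy
      rw [indicator_of_mem (hin y hy)]
    · have : φ.normed μ a = 0 := by
        rw [← Function.notMem_support, φ.support_normed_eq]; exact ha
      simp only [this, zero_mul]
      exact hasDerivAt_const x (0:ℝ)

lemma mo_approx (φ : ContDiffBump (0:E)) {K : Set E} (hK : IsCompact K) {g : E → ℝ} (hg : ContinuousOn g K) {z : E} {ε : ℝ}
    (hz : ball z φ.rOut ⊆ K) (hε : ∀ x ∈ ball z φ.rOut, |g x - g z| ≤ ε) : |mo μ φ (K.indicator g) z - g z| ≤ ε := by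
  have hzK : z ∈ K := hz (mem_ball_self φ.rOut_pos)
  have := φ.dist_normed_convolution_le (μ := μ) (g := K.indicator g) (x₀ := z) (ε := ε) (ind_meas hK hg).aestronglyMeasurable (fun x hx => by
    rw [indicator_of_mem (hz hx), indicator_of_mem hzK]; exact hε x hx)
  rw [indicator_of_mem hzK] at this
  exact this

/-- uniform modulus on neighbourhoods -/
lemma unif_near {K : Set E} (hK : IsCompact K) {g : E → ℝ} (hg : ContinuousOn g K) {ε : ℝ} (hε : 0 < ε) :
    ∃ ρ > 0, ∀ x ∈ K, ∀ y ∈ K, dist x y < ρ → |g x - g y| ≤ ε := by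
  have := hK.uniformContinuousOn_of_continuous hg
  rw [Metric.uniformContinuousOn_iff] at this
  obtain ⟨ρ, hρ, h⟩ := this ε hε
  exact ⟨ρ, hρ, fun x hx y hy hxy => (h x hx y hy hxy).le⟩

end moll

section pc
variable {n : ℕ}


lemma parQ_open (d : ℕ) (ρ : ℝ) : IsOpen (parQ d ρ) := isOpen_Ioo.prod isOpen_ball

lemma pc_dt {u : ℝ → (EuclideanSpace ℝ (Fin n)) → ℝ} {Q : Set (ℝ × (EuclideanSpace ℝ (Fin n)))} (hu : ParClassical Q u) {z : ℝ × (EuclideanSpace ℝ (Fin n))} (hz : z ∈ Q) :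
    HasDerivAt (fun s : ℝ => u (z + s • ((1:ℝ), (0:EuclideanSpace ℝ (Fin n)))).1 (z + s • ((1:ℝ), (0:EuclideanSpace ℝ (Fin n)))).2) (td u z.1 z.2) 0 := by
  have h := (hu.1 z hz).hasDerivAt
  have h8 : HasDerivAt (fun y : ℝ => z.1 + y) 1 0 := (hasDerivAt_id (0:ℝ)).const_add z.1
  have h' : HasDerivAt (fun s => u s z.2) (td u z.1 z.2) (z.1 + 0) := by rw [add_zero]; exact h
  have h9 := h'.scomp (0:ℝ) h8
  rw [one_smul] at h9
  refine h9.congr_of_eventuallyEq (Eventually.of_forall fun y => ?_)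
  simp [Function.comp]

lemma line_sd {v : (EuclideanSpace ℝ (Fin n)) → ℝ} {x : (EuclideanSpace ℝ (Fin n))} (hv : DifferentiableAt ℝ v x) (j : Fin n) :
    HasDerivAt (fun s : ℝ => v (x + s • EuclideanSpace.single j (1:ℝ))) (sd j v x) 0 := by
  have hh : HasFDerivAt v (fderiv ℝ v x) (x + (0:ℝ) • EuclideanSpace.single j (1:ℝ)) := by
    rw [zero_smul, add_zero]; exact hv.hasFDerivAt
  have h2 : HasDerivAt (fun s : ℝ => x + s • EuclideanSpace.single j (1:ℝ)) (EuclideanSpace.single j (1:ℝ)) 0 := by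
    simpa using ((hasDerivAt_id (0:ℝ)).smul_const (EuclideanSpace.single j (1:ℝ))).const_add x
  exact hh.comp_hasDerivAt (0:ℝ) h2

lemma sd_diff {v : (EuclideanSpace ℝ (Fin n)) → ℝ} {x : (EuclideanSpace ℝ (Fin n))} (hv : ContDiffAt ℝ 2 v x) (j : Fin n) : DifferentiableAt ℝ (fun y => sd j v y) x := by
  have h1 : ContDiffAt ℝ 1 (fderiv ℝ v) x := hv.fderiv_right (by norm_num)
  exact (h1.differentiableAt (by norm_num)).clm_apply (differentiableAt_const _)

lemma sd2_comm {v : (EuclideanSpace ℝ (Fin n)) → ℝ} {x : (EuclideanSpace ℝ (Fin n))} (hv : ContDiffAt ℝ 2 v x) (i j : Fin n) : sd2 i j v x = sd2 j i v x := by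
  have hs := hv.isSymmSndFDerivAt (by simp)
  have h1 : DifferentiableAt ℝ (fderiv ℝ v) x := (hv.fderiv_right (m := 1) (by norm_num)).differentiableAt (by norm_num)
  have e : ∀ i j, sd2 i j v x = fderiv ℝ (fderiv ℝ v) x (EuclideanSpace.single i 1) (EuclideanSpace.single j 1) := by
    intro i j
    unfold sd2 sd
    rw [fderiv_clm_apply h1 (differentiableAt_const _)]
    simp
  rw [e, e]; exact hs _ _

lemma pc_sd {u : ℝ → (EuclideanSpace ℝ (Fin n)) → ℝ} {Q : Set (ℝ × (EuclideanSpace ℝ (Fin n)))} (hu : ParClassical Q u) {z : ℝ × (EuclideanSpace ℝ (Fin n))} (hz : z ∈ Q) (j : Fin n) :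
    HasDerivAt (fun s : ℝ => u (z + s • ((0:ℝ), (EuclideanSpace.single j (1:ℝ) : (EuclideanSpace ℝ (Fin n))))).1 (z + s • ((0:ℝ), (EuclideanSpace.single j (1:ℝ) : (EuclideanSpace ℝ (Fin n))))).2) (sd j (u z.1) z.2) 0 := by
  have := line_sd ((hu.2.1 z hz).differentiableAt (by norm_num)) j
  simpa using this

lemma pc_sd2 {u : ℝ → (EuclideanSpace ℝ (Fin n)) → ℝ} {Q : Set (ℝ × (EuclideanSpace ℝ (Fin n)))} (hu : ParClassical Q u) {z : ℝ × (EuclideanSpace ℝ (Fin n))} (hz : z ∈ Q) (i j : Fin n) :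
    HasDerivAt (fun s : ℝ => sd j (u (z + s • ((0:ℝ), (EuclideanSpace.single i (1:ℝ) : (EuclideanSpace ℝ (Fin n))))).1) (z + s • ((0:ℝ), (EuclideanSpace.single i (1:ℝ) : (EuclideanSpace ℝ (Fin n))))).2) (sd2 i j (u z.1) z.2) 0 := by
  have := line_sd (sd_diff (hu.2.1 z hz) j) i
  simpa [sd2] using this

set_option maxHeartbeats 1000000 in
lemma approx {u : ℝ → (EuclideanSpace ℝ (Fin n)) → ℝ} {Q : Set (ℝ × (EuclideanSpace ℝ (Fin n)))} (hQ : IsOpen Q) (hu : ParClassical Q u) {K : Set (ℝ × (EuclideanSpace ℝ (Fin n)))} (hK : IsCompact K) (hKQ : K ⊆ Q)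
    {ε : ℝ} (hε : 0 < ε) : ∃ U : ℝ × (EuclideanSpace ℝ (Fin n)) → ℝ, ContDiff ℝ ∞ U ∧ ∀ z ∈ K, |fderiv ℝ U z ((1:ℝ), (0:EuclideanSpace ℝ (Fin n))) - td u z.1 z.2| ≤ ε ∧
      ∀ i j, |fderiv ℝ (fun y => fderiv ℝ U y ((0:ℝ), (EuclideanSpace.single j (1:ℝ) : (EuclideanSpace ℝ (Fin n))))) z ((0:ℝ), (EuclideanSpace.single i (1:ℝ) : (EuclideanSpace ℝ (Fin n)))) - sd2 i j (u z.1) z.2| ≤ ε := by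
  haveI : (volume : Measure (ℝ × EuclideanSpace ℝ (Fin n))).IsAddHaarMeasure := by
    rw [Measure.volume_eq_prod]; infer_instance
  obtain ⟨ρ, hρ, hρQ⟩ := hK.exists_cthickening_subset_open hQ hKQ
  set K0 := cthickening ρ K with hK0
  have hK0c : IsCompact K0 := hK.cthickening
  obtain ⟨h1, h2, h3, h4, h5, h6⟩ := hu
  have hu : ParClassical Q u := ⟨h1, h2, h3, h4, h5, h6⟩
  obtain ⟨ρt, hρt, ht⟩ := unif_near hK0c (h4.mono hρQ) hε
  have : ∀ i j : Fin n, ∃ r > 0, ∀ x ∈ K0, ∀ y ∈ K0, dist x y < r → |sd2 i j (u x.1) x.2 - sd2 i j (u y.1) y.2| ≤ ε :=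
    fun i j => unif_near hK0c ((h6 i j).mono hρQ) hε
  choose r hr hrr using this
  obtain ⟨r0, hr0, hr0'⟩ : ∃ r0 > 0, ∀ i j, r0 ≤ r i j := by
    rcases isEmpty_or_nonempty (Fin n) with he | he
    · exact ⟨1, one_pos, fun i => he.elim i⟩
    · obtain ⟨p, hp⟩ := Finite.exists_min (fun p : Fin n × Fin n => r p.1 p.2)
      exact ⟨_, hr p.1 p.2, fun i j => hp (i, j)⟩
  set σ := min (ρ / 3) (min ρt r0) with hσ
  have hσ0 : 0 < σ := by positivity
  set φ : ContDiffBump (0 : ℝ × (EuclideanSpace ℝ (Fin n))) := ⟨σ / 2, σ, by positivity, by linarith⟩ with hφ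
  have hφr : φ.rOut = σ := rfl
  have hσρ : σ ≤ ρ / 3 := min_le_left _ _
  have hball : ∀ z ∈ K, ball z ρ ⊆ K0 := by
    intro z hz y hy
    exact mem_cthickening_of_dist_le y z ρ K hz (mem_ball.1 hy).le
  refine ⟨mo volume φ (K0.indicator (fun z => u z.1 z.2)), mo_smooth volume φ hK0c (h3.mono hρQ), fun z hz => ?_⟩
  have hb1 : ball z (φ.rOut + ρ / 3) ⊆ K0 := (ball_subset_ball (by rw [hφr]; linarith)).trans (hball z hz)
  have hb0 : ball z (φ.rOut) ⊆ K0 := (ball_subset_ball (by linarith)).trans hb1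
  have hzK : z ∈ K0 := hb0 (mem_ball_self φ.rOut_pos)
  refine ⟨?_, fun i j => ?_⟩
  · rw [mo_fderiv volume φ hK0c (h3.mono hρQ) (h4.mono hρQ) _ (fun x hx => pc_dt hu (hρQ hx)) (by positivity : 0 < ρ / 3) hb1]
    refine mo_approx volume φ hK0c (g := fun z => td u z.1 z.2) (h4.mono hρQ) hb0 (fun x hx => ht x (hb0 hx) z hzK ?_)
    exact lt_of_lt_of_le (mem_ball.1 hx) ((min_le_right _ _).trans (min_le_left _ _))
  · have hev : (fun y => fderiv ℝ (mo volume φ (K0.indicator (fun z => u z.1 z.2))) y ((0:ℝ), (EuclideanSpace.single j (1:ℝ) : (EuclideanSpace ℝ (Fin n)))))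
        =ᶠ[nhds z] mo volume φ (K0.indicator (fun z => sd j (u z.1) z.2)) := by
      filter_upwards [ball_mem_nhds z (by positivity : 0 < ρ / 3)] with y hy
      refine mo_fderiv volume φ hK0c (h3.mono hρQ) ((h5 j).mono hρQ) _ (fun x hx => pc_sd hu (hρQ hx) j) (by positivity : 0 < ρ / 3) ?_
      refine (ball_subset_ball' ?_).trans (hball z hz)
      rw [hφr]; rw [mem_ball] at hy; linarith
    rw [hev.fderiv_eq, mo_fderiv volume φ hK0c ((h5 j).mono hρQ) ((h6 i j).mono hρQ) _ (fun x hx => pc_sd2 hu (hρQ hx) i j) (by positivity : 0 < ρ / 3) hb1]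
    refine mo_approx volume φ hK0c (g := fun z => sd2 i j (u z.1) z.2) ((h6 i j).mono hρQ) hb0 (fun x hx => hrr i j x (hb0 hx) z hzK ?_)
    exact lt_of_lt_of_le (mem_ball.1 hx) (((min_le_right _ _).trans (min_le_right _ _)).trans (hr0' i j))

end pc
end PSP

namespace PSP
open scoped ContDiff ENNReal

/-- index type: space indices, time and doubling variable -/
abbrev Ix (n : ℕ) := Fin n ⊕ Fin 2
abbrev ES (n : ℕ) := EuclideanSpace ℝ (Fin n)
def tt {n : ℕ} : Ix n := Sum.inr 0
def hh {n : ℕ} : Ix n := Sum.inr 1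

section setup
variable {n : ℕ}

lemma tt_ne_hh : (tt : Ix n) ≠ hh := by simp [tt, hh]
lemma inl_ne_tt (k : Fin n) : (Sum.inl k : Ix n) ≠ tt := by simp [tt]
lemma inl_ne_hh (k : Fin n) : (Sum.inl k : Ix n) ≠ hh := by simp [hh]

/-- unit vectors -/
def eu (k : Fin n) : ES n := EuclideanSpace.single k (1:ℝ)

/-- the linear part -/
def LA (e : Fin n) (r σ : ℝ) : (Ix n → ℝ) →L[ℝ] ℝ × ES n :=
  (r ^ 2 • ContinuousLinearMap.proj (R := ℝ) (φ := fun _ : Ix n => ℝ) (tt : Ix n)).prod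
    ((∑ k : Fin n, (r • ContinuousLinearMap.proj (R := ℝ) (φ := fun _ : Ix n => ℝ) (Sum.inl k : Ix n)).smulRight (eu k)) +
      ((r * σ) • ContinuousLinearMap.proj (R := ℝ) (φ := fun _ : Ix n => ℝ) (hh : Ix n)).smulRight (eu e))

lemma LA_apply (e : Fin n) (r σ : ℝ) (z : Ix n → ℝ) :
    LA e r σ z = (r ^ 2 * z tt, (∑ k, (r * z (Sum.inl k)) • eu k) + (r * σ * z hh) • eu e) := by
  unfold LA
  ext1
  · simp
  · simp [ContinuousLinearMap.sum_apply]

/-- the affine change of variables -/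
def Am (e : Fin n) (z0 : ℝ × ES n) (r σ : ℝ) (z : Ix n → ℝ) : ℝ × ES n := z0 + LA e r σ z

def ix (e : Fin n) : Ix n → Fin n := Sum.elim id (fun _ => e)
def sg (i : Ix n) : ℝ := if i = hh then -1 else 1

lemma LA_t (e : Fin n) (r σ : ℝ) : LA e r σ (ev tt) = r ^ 2 • ((1:ℝ), (0 : ES n)) := by
  rw [LA_apply]
  simp [ev, tt, hh, Pi.single_apply]

lemma LA_p (e : Fin n) (r : ℝ) {j : Ix n} (hj : j ≠ tt) : LA e r 1 (ev j) = r • ((0:ℝ), eu (ix e j)) := by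
  rw [LA_apply]
  rcases j with k | m
  · simp [ev, tt, hh, Pi.single_apply, ix]
  · have : m = 1 := by
      rcases Fin.exists_fin_two.1 ⟨m, rfl⟩ with h | h
      · exact absurd (by rw [h]; rfl) hj
      · exact h.symm ▸ rfl
    subst this
    simp [ev, tt, hh, Pi.single_apply, ix]

lemma LA_m (e : Fin n) (r : ℝ) {j : Ix n} (hj : j ≠ tt) : LA e r (-1) (ev j) = (sg j * r) • ((0:ℝ), eu (ix e j)) := by
  rw [LA_apply]
  rcases j with k | m
  · simp [ev, tt, hh, Pi.single_apply, ix, sg]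
  · have : m = 1 := by
      rcases Fin.exists_fin_two.1 ⟨m, rfl⟩ with h | h
      · exact absurd (by rw [h]; rfl) hj
      · exact h.symm ▸ rfl
    subst this
    simp [ev, tt, hh, Pi.single_apply, ix, sg]

lemma Am_cont (e : Fin n) (z0 : ℝ × ES n) (r σ : ℝ) : Continuous (Am e z0 r σ) := by unfold Am; fun_prop
lemma Am_smooth (e : Fin n) (z0 : ℝ × ES n) (r σ : ℝ) : ContDiff ℝ ∞ (Am e z0 r σ) := by
  unfold Am; exact contDiff_const.add (LA e r σ).contDiff

lemma Am_fl (e : Fin n) (z0 : ℝ × ES n) (r σ : ℝ) (z : Ix n → ℝ) : Am e z0 r σ (fl hh z) = Am e z0 r (-σ) z := by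
  unfold Am; rw [LA_apply, LA_apply]
  simp [fl, tt, hh, Function.update_apply]

lemma Am_dl (e : Fin n) (z0 : ℝ × ES n) (r θ σ : ℝ) (z : Ix n → ℝ) : Am e z0 (r * θ) σ z = Am e z0 r σ (dl tt θ z) := by
  unfold Am; rw [LA_apply, LA_apply]
  have h1 : ∀ k : Fin n, ¬ (Sum.inl k : Ix n) = tt := fun k => inl_ne_tt k
  have h2 : ¬ (hh : Ix n) = tt := tt_ne_hh.symm
  simp only [dl, h1, h2, if_false, if_true]
  congr 2
  · ring
  · congr 2
    · funext k; congr 1; ring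
    · ring

lemma Am_fst (e : Fin n) (z0 : ℝ × ES n) (r σ : ℝ) (z : Ix n → ℝ) : (Am e z0 r σ z).1 = z0.1 + r ^ 2 * z tt := by
  unfold Am; rw [LA_apply]; rfl

lemma Am_snd (e : Fin n) (z0 : ℝ × ES n) (r σ : ℝ) (z : Ix n → ℝ) : (Am e z0 r σ z).2 =
    z0.2 + ((∑ k, (r * z (Sum.inl k)) • eu k) + (r * σ * z hh) • eu e) := by
  unfold Am; rw [LA_apply]; rfl

lemma norm_eu (k : Fin n) : ‖eu k‖ = 1 := by simp [eu]

lemma Am_dist (e : Fin n) (z0 : ℝ × ES n) {r σ : ℝ} (hr : 0 ≤ r) (hσ : |σ| ≤ 1) {z : Ix n → ℝ} (hz : z ∈ Cb tt 1) :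
    dist (Am e z0 r σ z).2 z0.2 ≤ r * (n + 1) := by
  rw [Am_snd, dist_eq_norm, add_sub_cancel_left]
  have hk : ∀ k : Fin n, ‖(r * z (Sum.inl k)) • eu k‖ ≤ r := by
    intro k
    rw [norm_smul, norm_eu, mul_one, norm_mul, Real.norm_of_nonneg hr, Real.norm_eq_abs]
    exact mul_le_of_le_one_right hr (hz.2.2 _ (inl_ne_tt k))
  have hh' : ‖(r * σ * z hh) • eu e‖ ≤ r := by
    rw [norm_smul, norm_eu, mul_one, norm_mul, norm_mul, Real.norm_of_nonneg hr, Real.norm_eq_abs, Real.norm_eq_abs]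
    have h1 := hz.2.2 hh tt_ne_hh.symm
    calc r * |σ| * |z hh| ≤ r * 1 * 1 := by gcongr
      _ = r := by ring
  calc _ ≤ ‖∑ k, (r * z (Sum.inl k)) • eu k‖ + ‖(r * σ * z hh) • eu e‖ := norm_add_le _ _
    _ ≤ (∑ k : Fin n, r) + r := add_le_add ((norm_sum_le _ _).trans (Finset.sum_le_sum fun k _ => hk k)) hh'
    _ = _ := by simp; ring

/-- the region of base points -/
def Rg (n : ℕ) : Set (ℝ × ES n) := Ioo (-(9/16)) 0 ×ˢ ball (0 : ES n) (3/4)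

lemma Am_mem (e : Fin n) {z0 : ℝ × ES n} (h0 : z0 ∈ Rg n) {r σ : ℝ} (hr : 0 ≤ r) (hr1 : r ≤ 1 / (8 * (n + 1))) (hσ : |σ| ≤ 1) {z : Ix n → ℝ} (hz : z ∈ Cb tt 1) :
    Am e z0 r σ z ∈ parQ n 1 := by
  have hd := Am_dist e z0 hr hσ hz
  have hrn : r * (n + 1) ≤ 1 / 8 := by
    rw [le_div_iff₀ (by positivity)] at hr1; linarith
  have hr8 : r ≤ 1 / 8 := by nlinarith [mul_nonneg hr (Nat.cast_nonneg n : (0:ℝ) ≤ n)]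
  obtain ⟨⟨ht1, ht2⟩, hx⟩ := h0
  obtain ⟨hz1, hz2, -⟩ := hz
  refine ⟨⟨?_, ?_⟩, ?_⟩
  · rw [Am_fst]; nlinarith
  · rw [Am_fst]; nlinarith [sq_nonneg r]
  · rw [mem_ball] at hx ⊢
    linarith [dist_triangle (Am e z0 r σ z).2 z0.2 0]

lemma Cb_compact {ι : Type} [Fintype ι] [DecidableEq ι] (t : ι) (ρ : ℝ) : IsCompact (Cb t ρ) :=
  Metric.isCompact_of_isClosed_isBounded (Cb_closed t ρ) (Cb_bdd t ρ)

/-- the doubled functions -/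
def dT (e : Fin n) (g : ℝ → ES n → ℝ) (z0 : ℝ × ES n) (r : ℝ) : (Ix n → ℝ) → ℝ := (Cb tt 1).indicator fun z =>
  g (Am e z0 r 1 z).1 (Am e z0 r 1 z).2 - g (Am e z0 r (-1) z).1 (Am e z0 r (-1) z).2
def dW (e : Fin n) (u : ℝ → ES n → ℝ) (z0 : ℝ × ES n) (r : ℝ) (i j : Ix n) : (Ix n → ℝ) → ℝ := (Cb tt 1).indicator fun z =>
  sd2 (ix e i) (ix e j) (u (Am e z0 r 1 z).1) (Am e z0 r 1 z).2 - sg i * sg j * sd2 (ix e i) (ix e j) (u (Am e z0 r (-1) z).1) (Am e z0 r (-1) z).2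

lemma LB_ind {ι : Type} [Fintype ι] [DecidableEq ι] (t : ι) {g : (ι → ℝ) → ℝ} (hg : ContinuousOn g (Cb t 1)) : LB ((Cb t 1).indicator g) := by
  obtain ⟨C, _, hC⟩ := ind_bdd (Cb_compact t 1) hg
  exact ⟨ind_meas (Cb_compact t 1) hg, fun R => ⟨C, fun z _ => hC z⟩⟩

lemma comp_Am (e : Fin n) {z0 : ℝ × ES n} (h0 : z0 ∈ Rg n) {r σ : ℝ} (hr : 0 ≤ r) (hr1 : r ≤ 1 / (8 * (n + 1))) (hσ : |σ| ≤ 1)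
    {G : ℝ × ES n → ℝ} (hG : ContinuousOn G (parQ n 1)) : ContinuousOn (fun z => G (Am e z0 r σ z)) (Cb tt 1) :=
  hG.comp (Am_cont e z0 r σ).continuousOn fun z hz => Am_mem e h0 hr hr1 hσ hz

lemma dT_LB (e : Fin n) {u : ℝ → ES n → ℝ} (hu : ParClassical (parQ n 1) u) {z0 : ℝ × ES n} (h0 : z0 ∈ Rg n) {r : ℝ} (hr : 0 ≤ r) (hr1 : r ≤ 1 / (8 * (n + 1))) :
    LB (dT e (td u) z0 r) :=
  LB_ind tt ((comp_Am e h0 hr hr1 (by simp) hu.2.2.2.1).sub (comp_Am e h0 hr hr1 (by simp) hu.2.2.2.1))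

lemma dW_LB (e : Fin n) {u : ℝ → ES n → ℝ} (hu : ParClassical (parQ n 1) u) {z0 : ℝ × ES n} (h0 : z0 ∈ Rg n) {r : ℝ} (hr : 0 ≤ r) (hr1 : r ≤ 1 / (8 * (n + 1))) (i j : Ix n) :
    LB (dW e u z0 r i j) :=
  LB_ind tt ((comp_Am e h0 hr hr1 (by simp) (hu.2.2.2.2.2 _ _)).sub (continuousOn_const.mul (comp_Am e h0 hr hr1 (by simp) (hu.2.2.2.2.2 _ _))))

lemma pd_compL {U : ℝ × ES n → ℝ} (hU : ContDiff ℝ ∞ U) (e : Fin n) (z0 : ℝ × ES n) (r σ : ℝ) (j : Ix n) (z : Ix n → ℝ) :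
    pd j (fun z => U (Am e z0 r σ z)) z = fderiv ℝ U (Am e z0 r σ z) (LA e r σ (ev j)) := by
  unfold pd
  have h1 : HasFDerivAt (Am e z0 r σ) (LA e r σ) z := (LA e r σ).hasFDerivAt.const_add z0
  have h2 : HasFDerivAt U (fderiv ℝ U (Am e z0 r σ z)) (Am e z0 r σ z) := ((hU.differentiable (by simp)) _).hasFDerivAt
  have h3 : HasFDerivAt (fun z => U (Am e z0 r σ z)) ((fderiv ℝ U (Am e z0 r σ z)).comp (LA e r σ)) z := h2.comp z h1
  rw [h3.fderiv]; rfl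

lemma fd_smooth {U : ℝ × ES n → ℝ} (hU : ContDiff ℝ ∞ U) (v : ℝ × ES n) : ContDiff ℝ ∞ (fun y => fderiv ℝ U y v) :=
  (hU.fderiv_right (m := ∞) (by simp)).clm_apply contDiff_const

set_option maxHeartbeats 1000000 in
lemma dAp (e : Fin n) {u : ℝ → ES n → ℝ} (hu : ParClassical (parQ n 1) u) {z0 : ℝ × ES n} (h0 : z0 ∈ Rg n) {r : ℝ} (hr : 0 < r) (hr1 : r ≤ 1 / (8 * (n + 1))) :
    Ap tt hh (dT e (td u) z0 r) (dW e u z0 r) := by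
  intro ε hε
  have hK : IsCompact (Set.image (Am e z0 r 1) (Cb tt 1) ∪ Set.image (Am e z0 r (-1)) (Cb tt 1)) :=
    ((Cb_compact tt 1).image (Am_cont e z0 r 1)).union ((Cb_compact tt 1).image (Am_cont e z0 r (-1)))
  obtain ⟨U, hU, hap⟩ := approx (parQ_open n 1) hu hK (by
    rintro _ (⟨z, hz, rfl⟩ | ⟨z, hz, rfl⟩)
    · exact Am_mem e h0 hr.le hr1 (by simp) hz
    · exact Am_mem e h0 hr.le hr1 (by simp) hz) (half_pos hε)
  have hs : ∀ σ, ContDiff ℝ ∞ (fun z => U (Am e z0 r σ z)) := fun σ => hU.comp (Am_smooth e z0 r σ)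
  have hr2 : (r ^ 2)⁻¹ * r ^ 2 = 1 := inv_mul_cancel₀ (by positivity)
  refine ⟨fun z => (r ^ 2)⁻¹ * (U (Am e z0 r 1 z) - U (Am e z0 r (-1) z)), contDiff_const.mul ((hs 1).sub (hs (-1))), ?_, fun z hz => ?_⟩
  · intro z
    simp only [Am_fl, neg_neg]; ring
  have hp := hap _ (Or.inl ⟨z, hz, rfl⟩)
  have hm := hap _ (Or.inr ⟨z, hz, rfl⟩)
  have h1 : ∀ j z, pd j (fun z => (r ^ 2)⁻¹ * (U (Am e z0 r 1 z) - U (Am e z0 r (-1) z))) z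
      = (r ^ 2)⁻¹ * (fderiv ℝ U (Am e z0 r 1 z) (LA e r 1 (ev j)) - fderiv ℝ U (Am e z0 r (-1) z) (LA e r (-1) (ev j))) := by
    intro j z
    rw [pd_const_mul ((hs 1).sub (hs (-1))), pd_sub (hs 1) (hs (-1)), pd_compL hU, pd_compL hU]
  constructor
  · rw [h1, LA_t, LA_t, map_smul, map_smul, smul_eq_mul, smul_eq_mul, ← mul_sub, ← mul_assoc, hr2, one_mul, dT, indicator_of_mem hz]
    have a1 := abs_le.1 hp.1
    have a2 := abs_le.1 hm.1
    rw [abs_le]; constructor <;> linarith [a1.1, a1.2, a2.1, a2.2]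
  · intro i j hi hj
    have h2 : pd j (fun z => (r ^ 2)⁻¹ * (U (Am e z0 r 1 z) - U (Am e z0 r (-1) z))) = fun z =>
        (r ^ 2)⁻¹ * r * (fderiv ℝ U (Am e z0 r 1 z) ((0:ℝ), eu (ix e j))) - (r ^ 2)⁻¹ * (sg j * r) * (fderiv ℝ U (Am e z0 r (-1) z) ((0:ℝ), eu (ix e j))) := by
      funext z
      rw [h1, LA_p e r hj, LA_m e r hj, map_smul, map_smul, smul_eq_mul, smul_eq_mul]; ring
    have hs' : ∀ σ, ContDiff ℝ ∞ (fun z => fderiv ℝ U (Am e z0 r σ z) ((0:ℝ), eu (ix e j))) := fun σ => (fd_smooth hU _).comp (Am_smooth e z0 r σ)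
    rw [h2, pd_sub (contDiff_const.mul (hs' 1)) (contDiff_const.mul (hs' (-1))), pd_const_mul (hs' 1), pd_const_mul (hs' (-1)),
      pd_compL (fd_smooth hU _), pd_compL (fd_smooth hU _), LA_p e r hi, LA_m e r hi, map_smul, map_smul, smul_eq_mul, smul_eq_mul, dW, indicator_of_mem hz]
    have a1 := abs_le.1 (hp.2 (ix e i) (ix e j))
    have a2 := abs_le.1 (hm.2 (ix e i) (ix e j))
    unfold eu
    set P := fderiv ℝ (fun y => fderiv ℝ U y ((0:ℝ), (EuclideanSpace.single (ix e j) (1:ℝ)))) (Am e z0 r 1 z) ((0:ℝ), (EuclideanSpace.single (ix e i) (1:ℝ)))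
    set Q := fderiv ℝ (fun y => fderiv ℝ U y ((0:ℝ), (EuclideanSpace.single (ix e j) (1:ℝ)))) (Am e z0 r (-1) z) ((0:ℝ), (EuclideanSpace.single (ix e i) (1:ℝ)))
    have e1 : (r ^ 2)⁻¹ * r * (r * P) - (r ^ 2)⁻¹ * (sg j * r) * (sg i * r * Q) = P - sg i * sg j * Q := by
      calc _ = ((r ^ 2)⁻¹ * r ^ 2) * (P - sg i * sg j * Q) := by ring
        _ = _ := by rw [hr2, one_mul]
    rw [e1]
    have hsg : sg i * sg j = 1 ∨ sg i * sg j = -1 := by unfold sg; split_ifs <;> simp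
    rcases hsg with h | h <;> rw [h, abs_le] <;> constructor <;> linarith [a1.1, a1.2, a2.1, a2.2]

end setup
end PSP

namespace PSP
open scoped ContDiff ENNReal
section coef
variable {n : ℕ}

/-- ellipticity of a constant matrix -/
structure El (ν : ℝ) (α : Fin n → Fin n → ℝ) : Prop where
  symm : ∀ i j, α i j = α j i
  lo : ∀ ξ : Fin n → ℝ, ν * ∑ i, ξ i ^ 2 ≤ ∑ i, ∑ j, α i j * ξ i * ξ j
  hi : ∀ ξ : Fin n → ℝ, ∑ i, ∑ j, α i j * ξ i * ξ j ≤ ν⁻¹ * ∑ i, ξ i ^ 2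

lemma El.diag {ν : ℝ} {α : Fin n → Fin n → ℝ} (H : El ν α) (k : Fin n) : ν ≤ α k k ∧ α k k ≤ ν⁻¹ := by
  have h1 := H.lo (fun i => if i = k then 1 else 0)
  have h2 := H.hi (fun i => if i = k then 1 else 0)
  simp at h1 h2
  exact ⟨h1, h2⟩

lemma El.quad {α : Fin n → Fin n → ℝ} {k l : Fin n} (s : ℝ) :
    ∑ i, ∑ j, α i j * ((if i = k then 1 else 0) + (if i = l then s else 0)) * ((if j = k then 1 else 0) + (if j = l then s else 0))
      = α k k + s * α k l + s * α l k + s ^ 2 * α l l := by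
  simp only [mul_add, add_mul, mul_ite, ite_mul, mul_one, mul_zero, zero_mul, Finset.sum_add_distrib, Finset.sum_ite_eq', Finset.mem_univ, if_true,
    Finset.sum_ite_eq]
  ring

lemma El.bd {ν : ℝ} (hν : 0 < ν) {α : Fin n → Fin n → ℝ} (H : El ν α) (k l : Fin n) : |α k l| ≤ ν⁻¹ := by
  by_cases hkl : k = l
  · subst hkl
    have := H.diag k
    rw [abs_of_nonneg (by linarith)]; exact this.2
  have hs : ∀ s : ℝ, s ^ 2 = 1 → ∑ i, ((if i = k then (1:ℝ) else 0) + (if i = l then s else 0)) ^ 2 = 2 := by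
    intro s hs
    have : ∀ i : Fin n, ((if i = k then (1:ℝ) else 0) + (if i = l then s else 0)) ^ 2 = (if i = k then (1:ℝ) else 0) + (if i = l then 1 else 0) := by
      intro i
      by_cases h1 : i = k
      · have h2 : i ≠ l := by rw [h1]; exact hkl
        simp [h1, h2, hkl]
      · by_cases h2 : i = l <;> simp [h1, h2, hs]
        have h3 : l ≠ k := by rw [← h2]; exact h1
        simp [h3, hs]
    simp only [this, Finset.sum_add_distrib, Finset.sum_ite_eq', Finset.mem_univ, if_true]; norm_num
  have h1 := H.hi (fun i => (if i = k then 1 else 0) + (if i = l then 1 else 0))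
  have h2 := H.hi (fun i => (if i = k then 1 else 0) + (if i = l then -1 else 0))
  rw [El.quad, hs _ (by norm_num)] at h1 h2
  have h3 := H.diag k
  have h4 := H.diag l
  have h5 := H.symm k l
  rw [abs_le]; constructor <;> linarith

/-- doubled matrix -/
def xt (ν : ℝ) (e : Fin n) (α : Fin n → Fin n → ℝ) : Ix n → Ix n → ℝ
  | Sum.inl k, Sum.inl l => α k l - if k = e ∧ l = e then ν / 2 else 0
  | Sum.inr a, Sum.inr b => if a = 1 ∧ b = 1 then ν / 2 else 0
  | Sum.inl _, Sum.inr _ => 0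
  | Sum.inr _, Sum.inl _ => 0

lemma xt_sum (ν : ℝ) (e : Fin n) (α : Fin n → Fin n → ℝ) (W : Ix n → Ix n → ℝ) :
    ∑ i, ∑ j, xt ν e α i j * W i j = (∑ k, ∑ l, α k l * W (Sum.inl k) (Sum.inl l)) - ν / 2 * W (Sum.inl e) (Sum.inl e) + ν / 2 * W hh hh := by
  simp only [Fintype.sum_sum_type, xt, Fin.sum_univ_two, zero_mul, Finset.sum_const_zero, sub_mul, Finset.sum_sub_distrib]
  have : ∑ x, ∑ y, (if x = e ∧ y = e then ν / 2 else 0) * W (Sum.inl x) (Sum.inl y) = ν / 2 * W (Sum.inl e) (Sum.inl e) := by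
    rw [Finset.sum_eq_single e, Finset.sum_eq_single e]
    · simp
    · intro b _ hb; simp [hb]
    · simp
    · intro b _ hb; simp [hb]
    · simp
  simp only [add_zero, Finset.sum_sub_distrib]
  rw [this]
  simp [hh]

lemma xt_symm {ν : ℝ} (e : Fin n) {α : Fin n → Fin n → ℝ} (H : ∀ i j, α i j = α j i) (i j : Ix n) : xt ν e α i j = xt ν e α j i := by
  rcases i with k | a <;> rcases j with l | b <;> simp only [xt]
  · rw [H]; congr 1; simp only [and_comm]
  · simp only [and_comm]

lemma xt_bd {ν : ℝ} (hν : 0 < ν) (hν1 : ν ≤ 1) (e : Fin n) {α : Fin n → Fin n → ℝ} (H : El ν α) (i j : Ix n) : |xt ν e α i j| ≤ 2 * ν⁻¹ := by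
  have h1 : 1 ≤ ν⁻¹ := (one_le_inv₀ hν).2 hν1
  rcases i with k | a <;> rcases j with l | b <;> simp only [xt]
  · have h2 := H.bd hν k l
    have h3 : |if k = e ∧ l = e then ν / 2 else 0| ≤ 1 := by
      split_ifs
      · rw [abs_of_nonneg (by linarith)]; linarith
      · simp
    have := abs_sub (α k l) (if k = e ∧ l = e then ν / 2 else 0)
    linarith
  · simp; linarith
  · simp; linarith
  · split_ifs
    · rw [abs_of_nonneg (by linarith)]; linarith
    · simp; linarith

lemma sum_Sx (ξ : Ix n → ℝ) : ∑ i ∈ Finset.univ.erase (tt : Ix n), ξ i ^ 2 = ∑ k, ξ (Sum.inl k) ^ 2 + ξ hh ^ 2 := by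
  have h1 := Finset.add_sum_erase Finset.univ (fun i : Ix n => ξ i ^ 2) (Finset.mem_univ tt)
  rw [Fintype.sum_sum_type, Fin.sum_univ_two] at h1
  simp only [tt, hh] at *
  linarith

lemma xt_ell {ν : ℝ} (hν : 0 < ν) (e : Fin n) {α : Fin n → Fin n → ℝ} (H : El ν α) (ξ : Ix n → ℝ) :
    ν / 2 * ∑ i ∈ Finset.univ.erase (tt : Ix n), ξ i ^ 2 ≤ ∑ i, ∑ j, xt ν e α i j * (ξ i * ξ j) := by
  rw [xt_sum, sum_Sx]
  have h1 := H.lo (fun k => ξ (Sum.inl k))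
  have h2 : ξ (Sum.inl e) ^ 2 ≤ ∑ k, ξ (Sum.inl k) ^ 2 := Finset.single_le_sum (f := fun k : Fin n => ξ (Sum.inl k) ^ 2) (fun k _ => sq_nonneg _) (Finset.mem_univ e)
  simp only [mul_assoc] at h1
  nlinarith

/-- normalized asymmetric matrix -/
def nM (m : Fin n) (A : Ix n → Ix n → ℝ) (i j : Ix n) : ℝ :=
  (A i j + (if j = Sum.inl m then A i (Sum.inl m) else 0) - (if i = Sum.inl m then A (Sum.inl m) j else 0)) / A (Sum.inl m) (Sum.inl m)

lemma nM_sum (m : Fin n) {A W : Ix n → Ix n → ℝ} (hA : ∀ i j, A i j = A j i) (hW : ∀ i, W i (Sum.inl m) = W (Sum.inl m) i) :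
    ∑ i, ∑ j, nM m A i j * W i j = (∑ i, ∑ j, A i j * W i j) / A (Sum.inl m) (Sum.inl m) := by
  have h : ∀ i j, nM m A i j * W i j = A i j * W i j / A (Sum.inl m) (Sum.inl m) + (if j = Sum.inl m then A i (Sum.inl m) * W i (Sum.inl m) / A (Sum.inl m) (Sum.inl m) else 0)
      - (if i = Sum.inl m then A (Sum.inl m) j * W (Sum.inl m) j / A (Sum.inl m) (Sum.inl m) else 0) := by
    intro i j
    unfold nM
    by_cases h1 : j = Sum.inl m
    · by_cases h2 : i = Sum.inl m
      · simp only [h1, h2, if_true]; ring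
      · simp only [h1, h2, if_true, if_false]; ring
    · by_cases h2 : i = Sum.inl m
      · simp only [h1, h2, if_true, if_false]; ring
      · simp only [h1, h2, if_false]; ring
  simp only [h, Finset.sum_add_distrib, Finset.sum_sub_distrib]
  rw [Finset.sum_comm (f := fun i j => if i = Sum.inl m then A (Sum.inl m) j * W (Sum.inl m) j / A (Sum.inl m) (Sum.inl m) else 0)]
  simp only [Finset.sum_ite_eq', Finset.mem_univ, if_true, Finset.sum_div]
  have : ∀ i, A i (Sum.inl m) * W i (Sum.inl m) = A (Sum.inl m) i * W (Sum.inl m) i := fun i => by rw [hA, hW]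
  simp only [this]; ring

def bC (m : Fin n) (α : Fin n → Fin n → ℝ → ℝ) (z : Ix n → ℝ) : ℝ := (α m m (z (Sum.inl m)))⁻¹
def MC (ν : ℝ) (e m : Fin n) (α : Fin n → Fin n → ℝ → ℝ) (i j : Ix n) (z : Ix n → ℝ) : ℝ :=
  nM m (xt ν e (fun k l => α k l (z (Sum.inl m)))) i j

lemma xt_mm (ν : ℝ) {e m : Fin n} (hem : e ≠ m) (α : Fin n → Fin n → ℝ) : xt ν e α (Sum.inl m) (Sum.inl m) = α m m := by
  simp [xt, hem.symm]

lemma xt_meas (ν : ℝ) (e m : Fin n) {α : Fin n → Fin n → ℝ → ℝ} (hm : ∀ i j, Measurable (α i j)) (i j : Ix n) :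
    Measurable (fun z : Ix n → ℝ => xt ν e (fun k l => α k l (z (Sum.inl m))) i j) := by
  rcases i with k | a <;> rcases j with l | b <;> simp only [xt]
  · exact ((hm k l).comp (measurable_pi_apply _)).sub_const _
  all_goals exact measurable_const

set_option maxHeartbeats 1000000 in
lemma co_concrete {ν : ℝ} (hν : 0 < ν) (hν1 : ν ≤ 1) {e m : Fin n} (hem : e ≠ m) {α : Fin n → Fin n → ℝ → ℝ} (hm : ∀ i j, Measurable (α i j))
    (H : ∀ s, El ν (fun i j => α i j s)) : Co (tt : Ix n) (Sum.inl m) hh (ν ^ 2 / 6) (bC m α) (MC ν e m α) := by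
  have hinv : 1 ≤ ν⁻¹ := (one_le_inv₀ hν).2 hν1
  have hpos : ∀ s, 0 < α m m s := fun s => lt_of_lt_of_le hν ((H s).diag m).1
  have hb1 : ∀ s, (α m m s)⁻¹ ≤ ν⁻¹ := fun s => (inv_le_inv₀ (hpos s) hν).2 ((H s).diag m).1
  have hb2 : ∀ s, ν ≤ (α m m s)⁻¹ := fun s => by
    have := (inv_le_inv₀ (by positivity) (hpos s)).2 ((H s).diag m).2
    rwa [inv_inv] at this
  have hx0 : ∀ s (i j : Ix n), (i = hh ↔ ¬ j = hh) → xt ν e (fun k l => α k l s) i j = 0 := by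
    intro s i j h
    rcases i with k | a <;> rcases j with l | b <;> simp only [xt]
    · simp [hh] at h
    · rw [if_neg]; rintro ⟨rfl, rfl⟩; simp [hh] at h
  have hxt : ∀ s (i : Ix n), xt ν e (fun k l => α k l s) i tt = 0 := by
    intro s i; rcases i with k | a <;> simp [xt, tt]
  have hxt' : ∀ s (i : Ix n), xt ν e (fun k l => α k l s) tt i = 0 := by
    intro s i; rcases i with k | a <;> simp [xt, tt]
  have hν2 : ν ^ 2 ≤ ν := by nlinarith
  refine { pos := by positivity, le1 := by nlinarith, td := (inl_ne_tt m).symm, th := tt_ne_hh, dh := inl_ne_hh m, bm := ?_, Mm := ?_, bi := ?_, Mi := ?_, blo := ?_, bhi := ?_, Mhi := ?_, Mdd := ?_, Mdj := ?_, Mhj := ?_, Mjh := ?_, Mtj := ?_, Mjt := ?_, ell := ?_ }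
  · exact ((hm m m).comp (measurable_pi_apply _)).inv
  · intro i j
    unfold MC nM
    refine ((xt_meas ν e m hm i j).add ?_).sub ?_ |>.div (xt_meas ν e m hm _ _)
    · split_ifs
      · exact xt_meas ν e m hm _ _
      · exact measurable_const
    · split_ifs
      · exact xt_meas ν e m hm _ _
      · exact measurable_const
  · intro z z' h; unfold bC; rw [h]
  · intro i j z z' h; unfold MC; rw [h]
  · intro z; unfold bC; linarith [hb2 (z (Sum.inl m))]
  · intro z; unfold bC
    refine (hb1 _).trans ((inv_le_inv₀ hν (by positivity)).2 (by linarith))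
  · intro i j z
    unfold MC nM
    rw [xt_mm ν hem, div_eq_mul_inv, abs_mul, abs_of_nonneg (inv_nonneg.2 (hpos _).le)]
    set s := z (Sum.inl m)
    have a1 := xt_bd hν hν1 e (H s)
    have a2 : |if j = Sum.inl m then xt ν e (fun k l => α k l s) i (Sum.inl m) else 0| ≤ 2 * ν⁻¹ := by
      split_ifs
      · exact a1 _ _
      · simp; linarith
    have a3 : |if i = Sum.inl m then xt ν e (fun k l => α k l s) (Sum.inl m) j else 0| ≤ 2 * ν⁻¹ := by
      split_ifs
      · exact a1 _ _
      · simp; linarith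
    have a4 := abs_sub (xt ν e (fun k l => α k l s) i j + (if j = Sum.inl m then xt ν e (fun k l => α k l s) i (Sum.inl m) else 0)) (if i = Sum.inl m then xt ν e (fun k l => α k l s) (Sum.inl m) j else 0)
    have a5 := abs_add_le (xt ν e (fun k l => α k l s) i j) (if j = Sum.inl m then xt ν e (fun k l => α k l s) i (Sum.inl m) else 0)
    have a6 := a1 i j
    calc _ ≤ 6 * ν⁻¹ * ν⁻¹ := mul_le_mul (by linarith) (hb1 s) (inv_nonneg.2 (hpos _).le) (by positivity)
      _ = _ := by rw [inv_div]; field_simp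
  · intro z; unfold MC nM
    simp only [if_true]; rw [add_sub_cancel_right, xt_mm ν hem, div_self (hpos _).ne']
  · intro j z hj; unfold MC nM; rw [if_neg hj]; simp
  · intro j z hj; unfold MC nM
    rw [hx0 _ hh j (by simp [hj]), hx0 _ hh (Sum.inl m) (by simp [inl_ne_hh]), if_neg (inl_ne_hh m).symm]; simp
  · intro j z hj; unfold MC nM
    rw [hx0 _ j hh (by simp [hj]), hx0 _ (Sum.inl m) hh (by simp [inl_ne_hh]), if_neg (inl_ne_hh m).symm]; simp
  · intro j z; unfold MC nM; rw [hxt', hxt', if_neg (inl_ne_tt m).symm]; simp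
  · intro j z; unfold MC nM; rw [hxt, hxt, if_neg (inl_ne_tt m).symm]; simp
  · intro z ξ
    unfold MC
    have h1 := nM_sum m (A := xt ν e (fun k l => α k l (z (Sum.inl m)))) (W := fun i j => ξ i * ξ j) (xt_symm e (H _).symm) (fun i => mul_comm _ _)
    simp only [mul_assoc] at h1 ⊢
    rw [h1, xt_mm ν hem, div_eq_mul_inv]
    have h2 := xt_ell hν e (H (z (Sum.inl m))) ξ
    have h3 : 0 ≤ ∑ i ∈ Finset.univ.erase (tt : Ix n), ξ i ^ 2 := Finset.sum_nonneg fun i _ => sq_nonneg _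
    calc _ ≤ (ν / 2 * ∑ i ∈ Finset.univ.erase (tt : Ix n), ξ i ^ 2) * ν := by nlinarith [mul_nonneg (sq_nonneg ν) h3]
      _ ≤ _ := mul_le_mul h2 (hb2 _) hν.le (le_trans (by positivity) h2)

lemma FoW_concrete (ν : ℝ) {e m : Fin n} (hem : e ≠ m) {α : Fin n → Fin n → ℝ → ℝ} (hs : ∀ s i j, α i j s = α j i s)
    (wT : (Ix n → ℝ) → ℝ) (w : Ix n → Ix n → (Ix n → ℝ) → ℝ) (z : Ix n → ℝ) (hW : ∀ i, w i (Sum.inl m) z = w (Sum.inl m) i z)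
    (hW2 : w hh hh z = w (Sum.inl e) (Sum.inl e) z) : FoW (bC m α) (MC ν e m α) wT w z =
      (α m m (z (Sum.inl m)))⁻¹ * (wT z - ∑ k, ∑ l, α k l (z (Sum.inl m)) * w (Sum.inl k) (Sum.inl l) z) := by
  unfold FoW bC MC
  rw [nM_sum m (W := fun i j => w i j z) (xt_symm e (hs _)) hW, xt_mm ν hem, xt_sum, hW2]
  ring

end coef
end PSP

namespace PSP
open scoped ContDiff ENNReal
section meas
variable {n : ℕ}

lemma lint_scale {E : Type} [NormedAddCommGroup E] [NormedSpace ℝ E] [FiniteDimensional ℝ E] [MeasurableSpace E] [BorelSpace E]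
    (μ : Measure E) [μ.IsAddHaarMeasure] {r : ℝ} (hr : 0 < r) (c : E) {g : E → ℝ≥0∞} (hg : Measurable g) :
    ∫⁻ x, g (c + r • x) ∂μ = ENNReal.ofReal ((r ^ Module.finrank ℝ E)⁻¹) * ∫⁻ x, g x ∂μ := by
  have h1 : ∫⁻ x, g (c + r • x) ∂μ = ∫⁻ y, g (c + y) ∂(Measure.map (r • ·) μ) := by
    have hm : Measurable (fun y => g (c + y)) := hg.comp (by fun_prop)
    rw [lintegral_map hm (by fun_prop)]
  rw [h1, Measure.map_addHaar_smul μ hr.ne', lintegral_smul_measure, abs_of_pos (by positivity), smul_eq_mul, lintegral_add_left_eq_self]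

def Ps (z : Ix n → ℝ) : ES n × (ℝ × ℝ) := (WithLp.toLp 2 (fun k => z (Sum.inl k)), (z tt, z hh))

lemma Ps_mp : MeasurePreserving (Ps : (Ix n → ℝ) → _) volume volume := by
  have h1 := volume_measurePreserving_sumPiEquivProdPi (fun _ : Ix n => ℝ)
  have h2 := (PiLp.volume_preserving_toLp (Fin n)).prod (volume_preserving_finTwoArrow ℝ)
  exact h2.comp h1

lemma Am_snd' (e : Fin n) (z0 : ℝ × ES n) (r σ : ℝ) (z : Ix n → ℝ) : (Am e z0 r σ z).2 =
    (z0.2 + (r * σ * z hh) • eu e) + r • (WithLp.toLp 2 (fun k => z (Sum.inl k)) : ES n) := by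
  rw [Am_snd]
  have : (∑ k, (r * z (Sum.inl k)) • eu k) = r • (WithLp.toLp 2 (fun k => z (Sum.inl k)) : ES n) := by
    ext i
    simp [eu, Finset.sum_apply, PiLp.single_apply, WithLp.ofLp_sum, Pi.single_apply]
  rw [this]; abel

set_option maxHeartbeats 1000000 in
lemma lint_Am (e : Fin n) {z0 : ℝ × ES n} (h0 : z0 ∈ Rg n) {r σ : ℝ} (hr : 0 < r) (hr1 : r ≤ 1 / (8 * (n + 1))) (hσ : |σ| ≤ 1)
    {G : ℝ × ES n → ℝ≥0∞} (hG : Measurable G) :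
    ∫⁻ z in Cb tt 1, G (Am e z0 r σ z) ≤ 2 * ENNReal.ofReal ((r ^ (n + 2))⁻¹) * ∫⁻ y in parQ n 1, G y := by
  set G' := (parQ n 1).indicator G with hG'
  have hQm : MeasurableSet (parQ n 1) := (parQ_open n 1).measurableSet
  have hG'm : Measurable G' := hG.indicator hQm
  set F : ES n × (ℝ × ℝ) → ℝ≥0∞ := fun y => (Icc (-1:ℝ) 1).indicator (fun _ => (1:ℝ≥0∞)) y.2.2 * G' (z0.1 + r ^ 2 * y.2.1, (z0.2 + (r * σ * y.2.2) • eu e) + r • y.1) with hF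
  have hFm : Measurable F := by
    refine Measurable.mul ?_ (hG'm.comp (by fun_prop))
    exact (measurable_const.indicator measurableSet_Icc).comp (by fun_prop)
  have h1 : ∫⁻ z in Cb tt 1, G (Am e z0 r σ z) ≤ ∫⁻ z, F (Ps z) := by
    rw [← lintegral_indicator (Cb_meas tt 1)]
    refine lintegral_mono fun z => ?_
    by_cases hz : z ∈ Cb tt 1
    · rw [indicator_of_mem hz]
      have h2 := Am_mem e h0 hr.le hr1 hσ hz
      have h3 : z hh ∈ Icc (-1:ℝ) 1 := abs_le.1 (hz.2.2 hh tt_ne_hh.symm)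
      have h4 : Am e z0 r σ z = (z0.1 + r ^ 2 * z tt, (z0.2 + (r * σ * z hh) • eu e) + r • (WithLp.toLp 2 (fun k => z (Sum.inl k)) : ES n)) :=
        Prod.ext (Am_fst ..) (Am_snd' ..)
      simp only [hF, Ps]
      rw [indicator_of_mem h3, one_mul, ← h4, hG', indicator_of_mem h2]
    · rw [indicator_of_notMem hz]; exact bot_le
  refine h1.trans (le_of_eq ?_)
  rw [Ps_mp.lintegral_comp hFm, Measure.volume_eq_prod, lintegral_prod_symm _ hFm.aemeasurable]
  have h2 : ∀ y : ℝ × ℝ, ∫⁻ x, F (x, y) = (Icc (-1:ℝ) 1).indicator (fun _ => (1:ℝ≥0∞)) y.2 * (ENNReal.ofReal ((r ^ n)⁻¹) * ∫⁻ x, G' (z0.1 + r ^ 2 * y.1, x)) := by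
    intro y
    simp only [hF]
    have hm1 : Measurable (fun x : ES n => G' (z0.1 + r ^ 2 * y.1, (z0.2 + (r * σ * y.2) • eu e) + r • x)) := hG'm.comp (by fun_prop)
    rw [lintegral_const_mul _ hm1]
    have := lint_scale (volume : Measure (ES n)) hr (z0.2 + (r * σ * y.2) • eu e) (g := fun x => G' (z0.1 + r ^ 2 * y.1, x)) (hG'm.comp (by fun_prop))
    rw [finrank_euclideanSpace_fin] at this
    rw [this]
  simp only [h2]
  have hI : Measurable (fun s : ℝ => ∫⁻ x, G' (s, x)) := hG'm.lintegral_prod_right'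
  rw [Measure.volume_eq_prod, lintegral_prod_symm]
  · simp only
    have h3 : ∀ y : ℝ, ∫⁻ x : ℝ, (Icc (-1:ℝ) 1).indicator (fun _ => (1:ℝ≥0∞)) y * (ENNReal.ofReal ((r ^ n)⁻¹) * ∫⁻ w, G' (z0.1 + r ^ 2 * x, w))
        = (Icc (-1:ℝ) 1).indicator (fun _ => (1:ℝ≥0∞)) y * (ENNReal.ofReal ((r ^ n)⁻¹) * (ENNReal.ofReal ((r ^ 2)⁻¹) * ∫⁻ y in parQ n 1, G y)) := by
      intro y
      rw [lintegral_const_mul, lintegral_const_mul]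
      · have := lint_scale (volume : Measure ℝ) (by positivity : 0 < r ^ 2) z0.1 hI
        simp only [Module.finrank_self, pow_one, smul_eq_mul] at this
        rw [this, ← lintegral_indicator hQm, ← hG', Measure.volume_eq_prod, lintegral_prod _ hG'm.aemeasurable]
      · exact hI.comp (by fun_prop)
      · have hm2 : Measurable (fun y : ℝ => ∫⁻ x, G' (z0.1 + r ^ 2 * y, x)) := hI.comp (by fun_prop)
        exact hm2.const_mul _
    simp only [h3]
    rw [lintegral_mul_const _ (measurable_const.indicator measurableSet_Icc), lintegral_indicator measurableSet_Icc]
    simp only [lintegral_const, Measure.restrict_apply_univ, Real.volume_Icc, one_mul]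
    have e2 : ENNReal.ofReal ((r ^ (n + 2))⁻¹) = ENNReal.ofReal ((r ^ n)⁻¹) * ENNReal.ofReal ((r ^ 2)⁻¹) := by
      rw [← ENNReal.ofReal_mul (by positivity), ← mul_inv, ← pow_add]
    have e3 : ENNReal.ofReal (1 - -1) = 2 := by norm_num
    rw [e2, e3]; ring
  · refine (Measurable.mul ?_ ?_).aemeasurable
    · exact (measurable_const.indicator measurableSet_Icc).comp (by fun_prop)
    · have hm2 : Measurable (fun y : ℝ × ℝ => ∫⁻ x, G' (z0.1 + r ^ 2 * y.1, x)) := hI.comp (by fun_prop)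
      exact hm2.const_mul _

lemma ae_Am (e : Fin n) {z0 : ℝ × ES n} (h0 : z0 ∈ Rg n) {r σ : ℝ} (hr : 0 < r) (hr1 : r ≤ 1 / (8 * (n + 1))) (hσ : |σ| ≤ 1)
    {P : ℝ × ES n → Prop} (hP : ∀ᵐ y ∂(volume.restrict (parQ n 1)), P y) : ∀ᵐ z ∂(volume.restrict (Cb tt 1)), P (Am e z0 r σ z) := by
  set N := toMeasurable (volume.restrict (parQ n 1)) {y | ¬ P y} with hN
  have hNm : MeasurableSet N := measurableSet_toMeasurable _ _
  have hN0 : (volume.restrict (parQ n 1)) N = 0 := by rw [hN, measure_toMeasurable]; exact hP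
  have h1 := lint_Am e h0 hr hr1 hσ (G := N.indicator fun _ => 1) (measurable_const.indicator hNm)
  have h2 : ∫⁻ y in parQ n 1, N.indicator (fun _ => (1:ℝ≥0∞)) y = 0 := by
    rw [lintegral_indicator hNm]; simp [hN0]
  have hm3 : Measurable (fun z => N.indicator (fun _ => (1:ℝ≥0∞)) (Am e z0 r σ z)) := (measurable_const.indicator hNm).comp (Am_cont e z0 r σ).measurable
  rw [h2, mul_zero, nonpos_iff_eq_zero, lintegral_eq_zero_iff hm3] at h1
  filter_upwards [h1] with z hz
  by_contra hc
  have : Am e z0 r σ z ∈ N := subset_toMeasurable _ _ hc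
  simp [indicator_of_mem this] at hz

end meas
end PSP

namespace PSP
open scoped ENNReal
section bnd
variable {n : ℕ}

/-- Frobenius norm of the Hessian -/
def HsN (u : ℝ → ES n → ℝ) (y : ℝ × ES n) : ℝ := Real.sqrt (∑ k, ∑ l, sd2 k l (u y.1) y.2 ^ 2)

lemma HsN_nonneg (u : ℝ → ES n → ℝ) (y : ℝ × ES n) : 0 ≤ HsN u y := Real.sqrt_nonneg _

lemma HsN_ge (u : ℝ → ES n → ℝ) (y : ℝ × ES n) (k l : Fin n) : |sd2 k l (u y.1) y.2| ≤ HsN u y := by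
  unfold HsN
  apply Real.abs_le_sqrt
  calc sd2 k l (u y.1) y.2 ^ 2 ≤ ∑ l, sd2 k l (u y.1) y.2 ^ 2 :=
        Finset.single_le_sum (f := fun l => sd2 k l (u y.1) y.2 ^ 2) (fun _ _ => sq_nonneg _) (Finset.mem_univ l)
    _ ≤ _ := Finset.single_le_sum (f := fun k => ∑ l, sd2 k l (u y.1) y.2 ^ 2) (fun _ _ => Finset.sum_nonneg fun _ _ => sq_nonneg _) (Finset.mem_univ k)

lemma HsN_cont {u : ℝ → ES n → ℝ} (hu : ParClassical (parQ n 1) u) : ContinuousOn (HsN u) (parQ n 1) := by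
  unfold HsN
  refine Real.continuous_sqrt.comp_continuousOn ?_
  exact continuousOn_finset_sum _ fun k _ => continuousOn_finset_sum _ fun l _ => (hu.2.2.2.2.2 k l).pow 2

def hA (e : Fin n) (u : ℝ → ES n → ℝ) (z0 : ℝ × ES n) (r σ : ℝ) : (Ix n → ℝ) → ℝ := (Cb tt 1).indicator fun z => HsN u (Am e z0 r σ z)

lemma hA_LB (e : Fin n) {u : ℝ → ES n → ℝ} (hu : ParClassical (parQ n 1) u) {z0 : ℝ × ES n} (h0 : z0 ∈ Rg n) {r σ : ℝ} (hr : 0 ≤ r) (hr1 : r ≤ 1 / (8 * (n + 1))) (hσ : |σ| ≤ 1) :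
    LB (hA e u z0 r σ) := LB_ind tt (comp_Am e h0 hr hr1 hσ (HsN_cont hu))

lemma yng {x l p : ℝ} (hx : 0 ≤ x) (hl : 0 < l) (hp : 2 < p) : x ^ 2 ≤ l ^ 2 + l ^ (2 - p) * x ^ p := by
  have h0 : 0 ≤ l ^ (2 - p) * x ^ p := by positivity
  rcases le_total x l with h | h
  · have : x ^ 2 ≤ l ^ 2 := by gcongr
    linarith
  · have hx' : 0 < x := hl.trans_le h
    have h1 : x ^ (2 - p) ≤ l ^ (2 - p) := Real.rpow_le_rpow_of_nonpos hl h (by linarith)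
    have h2 : x ^ 2 = x ^ (2 - p) * x ^ p := by
      rw [← Real.rpow_add hx']; norm_num
    rw [h2]
    have : x ^ (2 - p) * x ^ p ≤ l ^ (2 - p) * x ^ p := by gcongr
    nlinarith [sq_nonneg l]

/-- the constant from the volume -/
def V2 (n : ℕ) : ℝ := 2 ^ (n + 1) + 2

lemma card_Ix : Fintype.card (Ix n) - 1 = n + 1 := by simp

set_option maxHeartbeats 1000000 in
lemma N2_hA (e : Fin n) {u : ℝ → ES n → ℝ} (hu : ParClassical (parQ n 1) u) {z0 : ℝ × ES n} (h0 : z0 ∈ Rg n) {r σ : ℝ} (hr : 0 < r) (hr1 : r ≤ 1 / (8 * (n + 1))) (hσ : |σ| ≤ 1)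
    {p P : ℝ} (hp : 2 < p) (hP : 0 < P) (hI : ∫⁻ y in parQ n 1, ENNReal.ofReal (HsN u y ^ p) ≤ ENNReal.ofReal (P ^ p)) :
    N2 tt 1 (hA e u z0 r σ) ≤ V2 n * (P * r ^ (-((n + 2 : ℝ) / p))) ^ 2 := by
  set l := P * r ^ (-((n + 2 : ℝ) / p)) with hl
  have hl0 : 0 < l := by positivity
  have hp0 : (0:ℝ) < p := by linarith
  have hQm : MeasurableSet (parQ n 1) := (parQ_open n 1).measurableSet
  set G : ℝ × ES n → ℝ≥0∞ := fun y => ENNReal.ofReal ((parQ n 1).indicator (fun y => HsN u y ^ p) y) with hG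
  have hGm : Measurable G := by
    refine ENNReal.measurable_ofReal.comp ?_
    have hc : ContinuousOn (fun y => HsN u y ^ p) (parQ n 1) := (HsN_cont hu).rpow_const fun _ _ => Or.inr hp0.le
    classical
    have := hc.measurable_piecewise (g := (0 : ℝ × ES n → ℝ)) continuousOn_const hQm
    rwa [piecewise_eq_indicator] at this
  have h1 := lint_Am e h0 hr hr1 hσ hGm
  have h2 : ∫⁻ y in parQ n 1, G y ≤ ENNReal.ofReal (P ^ p) := by
    refine le_trans (le_of_eq ?_) hI
    refine setLIntegral_congr_fun hQm fun y hy => ?_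
    simp only [hG, indicator_of_mem hy]
  have hlb := hA_LB e hu h0 hr.le hr1 hσ
  have h3 : ENNReal.ofReal (N2 tt 1 (hA e u z0 r σ)) ≤ ENNReal.ofReal (V2 n * l ^ 2) := by
    rw [N2_lint tt 1 hlb]
    calc ∫⁻ z in Cb tt 1, ENNReal.ofReal (hA e u z0 r σ z ^ 2)
        ≤ ∫⁻ z in Cb tt 1, (ENNReal.ofReal (l ^ 2) + ENNReal.ofReal (l ^ (2 - p)) * G (Am e z0 r σ z)) := by
          refine setLIntegral_mono_ae ?_ (ae_of_all _ fun z hz => ?_)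
          · have : Measurable (fun z => G (Am e z0 r σ z)) := hGm.comp (Am_cont e z0 r σ).measurable
            exact ((this.const_mul _).const_add _).aemeasurable
          · simp only [hG, hA, indicator_of_mem hz, indicator_of_mem (Am_mem e h0 hr.le hr1 hσ hz)]
            rw [← ENNReal.ofReal_mul (by positivity), ← ENNReal.ofReal_add (by positivity) (mul_nonneg (by positivity) (Real.rpow_nonneg (HsN_nonneg _ _) _))]
            exact ENNReal.ofReal_le_ofReal (yng (HsN_nonneg _ _) hl0 hp)
      _ = ENNReal.ofReal (l ^ 2) * volume (Cb (tt : Ix n) 1) + ENNReal.ofReal (l ^ (2 - p)) * ∫⁻ z in Cb tt 1, G (Am e z0 r σ z) := by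
          have hm : Measurable (fun z => G (Am e z0 r σ z)) := hGm.comp (Am_cont e z0 r σ).measurable
          rw [lintegral_add_left measurable_const, lintegral_const_mul _ hm, setLIntegral_const]
      _ ≤ ENNReal.ofReal (l ^ 2) * ENNReal.ofReal (2 ^ (n + 1)) + ENNReal.ofReal (l ^ (2 - p)) * (2 * ENNReal.ofReal ((r ^ (n + 2))⁻¹) * ENNReal.ofReal (P ^ p)) := by
          have hv : volume (Cb (tt : Ix n) 1) = ENNReal.ofReal (2 ^ (n + 1)) := by
            rw [← ENNReal.ofReal_toReal (measure_ne_top_of_subset (subset_refl _) (Cb_compact tt 1).measure_lt_top.ne), vol_Cb tt zero_le_one, card_Ix]; simp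
          rw [hv]
          gcongr
          exact h1.trans (by gcongr)
      _ = ENNReal.ofReal (V2 n * l ^ 2) := by
          have e2 : (2:ℝ≥0∞) = ENNReal.ofReal 2 := by simp
          rw [e2, ← ENNReal.ofReal_mul (by positivity), ← ENNReal.ofReal_mul (by positivity), ← ENNReal.ofReal_mul (by positivity), ← ENNReal.ofReal_mul (by positivity),
            ← ENNReal.ofReal_add (by positivity) (by positivity)]
          congr 1
          have e3 : (r ^ (n + 2))⁻¹ * P ^ p = l ^ p := by
            rw [hl, Real.mul_rpow hP.le (by positivity), ← Real.rpow_mul hr.le, neg_mul, div_mul_cancel₀ _ hp0.ne', Real.rpow_neg hr.le]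
            have : r ^ ((n:ℝ) + 2) = r ^ (n + 2) := by exact_mod_cast Real.rpow_natCast r (n + 2)
            rw [this]; ring
          have e4 : l ^ (2 - p) * l ^ p = l ^ 2 := by rw [← Real.rpow_add hl0]; norm_num
          unfold V2
          linear_combination (2 * l ^ (2 - p)) * e3 + 2 * e4
  exact (ENNReal.ofReal_le_ofReal_iff (by unfold V2; positivity)).1 h3

lemma N2_ae {ι : Type} [Fintype ι] [DecidableEq ι] {f g : (ι → ℝ) → ℝ} (hf : LB f) (hg : LB g) (t : ι) {r : ℝ}
    (h : ∀ᵐ z ∂(volume.restrict (Cb t r)), |f z| ≤ g z) : N2 t r f ≤ N2 t r g := by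
  refine integral_mono_ae (hf.sq.onCb t r) (hg.sq.onCb t r) ?_
  filter_upwards [h] with z hz
  have := abs_nonneg (f z)
  show f z ^ 2 ≤ g z ^ 2
  rw [← sq_abs (f z)]; gcongr

/-- all data of the problem -/
structure Dat (m e : Fin n) (q : ℕ) (ν δ p : ℝ) (ω : ℝ → ℝ) (a : Fin n → Fin n → ℝ → ES n → ℝ) (u f : ℝ → ES n → ℝ) (Ka Kf P : ℝ) : Prop where
  ν0 : 0 < ν
  ν1 : ν ≤ 1
  δ0 : 0 < δ
  p2 : 2 < p
  em : e ≠ m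
  eq : (e : ℕ) < q
  ω0 : ∀ r, 0 ≤ ω r
  ωm : MonotoneOn ω (Ici (0 : ℝ))
  am : ∀ i j, Measurable (fun z : ℝ × ES n => a i j z.1 z.2)
  ell : ∀ t x, El ν (fun i j => a i j t x)
  ac : ∀ (i j : Fin n) (t s : ℝ) (x y : ES n), x m = y m → |a i j t x - a i j s y| ≤ ω (|t - s| ^ ((1:ℝ)/2) + dist x y)
  Ka0 : 0 ≤ Ka
  ah : ∀ i j, PHolderXPar n q δ (parQ n 1) (a i j) Ka
  hu : ParClassical (parQ n 1) u
  P0 : 0 < P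
  hI : ∫⁻ y in parQ n 1, ENNReal.ofReal (HsN u y ^ p) ≤ ENNReal.ofReal (P ^ p)
  hE : ∀ᵐ z ∂(volume.restrict (parQ n 1)), td u z.1 z.2 - ∑ i, ∑ j, a i j z.1 z.2 * sd2 i j (u z.1) z.2 = f z.1 z.2
  Kf0 : 0 ≤ Kf
  fh : PHolderXPar n q (δ - ((n : ℝ) + 2) / p) (parQ n 1) f Kf

variable {m e : Fin n} {q : ℕ} {ν δ p : ℝ} {ω : ℝ → ℝ} {a : Fin n → Fin n → ℝ → ES n → ℝ} {u f : ℝ → ES n → ℝ} {Ka Kf P : ℝ}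

lemma Am_diff (e : Fin n) (z0 : ℝ × ES n) (r σ τ : ℝ) (z : Ix n → ℝ) : (Am e z0 r σ z).2 = (Am e z0 r τ z).2 + (r * (σ - τ) * z hh) • eu e := by
  rw [Am_snd, Am_snd]
  have : (r * σ * z hh) • eu e = (r * τ * z hh) • eu e + (r * (σ - τ) * z hh) • eu e := by rw [← add_smul]; congr 1; ring
  rw [this]; abel

lemma eu_apply (k l : Fin n) : (eu k : ES n) l = if l = k then 1 else 0 := by simp [eu, Pi.single_apply]

/-- partial Hölder bounds between points of the doubling -/
lemma PH_Am {g : ℝ → ES n → ℝ} {η K : ℝ} (hη : 0 ≤ η) (hK : 0 ≤ K) (hg : PHolderXPar n q η (parQ n 1) g K) (hq : (e : ℕ) < q) {z0 : ℝ × ES n} (h0 : z0 ∈ Rg n) {r : ℝ} (hr : 0 ≤ r)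
    (hr1 : r ≤ 1 / (8 * (n + 1))) {σ τ : ℝ} (hσ : |σ| ≤ 1) (hτ : |τ| ≤ 1) {z : Ix n → ℝ} (hz : z ∈ Cb tt 1) :
    |g (Am e z0 r σ z).1 (Am e z0 r σ z).2 - g (Am e z0 r τ z).1 (Am e z0 r τ z).2| ≤ K * (|σ - τ| * r) ^ η := by
  have h1 : (Am e z0 r σ z).1 = (Am e z0 r τ z).1 := by rw [Am_fst, Am_fst]
  have m1 := Am_mem e h0 hr hr1 hσ hz
  have m2 := Am_mem e h0 hr hr1 hτ hz
  have h2 := hg (Am e z0 r τ z).1 (Am e z0 r σ z).2 (Am e z0 r τ z).2 (by rw [← h1]; exact m1) m2 (fun i hi => by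
    rw [Am_diff e z0 r σ τ z]
    have : i ≠ e := by rintro rfl; omega
    simp [eu_apply, this])
  rw [h1]
  refine h2.trans ?_
  gcongr
  rw [Am_diff e z0 r σ τ z, dist_eq_norm, add_sub_cancel_left, norm_smul, norm_eu, mul_one, norm_mul, norm_mul, Real.norm_of_nonneg hr, Real.norm_eq_abs, Real.norm_eq_abs]
  have := hz.2.2 hh tt_ne_hh.symm
  calc r * |σ - τ| * |z hh| ≤ r * |σ - τ| * 1 := by gcongr
    _ = _ := by ring

end bnd
end PSP

namespace PSP
open scoped ENNReal
section fow
variable {n : ℕ}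
variable {m e : Fin n} {q : ℕ} {ν δ p : ℝ} {ω : ℝ → ℝ} {a : Fin n → Fin n → ℝ → ES n → ℝ} {u f : ℝ → ES n → ℝ} {Ka Kf P : ℝ}

lemma ds_le1 {x y : Fin n → Fin n → ℝ} {A : ℝ} (hx : ∀ k l, |x k l| ≤ A) : |∑ k, ∑ l, x k l * y k l| ≤ A * ∑ k, ∑ l, |y k l| := by
  rw [Finset.mul_sum]
  refine (Finset.abs_sum_le_sum_abs _ _).trans (Finset.sum_le_sum fun k _ => ?_)
  rw [Finset.mul_sum]
  refine (Finset.abs_sum_le_sum_abs _ _).trans (Finset.sum_le_sum fun l _ => ?_)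
  rw [abs_mul]
  have := hx k l
  gcongr

lemma ds_le2 {x y : Fin n → Fin n → ℝ} {A B : ℝ} (hA : 0 ≤ A) (hx : ∀ k l, |x k l| ≤ A) (hy : ∀ k l, |y k l| ≤ B) : |∑ k, ∑ l, x k l * y k l| ≤ n ^ 2 * A * B := by
  refine (ds_le1 hx).trans ?_
  have : ∑ k, ∑ l, |y k l| ≤ ∑ k : Fin n, ∑ l : Fin n, B := Finset.sum_le_sum fun k _ => Finset.sum_le_sum fun l _ => hy k l
  simp at this
  nlinarith

/-- frozen coefficients -/
def aF (a : Fin n → Fin n → ℝ → ES n → ℝ) (m : Fin n) (z0 : ℝ × ES n) (r : ℝ) (k l : Fin n) (s : ℝ) : ℝ := a k l z0.1 (z0.2 + (r * s) • eu m)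

lemma aF_meas (H : Dat m e q ν δ p ω a u f Ka Kf P) (z0 : ℝ × ES n) (r : ℝ) (k l : Fin n) : Measurable (aF a m z0 r k l) := by
  have h1 : Measurable (fun s : ℝ => (z0.1, z0.2 + (r * s) • (eu m : ES n))) := by fun_prop
  exact (H.am k l).comp h1

lemma aF_El (H : Dat m e q ν δ p ω a u f Ka Kf P) (z0 : ℝ × ES n) (r s : ℝ) : El ν (fun i j => aF a m z0 r i j s) := H.ell _ _

lemma aF_Co (H : Dat m e q ν δ p ω a u f Ka Kf P) (z0 : ℝ × ES n) (r : ℝ) :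
    Co (tt : Ix n) (Sum.inl m) hh (ν ^ 2 / 6) (bC m (aF a m z0 r)) (MC ν e m (aF a m z0 r)) :=
  co_concrete H.ν0 H.ν1 H.em (aF_meas H z0 r) (aF_El H z0 r)

lemma dW_symm (e : Fin n) (hu : ParClassical (parQ n 1) u) {z0 : ℝ × ES n} (h0 : z0 ∈ Rg n) {r : ℝ} (hr : 0 ≤ r) (hr1 : r ≤ 1 / (8 * (n + 1)))
    {z : Ix n → ℝ} (hz : z ∈ Cb tt 1) (i j : Ix n) : dW e u z0 r i j z = dW e u z0 r j i z := by
  unfold dW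
  rw [indicator_of_mem hz, indicator_of_mem hz, sd2_comm (hu.2.1 _ (Am_mem e h0 hr hr1 (by simp) hz)) (ix e i) (ix e j),
    sd2_comm (hu.2.1 _ (Am_mem e h0 hr hr1 (by simp) hz)) (ix e i) (ix e j)]
  ring

lemma dW_hh (e : Fin n) (z0 : ℝ × ES n) (r : ℝ) (z : Ix n → ℝ) : dW e u z0 r hh hh z = dW e u z0 r (Sum.inl e) (Sum.inl e) z := by
  unfold dW
  simp [sg, ix, hh]

lemma dW_inl (e : Fin n) (z0 : ℝ × ES n) (r : ℝ) {z : Ix n → ℝ} (hz : z ∈ Cb tt 1) (k l : Fin n) : dW e u z0 r (Sum.inl k) (Sum.inl l) z =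
    sd2 k l (u (Am e z0 r 1 z).1) (Am e z0 r 1 z).2 - sd2 k l (u (Am e z0 r (-1) z).1) (Am e z0 r (-1) z).2 := by
  unfold dW
  rw [indicator_of_mem hz]
  simp [sg, ix, hh]

lemma dW_le (e : Fin n) (z0 : ℝ × ES n) (r : ℝ) (z : Ix n → ℝ) (i j : Ix n) : |dW e u z0 r i j z| ≤ hA e u z0 r 1 z + hA e u z0 r (-1) z := by
  unfold dW hA
  by_cases hz : z ∈ Cb tt 1
  · rw [indicator_of_mem hz, indicator_of_mem hz, indicator_of_mem hz]
    have h1 := HsN_ge u (Am e z0 r 1 z) (ix e i) (ix e j)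
    have h2 := HsN_ge u (Am e z0 r (-1) z) (ix e i) (ix e j)
    have hsg : |sg i * sg j| = 1 := by unfold sg; split_ifs <;> simp
    refine (abs_sub _ _).trans ?_
    rw [abs_mul, hsg, one_mul]; linarith
  · simp [indicator_of_notMem hz]

lemma frz (H : Dat m e q ν δ p ω a u f Ka Kf P) (z0 : ℝ × ES n) {r : ℝ} (hr : 0 ≤ r) {z : Ix n → ℝ} (hz : z ∈ Cb tt 1) (k l : Fin n) :
    |a k l (Am e z0 r 0 z).1 (Am e z0 r 0 z).2 - aF a m z0 r k l (z (Sum.inl m))| ≤ ω (r * (n + 3)) := by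
  unfold aF
  have h1 := H.ac k l (Am e z0 r 0 z).1 z0.1 (Am e z0 r 0 z).2 (z0.2 + (r * z (Sum.inl m)) • eu m) (by
    rw [Am_snd']; simp [eu_apply])
  refine h1.trans (H.ωm ?_ ?_ ?_)
  · exact mem_Ici.2 (by positivity)
  · exact mem_Ici.2 (by positivity)
  · have h2 := Am_dist e z0 hr (σ := 0) (by simp) hz
    have h3 : dist z0.2 (z0.2 + (r * z (Sum.inl m)) • eu m) ≤ r := by
      rw [dist_self_add_right, norm_smul, norm_eu, mul_one, norm_mul, Real.norm_of_nonneg hr, Real.norm_eq_abs]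
      exact mul_le_of_le_one_right hr (hz.2.2 _ (inl_ne_tt m))
    have h4 : |(Am e z0 r 0 z).1 - z0.1| ^ ((1:ℝ)/2) ≤ r := by
      rw [Am_fst, add_sub_cancel_left, ← Real.sqrt_eq_rpow]
      apply Real.sqrt_le_iff.2 ⟨hr, ?_⟩
      rw [abs_mul, abs_of_nonneg (sq_nonneg r)]
      have : |z tt| ≤ 1 := by rw [abs_le]; constructor <;> linarith [hz.1, hz.2.1]
      nlinarith [sq_nonneg r]
    have := dist_triangle (Am e z0 r 0 z).2 z0.2 (z0.2 + (r * z (Sum.inl m)) • eu m)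
    linarith

/-- size of the data -/
def Bd (n : ℕ) (B r : ℝ) (e : Fin n) (u : ℝ → ES n → ℝ) (z0 : ℝ × ES n) (A : ℝ) (z : Ix n → ℝ) : ℝ :=
  A + B * (hA e u z0 r 1 z + hA e u z0 r (-1) z)

lemma fdiff (H : Dat m e q ν δ p ω a u f Ka Kf P) (hγ : 0 < δ - ((n : ℝ) + 2) / p) (hγ1 : δ - ((n : ℝ) + 2) / p ≤ 1) {z0 : ℝ × ES n} (h0 : z0 ∈ Rg n) {r : ℝ} (hr : 0 < r) (hr1 : r ≤ 1 / (8 * (n + 1)))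
    {z : Ix n → ℝ} (hz : z ∈ Cb tt 1) :
    |f (Am e z0 r 1 z).1 (Am e z0 r 1 z).2 - f (Am e z0 r (-1) z).1 (Am e z0 r (-1) z).2| ≤ 2 * Kf * r ^ (δ - ((n : ℝ) + 2) / p) := by
  refine (PH_Am hγ.le H.Kf0 H.fh H.eq h0 hr.le hr1 (σ := 1) (τ := -1) (by simp) (by simp) hz).trans ?_
  have e1 : |(1:ℝ) - -1| = 2 := by norm_num
  rw [e1, Real.mul_rpow (by norm_num) hr.le]
  have h2 : (2:ℝ) ^ (δ - ((n : ℝ) + 2) / p) ≤ 2 := by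
    calc (2:ℝ) ^ (δ - ((n : ℝ) + 2) / p) ≤ 2 ^ (1:ℝ) := Real.rpow_le_rpow_of_exponent_le (by norm_num) hγ1
      _ = 2 := by simp
  have h3 := H.Kf0
  have h4 : 0 ≤ r ^ (δ - ((n : ℝ) + 2) / p) := by positivity
  calc _ ≤ Kf * (2 * r ^ (δ - ((n : ℝ) + 2) / p)) := by gcongr
    _ = _ := by ring

set_option maxHeartbeats 1000000 in
lemma FoW_ae (H : Dat m e q ν δ p ω a u f Ka Kf P) (hγ : 0 < δ - ((n : ℝ) + 2) / p) (hγ1 : δ - ((n : ℝ) + 2) / p ≤ 1) {z0 : ℝ × ES n} (h0 : z0 ∈ Rg n) {r : ℝ} (hr : 0 < r) (hr1 : r ≤ 1 / (8 * (n + 1))) :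
    ∀ᵐ z ∂(volume.restrict (Cb tt 1)),
      |FoW (bC m (aF a m z0 r)) (MC ν e m (aF a m z0 r)) (dT e (td u) z0 r) (dW e u z0 r) z| ≤
        ν⁻¹ * (Bd n (n ^ 2 * (Ka * r ^ δ)) r e u z0 (2 * Kf * r ^ (δ - ((n : ℝ) + 2) / p)) z + ω (r * (n + 3)) * ∑ k : Fin n, ∑ l : Fin n, |dW e u z0 r (Sum.inl k) (Sum.inl l) z|)
      ∧ |dT e (td u) z0 r z| ≤ Bd n (n ^ 2 * ν⁻¹) r e u z0 (2 * Kf * r ^ (δ - ((n : ℝ) + 2) / p)) z := by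
  filter_upwards [ae_Am e h0 hr hr1 (by simp : |(1:ℝ)| ≤ 1) H.hE, ae_Am e h0 hr hr1 (by simp : |(-1:ℝ)| ≤ 1) H.hE, ae_restrict_mem (Cb_meas tt 1)] with z h1 h2 hz
  have hf := fdiff H hγ hγ1 h0 hr hr1 hz
  have hT : dT e (td u) z0 r z = td u (Am e z0 r 1 z).1 (Am e z0 r 1 z).2 - td u (Am e z0 r (-1) z).1 (Am e z0 r (-1) z).2 := by
    unfold dT; rw [indicator_of_mem hz]
  have hg1 : hA e u z0 r 1 z = HsN u (Am e z0 r 1 z) := by unfold hA; rw [indicator_of_mem hz]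
  have hg2 : hA e u z0 r (-1) z = HsN u (Am e z0 r (-1) z) := by unfold hA; rw [indicator_of_mem hz]
  have b1 := fun k l => HsN_ge u (Am e z0 r 1 z) k l
  have b2 := fun k l => HsN_ge u (Am e z0 r (-1) z) k l
  have c1 : ∀ k l, |a k l (Am e z0 r 1 z).1 (Am e z0 r 1 z).2 - a k l (Am e z0 r 0 z).1 (Am e z0 r 0 z).2| ≤ Ka * r ^ δ := by
    intro k l
    have := PH_Am H.δ0.le H.Ka0 (H.ah k l) H.eq h0 hr.le hr1 (σ := 1) (τ := 0) (by simp) (by simp) hz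
    simpa using this
  have c2 : ∀ k l, |a k l (Am e z0 r (-1) z).1 (Am e z0 r (-1) z).2 - a k l (Am e z0 r 0 z).1 (Am e z0 r 0 z).2| ≤ Ka * r ^ δ := by
    intro k l
    have := PH_Am H.δ0.le H.Ka0 (H.ah k l) H.eq h0 hr.le hr1 (σ := -1) (τ := 0) (by simp) (by simp) hz
    simpa using this
  have hKr : 0 ≤ Ka * r ^ δ := mul_nonneg H.Ka0 (by positivity)
  have hν := H.ν0
  constructor
  · rw [FoW_concrete ν H.em (fun s i j => (aF_El H z0 r s).symm i j) _ _ z (fun i => dW_symm e H.hu h0 hr.le hr1 hz _ _) (dW_hh ..), abs_mul]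
    have hd := (aF_El H z0 r (z (Sum.inl m))).diag m
    have hi : |(aF a m z0 r m m (z (Sum.inl m)))⁻¹| ≤ ν⁻¹ := by
      rw [abs_of_nonneg (inv_nonneg.2 (hν.le.trans hd.1))]
      exact (inv_le_inv₀ (hν.trans_le hd.1) hν).2 hd.1
    refine mul_le_mul hi ?_ (abs_nonneg _) (by positivity)
    have key : dT e (td u) z0 r z - ∑ k, ∑ l, aF a m z0 r k l (z (Sum.inl m)) * dW e u z0 r (Sum.inl k) (Sum.inl l) z =
        (f (Am e z0 r 1 z).1 (Am e z0 r 1 z).2 - f (Am e z0 r (-1) z).1 (Am e z0 r (-1) z).2)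
        + ∑ k, ∑ l, (a k l (Am e z0 r 1 z).1 (Am e z0 r 1 z).2 - a k l (Am e z0 r 0 z).1 (Am e z0 r 0 z).2) * sd2 k l (u (Am e z0 r 1 z).1) (Am e z0 r 1 z).2
        - ∑ k, ∑ l, (a k l (Am e z0 r (-1) z).1 (Am e z0 r (-1) z).2 - a k l (Am e z0 r 0 z).1 (Am e z0 r 0 z).2) * sd2 k l (u (Am e z0 r (-1) z).1) (Am e z0 r (-1) z).2
        + ∑ k, ∑ l, (a k l (Am e z0 r 0 z).1 (Am e z0 r 0 z).2 - aF a m z0 r k l (z (Sum.inl m))) * dW e u z0 r (Sum.inl k) (Sum.inl l) z := by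
      rw [hT, ← h1, ← h2]
      simp only [dW_inl e z0 r hz, sub_mul, mul_sub, Finset.sum_sub_distrib]
      ring
    rw [key]
    have s1 := ds_le2 hKr c1 b1
    have s2 := ds_le2 hKr c2 b2
    have s3 := ds_le1 (y := fun k l => dW e u z0 r (Sum.inl k) (Sum.inl l) z) (fun k l => frz H z0 hr.le hz k l)
    unfold Bd
    rw [hg1, hg2]
    rw [abs_le] at s1 s2 s3 hf ⊢
    constructor <;> linarith [s1.1, s1.2, s2.1, s2.2, s3.1, s3.2, hf.1, hf.2]
  · have s1 := ds_le2 (by positivity) (fun k l => (H.ell (Am e z0 r 1 z).1 (Am e z0 r 1 z).2).bd hν k l) b1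
    have s2 := ds_le2 (by positivity) (fun k l => (H.ell (Am e z0 r (-1) z).1 (Am e z0 r (-1) z).2).bd hν k l) b2
    rw [hT]
    unfold Bd
    rw [hg1, hg2]
    rw [abs_le] at s1 s2 hf ⊢
    constructor <;> linarith [s1.1, s1.2, s2.1, s2.2, hf.1, hf.2]

lemma Bd_LB (e : Fin n) (hu : ParClassical (parQ n 1) u) {z0 : ℝ × ES n} (h0 : z0 ∈ Rg n) {r : ℝ} (hr : 0 ≤ r) (hr1 : r ≤ 1 / (8 * (n + 1))) (A B : ℝ) :
    LB (Bd n B r e u z0 A) :=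
  (LB.const A).add (((hA_LB e hu h0 hr hr1 (by simp)).add (hA_LB e hu h0 hr hr1 (by simp))).cmul B)

lemma N2_Bd (H : Dat m e q ν δ p ω a u f Ka Kf P) {z0 : ℝ × ES n} (h0 : z0 ∈ Rg n) {r : ℝ} (hr : 0 < r) (hr1 : r ≤ 1 / (8 * (n + 1))) (A B : ℝ) :
    N2 tt 1 (Bd n B r e u z0 A) ≤ V2 n * (2 * A ^ 2 + 8 * (B * (P * r ^ (-((n + 2 : ℝ) / p)))) ^ 2) := by
  have l1 := hA_LB e H.hu h0 hr.le hr1 (σ := 1) (by simp)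
  have l2 := hA_LB e H.hu h0 hr.le hr1 (σ := -1) (by simp)
  have b1 := N2_hA e H.hu h0 hr hr1 (σ := 1) (by simp) H.p2 H.P0 H.hI
  have b2 := N2_hA e H.hu h0 hr hr1 (σ := -1) (by simp) H.p2 H.P0 H.hI
  have h1 := N2_add l1 l2 tt 1
  have h2 := N2_add (LB.const A) ((l1.add l2).cmul B) tt 1
  rw [N2_cmul, N2_constCb, card_Ix] at h2
  have h3 : N2 tt 1 (Bd n B r e u z0 A) = N2 tt 1 (fun z => A + B * (hA e u z0 r 1 z + hA e u z0 r (-1) z)) := rfl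
  have h4 : B ^ 2 * N2 tt 1 (fun z => hA e u z0 r 1 z + hA e u z0 r (-1) z) ≤ B ^ 2 * (4 * (V2 n * (P * r ^ (-((n + 2 : ℝ) / p))) ^ 2)) := by
    gcongr; linarith
  have h5 : A ^ 2 * 2 ^ (n + 1) ≤ A ^ 2 * V2 n := by gcongr; unfold V2; linarith
  rw [h3]
  calc _ ≤ _ := h2
    _ ≤ 2 * (A ^ 2 * V2 n) + 2 * (B ^ 2 * (4 * (V2 n * (P * r ^ (-((n + 2 : ℝ) / p))) ^ 2))) := by gcongr
    _ = _ := by ring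

/-- main constant -/
def C1 (n : ℕ) (ν : ℝ) : ℝ := 16 * V2 n * n ^ 4 * (ν⁻¹) ^ 2

set_option maxHeartbeats 1000000 in
lemma N2_FoW (H : Dat m e q ν δ p ω a u f Ka Kf P) (hγ : 0 < δ - ((n : ℝ) + 2) / p) (hγ1 : δ - ((n : ℝ) + 2) / p ≤ 1) {z0 : ℝ × ES n} (h0 : z0 ∈ Rg n) {r : ℝ} (hr : 0 < r) (hr1 : r ≤ 1 / (8 * (n + 1)))
    {c : Ix n → Ix n → ℝ} (hc : Adm tt hh c) :
    N2 tt 1 (FoW (bC m (aF a m z0 r)) (MC ν e m (aF a m z0 r)) (dT e (td u) z0 r) (dW e u z0 r)) ≤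
      C1 n ν * (ω (r * (n + 3)) ^ 2 * Ev tt 1 (dT e (td u) z0 r) (dW e u z0 r) c + ((Kf + Ka * P) * r ^ (δ - ((n : ℝ) + 2) / p)) ^ 2) := by
  have hn : (1:ℝ) ≤ n := by exact_mod_cast (Fin.pos e)
  set γ := δ - ((n : ℝ) + 2) / p with hγd
  set Ω := ω (r * (n + 3)) with hΩ
  set E := Ev tt 1 (dT e (td u) z0 r) (dW e u z0 r) c with hE
  have hE0 : 0 ≤ E := Ev_nonneg ..
  have lT := dT_LB e H.hu h0 hr.le hr1
  have lW := dW_LB e H.hu h0 hr.le hr1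
  have lS : LB (fun z => ∑ x : Fin n × Fin n, |dW e u z0 r (Sum.inl x.1) (Sum.inl x.2) z|) := LB.sum fun x _ => (lW _ _).abs
  have lB := Bd_LB e H.hu h0 hr.le hr1 (2 * Kf * r ^ γ) (n ^ 2 * (Ka * r ^ δ))
  have lF := (aF_Co H z0 r).lbFW lT lW
  have h1 := N2_ae lF ((lB.add (lS.cmul Ω)).cmul ν⁻¹) tt (r := 1) (by
    filter_upwards [FoW_ae H hγ hγ1 h0 hr hr1] with z hz
    have := hz.1
    rwa [← Fintype.sum_prod_type' (fun k l => |dW e u z0 r (Sum.inl k) (Sum.inl l) z|)] at this)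
  rw [N2_cmul] at h1
  have h2 := N2_add lB (lS.cmul Ω) tt 1
  rw [N2_cmul] at h2
  have h3 := N2_sum (Finset.univ : Finset (Fin n × Fin n)) (fun x _ => (lW (Sum.inl x.1) (Sum.inl x.2)).abs) tt 1
  have h4 : ∀ x : Fin n × Fin n, N2 tt 1 (fun z => |dW e u z0 r (Sum.inl x.1) (Sum.inl x.2) z|) ≤ E := by
    intro x
    have e1 := Ev_ij tt 1 (dT e (td u) z0 r) (dW e u z0 r) c (inl_ne_tt x.1) (inl_ne_tt x.2)
    rw [hc.zero _ _ (by simp [inl_ne_hh])] at e1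
    refine le_trans (le_of_eq ?_) e1
    unfold N2; congr 1; funext z; simp only [sq_abs, sub_zero]
  have h5 : ∑ x : Fin n × Fin n, N2 tt 1 (fun z => |dW e u z0 r (Sum.inl x.1) (Sum.inl x.2) z|) ≤ n ^ 2 * E := by
    refine (Finset.sum_le_sum fun x _ => h4 x).trans (le_of_eq ?_)
    rw [Finset.sum_const, Finset.card_univ, Fintype.card_prod, Fintype.card_fin, nsmul_eq_mul]; push_cast; ring
  have h6 : N2 tt 1 (fun z => ∑ x : Fin n × Fin n, |dW e u z0 r (Sum.inl x.1) (Sum.inl x.2) z|) ≤ n ^ 4 * E := by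
    refine h3.trans ?_
    simp only [Finset.card_univ, Fintype.card_prod, Fintype.card_fin]
    push_cast
    calc (n:ℝ) * n * _ ≤ (n:ℝ) * n * (n ^ 2 * E) := by gcongr
      _ = _ := by ring
  have h7 := N2_Bd H h0 hr hr1 (2 * Kf * r ^ γ) (n ^ 2 * (Ka * r ^ δ))
  have h8 : n ^ 2 * (Ka * r ^ δ) * (P * r ^ (-((n + 2 : ℝ) / p))) = n ^ 2 * (Ka * P * r ^ γ) := by
    have : r ^ γ = r ^ δ * r ^ (-((n + 2 : ℝ) / p)) := by rw [← Real.rpow_add hr]; congr 1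
    rw [this]; ring
  rw [h8] at h7
  set R := r ^ γ with hR
  have hR0 : 0 ≤ R := by positivity
  have hV : 2 ≤ V2 n := by unfold V2; linarith [pow_pos (two_pos : (0:ℝ) < 2) (n + 1)]
  have h9 : 2 * (2 * Kf * R) ^ 2 + 8 * (n ^ 2 * (Ka * P * R)) ^ 2 ≤ 8 * n ^ 4 * ((Kf + Ka * P) * R) ^ 2 := by
    have hn4 : (1:ℝ) ≤ n ^ 4 := one_le_pow₀ hn
    have k1 := mul_nonneg H.Kf0 hR0
    have k2 : 0 ≤ Ka * P * R := mul_nonneg (mul_nonneg H.Ka0 H.P0.le) hR0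
    have k3 : (Kf * R) ^ 2 * 1 ≤ (Kf * R) ^ 2 * n ^ 4 := by gcongr
    have k4 : 0 ≤ (n:ℝ) ^ 4 * ((Kf * R) * (Ka * P * R)) := by positivity
    nlinarith
  have hK2 : 0 ≤ ((Kf + Ka * P) * R) ^ 2 := sq_nonneg _
  have hν2 : 0 ≤ (ν⁻¹) ^ 2 := sq_nonneg _
  calc _ ≤ _ := h1
    _ ≤ (ν⁻¹) ^ 2 * (2 * (V2 n * (8 * n ^ 4 * ((Kf + Ka * P) * R) ^ 2)) + 2 * (Ω ^ 2 * (n ^ 4 * E))) := by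
        have : V2 n * (2 * (2 * Kf * R) ^ 2 + 8 * (n ^ 2 * (Ka * P * R)) ^ 2) ≤ V2 n * (8 * n ^ 4 * ((Kf + Ka * P) * R) ^ 2) := by gcongr
        have h6' : Ω ^ 2 * N2 tt 1 (fun z => ∑ x : Fin n × Fin n, |dW e u z0 r (Sum.inl x.1) (Sum.inl x.2) z|) ≤ Ω ^ 2 * (n ^ 4 * E) := by gcongr
        gcongr
        linarith
    _ ≤ _ := by
        unfold C1
        have : (ν⁻¹) ^ 2 * (2 * (Ω ^ 2 * (n ^ 4 * E))) ≤ (ν⁻¹) ^ 2 * (16 * V2 n * (Ω ^ 2 * (n ^ 4 * E))) := by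
          have : 0 ≤ Ω ^ 2 * (n ^ 4 * E) := by positivity
          gcongr; linarith
        nlinarith

/-- constant of the initial bound -/
def C2 (n : ℕ) (ν p r : ℝ) : ℝ := (n + 2) ^ 2 * (V2 n * (8 * (n ^ 4 * (ν⁻¹) ^ 2 + 1) * (1 + r ^ (-((n + 2 : ℝ) / p))) ^ 2))

lemma C2_pos (n : ℕ) {ν p r : ℝ} (hr : 0 < r) : 0 < C2 n ν p r := by
  unfold C2 V2; positivity

set_option maxHeartbeats 1000000 in
lemma Ev0 (H : Dat m e q ν δ p ω a u f Ka Kf P) (hγ : 0 < δ - ((n : ℝ) + 2) / p) (hγ1 : δ - ((n : ℝ) + 2) / p ≤ 1) {z0 : ℝ × ES n} (h0 : z0 ∈ Rg n) {r : ℝ} (hr : 0 < r) (hr1 : r ≤ 1 / (8 * (n + 1))) :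
    Ev tt 1 (dT e (td u) z0 r) (dW e u z0 r) (fun _ _ => 0) ≤ C2 n ν p r * (Kf + P) ^ 2 := by
  set γ := δ - ((n : ℝ) + 2) / p with hγd
  set L := r ^ (-((n + 2 : ℝ) / p)) with hL
  have hL0 : 0 ≤ L := by positivity
  have hR : r ^ γ ≤ 1 := by
    refine Real.rpow_le_one hr.le (hr1.trans ?_) hγ.le
    rw [div_le_one (by positivity)]; linarith [(Nat.cast_nonneg n : (0:ℝ) ≤ n)]
  have hR0 : 0 ≤ r ^ γ := by positivity
  have hV : 0 ≤ V2 n := by unfold V2; positivity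
  have hP := H.P0.le
  have hK := H.Kf0
  set X := V2 n * (8 * (n ^ 4 * (ν⁻¹) ^ 2 + 1) * (1 + L) ^ 2) * (Kf + P) ^ 2 with hX
  have lT := dT_LB e H.hu h0 hr.le hr1
  have lW := dW_LB e H.hu h0 hr.le hr1
  have hk : (Kf * r ^ γ) ^ 2 ≤ Kf ^ 2 := by
    have : Kf * r ^ γ ≤ Kf * 1 := by gcongr
    rw [mul_one] at this; gcongr
  have hbase : 0 ≤ (n:ℝ) ^ 4 * (ν⁻¹) ^ 2 := by positivity
  have hsq : Kf ^ 2 + (P * L) ^ 2 ≤ (1 + L) ^ 2 * (Kf + P) ^ 2 := by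
    have : (1 + L) * (Kf + P) = Kf + P * L + (P + L * Kf) := by ring
    rw [← mul_pow, this]
    have : 0 ≤ P * L := by positivity
    have : 0 ≤ P + L * Kf := by positivity
    nlinarith [mul_nonneg hK (by positivity : 0 ≤ P * L)]
  have hT : N2 tt 1 (dT e (td u) z0 r) ≤ X := by
    have h1 := N2_ae lT (Bd_LB e H.hu h0 hr.le hr1 (2 * Kf * r ^ γ) (n ^ 2 * ν⁻¹)) tt (r := 1) (by
      filter_upwards [FoW_ae H hγ hγ1 h0 hr hr1] with z hz using hz.2)
    refine (h1.trans (N2_Bd H h0 hr hr1 _ _)).trans ?_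
    rw [hX, mul_assoc (V2 n)]
    refine mul_le_mul_of_nonneg_left ?_ hV
    rw [← hL]
    have e1 : 2 * (2 * Kf * r ^ γ) ^ 2 + 8 * (↑n ^ 2 * ν⁻¹ * (P * L)) ^ 2 = 8 * (Kf * r ^ γ) ^ 2 + 8 * (n ^ 4 * (ν⁻¹) ^ 2) * (P * L) ^ 2 := by ring
    rw [e1]
    have e2 : (n ^ 4 * (ν⁻¹) ^ 2 + 1) * (Kf ^ 2 + (P * L) ^ 2) ≤ (n ^ 4 * (ν⁻¹) ^ 2 + 1) * ((1 + L) ^ 2 * (Kf + P) ^ 2) := by gcongr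
    nlinarith [mul_nonneg hbase (sq_nonneg Kf), sq_nonneg (P * L)]
  have hW : ∀ i j, N2 tt 1 (fun z => dW e u z0 r i j z - 0) ≤ X := by
    intro i j
    have h1 := N2_ae (lW i j) (Bd_LB e H.hu h0 hr.le hr1 0 1) tt (r := 1) (ae_of_all _ fun z => by
      unfold Bd; rw [zero_add, one_mul]; exact dW_le ..)
    simp only [sub_zero]
    refine (h1.trans (N2_Bd H h0 hr hr1 _ _)).trans ?_
    rw [hX, mul_assoc (V2 n)]
    refine mul_le_mul_of_nonneg_left ?_ hV
    rw [← hL]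
    have e2 : (n ^ 4 * (ν⁻¹) ^ 2 + 1) * (Kf ^ 2 + (P * L) ^ 2) ≤ (n ^ 4 * (ν⁻¹) ^ 2 + 1) * ((1 + L) ^ 2 * (Kf + P) ^ 2) := by gcongr
    nlinarith [mul_nonneg hbase (sq_nonneg Kf), mul_nonneg hbase (sq_nonneg (P * L)), sq_nonneg (P * L), sq_nonneg Kf]
  have hX0 : 0 ≤ X := by positivity
  have hcard : ((Sx (tt : Ix n)).card : ℝ) = n + 1 := by
    have : (Sx (tt : Ix n)).card = n + 1 := by
      unfold Sx; rw [Finset.card_erase_of_mem (Finset.mem_univ _), Finset.card_univ, card_Ix]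
    rw [this]; push_cast; ring
  have hS : ∑ i ∈ Sx (tt : Ix n), ∑ j ∈ Sx (tt : Ix n), N2 tt 1 (fun z => dW e u z0 r i j z - 0) ≤ (n + 1) ^ 2 * X := by
    refine (Finset.sum_le_sum fun i _ => Finset.sum_le_sum fun j _ => hW i j).trans (le_of_eq ?_)
    simp only [Finset.sum_const, nsmul_eq_mul, hcard]; ring
  have e3 : C2 n ν p r * (Kf + P) ^ 2 = (n + 2) ^ 2 * X := by unfold C2; rw [hX]; ring
  rw [e3]
  unfold Ev
  have hn0 : (0:ℝ) ≤ n := Nat.cast_nonneg n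
  nlinarith

end fow
end PSP

namespace PSP
open scoped ENNReal
section cmp
variable {n : ℕ}
variable {m e : Fin n} {q : ℕ} {ν δ p : ℝ} {ω : ℝ → ℝ} {a : Fin n → Fin n → ℝ → ES n → ℝ} {u f : ℝ → ES n → ℝ} {Ka Kf P : ℝ}

/-- value of the doubled Hessian at the base point -/
def cW (e : Fin n) (u : ℝ → ES n → ℝ) (z0 : ℝ × ES n) (i j : Ix n) : ℝ := (1 - sg i * sg j) * sd2 (ix e i) (ix e j) (u z0.1) z0.2

lemma Rg_sub {z0 : ℝ × ES n} (h0 : z0 ∈ Rg n) : z0 ∈ parQ n 1 := by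
  obtain ⟨⟨h1, h2⟩, h3⟩ := h0
  refine ⟨⟨by linarith, h2⟩, ?_⟩
  rw [mem_ball] at h3 ⊢; linarith

lemma Am_dist' (e : Fin n) (z0 : ℝ × ES n) {r σ : ℝ} (hr : 0 ≤ r) (hr1 : r ≤ 1) (hσ : |σ| ≤ 1) {z : Ix n → ℝ} (hz : z ∈ Cb tt 1) :
    dist (Am e z0 r σ z) z0 ≤ r * (n + 1) := by
  rw [Prod.dist_eq]
  refine max_le ?_ (Am_dist e z0 hr hσ hz)
  rw [Am_fst, Real.dist_eq, add_sub_cancel_left, abs_mul, abs_of_nonneg (sq_nonneg r)]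
  have h1 : |z tt| ≤ 1 := by rw [abs_le]; constructor <;> linarith [hz.1, hz.2.1]
  have hn0 : (0:ℝ) ≤ n := Nat.cast_nonneg n
  calc r ^ 2 * |z tt| ≤ r ^ 2 * 1 := by gcongr
    _ ≤ r * (n + 1) := by nlinarith [mul_nonneg hr hn0]

lemma dW_lim (e : Fin n) (hu : ParClassical (parQ n 1) u) {z0 : ℝ × ES n} (h0 : z0 ∈ Rg n) (i j : Ix n) {ε : ℝ} (hε : 0 < ε) :
    ∃ η, 0 < η ∧ ∀ r, 0 ≤ r → r ≤ 1 → r < η → ∀ z ∈ Cb tt 1, |dW e u z0 r i j z - cW e u z0 i j| ≤ ε := by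
  have hc := (hu.2.2.2.2.2 (ix e i) (ix e j)).continuousAt ((parQ_open n 1).mem_nhds (Rg_sub h0))
  obtain ⟨η, hη, hb⟩ := Metric.continuousAt_iff.1 hc (ε / 2) (half_pos hε)
  refine ⟨η / (n + 1), by positivity, fun r hr hr1 hrη z hz => ?_⟩
  rw [lt_div_iff₀ (by positivity)] at hrη
  have h1 := hb (lt_of_le_of_lt (Am_dist' e z0 hr hr1 (σ := 1) (by simp) hz) hrη)
  have h2 := hb (lt_of_le_of_lt (Am_dist' e z0 hr hr1 (σ := -1) (by simp) hz) hrη)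
  rw [Real.dist_eq] at h1 h2
  unfold dW cW
  rw [indicator_of_mem hz]
  rw [abs_lt] at h1 h2
  have hsg : sg i * sg j = 1 ∨ sg i * sg j = -1 := by unfold sg; split_ifs <;> simp
  rcases hsg with h | h <;> rw [h, abs_le] <;> constructor <;> linarith [h1.1, h1.2, h2.1, h2.2]

lemma dl_Cb {θ : ℝ} (hθ : 0 < θ) (hθ1 : θ ≤ 1) {z : Ix n → ℝ} (hz : z ∈ Cb tt 1) : dl tt θ z ∈ Cb tt 1 :=
  Cb_mono tt hθ.le hθ1 ((dl_mem hθ z).2 hz)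

lemma dT_dl (e : Fin n) (g : ℝ → ES n → ℝ) (z0 : ℝ × ES n) (r : ℝ) {θ : ℝ} (hθ : 0 < θ) (hθ1 : θ ≤ 1) {z : Ix n → ℝ} (hz : z ∈ Cb tt 1) :
    dT e g z0 (r * θ) z = dT e g z0 r (dl tt θ z) := by
  unfold dT
  rw [indicator_of_mem hz, indicator_of_mem (dl_Cb hθ hθ1 hz), Am_dl, Am_dl]

lemma dW_dl (e : Fin n) (u : ℝ → ES n → ℝ) (z0 : ℝ × ES n) (r : ℝ) {θ : ℝ} (hθ : 0 < θ) (hθ1 : θ ≤ 1) (i j : Ix n) {z : Ix n → ℝ} (hz : z ∈ Cb tt 1) :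
    dW e u z0 (r * θ) i j z = dW e u z0 r i j (dl tt θ z) := by
  unfold dW
  rw [indicator_of_mem hz, indicator_of_mem (dl_Cb hθ hθ1 hz), Am_dl, Am_dl]

set_option maxHeartbeats 1000000 in
/-- discrete decay -/
lemma decay0 (m : Fin n) (ν δ p : ℝ) (ω : ℝ → ℝ) (hν : 0 < ν) (hγ : 0 < δ - ((n : ℝ) + 2) / p) (hγ1 : δ - ((n : ℝ) + 2) / p < 1)
    (hωlim : Tendsto ω (nhdsWithin 0 (Ioi (0 : ℝ))) (nhds 0)) (hω0 : ∀ r, 0 ≤ ω r) :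
    ∃ θ r0 C : ℝ, 0 < θ ∧ θ ≤ 1/8 ∧ 0 < r0 ∧ r0 ≤ 1 / (8 * (n + 1)) ∧ 0 < C ∧
      ∀ (e : Fin n) (q : ℕ) (a : Fin n → Fin n → ℝ → ES n → ℝ) (u f : ℝ → ES n → ℝ) (Ka Kf P : ℝ), Dat m e q ν δ p ω a u f Ka Kf P →
      ∀ z0 ∈ Rg n, ∀ k : ℕ, N2 tt 1 (dT e (td u) z0 (r0 * θ ^ k)) ≤ (C * (Kf + (1 + Ka) * P) * (θ ^ (δ - ((n : ℝ) + 2) / p)) ^ k) ^ 2 ∧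
        ∀ i j, i ≠ tt → j ≠ tt → N2 tt 1 (fun z => dW e u z0 (r0 * θ ^ k) i j z - cW e u z0 i j) ≤ (C * (Kf + (1 + Ka) * P) * (θ ^ (δ - ((n : ℝ) + 2) / p)) ^ k) ^ 2 := by
  set γ := δ - ((n : ℝ) + 2) / p with hγd
  obtain ⟨θ, hθ0, hθ8, ε0, hε0, K, hK, hit⟩ := iter (tt : Ix n) (Sum.inl m) hh (ν ^ 2 / 6) γ hγ hγ1
  have hn0 : (0:ℝ) ≤ n := Nat.cast_nonneg n
  have hC1 : 0 ≤ C1 n ν := by unfold C1 V2; positivity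
  -- choose r0
  obtain ⟨r0, hr0, hr01, hωr⟩ : ∃ r0, 0 < r0 ∧ r0 ≤ 1 / (8 * ((n:ℝ) + 1)) ∧ C1 n ν * ω (r0 * (n + 3)) ^ 2 ≤ ε0 := by
    have h1 : Tendsto (fun s => C1 n ν * ω s ^ 2) (nhdsWithin 0 (Ioi (0 : ℝ))) (nhds (C1 n ν * 0 ^ 2)) := (hωlim.pow 2).const_mul _
    have h2 : ∀ᶠ s in nhdsWithin 0 (Ioi (0 : ℝ)), C1 n ν * ω s ^ 2 < ε0 := h1.eventually_lt_const (by simpa using hε0)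
    obtain ⟨η, hη, hb⟩ := mem_nhdsGT_iff_exists_Ioo_subset.1 h2
    have hη' : (0:ℝ) < η := hη
    refine ⟨min (1 / (8 * ((n:ℝ) + 1))) (η / (2 * (n + 3))), lt_min (by positivity) (by positivity), min_le_left _ _, ?_⟩
    have h3 : min (1 / (8 * ((n:ℝ) + 1))) (η / (2 * (n + 3))) * (n + 3) < η := by
      calc _ ≤ η / (2 * (n + 3)) * (n + 3) := by gcongr; exact min_le_right _ _
        _ = η / 2 := by field_simp
        _ < η := by linarith
    have h4 : 0 < min (1 / (8 * ((n:ℝ) + 1))) (η / (2 * (n + 3))) := lt_min (by positivity) (by positivity)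
    exact le_of_lt (hb ⟨by positivity, h3⟩)
  have hC2 := C2_pos n (ν := ν) (p := p) hr0
  set C3 := C1 n ν + C2 n ν p r0 + 1 with hC3
  have hC3a : C1 n ν ≤ C3 ^ 2 := by nlinarith
  have hC3b : C2 n ν p r0 ≤ C3 ^ 2 := by nlinarith
  refine ⟨θ, r0, K * C3, hθ0, hθ8, hr0, hr01, by positivity, ?_⟩
  intro e q a u f Ka Kf P H z0 h0
  set M0 := Kf + (1 + Ka) * P with hM0
  have hKa := H.Ka0
  have hKf := H.Kf0
  have hP := H.P0
  have hM00 : 0 ≤ M0 := by positivity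
  have hrk : ∀ k : ℕ, 0 < r0 * θ ^ k := fun k => by positivity
  have hθk : ∀ k : ℕ, θ ^ k ≤ 1 := fun k => pow_le_one₀ hθ0.le (by linarith)
  have hrk0 : ∀ k : ℕ, r0 * θ ^ k ≤ r0 := fun k => mul_le_of_le_one_right hr0.le (hθk k)
  have hrk1 : ∀ k : ℕ, r0 * θ ^ k ≤ 1 / (8 * ((n:ℝ) + 1)) := fun k => (hrk0 k).trans hr01
  have hr0le1 : r0 ≤ 1 := hr01.trans (by rw [div_le_one (by positivity)]; linarith)
  have hpw : ∀ k : ℕ, (r0 * θ ^ k) ^ γ ≤ (θ ^ γ) ^ k := by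
    intro k
    rw [Real.mul_rpow hr0.le (by positivity), ← Real.rpow_natCast, ← Real.rpow_mul hθ0.le, mul_comm (k:ℝ) γ, Real.rpow_mul hθ0.le, Real.rpow_natCast]
    exact mul_le_of_le_one_left (by positivity) (Real.rpow_le_one hr0.le hr0le1 hγ.le)
  have hmain := hit (fun k => bC m (aF a m z0 (r0 * θ ^ k))) (fun k => MC ν e m (aF a m z0 (r0 * θ ^ k))) (fun k => dT e (td u) z0 (r0 * θ ^ k)) (fun k => dW e u z0 (r0 * θ ^ k))
    (cW e u z0) (C3 * M0) (by positivity) (fun k => aF_Co H z0 _) (fun k => dT_LB e H.hu h0 (hrk k).le (hrk1 k)) (fun k => dW_LB e H.hu h0 (hrk k).le (hrk1 k))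
    (fun k => dAp e H.hu h0 (hrk k) (hrk1 k)) (fun k z hz => by
      rw [pow_succ, ← mul_assoc]; exact dT_dl e _ z0 _ hθ0 (by linarith) hz)
    (fun k i j z hz => by
      simp only [pow_succ, ← mul_assoc]; exact dW_dl e _ z0 _ hθ0 (by linarith) i j hz)
    (fun k c hc => by
      refine (N2_FoW H hγ hγ1.le h0 (hrk k) (hrk1 k) hc).trans ?_
      rw [mul_add, ← mul_assoc]
      have hE0 := Ev_nonneg tt 1 (dT e (td u) z0 (r0 * θ ^ k)) (dW e u z0 (r0 * θ ^ k)) c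
      refine add_le_add (mul_le_mul_of_nonneg_right (le_trans ?_ hωr) hE0) ?_
      · have : ω (r0 * θ ^ k * (n + 3)) ≤ ω (r0 * (n + 3)) := H.ωm (mem_Ici.2 (by positivity)) (mem_Ici.2 (by positivity)) (by have := hrk0 k; gcongr)
        have := hω0 (r0 * θ ^ k * (n + 3))
        gcongr
      · have h1 : (Kf + Ka * P) * (r0 * θ ^ k) ^ γ ≤ M0 * (θ ^ γ) ^ k := by
          have := hpw k
          have : Kf + Ka * P ≤ M0 := by rw [hM0]; linarith
          gcongr
        have h2 : 0 ≤ (Kf + Ka * P) * (r0 * θ ^ k) ^ γ := by positivity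
        calc _ ≤ C3 ^ 2 * (M0 * (θ ^ γ) ^ k) ^ 2 := by gcongr
          _ = _ := by ring)
    (by
      simp only [pow_zero, mul_one]
      refine (Ev0 H hγ hγ1.le h0 hr0 hr01).trans ?_
      have : Kf + P ≤ M0 := by rw [hM0]; nlinarith
      calc _ ≤ C3 ^ 2 * M0 ^ 2 := by gcongr
        _ = _ := by ring)
    (by
      intro i j _ _ ε hε
      obtain ⟨η, hη, hb⟩ := dW_lim e H.hu h0 i j hε
      have ht : Tendsto (fun k : ℕ => r0 * θ ^ k) atTop (nhds (r0 * 0)) := (tendsto_pow_atTop_nhds_zero_of_lt_one hθ0.le (by linarith)).const_mul _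
      have hev : ∀ᶠ k : ℕ in atTop, r0 * θ ^ k < η := ht.eventually_lt_const (by simpa using hη)
      obtain ⟨k0, hk0⟩ := eventually_atTop.1 hev
      exact ⟨k0, fun k hk z hz => hb _ (hrk k).le ((hrk0 k).trans hr0le1) (hk0 k hk) z hz⟩)
  intro k
  obtain ⟨h1, h2⟩ := hmain k
  have hle : K * (C3 * M0 * (θ ^ γ) ^ k) ^ 2 ≤ (K * C3 * M0 * (θ ^ γ) ^ k) ^ 2 := by
    have : (K * C3 * M0 * (θ ^ γ) ^ k) ^ 2 = K ^ 2 * (C3 * M0 * (θ ^ γ) ^ k) ^ 2 := by ring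
    rw [this]
    have : K ≤ K ^ 2 := by nlinarith
    gcongr
  exact ⟨h1.trans hle, fun i j hi hj => (h2 i j hi hj).trans hle⟩

set_option maxHeartbeats 1000000 in
/-- continuous decay -/
lemma decayC (m : Fin n) (ν δ p : ℝ) (ω : ℝ → ℝ) (hν : 0 < ν) (hγ : 0 < δ - ((n : ℝ) + 2) / p) (hγ1 : δ - ((n : ℝ) + 2) / p < 1)
    (hωlim : Tendsto ω (nhdsWithin 0 (Ioi (0 : ℝ))) (nhds 0)) (hω0 : ∀ r, 0 ≤ ω r) :
    ∃ r0 C : ℝ, 0 < r0 ∧ r0 ≤ 1 / (8 * (n + 1)) ∧ 0 < C ∧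
      ∀ (e : Fin n) (q : ℕ) (a : Fin n → Fin n → ℝ → ES n → ℝ) (u f : ℝ → ES n → ℝ) (Ka Kf P : ℝ), Dat m e q ν δ p ω a u f Ka Kf P →
      ∀ z0 ∈ Rg n, ∀ r, 0 < r → r ≤ r0 → N2 tt 1 (dT e (td u) z0 r) ≤ (C * (Kf + (1 + Ka) * P) * r ^ (δ - ((n : ℝ) + 2) / p)) ^ 2 ∧
        ∀ i j, i ≠ tt → j ≠ tt → N2 tt 1 (fun z => dW e u z0 r i j z - cW e u z0 i j) ≤ (C * (Kf + (1 + Ka) * P) * r ^ (δ - ((n : ℝ) + 2) / p)) ^ 2 := by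
  set γ := δ - ((n : ℝ) + 2) / p with hγd
  obtain ⟨θ, r0, C, hθ0, hθ8, hr0, hr01, hC, hd⟩ := decay0 m ν δ p ω hν hγ hγ1 hωlim hω0
  set c := Fintype.card (Ix n) + 1 with hc
  set B := ((θ⁻¹) ^ c + 1) * C * (r0 * θ) ^ (-γ) with hB
  have hB0 : 0 < B := by positivity
  refine ⟨r0, B, hr0, hr01, hB0, ?_⟩
  intro e q a u f Ka Kf P H z0 h0 r hr hrr
  obtain ⟨k, hk1, hk2⟩ := exists_nat_pow_near_of_lt_one (x := r / r0) (y := θ) (by positivity) (by rw [div_le_one hr0]; exact hrr) hθ0 (by linarith)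
  rw [lt_div_iff₀ hr0] at hk1
  rw [div_le_iff₀ hr0] at hk2
  set rk := r0 * θ ^ k with hrk
  have hrk0 : 0 < rk := by positivity
  have hrk1 : rk ≤ 1 / (8 * ((n:ℝ) + 1)) := (mul_le_of_le_one_right hr0.le (pow_le_one₀ hθ0.le (by linarith))).trans hr01
  set s := r / rk with hs
  have hs0 : 0 < s := by positivity
  have hs1 : s ≤ 1 := by rw [hs, div_le_one hrk0, hrk, mul_comm]; exact hk2
  have hsθ : θ ≤ s := by
    rw [hs, le_div_iff₀ hrk0, hrk]
    rw [pow_succ] at hk1; nlinarith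
  have hrs : r = rk * s := by rw [hs]; field_simp
  set X := C * (Kf + (1 + Ka) * P) * (θ ^ γ) ^ k with hX
  have hM0 : 0 ≤ Kf + (1 + Ka) * P := by
    have := H.Ka0; have := H.Kf0; have := H.P0; positivity
  have hXr : ((θ⁻¹) ^ c + 1) * X ≤ B * (Kf + (1 + Ka) * P) * r ^ γ := by
    have h1 : (θ ^ γ) ^ k ≤ (r0 * θ) ^ (-γ) * r ^ γ := by
      have e1 : (θ ^ γ) ^ k = (θ ^ k) ^ γ := by
        rw [← Real.rpow_natCast, ← Real.rpow_mul hθ0.le, mul_comm γ (k:ℝ), Real.rpow_mul hθ0.le, Real.rpow_natCast]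
      have e2 : (r0 * θ) ^ (-γ) * r ^ γ = (r / (r0 * θ)) ^ γ := by
        rw [Real.div_rpow hr.le (by positivity), Real.rpow_neg (by positivity)]; field_simp
      rw [e1, e2]
      refine Real.rpow_le_rpow (by positivity) ?_ hγ.le
      rw [le_div_iff₀ (by positivity)]
      rw [pow_succ] at hk1; nlinarith
    calc ((θ⁻¹) ^ c + 1) * X = ((θ⁻¹) ^ c + 1) * C * (Kf + (1 + Ka) * P) * (θ ^ γ) ^ k := by rw [hX]; ring
      _ ≤ ((θ⁻¹) ^ c + 1) * C * (Kf + (1 + Ka) * P) * ((r0 * θ) ^ (-γ) * r ^ γ) := by gcongr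
      _ = _ := by rw [hB]; ring
  have hX0 : 0 ≤ X := by positivity
  have gen : ∀ f g : (Ix n → ℝ) → ℝ, LB f → (∀ z ∈ Cb tt 1, g z = f (dl tt s z)) → N2 tt 1 f ≤ X ^ 2 → N2 tt 1 g ≤ (B * (Kf + (1 + Ka) * P) * r ^ γ) ^ 2 := by
    intro f g hf hg hb
    have h1 := N2_dl hf tt hs0 hg
    have h2 := N2_mono hf tt hs0.le hs1
    have h3 : θ ^ c * N2 tt 1 g ≤ X ^ 2 := by
      calc θ ^ c * N2 tt 1 g ≤ s ^ c * N2 tt 1 g := by have := N2_nonneg tt 1 g; gcongr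
        _ ≤ X ^ 2 := by rw [hc, ← h1]; exact h2.trans hb
    have h4 : N2 tt 1 g ≤ (θ⁻¹) ^ c * X ^ 2 := by
      rw [inv_pow, ← div_eq_inv_mul, le_div_iff₀ (by positivity)]; linarith
    calc N2 tt 1 g ≤ (θ⁻¹) ^ c * X ^ 2 := h4
      _ ≤ (((θ⁻¹) ^ c + 1) * X) ^ 2 := by
          rw [mul_pow ((θ⁻¹) ^ c + 1) X 2]
          have : 0 < (θ⁻¹) ^ c := by positivity
          refine mul_le_mul_of_nonneg_right ?_ (sq_nonneg X)
          nlinarith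
      _ ≤ _ := by gcongr
  obtain ⟨d1, d2⟩ := hd e q a u f Ka Kf P H z0 h0 k
  have lT := dT_LB e H.hu h0 hrk0.le hrk1
  have lW := dW_LB e H.hu h0 hrk0.le hrk1
  refine ⟨gen _ _ lT (fun z hz => ?_) d1, fun i j hi hj => gen _ _ ((lW i j).sub (LB.const _)) (fun z hz => ?_) (d2 i j hi hj)⟩
  · rw [hrs]; exact dT_dl e _ z0 _ hs0 hs1 hz
  · rw [hrs, dW_dl e _ z0 _ hs0 hs1 i j hz]

end cmp
end PSP

namespace PSP
open scoped ENNReal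
section grd
variable {n : ℕ}
variable {m e : Fin n} {q : ℕ} {ν δ p : ℝ} {ω : ℝ → ℝ} {a : Fin n → Fin n → ℝ → ES n → ℝ} {u f : ℝ → ES n → ℝ} {Ka Kf P : ℝ}

/-- change of cylinder -/
lemma N2_shift {F G : (Ix n → ℝ) → ℝ} (hF : LB F) (v : Ix n → ℝ) {s : ℝ} (hs : 0 < s) (hv : ∀ y ∈ Cb tt s, v + y ∈ Cb tt 1)
    (hG : ∀ z ∈ Cb tt 1, G z = F (v + dl tt s z)) : s ^ (Fintype.card (Ix n) + 1) * N2 tt 1 G ≤ N2 tt 1 F := by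
  have hFv : LB (fun y => F (v + y)) := by
    refine ⟨hF.meas.comp (by fun_prop), fun R => ?_⟩
    obtain ⟨C, hC⟩ := hF.bdd (‖v‖ + R)
    exact ⟨C, fun z hz => hC _ ((norm_add_le _ _).trans (by linarith))⟩
  rw [← N2_dl hFv tt hs hG]
  unfold N2
  have e1 : ∫ z in Cb tt 1, F z ^ 2 = ∫ z, (Cb tt 1).indicator (fun z => F z ^ 2) (v + z) := by
    rw [integral_add_left_eq_self (fun z => (Cb tt 1).indicator (fun z => F z ^ 2) z) v, integral_indicator (Cb_meas tt 1)]
  rw [e1, ← integral_indicator (Cb_meas tt s)]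
  have hi1 : Integrable ((Cb tt 1).indicator (fun z => F z ^ 2)) := (integrable_indicator_iff (Cb_meas tt 1)).2 (hF.sq.onCb tt 1)
  refine integral_mono ((integrable_indicator_iff (Cb_meas tt s)).2 (hFv.sq.onCb tt s)) (hi1.comp_add_left v) (fun z => ?_)
  by_cases hz : z ∈ Cb tt s
  · rw [indicator_of_mem hz, indicator_of_mem (hv z hz)]
  · rw [indicator_of_notMem hz]; exact indicator_nonneg (fun _ _ => sq_nonneg _) _

lemma Am_shift (e : Fin n) (z0 z1 : ℝ × ES n) {ρ : ℝ} (hρ : 0 < ρ) (σ : ℝ) (z : Ix n → ℝ) :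
    Am e z1 ρ σ z = Am e z0 (2 * ρ) σ ((Sum.elim (fun k => (z1.2 - z0.2) k / (2 * ρ)) (fun j => if j = 0 then (z1.1 - z0.1) / (4 * ρ ^ 2) else 0) : Ix n → ℝ) + dl tt (1/2) z) := by
  refine Prod.ext ?_ ?_
  · rw [Am_fst, Am_fst]
    simp only [Pi.add_apply, dl, tt, Sum.elim_inr, if_true]
    field_simp; ring
  · rw [Am_snd', Am_snd']
    ext i
    simp [Pi.add_apply, dl, tt, hh, Sum.elim_inr, eu_apply]
    by_cases h : i = e
    · simp [h]; field_simp; ring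
    · simp [h]; field_simp; ring

lemma coord_le (x y : ES n) (k : Fin n) : |x k - y k| ≤ dist x y := by
  have := PiLp.norm_apply_le (x - y) k
  rw [dist_eq_norm]; simpa using this

set_option maxHeartbeats 1000000 in
/-- local Hölder bound for the good second derivatives -/
lemma loc (m : Fin n) (ν δ p : ℝ) (ω : ℝ → ℝ) (hν : 0 < ν) (hγ : 0 < δ - ((n : ℝ) + 2) / p) (hγ1 : δ - ((n : ℝ) + 2) / p < 1)
    (hωlim : Tendsto ω (nhdsWithin 0 (Ioi (0 : ℝ))) (nhds 0)) (hω0 : ∀ r, 0 ≤ ω r) :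
    ∃ r0 C, 0 < r0 ∧ r0 ≤ 1 / (8 * ((n:ℝ) + 1)) ∧ 0 < C ∧
      ∀ (e : Fin n) (q : ℕ) (a : Fin n → Fin n → ℝ → ES n → ℝ) (u f : ℝ → ES n → ℝ) (Ka Kf P : ℝ), Dat m e q ν δ p ω a u f Ka Kf P →
      (∀ z0 ∈ Rg n, ∀ r, 0 < r → r ≤ r0 → N2 tt 1 (dT e (td u) z0 r) ≤ (C * (Kf + (1 + Ka) * P) * r ^ (δ - ((n : ℝ) + 2) / p)) ^ 2) ∧
      ∀ k : Fin n, ∀ z0 ∈ Rg n, ∀ z1 ∈ Rg n, ∀ r, 0 < r → r ≤ r0 → |z0.1 - z1.1| ≤ r ^ 2 → dist z0.2 z1.2 ≤ r →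
        |sd2 k e (u z0.1) z0.2 - sd2 k e (u z1.1) z1.2| ≤ C * (Kf + (1 + Ka) * P) * r ^ (δ - ((n : ℝ) + 2) / p) := by
  set γ := δ - ((n : ℝ) + 2) / p with hγd
  obtain ⟨r0, C, hr0, hr01, hC, hd⟩ := decayC m ν δ p ω hν hγ hγ1 hωlim hω0
  set c := Fintype.card (Ix n) + 1 with hc
  set B := 2 * C * 2 ^ γ * 2 ^ c with hB
  have h2c : (1:ℝ) ≤ 2 ^ c := one_le_pow₀ (by norm_num)
  have h2γ : (1:ℝ) ≤ 2 ^ γ := Real.one_le_rpow (by norm_num) hγ.le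
  have hCB : C ≤ B := by
    have : (1:ℝ) ≤ 2 ^ γ * 2 ^ c := by nlinarith
    rw [hB]; nlinarith
  refine ⟨r0 / 2, B, by positivity, by linarith, by positivity, ?_⟩
  intro e q a u f Ka Kf P H
  have hM0 : 0 ≤ Kf + (1 + Ka) * P := by
    have := H.Ka0; have := H.Kf0; have := H.P0; positivity
  set M := Kf + (1 + Ka) * P with hM
  refine ⟨fun z0 h0 r hr hrr => ((hd e q a u f Ka Kf P H z0 h0 r hr (by linarith)).1).trans (by gcongr), ?_⟩
  -- ordered version
  have key : ∀ k : Fin n, ∀ z0 ∈ Rg n, ∀ z1 ∈ Rg n, ∀ r, 0 < r → r ≤ r0 / 2 → z1.1 ≤ z0.1 → |z0.1 - z1.1| ≤ r ^ 2 → dist z0.2 z1.2 ≤ r →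
        |sd2 k e (u z0.1) z0.2 - sd2 k e (u z1.1) z1.2| ≤ B * M * r ^ γ := by
    intro k z0 h0 z1 h1 r hr hrr ht htr hx
    have d1 := (hd e q a u f Ka Kf P H z1 h1 r hr (by linarith)).2 hh (Sum.inl k) tt_ne_hh.symm (inl_ne_tt k)
    have d0 := (hd e q a u f Ka Kf P H z0 h0 (2 * r) (by linarith) (by linarith)).2 hh (Sum.inl k) tt_ne_hh.symm (inl_ne_tt k)
    set c0 := cW e u z0 hh (Sum.inl k) with hc0
    set c1 := cW e u z1 hh (Sum.inl k) with hc1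
    have l1 := dW_LB e H.hu h1 hr.le (by linarith) hh (Sum.inl k)
    have l0 := dW_LB e H.hu h0 (by linarith : 0 ≤ 2 * r) (by linarith) hh (Sum.inl k)
    set v : Ix n → ℝ := Sum.elim (fun k => (z1.2 - z0.2) k / (2 * r)) (fun j => if j = 0 then (z1.1 - z0.1) / (4 * r ^ 2) else 0) with hv
    rw [abs_of_nonneg (by linarith)] at htr
    have hvm : ∀ y ∈ Cb tt (1/2), v + y ∈ Cb tt 1 := by
      rintro y ⟨y1, y2, y3⟩
      have hvt : v tt = (z1.1 - z0.1) / (4 * r ^ 2) := by simp [hv, tt]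
      have hvt0 : v tt ≤ 0 := by rw [hvt]; exact div_nonpos_of_nonpos_of_nonneg (by linarith) (by positivity)
      have hvt1 : -(1/4) ≤ v tt := by rw [hvt, le_div_iff₀ (by positivity)]; linarith
      refine ⟨by simp only [Pi.add_apply]; linarith, by simp only [Pi.add_apply]; norm_num at y2 ⊢; linarith, fun i hi => ?_⟩
      have hvi : |v i| ≤ 1 / 2 := by
        rcases i with k | j
        · simp only [hv, Sum.elim_inl, PiLp.sub_apply, abs_div]
          have := coord_le z1.2 z0.2 k
          rw [dist_comm] at this
          rw [abs_of_pos (by linarith : 0 < 2 * r), div_le_iff₀ (by linarith)]; linarith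
        · have : j ≠ 0 := by rintro rfl; exact hi rfl
          simp [hv, this]
      simp only [Pi.add_apply]
      have := y3 i hi
      exact (abs_add_le _ _).trans (by linarith)
    have hG : ∀ z ∈ Cb tt 1, dW e u z1 r hh (Sum.inl k) z - c0 = (fun z => dW e u z0 (2 * r) hh (Sum.inl k) z - c0) (v + dl tt (1/2) z) := by
      intro z hz
      have hm := hvm _ ((dl_mem (by norm_num) z).2 hz)
      simp only
      congr 1
      unfold dW
      rw [indicator_of_mem hz, indicator_of_mem hm, Am_shift e z0 z1 hr, Am_shift e z0 z1 hr]
    have h2 := N2_shift (l0.sub (LB.const c0)) v (by norm_num : (0:ℝ) < 1/2) hvm hG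
    have h3 : N2 tt 1 (fun z => dW e u z1 r hh (Sum.inl k) z - c0) ≤ 2 ^ c * (C * M * (2 * r) ^ γ) ^ 2 := by
      have h4 := h2.trans d0
      rw [one_div, inv_pow, ← div_eq_inv_mul, div_le_iff₀ (by positivity)] at h4
      linarith
    have h5 := N2_sub (l1.sub (LB.const c0)) (l1.sub (LB.const c1)) tt 1
    have h6 : N2 tt 1 (fun z => (dW e u z1 r hh (Sum.inl k) z - c0) - (dW e u z1 r hh (Sum.inl k) z - c1)) = (c1 - c0) ^ 2 * 2 ^ (n + 1) := by
      have : (fun z : Ix n → ℝ => (dW e u z1 r hh (Sum.inl k) z - c0) - (dW e u z1 r hh (Sum.inl k) z - c1)) = fun _ => c1 - c0 := by funext z; ring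
      rw [this, N2_constCb, card_Ix]
    have h7 : (C * M * r ^ γ) ^ 2 ≤ (C * M * (2 * r) ^ γ) ^ 2 := by gcongr; linarith
    have h8 : (c1 - c0) ^ 2 ≤ (2 * (2 ^ c * (C * M * (2 * r) ^ γ))) ^ 2 := by
      have h9 : (c1 - c0) ^ 2 * 2 ^ (n + 1) ≤ 2 * (2 ^ c * (C * M * (2 * r) ^ γ) ^ 2) + 2 * (C * M * (2 * r) ^ γ) ^ 2 := by
        rw [← h6]; linarith
      have h10 : (c1 - c0) ^ 2 ≤ (c1 - c0) ^ 2 * 2 ^ (n + 1) := le_mul_of_one_le_right (sq_nonneg _) (one_le_pow₀ (by norm_num))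
      set Y := (C * M * (2 * r) ^ γ) with hY
      have hY2 := sq_nonneg Y
      have e2 : (2 * ((2:ℝ) ^ c * Y)) ^ 2 = 4 * ((2:ℝ) ^ c * (2:ℝ) ^ c) * Y ^ 2 := by ring
      rw [e2]
      nlinarith [mul_nonneg (sub_nonneg.2 h2c) hY2, mul_nonneg (mul_nonneg (sub_nonneg.2 h2c) (by linarith : (0:ℝ) ≤ 2 ^ c)) hY2]
    have h11 := abs_le_of_sq_le_sq h8 (by positivity)
    have e0 : c0 = 2 * sd2 k e (u z0.1) z0.2 := by
      rw [hc0, sd2_comm (H.hu.2.1 z0 (Rg_sub h0))]; simp [cW, sg, ix, hh]; norm_num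
    have e1 : c1 = 2 * sd2 k e (u z1.1) z1.2 := by
      rw [hc1, sd2_comm (H.hu.2.1 z1 (Rg_sub h1))]; simp [cW, sg, ix, hh]; norm_num
    rw [e0, e1] at h11
    have e3 : (2 * r) ^ γ = 2 ^ γ * r ^ γ := Real.mul_rpow (by norm_num) hr.le
    rw [e3] at h11
    have e4 : 2 * (2 ^ c * (C * M * (2 ^ γ * r ^ γ))) = B * M * r ^ γ := by rw [hB]; ring
    rw [e4] at h11
    have hnn : 0 ≤ B * M * r ^ γ := by positivity
    rw [abs_le] at *
    constructor <;> linarith [h11.1, h11.2]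
  intro k z0 h0 z1 h1 r hr hrr ht hx
  rcases le_total z1.1 z0.1 with h | h
  · exact key k z0 h0 z1 h1 r hr hrr h ht hx
  · rw [abs_sub_comm]; exact key k z1 h1 z0 h0 r hr hrr h (by rw [abs_sub_comm]; exact ht) (by rw [dist_comm]; exact hx)

end grd
end PSP

namespace PSP
open scoped ENNReal
section tim
variable {n : ℕ}
variable {m e : Fin n} {q : ℕ} {ν δ p : ℝ} {ω : ℝ → ℝ} {a : Fin n → Fin n → ℝ → ES n → ℝ} {u f : ℝ → ES n → ℝ} {Ka Kf P : ℝ}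

lemma Am_upd_fst (e : Fin n) (z0 : ℝ × ES n) (r σ : ℝ) (z : Ix n → ℝ) (s : ℝ) : (Am e z0 r σ (Function.update z tt s)).1 = z0.1 + r ^ 2 * s := by
  rw [Am_fst, Function.update_self]

lemma Am_upd_snd (e : Fin n) (z0 : ℝ × ES n) (r σ : ℝ) (z : Ix n → ℝ) (s : ℝ) : (Am e z0 r σ (Function.update z tt s)).2 = (Am e z0 r σ z).2 := by
  rw [Am_snd, Am_snd, Function.update_of_ne tt_ne_hh.symm]
  simp only [Function.update_of_ne (inl_ne_tt _), ne_eq]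

lemma upd_t {z : Ix n → ℝ} (hz : z ∈ Cb tt 1) {s : ℝ} (h1 : -1 ≤ s) (h2 : s ≤ 0) : Function.update z tt s ∈ Cb tt 1 := by
  obtain ⟨-, -, h⟩ := hz
  refine ⟨by rw [Function.update_self]; exact h2, by rw [Function.update_self]; linarith, fun i hi => ?_⟩
  rw [Function.update_of_ne hi]; exact h i hi

/-- the constant of the odd coordinate -/
def kap (n : ℕ) : ℝ := N2 tt 1 (fun z : Ix n → ℝ => z hh)

lemma kap_pos (n : ℕ) : 0 < kap n := by
  unfold kap N2
  have hl : LB (fun z : Ix n → ℝ => z hh) := LB.cont (by fun_prop)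
  rw [setIntegral_pos_iff_support_of_nonneg_ae (ae_of_all _ fun z => sq_nonneg _) (hl.sq.onCb tt 1)]
  set U : Set (Ix n → ℝ) := Set.pi univ (fun i => if i = tt then Ioo (-1) 0 else Ioo 0 1) with hU
  have hUo : IsOpen U := by
    refine isOpen_set_pi finite_univ (fun i _ => ?_)
    split_ifs <;> exact isOpen_Ioo
  have hUn : U.Nonempty := by
    refine ⟨fun i => if i = tt then -1/2 else 1/2, fun i _ => ?_⟩
    by_cases h : i = tt
    · simp only [h, if_true]; constructor <;> norm_num
    · simp only [h, if_false]; constructor <;> norm_num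
  refine lt_of_lt_of_le (hUo.measure_pos volume hUn) (measure_mono fun z hz => ?_)
  have hz' : ∀ i, z i ∈ (if i = tt then Ioo (-1:ℝ) 0 else Ioo 0 1) := fun i => hz i (mem_univ i)
  refine ⟨?_, ?_, ?_, ?_⟩
  · have := hz' hh
    rw [if_neg tt_ne_hh.symm] at this
    exact (pow_pos this.1 2).ne'
  · have := hz' tt
    rw [if_pos rfl] at this; exact this.2.le
  · have := hz' tt
    rw [if_pos rfl] at this; norm_num; exact this.1.le
  · intro i hi
    have := hz' i
    rw [if_neg hi] at this
    rw [abs_of_pos this.1]; exact this.2.le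

set_option maxHeartbeats 1000000 in
lemma timeL2 (hu : ParClassical (parQ n 1) u) {z0 : ℝ × ES n} (h0 : z0 ∈ Rg n) {r : ℝ} (hr : 0 < r) (hr1 : r ≤ 1 / (8 * (n + 1))) {β : ℝ} (hβ : 0 ≤ β)
    (hl : ∀ z ∈ Cb tt 1, β * |z hh| ≤ |(u z0.1 (Am e z0 r 1 z).2 - u z0.1 (Am e z0 r (-1) z).2) - (u (z0.1 - r ^ 2) (Am e z0 r 1 z).2 - u (z0.1 - r ^ 2) (Am e z0 r (-1) z).2)|) :
    β ^ 2 * kap n ≤ r ^ 4 * N2 tt 1 (dT e (td u) z0 r) := by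
  have lT := dT_LB e hu h0 hr.le hr1
  have lT2 : LB (fun z => r ^ 2 * dT e (td u) z0 r z) := lT.cmul _
  have lh : LB (fun z : Ix n → ℝ => β * z hh) := LB.cont (by fun_prop)
  have e1 : β ^ 2 * kap n = N2 tt 1 (fun z : Ix n → ℝ => β * z hh) := (N2_cmul _ _ _ _).symm
  have e2 : r ^ 4 * N2 tt 1 (dT e (td u) z0 r) = N2 tt 1 (fun z => r ^ 2 * dT e (td u) z0 r z) := by
    rw [N2_cmul]; ring
  rw [e1, e2, ← ENNReal.ofReal_le_ofReal_iff (N2_nonneg _ _ _), N2_lint _ _ lh, N2_lint _ _ lT2]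
  have hm : Measurable (fun z => ENNReal.ofReal ((r ^ 2 * dT e (td u) z0 r z) ^ 2)) := ENNReal.measurable_ofReal.comp lT2.sq.meas
  have hs := slice (tt : Ix n) 1 tt hm
  have hlo : lo (tt : Ix n) 1 tt = -1 := by simp [lo]
  have hhi : hi (tt : Ix n) 1 tt = 0 := by simp [hi]
  rw [hlo, hhi] at hs
  have e3 : ENNReal.ofReal (0 - -1) = 1 := by norm_num
  rw [e3, one_mul] at hs
  rw [← hs]
  refine setLIntegral_mono' (Cb_meas tt 1) (fun z hz => ?_)
  -- one dimensional argument
  set xp := (Am e z0 r 1 z).2 with hxp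
  set xm := (Am e z0 r (-1) z).2 with hxm
  have mp : ∀ s ∈ Icc (-1:ℝ) 0, (z0.1 + r ^ 2 * s, xp) ∈ parQ n 1 := by
    intro s hs
    have := Am_mem e h0 hr.le hr1 (by simp : |(1:ℝ)| ≤ 1) (upd_t hz hs.1 hs.2)
    rw [← Am_upd_fst e z0 r 1 z s, hxp, ← Am_upd_snd e z0 r 1 z s]; exact this
  have mm : ∀ s ∈ Icc (-1:ℝ) 0, (z0.1 + r ^ 2 * s, xm) ∈ parQ n 1 := by
    intro s hs
    have := Am_mem e h0 hr.le hr1 (by simp : |(-1:ℝ)| ≤ 1) (upd_t hz hs.1 hs.2)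
    rw [← Am_upd_fst e z0 r (-1) z s, hxm, ← Am_upd_snd e z0 r (-1) z s]; exact this
  have hd : ∀ x, (∀ s ∈ Icc (-1:ℝ) 0, (z0.1 + r ^ 2 * s, x) ∈ parQ n 1) → ∀ s ∈ Icc (-1:ℝ) 0, HasDerivAt (fun s => u (z0.1 + r ^ 2 * s) x) (td u (z0.1 + r ^ 2 * s) x * r ^ 2) s := by
    intro x hx s hs
    have h1 := (hu.1 _ (hx s hs)).hasDerivAt
    have h2 : HasDerivAt (fun s : ℝ => z0.1 + r ^ 2 * s) (r ^ 2) s := by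
      simpa using ((hasDerivAt_id s).const_mul (r ^ 2)).const_add z0.1
    exact HasDerivAt.comp s h1 h2
  have hc : ∀ x, (∀ s ∈ Icc (-1:ℝ) 0, (z0.1 + r ^ 2 * s, x) ∈ parQ n 1) → ContinuousOn (fun s => td u (z0.1 + r ^ 2 * s) x) (Icc (-1:ℝ) 0) := by
    intro x hx
    exact hu.2.2.2.1.comp (f := fun s : ℝ => (z0.1 + r ^ 2 * s, x)) (by fun_prop) hx
  have hcc : ContinuousOn (fun s => td u (z0.1 + r ^ 2 * s) xp * r ^ 2 - td u (z0.1 + r ^ 2 * s) xm * r ^ 2) (Icc (-1:ℝ) 0) :=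
    ((hc xp mp).mul continuousOn_const).sub ((hc xm mm).mul continuousOn_const)
  have h1 := sq_line (x := 0) (y := -1) (a := -1) (b := 0) (by constructor <;> norm_num) (by constructor <;> norm_num)
    (g := fun s => u (z0.1 + r ^ 2 * s) xp - u (z0.1 + r ^ 2 * s) xm) (fun s hs => (hd xp mp s hs).sub (hd xm mm s hs)) hcc
  have h2 := hl z hz
  have e4 : z0.1 + r ^ 2 * 0 = z0.1 := by ring
  have e5 : z0.1 + r ^ 2 * (-1) = z0.1 - r ^ 2 := by ring
  simp only [e4, e5] at h1
  have h3 : (β * z hh) ^ 2 ≤ ∫ s in Icc (-1:ℝ) 0, (td u (z0.1 + r ^ 2 * s) xp * r ^ 2 - td u (z0.1 + r ^ 2 * s) xm * r ^ 2) ^ 2 := by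
    refine le_trans ?_ (h1.trans (by norm_num))
    rw [← sq_abs (β * z hh), ← sq_abs (_ - _), abs_mul, abs_of_nonneg hβ]
    exact pow_le_pow_left₀ (by positivity) h2 2
  refine (ENNReal.ofReal_le_ofReal h3).trans ?_
  have hIntg : IntegrableOn (fun s => (td u (z0.1 + r ^ 2 * s) xp * r ^ 2 - td u (z0.1 + r ^ 2 * s) xm * r ^ 2) ^ 2) (Icc (-1:ℝ) 0) := (hcc.pow 2).integrableOn_compact isCompact_Icc
  rw [ofReal_integral_eq_lintegral_ofReal hIntg (ae_of_all _ fun s => sq_nonneg _)]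
  refine (setLIntegral_congr_fun measurableSet_Icc (fun s hs => ?_)).le
  unfold dT
  rw [indicator_of_mem (upd_t hz hs.1 hs.2), Am_upd_fst, Am_upd_fst, Am_upd_snd, Am_upd_snd]
  congr 2; ring

lemma opn (L : ES n →L[ℝ] ℝ) {D : ℝ} (h : ∀ k, |L (eu k)| ≤ D) : ‖L‖ ≤ n * D := by
  rcases Nat.eq_zero_or_pos n with h0 | h0
  · subst h0
    have : L = 0 := by ext x; have : x = 0 := Subsingleton.elim _ _; simp [this]
    simp [this]
  have hD : 0 ≤ D := (abs_nonneg _).trans (h ⟨0, h0⟩)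
  refine L.opNorm_le_bound (by positivity) (fun x => ?_)
  have hx : x = ∑ k, x k • (eu k : ES n) := by
    ext i
    simp [eu, Finset.sum_apply, PiLp.single_apply, WithLp.ofLp_sum, Pi.single_apply]
  conv_lhs => rw [hx]
  rw [map_sum]
  calc ‖∑ k, L (x k • eu k)‖ ≤ ∑ k, ‖L (x k • eu k)‖ := norm_sum_le _ _
    _ ≤ ∑ k : Fin n, ‖x‖ * D := by
        refine Finset.sum_le_sum (fun k _ => ?_)
        rw [map_smul, norm_smul]
        have := PiLp.norm_apply_le x k
        exact mul_le_mul this (h k) (norm_nonneg _) (norm_nonneg _)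
    _ = n * D * ‖x‖ := by simp; ring

set_option maxHeartbeats 1000000 in
/-- local bound for the time increments of the good first derivative -/
lemma timeLoc (hu : ParClassical (parQ n 1) u) {t0 : ℝ} {x0 : ES n} {r D D' : ℝ} (hx0 : x0 ∈ ball (0 : ES n) (1/2)) (ht0 : t0 ∈ Ioo (-(1/4) : ℝ) 0)
    (ht1 : t0 - r ^ 2 ∈ Ioo (-(1/4) : ℝ) 0) (hr : 0 < r) (hr1 : r ≤ 1 / (8 * (n + 1))) (hD : 0 ≤ D) (hD' : 0 ≤ D')
    (hT : N2 tt 1 (dT e (td u) (t0, x0) r) ≤ D ^ 2)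
    (hg : ∀ k, ∀ x ∈ ball (0 : ES n) (3/4), |sd2 k e (u t0) x - sd2 k e (u (t0 - r ^ 2)) x| ≤ D') :
    |sd e (u t0) x0 - sd e (u (t0 - r ^ 2)) x0| ≤ r * (n * (n + 1) * D' + D / Real.sqrt (kap n)) := by
  set t1 := t0 - r ^ 2 with ht1d
  have h0 : (t0, x0) ∈ Rg n := ⟨⟨by linarith [ht0.1], ht0.2⟩, by rw [mem_ball] at hx0 ⊢; linarith⟩
  have hin : ∀ t ∈ Ioo (-(1/4) : ℝ) 0, ∀ x ∈ ball (0 : ES n) (3/4), (t, x) ∈ parQ n 1 := by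
    intro t ht x hx
    exact Rg_sub ⟨⟨by linarith [ht.1], ht.2⟩, hx⟩
  have hrn : r * (n + 1) ≤ 1 / 8 := by
    rw [le_div_iff₀ (by positivity)] at hr1; linarith
  set g : ES n → ℝ := fun y => sd e (u t0) y - sd e (u t1) y with hgd
  have hgdiff : ∀ x ∈ ball (0 : ES n) (3/4), DifferentiableAt ℝ g x := fun x hx =>
    (sd_diff (hu.2.1 _ (hin t0 ht0 x hx)) e).sub (sd_diff (hu.2.1 _ (hin t1 ht1 x hx)) e)
  have hgn : ∀ x ∈ ball (0 : ES n) (3/4), ‖fderiv ℝ g x‖ ≤ n * D' := by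
    intro x hx
    refine opn _ (fun k => ?_)
    have : fderiv ℝ g x (eu k) = sd2 k e (u t0) x - sd2 k e (u t1) x := by
      have := fderiv_sub (sd_diff (hu.2.1 _ (hin t0 ht0 x hx)) e) (sd_diff (hu.2.1 _ (hin t1 ht1 x hx)) e)
      have h2 : fderiv ℝ g x = fderiv ℝ (fun y => sd e (u t0) y) x - fderiv ℝ (fun y => sd e (u t1) y) x := this
      rw [h2]; rfl
    rw [this]; exact hg k x hx
  have hball : ∀ y, dist y x0 ≤ r * (n + 1) → y ∈ ball (0 : ES n) (3/4) := by
    intro y hy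
    rw [mem_ball] at hx0 ⊢
    have := dist_triangle y x0 0
    linarith
  have hx34 : x0 ∈ ball (0 : ES n) (3/4) := hball x0 (by simp; positivity)
  have hgE : ∀ y, dist y x0 ≤ r * (n + 1) → |g x0| - n * D' * (r * (n + 1)) ≤ |g y| := by
    intro y hy
    have := (convex_ball (0 : ES n) (3/4)).norm_image_sub_le_of_norm_fderiv_le hgdiff hgn hx34 (hball y hy)
    rw [← dist_eq_norm y x0] at this
    have h2 : ‖g y - g x0‖ ≤ n * D' * (r * (n + 1)) := this.trans (by gcongr)
    rw [Real.norm_eq_abs, abs_sub_comm] at h2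
    have := abs_sub_abs_le_abs_sub (g x0) (g y)
    linarith
  set B := |g x0| - n * D' * (r * (n + 1)) with hB
  have hk := kap_pos n
  have hsk : 0 < Real.sqrt (kap n) := Real.sqrt_pos.2 hk
  suffices hBs : B ≤ r * (D / Real.sqrt (kap n)) by
    have : |g x0| = B + n * D' * (r * (n + 1)) := by rw [hB]; ring
    show |g x0| ≤ _
    rw [this]; linarith
  rcases le_total B 0 with hB0 | hB0
  · exact hB0.trans (by positivity)
  have hlow := timeL2 (e := e) hu h0 hr hr1 (β := 2 * r * B) (by positivity) ?_
  · have h4 : (2 * r * B) ^ 2 * kap n ≤ r ^ 4 * D ^ 2 := hlow.trans (by gcongr)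
    rw [← mul_div_assoc, le_div_iff₀ hsk]
    have h5 : (2 * r * B * Real.sqrt (kap n)) ^ 2 ≤ (r ^ 2 * D) ^ 2 := by
      rw [mul_pow, Real.sq_sqrt hk.le]; nlinarith
    have h6 := abs_le_of_sq_le_sq h5 (by positivity)
    rw [abs_of_nonneg (by positivity)] at h6
    have h7 : r * (2 * (B * Real.sqrt (kap n))) ≤ r * (r * D) := by nlinarith
    have h8 := le_of_mul_le_mul_left h7 hr
    have : 0 ≤ B * Real.sqrt (kap n) := by positivity
    linarith
  · intro z hz
    have hA : ∀ s ∈ Icc (-1:ℝ) 1, dist (Am e (t0, x0) r s z).2 x0 ≤ r * (n + 1) := fun s hs => Am_dist e (t0, x0) hr.le (abs_le.2 hs) hz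
    have hder : ∀ t ∈ Ioo (-(1/4) : ℝ) 0, ∀ s ∈ Icc (-1:ℝ) 1, HasDerivAt (fun s => u t (Am e (t0, x0) r s z).2) (r * z hh * sd e (u t) (Am e (t0, x0) r s z).2) s := by
      intro t ht s hs
      have h1 : HasFDerivAt (u t) _ (Am e (t0, x0) r s z).2 := ((hu.2.1 _ (hin t ht _ (hball _ (hA s hs)))).differentiableAt (by norm_num)).hasFDerivAt
      have h2 : HasDerivAt (fun s => (Am e (t0, x0) r s z).2) ((r * z hh) • eu e) s := by
        have h3 : (fun s => (Am e (t0, x0) r s z).2) = fun s => (Am e (t0, x0) r 0 z).2 + s • ((r * z hh) • eu e) := by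
          funext s; rw [Am_diff e (t0, x0) r s 0 z, smul_smul]; congr 2; ring
        rw [h3]
        simpa using ((hasDerivAt_id s).smul_const ((r * z hh) • (eu e : ES n))).const_add (Am e (t0, x0) r 0 z).2
      have := h1.comp_hasDerivAt s h2
      rw [map_smul, smul_eq_mul] at this
      exact this
    have hder2 : ∀ s ∈ Icc (-1:ℝ) 1, HasDerivAt (fun s => u t0 (Am e (t0, x0) r s z).2 - u t1 (Am e (t0, x0) r s z).2) (r * z hh * g (Am e (t0, x0) r s z).2) s := by
      intro s hs
      have := (hder t0 ht0 s hs).sub (hder t1 ht1 s hs)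
      have e7 : r * z hh * g (Am e (t0, x0) r s z).2 = r * z hh * sd e (u t0) (Am e (t0, x0) r s z).2 - r * z hh * sd e (u t1) (Am e (t0, x0) r s z).2 := by
        simp only [hgd]; ring
      rw [e7]; exact this
    obtain ⟨c, hc, hce⟩ := exists_hasDerivAt_eq_slope (fun s => u t0 (Am e (t0, x0) r s z).2 - u t1 (Am e (t0, x0) r s z).2) (fun s => r * z hh * g (Am e (t0, x0) r s z).2) (by norm_num : (-1:ℝ) < 1)
      (fun s hs => (hder2 s hs).continuousAt.continuousWithinAt) (fun s hs => hder2 s ⟨hs.1.le, hs.2.le⟩)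
    have hgc := hgE _ (hA c ⟨hc.1.le, hc.2.le⟩)
    have e6 : (u t0 (Am e (t0, x0) r 1 z).2 - u t0 (Am e (t0, x0) r (-1) z).2) - (u t1 (Am e (t0, x0) r 1 z).2 - u t1 (Am e (t0, x0) r (-1) z).2) = 2 * (r * z hh * g (Am e (t0, x0) r c z).2) := by
      rw [hce]; ring
    show _ ≤ |(u t0 (Am e (t0, x0) r 1 z).2 - u t0 (Am e (t0, x0) r (-1) z).2) - (u t1 (Am e (t0, x0) r 1 z).2 - u t1 (Am e (t0, x0) r (-1) z).2)|
    rw [e6, abs_mul, abs_mul, abs_mul, abs_of_pos hr, abs_two]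
    have := abs_nonneg (z hh)
    have h9 : r * |z hh| * B ≤ r * |z hh| * |g (Am e (t0, x0) r c z).2| := by gcongr
    linarith

/-- chaining -/
lemma chainN {E : Type} [NormedAddCommGroup E] [NormedSpace ℝ E] {S : Set E} (hS : Convex ℝ S) {g : E → ℝ} {x y : E} (hx : x ∈ S) (hy : y ∈ S) {N : ℕ} (hN : 0 < N) {D : ℝ}
    (h : ∀ x' ∈ S, ∀ y' ∈ S, ‖x' - y'‖ = ‖x - y‖ / N → |g x' - g y'| ≤ D) : |g x - g y| ≤ N * D := by
  have hN' : (0:ℝ) < N := by exact_mod_cast hN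
  set c : ℕ → E := fun i => x + ((i:ℝ) / N) • (y - x) with hc
  have hcS : ∀ i, i ≤ N → c i ∈ S := by
    intro i hi
    refine hS.add_smul_sub_mem hx hy ⟨by positivity, ?_⟩
    rw [div_le_one hN']; exact_mod_cast hi
  have key : ∀ i, i ≤ N → |g x - g (c i)| ≤ i * D := by
    intro i
    induction i with
    | zero => intro _; simp [hc]
    | succ i ih =>
      intro hi
      have h1 := ih (by omega)
      have h2 := h _ (hcS i (by omega)) _ (hcS (i+1) hi) ?_
      · have := abs_sub_le (g x) (g (c i)) (g (c (i+1)))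
        push_cast; linarith
      · have : c i - c (i+1) = (1 / (N:ℝ)) • (x - y) := by
          simp only [hc]; push_cast
          rw [add_sub_add_left_eq_sub, ← sub_smul, ← neg_sub x y, smul_neg, ← neg_smul]; congr 1; ring
        rw [this, norm_smul, Real.norm_of_nonneg (by positivity)]; ring
  have := key N le_rfl
  have e : c N = y := by simp [hc, div_self hN'.ne']
  rwa [e] at this

end tim
end PSP

namespace PSP
open scoped ENNReal
section fin
variable {n : ℕ}

set_option maxHeartbeats 1000000 in
lemma globH (m : Fin n) (ν δ p : ℝ) (ω : ℝ → ℝ) (hν : 0 < ν) (hγ : 0 < δ - ((n : ℝ) + 2) / p) (hγ1 : δ - ((n : ℝ) + 2) / p < 1)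
    (hωlim : Tendsto ω (nhdsWithin 0 (Ioi (0 : ℝ))) (nhds 0)) (hω0 : ∀ r, 0 ≤ ω r) :
    ∃ N : ℝ, 0 < N ∧
      ∀ (e : Fin n) (q : ℕ) (a : Fin n → Fin n → ℝ → ES n → ℝ) (u f : ℝ → ES n → ℝ) (Ka Kf P : ℝ), Dat m e q ν δ p ω a u f Ka Kf P →
      HolderTPar n ((1 + (δ - ((n : ℝ) + 2) / p)) / 2) (parQ n (1/2)) (fun t x => sd e (u t) x) (N * (Kf + (1 + Ka) * P)) ∧
      ∀ k, HolderTPar n ((δ - ((n : ℝ) + 2) / p) / 2) (parQ n (1/2)) (fun t x => sd2 k e (u t) x) (N * (Kf + (1 + Ka) * P)) ∧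
        HolderXPar n (δ - ((n : ℝ) + 2) / p) (parQ n (1/2)) (fun t x => sd2 k e (u t) x) (N * (Kf + (1 + Ka) * P)) := by
  set γ := δ - ((n : ℝ) + 2) / p with hγd
  obtain ⟨r0, C, hr0, hr01, hC, hd⟩ := loc m ν δ p ω hν hγ hγ1 hωlim hω0
  have hk := kap_pos n
  have hsk : 0 < Real.sqrt (kap n) := Real.sqrt_pos.2 hk
  have hr1 : r0 ≤ 1 := by
    refine hr01.trans ?_
    rw [div_le_one (by positivity)]
    have : (0:ℝ) ≤ n := Nat.cast_nonneg n
    linarith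
  obtain ⟨N0, hN0⟩ := exists_nat_gt (1 / r0 ^ 2)
  have hN0' : (0:ℝ) < N0 := lt_trans (by positivity) hN0
  have hNp : 0 < N0 := by exact_mod_cast hN0'
  have hNr : 1 / (N0:ℝ) ≤ r0 ^ 2 := by
    rw [div_le_iff₀ hN0']; rw [div_lt_iff₀ (by positivity)] at hN0; linarith
  have hN1 : (1:ℝ) ≤ N0 := by exact_mod_cast hNp
  have hC' : 0 ≤ n * (n + 1) * C + C / Real.sqrt (kap n) := by positivity
  set C2 := C + (n * (n + 1) * C + C / Real.sqrt (kap n)) with hC2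
  refine ⟨N0 * C2, by positivity, ?_⟩
  intro e q a u f Ka Kf P H
  obtain ⟨hdT, hdW⟩ := hd e q a u f Ka Kf P H
  have hM0 : 0 ≤ Kf + (1 + Ka) * P := by
    have := H.Ka0; have := H.Kf0; have := H.P0; positivity
  set M := Kf + (1 + Ka) * P with hM
  have hQ : ∀ t x, (t, x) ∈ parQ n (1/2) → t ∈ Ioo (-(1/4) : ℝ) 0 ∧ x ∈ ball (0 : ES n) (1/2) := by
    rintro t x ⟨⟨h1, h2⟩, h3⟩
    refine ⟨⟨?_, h2⟩, h3⟩
    norm_num at h1 ⊢; exact h1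
  have hR : ∀ t x, t ∈ Ioo (-(1/4) : ℝ) 0 → x ∈ ball (0 : ES n) (3/4) → (t, x) ∈ Rg n := by
    rintro t x h1 h2
    exact ⟨⟨by linarith [h1.1], h1.2⟩, h2⟩
  have h34 : ∀ x, x ∈ ball (0 : ES n) (1/2) → x ∈ ball (0 : ES n) (3/4) := fun x hx => ball_subset_ball (by norm_num) hx
  -- chaining in time
  have timeC : ∀ (g : ℝ → ℝ) (η K : ℝ), 0 < η → 0 ≤ K → (∀ t ∈ Ioo (-(1/4) : ℝ) 0, ∀ r, 0 < r → r ≤ r0 → t - r ^ 2 ∈ Ioo (-(1/4) : ℝ) 0 → |g t - g (t - r ^ 2)| ≤ K * r ^ η) →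
      ∀ t ∈ Ioo (-(1/4) : ℝ) 0, ∀ s ∈ Ioo (-(1/4) : ℝ) 0, |g t - g s| ≤ N0 * K * |t - s| ^ (η / 2) := by
    intro g η K hη hK hg t ht s hs
    rcases eq_or_ne t s with h | h
    · subst h; simp only [sub_self, abs_zero]; positivity
    have hts : 0 < |t - s| := abs_pos.2 (sub_ne_zero.2 h)
    have hts1 : |t - s| ≤ 1 := by rw [abs_le]; constructor <;> linarith [ht.1, ht.2, hs.1, hs.2]
    set r := Real.sqrt (|t - s| / N0) with hr
    have hrp : 0 < r := Real.sqrt_pos.2 (by positivity)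
    have hr2 : r ^ 2 = |t - s| / N0 := Real.sq_sqrt (by positivity)
    have hrr : r ≤ r0 := by
      refine Real.sqrt_le_iff.2 ⟨hr0.le, le_trans ?_ hNr⟩
      gcongr
    have hrη : r ^ η ≤ |t - s| ^ (η / 2) := by
      rw [hr, Real.sqrt_eq_rpow, ← Real.rpow_mul (by positivity)]
      have e1 : 1 / 2 * η = η / 2 := by ring
      rw [e1]
      refine Real.rpow_le_rpow (by positivity) ?_ (by positivity)
      exact div_le_self hts.le hN1
    have h1 : ∀ t' ∈ Ioo (-(1/4) : ℝ) 0, ∀ s' ∈ Ioo (-(1/4) : ℝ) 0, s' ≤ t' → |t' - s'| = |t - s| / N0 → |g t' - g s'| ≤ K * r ^ η := by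
      intro t' ht' s' hs' hle hts'
      rw [abs_of_nonneg (by linarith), ← hr2] at hts'
      have e2 : s' = t' - r ^ 2 := by linarith
      rw [e2] at hs' ⊢
      exact hg t' ht' r hrp hrr hs'
    have h2 := chainN (convex_Ioo (-(1/4) : ℝ) 0) (g := g) ht hs hNp (D := K * r ^ η) (fun t' ht' s' hs' h => by
      rw [Real.norm_eq_abs, Real.norm_eq_abs] at h
      rcases le_total s' t' with h' | h'
      · exact h1 t' ht' s' hs' h' h
      · rw [abs_sub_comm]; exact h1 s' hs' t' ht' h' (by rw [abs_sub_comm]; exact h))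
    calc |g t - g s| ≤ N0 * (K * r ^ η) := h2
      _ ≤ N0 * (K * |t - s| ^ (η / 2)) := by gcongr
      _ = _ := by ring
  have hsd2 : ∀ k, ∀ t ∈ Ioo (-(1/4) : ℝ) 0, ∀ r, 0 < r → r ≤ r0 → t - r ^ 2 ∈ Ioo (-(1/4) : ℝ) 0 → ∀ x ∈ ball (0 : ES n) (3/4),
      |sd2 k e (u t) x - sd2 k e (u (t - r ^ 2)) x| ≤ C * M * r ^ γ := by
    intro k t ht r hr hrr ht1 x hx
    refine hdW k (t, x) (hR t x ht hx) (t - r ^ 2, x) (hR _ x ht1 hx) r hr hrr ?_ (by simp; exact hr.le)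
    simp
  refine ⟨?_, fun k => ⟨?_, ?_⟩⟩
  · intro t s x htx hsx
    obtain ⟨ht, hx⟩ := hQ t x htx
    obtain ⟨hs, -⟩ := hQ s x hsx
    have := timeC (fun t => sd e (u t) x) (1 + γ) (C2 * M) (by linarith) (by positivity) (fun t ht r hr hrr ht1 => ?_) t ht s hs
    · calc _ ≤ _ := this
        _ = _ := by ring
    · have h1 := timeLoc (e := e) H.hu hx ht ht1 hr (hrr.trans hr01) (D := C * M * r ^ γ) (D' := C * M * r ^ γ) (by positivity) (by positivity)
        (hdT (t, x) (hR t x ht (h34 x hx)) r hr hrr) (fun k x hx => hsd2 k t ht r hr hrr ht1 x hx)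
      refine h1.trans ?_
      rw [Real.rpow_add hr, Real.rpow_one]
      have e3 : r * (n * (n + 1) * (C * M * r ^ γ) + C * M * r ^ γ / Real.sqrt (kap n)) = (n * (n + 1) * C + C / Real.sqrt (kap n)) * M * (r * r ^ γ) := by ring
      rw [e3]
      have : n * (n + 1) * C + C / Real.sqrt (kap n) ≤ C2 := by rw [hC2]; linarith
      gcongr
  · intro t s x htx hsx
    obtain ⟨ht, hx⟩ := hQ t x htx
    obtain ⟨hs, -⟩ := hQ s x hsx
    have := timeC (fun t => sd2 k e (u t) x) γ (C2 * M) hγ (by positivity) (fun t ht r hr hrr ht1 => ?_) t ht s hs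
    · calc _ ≤ _ := this
        _ = _ := by ring
    · refine (hsd2 k t ht r hr hrr ht1 x (h34 x hx)).trans ?_
      have : C ≤ C2 := by rw [hC2]; linarith
      gcongr
  · intro t x y htx hty
    obtain ⟨ht, hx⟩ := hQ t x htx
    obtain ⟨-, hy⟩ := hQ t y hty
    show |sd2 k e (u t) x - sd2 k e (u t) y| ≤ N0 * C2 * M * dist x y ^ γ
    rcases eq_or_ne x y with h | h
    · subst h; simp only [sub_self, abs_zero]; positivity
    have hxy : 0 < dist x y := dist_pos.2 h
    have hxy1 : dist x y ≤ 1 := by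
      rw [mem_ball] at hx hy
      have := dist_triangle_right x y 0
      linarith
    have h2 := chainN (convex_ball (0 : ES n) (1/2)) (g := fun x => sd2 k e (u t) x) hx hy hNp (D := C * M * dist x y ^ γ) (fun x' hx' y' hy' h => by
      rw [← dist_eq_norm, ← dist_eq_norm] at h
      have h3 : dist x y / N0 ≤ r0 := by
        calc dist x y / N0 ≤ 1 / N0 := by gcongr
          _ ≤ r0 ^ 2 := hNr
          _ ≤ r0 := by nlinarith
      have h4 := hdW k (t, x') (hR t x' ht (h34 x' hx')) (t, y') (hR t y' ht (h34 y' hy')) (dist x y / N0) (by positivity) h3 (by simp; positivity) h.le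
      refine h4.trans ?_
      have : dist x y / N0 ≤ dist x y := div_le_self hxy.le hN1
      gcongr)
    have : C ≤ C2 := by rw [hC2]; linarith
    calc _ ≤ (N0:ℝ) * (C * M * dist x y ^ γ) := h2
      _ ≤ N0 * (C2 * M * dist x y ^ γ) := by gcongr
      _ = _ := by ring

lemma limP {X N Kf Ka L Y : ℝ} (h : ∀ P, L < P → X ≤ N * (Kf + (1 + Ka) * P) * Y) : X ≤ N * (Kf + (1 + Ka) * L) * Y := by
  have hc : Continuous (fun P : ℝ => N * (Kf + (1 + Ka) * P) * Y) := by fun_prop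
  exact ge_of_tendsto (x := nhdsWithin L (Ioi L)) ((hc.tendsto L).mono_left nhdsWithin_le_nhds) (eventually_mem_nhdsWithin.mono fun P hP => h P hP)

end fin
end PSP

/-- **Theorem 4.4 (i), first case**: for non-divergence form parabolic equations with
coefficients uniformly continuous in `(t, x¹, …, x^{d-1})` (parabolic modulus `ω`),
merely measurable in `x^d`, and `δ`-Hölder in `x'`, we have `D_{x'} u ∈
C^{(1+γ)/2, 1+γ}(Q_{1/2})` with `γ = δ - (d+2)/p`. -/
theorem partial_schauder_parabolic_one_bad_direction
    (d q : ℕ) (ν δ p : ℝ) (ω : ℝ → ℝ)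
    (hd : 2 ≤ d) (hq1 : 1 ≤ q) (hqd : q < d)
    (hν : ν ∈ Ioc (0 : ℝ) 1) (hδ : δ ∈ Ioc (0 : ℝ) 1)
    (hp : (d : ℝ) + 2 < p) (hγ : 0 < δ - ((d : ℝ) + 2) / p)
    (hω0 : ∀ r, 0 ≤ ω r) (hωmono : MonotoneOn ω (Ici (0 : ℝ)))
    (hωlim : Tendsto ω (nhdsWithin 0 (Ioi (0 : ℝ))) (nhds 0)) :
    ∃ N : ℝ, 0 < N ∧
      ∀ (a : Fin d → Fin d → ℝ → EuclideanSpace ℝ (Fin d) → ℝ)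
        (u f : ℝ → EuclideanSpace ℝ (Fin d) → ℝ),
        (∀ i j, Measurable (fun z : ℝ × EuclideanSpace ℝ (Fin d) => a i j z.1 z.2)) →
        (∀ i j t x, a i j t x = a j i t x) →
        UnifEllipticP d ν a →
        -- uniform continuity in `(t, x¹, …, x^{d-1})` with modulus `ω`
        (∀ (i j : Fin d) (t s : ℝ) (x y : EuclideanSpace ℝ (Fin d)),
          x (⟨d - 1, by omega⟩ : Fin d) = y (⟨d - 1, by omega⟩ : Fin d) →
          |a i j t x - a i j s y| ≤ ω (|t - s| ^ ((1:ℝ)/2) + dist x y)) →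
        ∀ Ka : ℝ, 0 ≤ Ka →
        (∀ i j, PHolderXPar d q δ (parQ d 1) (a i j) Ka) →
        ParClassical (parQ d 1) u →
        IntegrableOn (fun z : ℝ × EuclideanSpace ℝ (Fin d) =>
          Real.sqrt (∑ k, ∑ l, sd2 k l (u z.1) z.2 ^ 2) ^ p) (parQ d 1) →
        (∀ᵐ z ∂(volume.restrict (parQ d 1)),
          td u z.1 z.2 - ∑ i, ∑ j, a i j z.1 z.2 * sd2 i j (u z.1) z.2 = f z.1 z.2) →
        ∀ Kf : ℝ, 0 ≤ Kf →
          PHolderXPar d q (δ - ((d : ℝ) + 2) / p) (parQ d 1) f Kf →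
          ∀ i : Fin d, (i : ℕ) < q →
            HolderTPar d ((1 + (δ - ((d : ℝ) + 2) / p)) / 2) (parQ d (1/2))
              (fun t x => sd i (u t) x)
              (N * (Kf + (1 + Ka) *
                (∫ z in parQ d 1,
                    Real.sqrt (∑ k, ∑ l, sd2 k l (u z.1) z.2 ^ 2) ^ p) ^ (1/p))) ∧
            ∀ k : Fin d,
              HolderTPar d ((δ - ((d : ℝ) + 2) / p) / 2) (parQ d (1/2))
                (fun t x => sd2 k i (u t) x)
                (N * (Kf + (1 + Ka) *
                  (∫ z in parQ d 1,
                      Real.sqrt (∑ k, ∑ l, sd2 k l (u z.1) z.2 ^ 2) ^ p) ^ (1/p))) ∧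
              HolderXPar d (δ - ((d : ℝ) + 2) / p) (parQ d (1/2))
                (fun t x => sd2 k i (u t) x)
                (N * (Kf + (1 + Ka) *
                  (∫ z in parQ d 1,
                      Real.sqrt (∑ k, ∑ l, sd2 k l (u z.1) z.2 ^ 2) ^ p) ^ (1/p))) := by
  have hp0 : 0 < p := by
    have : (0:ℝ) ≤ d := Nat.cast_nonneg d
    linarith
  have hγ1 : δ - ((d : ℝ) + 2) / p < 1 := by
    have : 0 < ((d : ℝ) + 2) / p := by positivity
    linarith [hδ.2]
  obtain ⟨N, hN, hglob⟩ := PSP.globH (⟨d - 1, by omega⟩ : Fin d) ν δ p ω hν.1 hγ hγ1 hωlim hω0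
  refine ⟨N, hN, ?_⟩
  intro a u f ham has hell hac Ka hKa hah hu hIntg hE Kf hKf hfh i hi
  set S := ∫ z in parQ d 1, Real.sqrt (∑ k, ∑ l, sd2 k l (u z.1) z.2 ^ 2) ^ p with hS
  have hS0 : 0 ≤ S := integral_nonneg fun z => by positivity
  have hL0 : 0 ≤ S ^ (1 / p) := by positivity
  have hdat : ∀ P, S ^ (1 / p) < P → PSP.Dat (⟨d - 1, by omega⟩ : Fin d) i q ν δ p ω a u f Ka Kf P := by
    intro P hP
    have hP0 : 0 < P := lt_of_le_of_lt hL0 hP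
    have hSP : S ≤ P ^ p := by
      have h1 : S = (S ^ (1 / p)) ^ p := by
        rw [← Real.rpow_mul hS0, one_div_mul_cancel hp0.ne', Real.rpow_one]
      rw [h1]
      exact Real.rpow_le_rpow hL0 hP.le hp0.le
    refine ⟨hν.1, hν.2, hδ.1, ?_, ?_, hi, hω0, hωmono, ham, fun t x => ⟨fun k l => has k l t x, fun ξ => (hell t x ξ).1, fun ξ => (hell t x ξ).2⟩,
      hac, hKa, hah, hu, hP0, ?_, hE, hKf, hfh⟩
    · have : (0:ℝ) ≤ d := Nat.cast_nonneg d
      linarith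
    · intro h
      have := congrArg Fin.val h
      simp only at this
      omega
    · refine le_trans (le_of_eq ?_) (ENNReal.ofReal_le_ofReal hSP)
      rw [hS, ofReal_integral_eq_lintegral_ofReal hIntg (ae_of_all _ fun z => by positivity)]
      rfl
  refine ⟨?_, fun k => ⟨?_, ?_⟩⟩
  · intro t s x h1 h2
    exact PSP.limP fun P hP => (hglob i q a u f Ka Kf P (hdat P hP)).1 t s x h1 h2
  · intro t s x h1 h2
    exact PSP.limP fun P hP => ((hglob i q a u f Ka Kf P (hdat P hP)).2 k).1 t s x h1 h2
  · intro t x y h1 h2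
    exact PSP.limP fun P hP => ((hglob i q a u f Ka Kf P (hdat P hP)).2 k).2 t x y h1 h2
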